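/- Let K = ℚ(√−11) with ring of integers 𝒪_K = ℤ[(1+√−11)/2], and let λ = (1+√−11)/2 ∈ 𝒪_K, which has norm 3. There exists a nonzero symmetric Hermitian modular form b₅ of weight 5 for 𝒪_K such that: (i) b₅ vanishes to order ≥ 5 along ℋ₁, i.e., for every symmetric τ ∈ 𝐇₂ the function t ↦ b₅(τ + tA), A = [[0,1],[−1,0]], vanishes to order ≥ 5 at t = 0; (ii) b₅ ∘ φ_λ ≡ 0, i.e., b₅ vanishes on the Heegner divisor ℋ₃; and (iii) every Hermitian modular form F of weight k for 𝒪_K which vanishes to order ≥ 5 along ℋ₁ and vanishes on ℋ₃ can be written F = b₅·G for some Hermitian modular form G of weight k − 5. -/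

import Mathlib

noncomputable section

open Matrix Filter Topology
open scoped ComplexOrder

attribute [local instance] Matrix.normedAddCommGroup Matrix.normedSpace

/-- The algebraic number (1 + √(-d))/2 = (1 + i·√d)/2 , viewed in ℂ. -/
def omg (d : ℕ) : ℂ := (1 + Complex.I * (Real.sqrt d : ℝ)) / 2

/-- The ring of integers ℤ[(1+√(-d))/2] of ℚ(√(-d)) (for d ≡ 3 mod 4), as a subset of ℂ. -/
def ringInts (d : ℕ) : Set ℂ := {z | ∃ a b : ℤ, z = (a : ℂ) + (b : ℂ) * omg d}

/-- The Hermitian upper half-space of degree two: 2×2 complex matrices τ such that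
(τ - conj(τ)ᵀ)/(2i) is positive definite. -/
def HH2 : Set (Matrix (Fin 2) (Fin 2) ℂ) :=
  {τ | (Matrix.of fun i j => (τ i j - (starRingEnd ℂ) (τ j i)) / (2 * Complex.I)).PosDef}

/-- The matrix J = [[0, -I₂],[I₂, 0]]. -/
def Jmat : Matrix (Fin 4) (Fin 4) ℂ :=
  !![0,0,-1,0; 0,0,0,-1; 1,0,0,0; 0,1,0,0]

/-- Upper-left 2×2 block. -/
def blkA (M : Matrix (Fin 4) (Fin 4) ℂ) : Matrix (Fin 2) (Fin 2) ℂ :=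
  !![M 0 0, M 0 1; M 1 0, M 1 1]
/-- Upper-right 2×2 block. -/
def blkB (M : Matrix (Fin 4) (Fin 4) ℂ) : Matrix (Fin 2) (Fin 2) ℂ :=
  !![M 0 2, M 0 3; M 1 2, M 1 3]
/-- Lower-left 2×2 block. -/
def blkC (M : Matrix (Fin 4) (Fin 4) ℂ) : Matrix (Fin 2) (Fin 2) ℂ :=
  !![M 2 0, M 2 1; M 3 0, M 3 1]
/-- Lower-right 2×2 block. -/
def blkD (M : Matrix (Fin 4) (Fin 4) ℂ) : Matrix (Fin 2) (Fin 2) ℂ :=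
  !![M 2 2, M 2 3; M 3 2, M 3 3]

/-- Membership in SU_{2,2}(𝒪_K): entries in 𝒪_K, determinant 1, and Mᵀ·J·conj(M) = J. -/
def inSU (d : ℕ) (M : Matrix (Fin 4) (Fin 4) ℂ) : Prop :=
  (∀ i j, M i j ∈ ringInts d) ∧ M.det = 1 ∧
    Mᵀ * Jmat * M.map (starRingEnd ℂ) = Jmat

/-- Möbius action M·τ = (aτ+b)(cτ+d)⁻¹. -/
def moebius (M : Matrix (Fin 4) (Fin 4) ℂ) (τ : Matrix (Fin 2) (Fin 2) ℂ) :
    Matrix (Fin 2) (Fin 2) ℂ :=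
  (blkA M * τ + blkB M) * (blkC M * τ + blkD M)⁻¹

/-- A Hermitian modular form of weight k for 𝒪_K, K = ℚ(√(-d)): a holomorphic function on
𝐇₂ satisfying F(M·τ) = det(cτ+d)^k·F(τ) for all M ∈ SU_{2,2}(𝒪_K). -/
def IsHMF (d k : ℕ) (F : Matrix (Fin 2) (Fin 2) ℂ → ℂ) : Prop :=
  DifferentiableOn ℂ F HH2 ∧
    ∀ M, inSU d M → ∀ τ ∈ HH2,
      F (moebius M τ) = (blkC M * τ + blkD M).det ^ k * F τ

/-- A symmetric Hermitian modular form: F(τᵀ) = (-1)^k F(τ). -/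
def IsSymHMF (d k : ℕ) (F : Matrix (Fin 2) (Fin 2) ℂ → ℂ) : Prop :=
  IsHMF d k F ∧ ∀ τ ∈ HH2, F τᵀ = (-1) ^ k * F τ

/-- A skew-symmetric Hermitian modular form: F(τᵀ) = -(-1)^k F(τ). -/
def IsSkewHMF (d k : ℕ) (F : Matrix (Fin 2) (Fin 2) ℂ → ℂ) : Prop :=
  IsHMF d k F ∧ ∀ τ ∈ HH2, F τᵀ = -((-1) ^ k * F τ)

/-- The embedding φ_λ of the Siegel upper half-space into 𝐇₂ given by
[[τ, z],[z, w]] ↦ [[τ, conj(λ)z],[λz, ℓw]] with ℓ = λ·conj(λ). -/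
def phiLam (lam : ℂ) (τ : Matrix (Fin 2) (Fin 2) ℂ) : Matrix (Fin 2) (Fin 2) ℂ :=
  !![τ 0 0, (starRingEnd ℂ) lam * τ 0 1;
     lam * τ 0 1, (lam * (starRingEnd ℂ) lam) * τ 1 1]

/-- The antisymmetric matrix A = [[0,1],[-1,0]], the normal direction to the diagonal ℋ₁. -/
def matA : Matrix (Fin 2) (Fin 2) ℂ := !![0, 1; -1, 0]

/-- F vanishes to order ≥ n along ℋ₁: for every symmetric τ ∈ 𝐇₂ the function
t ↦ F(τ + t·A) vanishes to order ≥ n at t = 0. -/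
def VanishesAlongH1 (F : Matrix (Fin 2) (Fin 2) ℂ → ℂ) (n : ℕ) : Prop :=
  ∀ τ ∈ HH2, τᵀ = τ → ∀ m < n, iteratedDeriv m (fun t : ℂ => F (τ + t • matA)) 0 = 0

/-- F vanishes on the Heegner divisor ℋ_ℓ, ℓ = λ·conj(λ): F ∘ φ_λ ≡ 0 on the Siegel upper
half-space (the symmetric matrices in 𝐇₂). -/
def VanishesOnHeegner (lam : ℂ) (F : Matrix (Fin 2) (Fin 2) ℂ → ℂ) : Prop :=
  ∀ τ ∈ HH2, τᵀ = τ → F (phiLam lam τ) = 0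

section Analytic

variable {E : Type*} [NormedAddCommGroup E] [NormedSpace ℂ E]

theorem norm_fderiv_le_of_bounded {f : E → ℂ} {x : E} {r C : ℝ} (hr : 0 < r)
    (hf : DifferentiableOn ℂ f (Metric.ball x r)) (hC : ∀ y ∈ Metric.ball x r, ‖f y‖ ≤ C) :
    ‖fderiv ℂ f x‖ ≤ C / r := by
  have hC0 : 0 ≤ C := (norm_nonneg _).trans (hC x (Metric.mem_ball_self hr))
  refine ContinuousLinearMap.opNorm_le_bound _ (by positivity) fun v => ?_
  have hfx : DifferentiableAt ℂ f x := hf.differentiableAt (Metric.ball_mem_nhds x hr)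
  by_cases hv : v = 0
  · simp [hv]
  have hv' : 0 < ‖v‖ := norm_pos_iff.2 hv
  have hline : ∀ t : ℂ, ‖t‖ < r / ‖v‖ → x + t • v ∈ Metric.ball x r := fun t ht => by
    simpa [norm_smul] using (lt_div_iff₀ hv').1 ht
  have hd : HasDerivAt (fun t : ℂ => f (x + t • v)) (fderiv ℂ f x v) 0 := by
    have h1 : HasDerivAt (fun t : ℂ => x + t • v) v 0 := by
      simpa using ((hasDerivAt_id (0 : ℂ)).smul_const v).const_add x
    have h2 : HasFDerivAt f (fderiv ℂ f x) (x + (0 : ℂ) • v) := by simpa using hfx.hasFDerivAt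
    exact h2.comp_hasDerivAt 0 h1
  have key : ∀ R : ℝ, 0 < R → R < r / ‖v‖ → ‖fderiv ℂ f x v‖ ≤ C / R := by
    intro R hR hRr
    rw [← hd.deriv]
    refine Complex.norm_deriv_le_of_forall_mem_sphere_norm_le hR ?_ ?_
    · refine DifferentiableOn.diffContOnCl fun t ht => ?_
      rw [closure_ball _ hR.ne'] at ht
      have ht' : ‖t‖ < r / ‖v‖ := lt_of_le_of_lt (by simpa using ht) hRr
      have := hf.differentiableAt (Metric.isOpen_ball.mem_nhds (hline t ht'))
      refine DifferentiableAt.differentiableWithinAt ?_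
      exact this.comp t (by fun_prop)
    · intro t ht
      have ht' : ‖t‖ < r / ‖v‖ := by
        have : ‖t‖ = R := by simpa using ht
        linarith
      exact hC _ (hline t ht')
  have hlim : Tendsto (fun R : ℝ => C / R) (𝓝[<] (r / ‖v‖)) (𝓝 (C / (r / ‖v‖))) := by
    refine (ContinuousAt.tendsto ?_).mono_left nhdsWithin_le_nhds
    exact continuousAt_const.div continuousAt_id (by positivity)
  have hfin := ge_of_tendsto hlim (b := ‖fderiv ℂ f x v‖) (by
    have : 0 < r / ‖v‖ := by positivity
    filter_upwards [Ioo_mem_nhdsLT this] with R hR using key R hR.1 hR.2)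
  calc _ ≤ _ := hfin
    _ = C / r * ‖v‖ := by field_simp

theorem differentiableOn_tsum_of_locally_bounded {ι : Type*} {f : ι → E → ℂ} {s : Set E}
    (hs : IsOpen s) (hf : ∀ i, DifferentiableOn ℂ (f i) s)
    (hb : ∀ x ∈ s, ∃ U ∈ 𝓝 x, ∃ u : ι → ℝ, Summable u ∧ ∀ i, ∀ y ∈ U, ‖f i y‖ ≤ u i) :
    DifferentiableOn ℂ (fun x => ∑' i, f i x) s := by
  intro x hx
  obtain ⟨U, hU, u, hu, hfu⟩ := hb x hx
  obtain ⟨r, hr, hrs⟩ := Metric.mem_nhds_iff.1 (inter_mem hU (hs.mem_nhds hx))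
  have hsub : ∀ y ∈ Metric.ball x (r / 2), Metric.ball y (r / 2) ⊆ Metric.ball x r := by
    intro y hy
    refine Metric.ball_subset_ball' ?_
    have := Metric.mem_ball.1 hy
    linarith
  have hball : ∀ i, DifferentiableOn ℂ (f i) (Metric.ball x r) := fun i =>
    (hf i).mono fun y hy => (hrs hy).2
  refine (hasFDerivAt_tsum_of_isPreconnected (u := fun i => u i / (r / 2))
    (f' := fun i y => fderiv ℂ (f i) y)
    (hu.div_const _) (s := Metric.ball x (r / 2)) Metric.isOpen_ball ?_ ?_ ?_
    (Metric.mem_ball_self (half_pos hr)) ?_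
    (Metric.mem_ball_self (half_pos hr))).differentiableAt.differentiableWithinAt
  · letI : NormedSpace ℝ E := NormedSpace.restrictScalars ℝ ℂ E
    exact ((convex_ball x (r / 2) : Convex ℝ _)).isPreconnected
  · intro i y hy
    exact ((hball i).differentiableAt (Metric.isOpen_ball.mem_nhds
      (hsub y hy (Metric.mem_ball_self (half_pos hr))))).hasFDerivAt
  · intro i y hy
    exact norm_fderiv_le_of_bounded (half_pos hr) ((hball i).mono (hsub y hy))
      fun z hz => hfu i z (hrs (hsub y hy hz)).1
  · exact Summable.of_norm_bounded hu fun i => hfu i x (mem_of_mem_nhds hU)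

theorem eqOn_zero_of_convex [NormedSpace ℝ E] [IsScalarTower ℝ ℂ E] {f : E → ℂ} {U : Set E} (hU : IsOpen U) (hc : Convex ℝ U)
    (hf : DifferentiableOn ℂ f U) {x₀ : E} (hx₀ : x₀ ∈ U) (h0 : ∀ᶠ y in 𝓝 x₀, f y = 0) :
    ∀ x ∈ U, f x = 0 := by
  intro x hx
  let L : ℂ → E := fun t => x₀ + t • (x - x₀)
  have hL : Continuous L := by fun_prop
  have hLU : IsOpen (L ⁻¹' U) := hU.preimage hL
  have hLc : Convex ℝ (L ⁻¹' U) := by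
    intro s hs t ht a b ha hb hab
    have : L (a • s + b • t) = a • L s + b • L t := by
      simp only [L]
      have hb' : b = 1 - a := by linarith
      subst hb'
      simp only [smul_add, add_smul, sub_smul, one_smul, smul_assoc]
      abel
    change L _ ∈ U
    rw [this]
    exact hc hs ht ha hb hab
  have hA : AnalyticOnNhd ℂ (f ∘ L) (L ⁻¹' U) := by
    refine DifferentiableOn.analyticOnNhd ?_ hLU
    exact hf.comp (by fun_prop) (fun t ht => ht)
  have h00 : (0 : ℂ) ∈ L ⁻¹' U := by simpa [L] using hx₀
  have hev : (f ∘ L) =ᶠ[𝓝 0] 0 := by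
    have : Tendsto L (𝓝 0) (𝓝 x₀) := by
      have := hL.tendsto 0
      simpa [L] using this
    exact this.eventually h0
  have := hA.eqOn_zero_of_preconnected_of_eventuallyEq_zero hLc.isPreconnected h00 hev
    (show (1 : ℂ) ∈ L ⁻¹' U by simpa [L] using hx)
  simpa [L] using this

theorem frequently_ne_zero_of_convex [NormedSpace ℝ E] [IsScalarTower ℝ ℂ E] {f : E → ℂ} {U : Set E} (hU : IsOpen U)
    (hc : Convex ℝ U) (hf : DifferentiableOn ℂ f U) {x₁ : E} (hx₁ : x₁ ∈ U) (h1 : f x₁ ≠ 0)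
    {x : E} (hx : x ∈ U) : ∃ᶠ y in 𝓝 x, f y ≠ 0 := by
  intro h
  simp only [not_not] at h
  exact h1 (eqOn_zero_of_convex hU hc hf hx h x₁ hx₁)

theorem eq_zero_of_mul_eq_zero_convex [NormedSpace ℝ E] [IsScalarTower ℝ ℂ E] {f g : E → ℂ} {U : Set E} (hU : IsOpen U)
    (hc : Convex ℝ U) (hf : DifferentiableOn ℂ f U) (hg : ContinuousOn g U) {x₁ : E}
    (hx₁ : x₁ ∈ U) (h1 : f x₁ ≠ 0) (h : ∀ x ∈ U, f x * g x = 0) : ∀ x ∈ U, g x = 0 := by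
  intro x hx
  by_contra hgx
  have h2 : ∀ᶠ y in 𝓝 x, g y ≠ 0 := (hg.continuousAt (hU.mem_nhds hx)).eventually_ne hgx
  obtain ⟨y, hy, hy2, hyU⟩ := ((frequently_ne_zero_of_convex hU hc hf hx₁ h1 hx).and_eventually
    (h2.and (hU.mem_nhds hx))).exists
  exact (mul_ne_zero hy hy2) (h y hyU)

/-- Holomorphic divisibility of `F` by `b` near `x`. -/
def GoodAt (F b : E → ℂ) (x : E) : Prop :=
  ∃ G : E → ℂ, ∃ U : Set E, IsOpen U ∧ x ∈ U ∧ DifferentiableOn ℂ G U ∧ ∀ y ∈ U, F y = b y * G y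

open Classical in
/-- The pointwise value of the local quotient of `F` by `b`. -/
def quo (F b : E → ℂ) (x : E) : ℂ :=
  if h : GoodAt F b x then h.choose x else 0

theorem isOpen_goodAt (F b : E → ℂ) : IsOpen {x | GoodAt F b x} := by
  rw [isOpen_iff_mem_nhds]
  rintro x ⟨G, U, hU, hx, hG, hF⟩
  filter_upwards [hU.mem_nhds hx] with y hy using ⟨G, U, hU, hy, hG, hF⟩

theorem GoodAt.of_ne_zero {F b : E → ℂ} {Ω : Set E} (hΩ : IsOpen Ω) (hF : DifferentiableOn ℂ F Ω)
    (hb : DifferentiableOn ℂ b Ω) {x : E} (hx : x ∈ Ω) (h : b x ≠ 0) : GoodAt F b x := by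
  have h1 : DifferentiableOn ℂ (fun y => F y / b y) (Ω ∩ b ⁻¹' {0}ᶜ) := by
    simp only [div_eq_mul_inv]
    exact (hF.mono Set.inter_subset_left).mul
      ((hb.mono Set.inter_subset_left).fun_inv fun y hy => hy.2)
  refine ⟨fun y => F y / b y, Ω ∩ b ⁻¹' {0}ᶜ,
    hb.continuousOn.isOpen_inter_preimage hΩ isOpen_compl_singleton, ⟨hx, h⟩, h1, fun y hy => ?_⟩
  have : b y ≠ 0 := hy.2
  field_simp

section Quo

variable {F b : E → ℂ} {Ω : Set E}

theorem quo_eventuallyEq (hΩ : IsOpen Ω) (hbd : ∀ x ∈ Ω, ∃ᶠ y in 𝓝 x, b y ≠ 0)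
    {x : E} (hx : x ∈ Ω) {G : E → ℂ} {U : Set E} (hU : IsOpen U) (hxU : x ∈ U)
    (hG : DifferentiableOn ℂ G U) (hF : ∀ y ∈ U, F y = b y * G y) :
    ∀ᶠ y in 𝓝 x, quo F b y = G y := by
  filter_upwards [hΩ.mem_nhds hx, hU.mem_nhds hxU] with y hyΩ hyU
  have hgood : GoodAt F b y := ⟨G, U, hU, hyU, hG, hF⟩
  rw [quo, dif_pos hgood]
  obtain ⟨U', hU', hyU', hG', hF'⟩ := hgood.choose_spec
  set G' := hgood.choose
  by_contra hne
  have hc : ContinuousAt (fun z => G' z - G z) y :=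
    (hG'.continuousOn.continuousAt (hU'.mem_nhds hyU')).sub
      (hG.continuousOn.continuousAt (hU.mem_nhds hyU))
  have h2 := hc.eventually_ne (sub_ne_zero.2 hne)
  obtain ⟨z, hz, hz2, hzU, hzU'⟩ := ((hbd y hyΩ).and_eventually
    (h2.and ((hU.eventually_mem hyU).and (hU'.eventually_mem hyU')))).exists
  have := (hF z hzU).symm.trans (hF' z hzU')
  exact sub_ne_zero.1 hz2 (mul_left_cancel₀ hz this.symm)

theorem GoodAt.differentiableAt_quo (hΩ : IsOpen Ω) (hbd : ∀ x ∈ Ω, ∃ᶠ y in 𝓝 x, b y ≠ 0)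
    {x : E} (hx : x ∈ Ω) (h : GoodAt F b x) :
    DifferentiableAt ℂ (quo F b) x := by
  obtain ⟨G, U, hU, hxU, hG, hF⟩ := h
  exact (hG.differentiableAt (hU.mem_nhds hxU)).congr_of_eventuallyEq
    (quo_eventuallyEq hΩ hbd hx hU hxU hG hF)

theorem GoodAt.eq_mul_quo (hΩ : IsOpen Ω) (hbd : ∀ x ∈ Ω, ∃ᶠ y in 𝓝 x, b y ≠ 0)
    {x : E} (hx : x ∈ Ω) (h : GoodAt F b x) : F x = b x * quo F b x := by
  obtain ⟨G, U, hU, hxU, hG, hF⟩ := h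
  rw [(quo_eventuallyEq hΩ hbd hx hU hxU hG hF).self_of_nhds]
  exact hF x hxU

theorem quo_eq_div (hΩ : IsOpen Ω) (hbd : ∀ x ∈ Ω, ∃ᶠ y in 𝓝 x, b y ≠ 0)
    {x : E} (hx : x ∈ Ω) (h : GoodAt F b x) (hne : b x ≠ 0) :
    quo F b x = F x / b x := by
  rw [h.eq_mul_quo hΩ hbd hx]; field_simp

end Quo

theorem differentiableOn_circleAverage [FiniteDimensional ℂ E] {f : E → ℂ} {O V : Set E} (hO : IsOpen O)
    (hV : IsOpen V) (hf : DifferentiableOn ℂ f O) {γ : ℂ → E} (hγ : Continuous γ) {ρ : ℝ}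
    (hρ : 0 < ρ) (h : ∀ e ∈ V, ∀ ζ : ℂ, ‖ζ‖ = ρ → e + γ ζ ∈ O) :
    DifferentiableOn ℂ (fun e => Real.circleAverage (fun ζ => f (e + γ ζ)) 0 ρ) V := by
  intro e₀ he₀
  haveI : ProperSpace E := FiniteDimensional.proper ℂ E
  haveI : ProperSpace (E →L[ℂ] ℂ) := FiniteDimensional.proper ℂ _
  have hnorm : ∀ θ : ℝ, ‖circleMap 0 ρ θ‖ = ρ := fun θ => by simp [abs_of_pos hρ]
  let K : Set E := (fun ζ => e₀ + γ ζ) '' Metric.sphere (0 : ℂ) ρ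
  have hK : IsCompact K := (isCompact_sphere (0 : ℂ) ρ).image (by fun_prop)
  have hKO : K ⊆ O := by
    rintro _ ⟨ζ, hζ, rfl⟩
    exact h e₀ he₀ ζ (by simpa using hζ)
  obtain ⟨δ, hδ, hδO⟩ := hK.exists_cthickening_subset_open hO hKO
  obtain ⟨C, hC⟩ := (hK.cthickening (r := δ)).exists_bound_of_continuousOn
    (hf.continuousOn.mono hδO)
  have hmem : ∀ e ∈ Metric.ball e₀ (δ / 2), ∀ θ : ℝ,
      Metric.ball (e + γ (circleMap 0 ρ θ)) (δ / 2) ⊆ Metric.cthickening δ K := by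
    intro e he θ y hy
    refine Metric.mem_cthickening_of_dist_le y (e₀ + γ (circleMap 0 ρ θ)) δ K
      ⟨_, by simpa using hnorm θ, rfl⟩ ?_
    have h1 := Metric.mem_ball.1 hy
    have h2 : dist (e + γ (circleMap 0 ρ θ)) (e₀ + γ (circleMap 0 ρ θ)) < δ / 2 := by
      simpa using Metric.mem_ball.1 he
    exact (dist_triangle _ _ _).trans (by linarith)
  have hself : ∀ e ∈ Metric.ball e₀ (δ / 2), ∀ θ : ℝ, e + γ (circleMap 0 ρ θ) ∈ O := fun e he θ =>
    hδO (hmem e he θ (Metric.mem_ball_self (half_pos hδ)))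
  have hcont : ∀ e ∈ Metric.ball e₀ (δ / 2),
      Continuous fun θ : ℝ => f (e + γ (circleMap 0 ρ θ)) := fun e he => by
    refine hf.continuousOn.comp_continuous ?_ (hself e he)
    exact continuous_const.add (hγ.comp (continuous_circleMap 0 ρ))
  have hmeas : MeasureTheory.AEStronglyMeasurable (fun θ : ℝ => fderiv ℂ f (e₀ + γ (circleMap 0 ρ θ)))
      (MeasureTheory.volume.restrict (Set.uIoc 0 (2 * Real.pi))) := by
    borelize E
    borelize (E →L[ℂ] ℂ)
    refine ((measurable_fderiv ℂ f).comp ?_).aestronglyMeasurable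
    exact (continuous_const.add (hγ.comp (continuous_circleMap 0 ρ))).measurable
  have key := intervalIntegral.hasFDerivAt_integral_of_dominated_of_fderiv_le (𝕜 := ℂ)
    (μ := MeasureTheory.volume) (a := 0) (b := 2 * Real.pi)
    (F := fun e (θ : ℝ) => f (e + γ (circleMap 0 ρ θ)))
    (F' := fun e (θ : ℝ) => fderiv ℂ f (e + γ (circleMap 0 ρ θ)))
    (x₀ := e₀) (s := Metric.ball e₀ (δ / 2)) (bound := fun _ => C / (δ / 2))
    (Metric.ball_mem_nhds e₀ (half_pos hδ))
    (by
      filter_upwards [Metric.ball_mem_nhds e₀ (half_pos hδ)] with e he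
      exact (hcont e he).aestronglyMeasurable)
    ((hcont e₀ (Metric.mem_ball_self (half_pos hδ))).intervalIntegrable _ _)
    hmeas
    (by
      refine Filter.Eventually.of_forall fun θ _ e he => ?_
      refine norm_fderiv_le_of_bounded (half_pos hδ) (hf.mono ?_) ?_
      · exact (hmem e he θ).trans hδO
      · exact fun y hy => hC y (hmem e he θ hy))
    (by simp)
    (by
      refine Filter.Eventually.of_forall fun θ _ e he => ?_
      have h1 : HasFDerivAt f (fderiv ℂ f (e + γ (circleMap 0 ρ θ))) (e + γ (circleMap 0 ρ θ)) :=
        (hf.differentiableAt (hO.mem_nhds (hself e he θ))).hasFDerivAt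
      have h2 : HasFDerivAt (fun e => e + γ (circleMap 0 ρ θ)) (ContinuousLinearMap.id ℂ E) e :=
        (hasFDerivAt_id e).add_const _
      have h3 := h1.comp e h2
      rwa [ContinuousLinearMap.comp_id] at h3)
  have := key.differentiableAt.const_smul ((2 * Real.pi)⁻¹ : ℝ)
  exact this.differentiableWithinAt

/-- Hartogs continuity principle along a translated family of holomorphic discs. -/
theorem goodAt_of_discs [FiniteDimensional ℂ E] [NormedSpace ℝ E] [IsScalarTower ℝ ℂ E]
    {F b : E → ℂ} {Ω V W : Set E} (hΩ : IsOpen Ω) (hF : DifferentiableOn ℂ F Ω)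
    (hb : DifferentiableOn ℂ b Ω) (hbd : ∀ x ∈ Ω, ∃ᶠ y in 𝓝 x, b y ≠ 0)
    (hV : IsOpen V) (hVc : Convex ℝ V) (hVΩ : V ⊆ Ω) {γ : ℂ → E} (hγ : Continuous γ)
    {ρ : ℝ} (hρ : 0 < ρ) (hsub : ∀ e ∈ V, ∀ ζ : ℂ, ‖ζ‖ = ρ → e + γ ζ ∈ Ω)
    (hcirc : ∀ e ∈ V, ∀ ζ : ℂ, ‖ζ‖ = ρ → GoodAt F b (e + γ ζ))
    (hW : IsOpen W) (hWV : W ⊆ V) (hWne : W.Nonempty)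
    (hdisc : ∀ e ∈ W, ∃ h : ℂ → ℂ, DiffContOnCl ℂ h (Metric.ball 0 ρ) ∧
      (∀ ζ : ℂ, ‖ζ‖ = ρ → h ζ = quo F b (e + γ ζ)) ∧ F e = b e * h 0) :
    ∀ e ∈ V, GoodAt F b e := by
  let O : Set E := {x | GoodAt F b x} ∩ Ω
  have hO : IsOpen O := (isOpen_goodAt F b).inter hΩ
  have hquo : DifferentiableOn ℂ (quo F b) O := fun x hx =>
    (GoodAt.differentiableAt_quo hΩ hbd hx.2 hx.1).differentiableWithinAt
  have hG := differentiableOn_circleAverage hO hV hquo hγ hρ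
    fun e he ζ hζ => ⟨hcirc e he ζ hζ, hsub e he ζ hζ⟩
  set G : E → ℂ := fun e => Real.circleAverage (fun ζ => quo F b (e + γ ζ)) 0 ρ with hGdef
  have hWG : ∀ e ∈ W, F e - b e * G e = 0 := by
    intro e he
    obtain ⟨h, hh, hh1, hh2⟩ := hdisc e he
    have : G e = h 0 := by
      rw [← (show DiffContOnCl ℂ h (Metric.ball 0 |ρ|) by rwa [abs_of_pos hρ]).circleAverage]
      refine Real.circleAverage_congr_sphere fun ζ hζ => ?_
      exact (hh1 ζ (by simpa [abs_of_pos hρ] using hζ)).symm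
    rw [this, hh2, sub_self]
  obtain ⟨x₀, hx₀⟩ := hWne
  have hzero := eqOn_zero_of_convex hV hVc
    ((hF.mono hVΩ).sub ((hb.mono hVΩ).mul hG)) (hWV hx₀) (by
      filter_upwards [hW.mem_nhds hx₀] with y hy using hWG y hy)
  exact fun e he => ⟨G, V, hV, he, hG, fun y hy => sub_eq_zero.1 (hzero y hy)⟩

end Analytic

section Geometry

/-- The Hermitian imaginary part of a `2 × 2` matrix. -/
def imM (Z : Matrix (Fin 2) (Fin 2) ℂ) : Matrix (Fin 2) (Fin 2) ℂ :=
  Matrix.of fun i j => (Z i j - (starRingEnd ℂ) (Z j i)) / (2 * Complex.I)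

theorem imM_eq (Z : Matrix (Fin 2) (Fin 2) ℂ) : imM Z = (2 * Complex.I)⁻¹ • (Z - Zᴴ) := by
  ext i j; simp [imM, Matrix.conjTranspose_apply, div_eq_mul_inv, mul_comm]

/-- Determinant of the imaginary part. -/
def detY (Z : Matrix (Fin 2) (Fin 2) ℂ) : ℝ :=
  (Z 0 0).im * (Z 1 1).im - Complex.normSq (Z 0 1 - (starRingEnd ℂ) (Z 1 0)) / 4

theorem imM_00 (Z : Matrix (Fin 2) (Fin 2) ℂ) : imM Z 0 0 = ((Z 0 0).im : ℂ) := by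
  simp only [imM, Matrix.of_apply]
  apply Complex.ext <;> simp [Complex.div_re, Complex.div_im, Complex.normSq] <;> ring

theorem imM_11 (Z : Matrix (Fin 2) (Fin 2) ℂ) : imM Z 1 1 = ((Z 1 1).im : ℂ) := by
  simp only [imM, Matrix.of_apply]
  apply Complex.ext <;> simp [Complex.div_re, Complex.div_im, Complex.normSq] <;> ring

theorem imM_det (Z : Matrix (Fin 2) (Fin 2) ℂ) : (imM Z).det = (detY Z : ℂ) := by
  rw [Matrix.det_fin_two, imM_00, imM_11]
  simp only [imM, Matrix.of_apply, detY]
  apply Complex.ext <;> simp [Complex.div_re, Complex.div_im, Complex.normSq] <;> ring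

theorem imM_isHermitian (Z : Matrix (Fin 2) (Fin 2) ℂ) : (imM Z).IsHermitian := by
  ext i j
  simp [imM, Matrix.conjTranspose_apply]
  ring

theorem mem_HH2_iff_posDef (Z : Matrix (Fin 2) (Fin 2) ℂ) : Z ∈ HH2 ↔ (imM Z).PosDef := Iff.rfl

theorem mem_HH2_iff (Z : Matrix (Fin 2) (Fin 2) ℂ) :
    Z ∈ HH2 ↔ 0 < (Z 0 0).im ∧ 0 < detY Z := by
  rw [mem_HH2_iff_posDef]
  constructor
  · intro h
    have h1 := h.diag_pos (i := 0)
    have h2 := h.det_pos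
    rw [imM_00] at h1
    rw [imM_det] at h2
    exact ⟨by exact_mod_cast h1, by exact_mod_cast h2⟩
  · rintro ⟨h1, h2⟩
    refine Matrix.PosDef.of_dotProduct_mulVec_pos (imM_isHermitian Z) fun x hx => ?_
    have key : star x ⬝ᵥ imM Z *ᵥ x =
        ((Complex.normSq ((Z 0 0).im * x 0 + imM Z 0 1 * x 1) / (Z 0 0).im +
          detY Z / (Z 0 0).im * Complex.normSq (x 1) : ℝ) : ℂ) := by
      have h10 : imM Z 1 0 = star (imM Z 0 1) := by
        rw [← (imM_isHermitian Z).apply 1 0]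
      have hd : (detY Z : ℂ) = (Z 0 0).im * (Z 1 1).im - imM Z 0 1 * star (imM Z 0 1) := by
        rw [← imM_det, Matrix.det_fin_two, imM_00, imM_11, h10]
      have hne : ((Z 0 0).im : ℂ) ≠ 0 := by exact_mod_cast h1.ne'
      simp only [dotProduct, Fin.sum_univ_two, mulVec, imM_00, imM_11, h10, Pi.star_apply]
      push_cast
      rw [hd, ← Complex.mul_conj, ← Complex.mul_conj]
      simp only [Complex.star_def, map_add, map_mul, Complex.conj_ofReal]
      field_simp
      ring
    rw [key]
    rw [Complex.zero_lt_real]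
    by_cases h : x 1 = 0
    · have h0 : x 0 ≠ 0 := by
        intro h0; apply hx; ext i; fin_cases i <;> simp [h, h0]
      rw [h]
      simp only [mul_zero, add_zero, map_zero]
      have : 0 < Complex.normSq ((Z 0 0).im * x 0) := by
        rw [Complex.normSq_pos]
        exact mul_ne_zero (by exact_mod_cast h1.ne') h0
      positivity
    · have := Complex.normSq_pos.2 h
      have h3 := Complex.normSq_nonneg ((Z 0 0).im * x 0 + imM Z 0 1 * x 1)
      positivity

theorem HH2_im_pos {Z : Matrix (Fin 2) (Fin 2) ℂ} (h : Z ∈ HH2) : 0 < (Z 0 0).im :=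
  ((mem_HH2_iff Z).1 h).1

theorem HH2_detY_pos {Z : Matrix (Fin 2) (Fin 2) ℂ} (h : Z ∈ HH2) : 0 < detY Z :=
  ((mem_HH2_iff Z).1 h).2

theorem HH2_im_pos' {Z : Matrix (Fin 2) (Fin 2) ℂ} (h : Z ∈ HH2) : 0 < (Z 1 1).im := by
  obtain ⟨h1, h2⟩ := (mem_HH2_iff Z).1 h
  have := Complex.normSq_nonneg (Z 0 1 - (starRingEnd ℂ) (Z 1 0))
  simp only [detY] at h2
  by_contra h3
  nlinarith

theorem continuous_detY : Continuous detY := by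
  unfold detY
  have h : ∀ i j, Continuous fun Z : Matrix (Fin 2) (Fin 2) ℂ => Z i j := fun i j =>
    (continuous_apply j).comp (continuous_apply i)
  have := h 0 0; have := h 0 1; have := h 1 0; have := h 1 1
  have hn : Continuous fun Z : Matrix (Fin 2) (Fin 2) ℂ =>
      Complex.normSq (Z 0 1 - (starRingEnd ℂ) (Z 1 0)) :=
    Complex.continuous_normSq.comp ((h 0 1).sub (Complex.continuous_conj.comp (h 1 0)))
  exact ((Complex.continuous_im.comp (h 0 0)).mul (Complex.continuous_im.comp (h 1 1))).sub
    (hn.div_const _)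

theorem isOpen_HH2 : IsOpen HH2 := by
  have : HH2 = {Z | 0 < (Z 0 0).im} ∩ {Z | 0 < detY Z} := by
    ext Z; exact mem_HH2_iff Z
  rw [this]
  refine (isOpen_lt continuous_const ?_).inter (isOpen_lt continuous_const continuous_detY)
  exact Complex.continuous_im.comp ((continuous_apply 0).comp (continuous_apply 0))

theorem convex_HH2 : Convex ℝ HH2 := by
  intro Z hZ W hW a b ha hb hab
  rw [mem_HH2_iff_posDef] at *
  have : imM (a • Z + b • W) = a • imM Z + b • imM W := by
    rw [imM_eq, imM_eq, imM_eq]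
    ext i j
    simp [Matrix.conjTranspose_apply]
    ring
  rw [this]
  rcases ha.eq_or_lt with rfl | ha
  · have : b = 1 := by linarith
    simpa [this] using hW
  rcases hb.eq_or_lt with rfl | hb
  · have : a = 1 := by linarith
    simpa [this] using hZ
  exact (hZ.smul ha).add (hW.smul hb)

/-- The unitary group condition without integrality. -/
def inU (M : Matrix (Fin 4) (Fin 4) ℂ) : Prop := Mᵀ * Jmat * M.map (starRingEnd ℂ) = Jmat

section Blocks

variable (M N : Matrix (Fin 4) (Fin 4) ℂ)

theorem blkA_mul : blkA (M * N) = blkA M * blkA N + blkB M * blkC N := by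
  ext i j; fin_cases i <;> fin_cases j <;>
  simp [blkA, blkB, blkC, Matrix.mul_apply, Fin.sum_univ_four] <;> ring
theorem blkB_mul : blkB (M * N) = blkA M * blkB N + blkB M * blkD N := by
  ext i j; fin_cases i <;> fin_cases j <;>
  simp [blkA, blkB, blkD, Matrix.mul_apply, Fin.sum_univ_four] <;> ring
theorem blkC_mul : blkC (M * N) = blkC M * blkA N + blkD M * blkC N := by
  ext i j; fin_cases i <;> fin_cases j <;>
  simp [blkA, blkC, blkD, Matrix.mul_apply, Fin.sum_univ_four] <;> ring
theorem blkD_mul : blkD (M * N) = blkC M * blkB N + blkD M * blkD N := by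
  ext i j; fin_cases i <;> fin_cases j <;>
  simp [blkB, blkC, blkD, Matrix.mul_apply, Fin.sum_univ_four] <;> ring

end Blocks

theorem inU_conj {M : Matrix (Fin 4) (Fin 4) ℂ} (h : inU M) : Mᴴ * Jmat * M = Jmat := by
  have h2 := congrArg (fun X : Matrix (Fin 4) (Fin 4) ℂ => X.map (starRingEnd ℂ)) h
  simp only [Matrix.map_mul] at h2
  have hJ : Jmat.map (starRingEnd ℂ) = Jmat := by
    ext i j; fin_cases i <;> fin_cases j <;> simp [Jmat]
  rw [hJ] at h2
  have h3 : Mᵀ.map (starRingEnd ℂ) = Mᴴ := by ext i j; simp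
  rwa [h3, show (M.map (starRingEnd ℂ)).map (starRingEnd ℂ) = M by ext i j; simp] at h2

theorem inU_of_conj {M : Matrix (Fin 4) (Fin 4) ℂ} (h : Mᴴ * Jmat * M = Jmat) : inU M := by
  have h2 := congrArg (fun X : Matrix (Fin 4) (Fin 4) ℂ => X.map (starRingEnd ℂ)) h
  simp only [Matrix.map_mul] at h2
  have hJ : Jmat.map (starRingEnd ℂ) = Jmat := by
    ext i j; fin_cases i <;> fin_cases j <;> simp [Jmat]
  rw [hJ] at h2
  unfold inU
  rwa [show Mᴴ.map (starRingEnd ℂ) = Mᵀ by ext i j; simp] at h2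

theorem inU_mul {M N : Matrix (Fin 4) (Fin 4) ℂ} (hM : inU M) (hN : inU N) : inU (M * N) := by
  apply inU_of_conj
  have h1 := inU_conj hM
  have h2 := inU_conj hN
  calc (M * N)ᴴ * Jmat * (M * N) = Nᴴ * (Mᴴ * Jmat * M) * N := by
        rw [Matrix.conjTranspose_mul]; simp only [Matrix.mul_assoc]
    _ = Jmat := by rw [h1, h2]

theorem inU_blocks {M : Matrix (Fin 4) (Fin 4) ℂ} (h : inU M) :
    (blkA M)ᴴ * blkC M = (blkC M)ᴴ * blkA M ∧ (blkB M)ᴴ * blkD M = (blkD M)ᴴ * blkB M ∧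
      (blkA M)ᴴ * blkD M - (blkC M)ᴴ * blkB M = 1 := by
  have h := inU_conj h
  refine ⟨?_, ?_, ?_⟩ <;> ext i j
  · have := congrFun (congrFun h (i.castLE (by norm_num))) (j.castLE (by norm_num))
    fin_cases i <;> fin_cases j <;>
    simp [blkA, blkC, Matrix.mul_apply, Fin.sum_univ_four, Fin.sum_univ_two, Jmat] at this ⊢ <;>
    linear_combination -this
  · have := congrFun (congrFun h (i.natAdd 2)) (j.natAdd 2)
    fin_cases i <;> fin_cases j <;>
    simp [blkB, blkD, Matrix.mul_apply, Fin.sum_univ_four, Fin.sum_univ_two, Jmat] at this ⊢ <;>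
    linear_combination -this
  · have := congrFun (congrFun h (i.castLE (by norm_num))) (j.natAdd 2)
    fin_cases i <;> fin_cases j <;>
    simp [blkA, blkB, blkC, blkD, Matrix.mul_apply, Fin.sum_univ_four, Fin.sum_univ_two, Jmat]
      at this ⊢ <;>
    linear_combination -this

/-- The automorphy matrix `cZ + d`. -/
def autM (M : Matrix (Fin 4) (Fin 4) ℂ) (Z : Matrix (Fin 2) (Fin 2) ℂ) :
    Matrix (Fin 2) (Fin 2) ℂ := blkC M * Z + blkD M

/-- The numerator `aZ + b`. -/
def numM (M : Matrix (Fin 4) (Fin 4) ℂ) (Z : Matrix (Fin 2) (Fin 2) ℂ) :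
    Matrix (Fin 2) (Fin 2) ℂ := blkA M * Z + blkB M

theorem autM_num {M : Matrix (Fin 4) (Fin 4) ℂ} (h : inU M) (Z : Matrix (Fin 2) (Fin 2) ℂ) :
    (autM M Z)ᴴ * numM M Z - (numM M Z)ᴴ * autM M Z = Z - Zᴴ := by
  obtain ⟨h1, h2, h3⟩ := inU_blocks h
  have h4 : (blkD M)ᴴ * blkA M - (blkB M)ᴴ * blkC M = 1 := by
    have := congrArg Matrix.conjTranspose h3
    simpa using this
  simp only [autM, numM, Matrix.conjTranspose_add, Matrix.conjTranspose_mul]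
  set A := blkA M; set B := blkB M; set C := blkC M; set D := blkD M
  calc _ = Zᴴ * (Cᴴ * A - Aᴴ * C) * Z - Zᴴ * (Aᴴ * D - Cᴴ * B) + (Dᴴ * A - Bᴴ * C) * Z
        + (Dᴴ * B - Bᴴ * D) := by noncomm_ring
    _ = _ := by rw [h3, h4, h1, h2]; simp; abel

theorem imM_posDef_re {Z : Matrix (Fin 2) (Fin 2) ℂ} (hZ : Z ∈ HH2) {x : Fin 2 → ℂ}
    (hx : star x ⬝ᵥ (Z - Zᴴ) *ᵥ x = 0) : x = 0 := by
  by_contra hne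
  have h1 := ((mem_HH2_iff_posDef Z).1 hZ).dotProduct_mulVec_pos hne
  rw [imM_eq, Matrix.smul_mulVec, dotProduct_smul, hx] at h1
  simp at h1

theorem autM_det_ne_zero {M : Matrix (Fin 4) (Fin 4) ℂ} (h : inU M)
    {Z : Matrix (Fin 2) (Fin 2) ℂ} (hZ : Z ∈ HH2) : (autM M Z).det ≠ 0 := by
  intro h0
  obtain ⟨x, hx, hx0⟩ := Matrix.exists_mulVec_eq_zero_iff.2 h0
  refine hx (imM_posDef_re hZ ?_)
  rw [← autM_num h Z, Matrix.sub_mulVec, ← Matrix.mulVec_mulVec, ← Matrix.mulVec_mulVec, hx0,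
    dotProduct_sub, Matrix.mulVec_zero, dotProduct_zero, sub_zero, Matrix.dotProduct_mulVec,
    ← Matrix.star_mulVec, hx0]
  simp

theorem moebius_eq (M : Matrix (Fin 4) (Fin 4) ℂ) (Z : Matrix (Fin 2) (Fin 2) ℂ) :
    moebius M Z = numM M Z * (autM M Z)⁻¹ := rfl

theorem moebius_mul_autM {M : Matrix (Fin 4) (Fin 4) ℂ} (h : inU M)
    {Z : Matrix (Fin 2) (Fin 2) ℂ} (hZ : Z ∈ HH2) : moebius M Z * autM M Z = numM M Z := by
  rw [moebius_eq, Matrix.mul_assoc, Matrix.nonsing_inv_mul _ (autM_det_ne_zero h hZ).isUnit,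
    Matrix.mul_one]

theorem moebius_sub {M : Matrix (Fin 4) (Fin 4) ℂ} (h : inU M)
    {Z : Matrix (Fin 2) (Fin 2) ℂ} (hZ : Z ∈ HH2) :
    (autM M Z)ᴴ * (moebius M Z - (moebius M Z)ᴴ) * autM M Z = Z - Zᴴ := by
  rw [← autM_num h Z, ← moebius_mul_autM h hZ, Matrix.conjTranspose_mul]
  noncomm_ring

theorem imM_moebius {M : Matrix (Fin 4) (Fin 4) ℂ} (h : inU M)
    {Z : Matrix (Fin 2) (Fin 2) ℂ} (hZ : Z ∈ HH2) :
    (autM M Z)ᴴ * imM (moebius M Z) * autM M Z = imM Z := by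
  rw [imM_eq, imM_eq, ← moebius_sub h hZ]
  simp

theorem imM_moebius' {M : Matrix (Fin 4) (Fin 4) ℂ} (h : inU M)
    {Z : Matrix (Fin 2) (Fin 2) ℂ} (hZ : Z ∈ HH2) :
    imM (moebius M Z) = ((autM M Z)⁻¹)ᴴ * imM Z * (autM M Z)⁻¹ := by
  have hu := (autM_det_ne_zero h hZ).isUnit
  rw [← imM_moebius h hZ]
  calc _ = (autM M Z * (autM M Z)⁻¹)ᴴ * imM (moebius M Z) * (autM M Z * (autM M Z)⁻¹) := by
        rw [Matrix.mul_nonsing_inv _ hu]; simp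
    _ = _ := by rw [Matrix.conjTranspose_mul]; noncomm_ring

theorem moebius_mem {M : Matrix (Fin 4) (Fin 4) ℂ} (h : inU M)
    {Z : Matrix (Fin 2) (Fin 2) ℂ} (hZ : Z ∈ HH2) : moebius M Z ∈ HH2 := by
  rw [mem_HH2_iff_posDef, imM_moebius' h hZ]
  refine Matrix.PosDef.conjTranspose_mul_mul_same hZ ?_
  apply Matrix.mulVec_injective_of_isUnit
  rw [Matrix.isUnit_nonsing_inv_iff, Matrix.isUnit_iff_isUnit_det]
  exact (autM_det_ne_zero h hZ).isUnit

theorem autM_mul {M N : Matrix (Fin 4) (Fin 4) ℂ} (hN : inU N)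
    {Z : Matrix (Fin 2) (Fin 2) ℂ} (hZ : Z ∈ HH2) :
    autM (M * N) Z = autM M (moebius N Z) * autM N Z := by
  simp only [autM, Matrix.add_mul, Matrix.mul_assoc]
  have := moebius_mul_autM hN hZ
  rw [autM, numM] at this
  rw [this, blkC_mul, blkD_mul]
  noncomm_ring

theorem numM_mul {M N : Matrix (Fin 4) (Fin 4) ℂ} (hN : inU N)
    {Z : Matrix (Fin 2) (Fin 2) ℂ} (hZ : Z ∈ HH2) :
    numM (M * N) Z = numM M (moebius N Z) * autM N Z := by
  simp only [numM, Matrix.add_mul, Matrix.mul_assoc]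
  rw [moebius_mul_autM hN hZ, numM, autM, blkA_mul, blkB_mul]
  noncomm_ring

theorem moebius_mul {M N : Matrix (Fin 4) (Fin 4) ℂ} (hN : inU N)
    {Z : Matrix (Fin 2) (Fin 2) ℂ} (hZ : Z ∈ HH2) :
    moebius (M * N) Z = moebius M (moebius N Z) := by
  have hu := (autM_det_ne_zero hN hZ).isUnit
  rw [moebius_eq, moebius_eq M, numM_mul hN hZ, autM_mul hN hZ, Matrix.mul_inv_rev,
    Matrix.mul_assoc, ← Matrix.mul_assoc (autM N Z), Matrix.mul_nonsing_inv _ hu, Matrix.one_mul]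

theorem inU_one : inU 1 := by
  apply inU_of_conj; simp

theorem autM_one (Z : Matrix (Fin 2) (Fin 2) ℂ) : autM 1 Z = 1 := by
  ext i j; fin_cases i <;> fin_cases j <;>
  simp [autM, blkC, blkD, Fin.sum_univ_two, Matrix.vecMul,
    dotProduct]

theorem moebius_one (Z : Matrix (Fin 2) (Fin 2) ℂ) : moebius 1 Z = Z := by
  rw [moebius_eq, autM_one]
  ext i j; fin_cases i <;> fin_cases j <;>
  simp [numM, blkA, blkB, Matrix.mul_apply, Fin.sum_univ_two, Matrix.one_apply, Matrix.vecMul,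
    dotProduct, Matrix.vecHead, Matrix.vecTail]

/-- The coordinate functionals on the matrix space. -/
theorem differentiable_entry (i j : Fin 2) :
    Differentiable ℂ fun Z : Matrix (Fin 2) (Fin 2) ℂ => Z i j := by
  have h1 : Differentiable ℂ fun Z : Fin 2 → Fin 2 → ℂ => Z i j := by fun_prop
  exact h1

theorem differentiableAt_of_entries {E : Type*} [NormedAddCommGroup E] [NormedSpace ℂ E]
    {f : E → Matrix (Fin 2) (Fin 2) ℂ} {x : E} (h : ∀ i j, DifferentiableAt ℂ (fun y => f y i j) x) :
    DifferentiableAt ℂ f x := by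
  have h1 : DifferentiableAt ℂ (fun y => (fun i j => f y i j : Fin 2 → Fin 2 → ℂ)) x := by
    rw [differentiableAt_pi]; intro i; rw [differentiableAt_pi]; exact h i
  exact h1

theorem differentiableAt_moebius {M : Matrix (Fin 4) (Fin 4) ℂ} (h : inU M)
    {Z : Matrix (Fin 2) (Fin 2) ℂ} (hZ : Z ∈ HH2) : DifferentiableAt ℂ (moebius M) Z := by
  have h0 := autM_det_ne_zero h hZ
  have e00 := differentiable_entry 0 0; have e01 := differentiable_entry 0 1
  have e10 := differentiable_entry 1 0; have e11 := differentiable_entry 1 1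
  have hdet : DifferentiableAt ℂ (fun W => (autM M W).det) Z := by
    simp only [autM, Matrix.det_fin_two, Matrix.add_apply, Matrix.mul_apply, Fin.sum_univ_two]
    fun_prop
  refine differentiableAt_of_entries fun i j => ?_
  have : (fun W => moebius M W i j) =
      fun W => (numM M W * (autM M W).adjugate) i j * ((autM M W).det)⁻¹ := by
    funext W
    rw [moebius_eq, Matrix.inv_def, Ring.inverse_eq_inv']
    simp [mul_comm]
  rw [this]
  refine DifferentiableAt.mul ?_ (hdet.fun_inv h0)
  simp only [Matrix.adjugate_fin_two, numM, autM, Matrix.mul_apply, Fin.sum_univ_two,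
    Matrix.add_apply]
  fin_cases j <;> simp <;> fun_prop

theorem detY_moebius {M : Matrix (Fin 4) (Fin 4) ℂ} (h : inU M)
    {Z : Matrix (Fin 2) (Fin 2) ℂ} (hZ : Z ∈ HH2) :
    detY (moebius M Z) * Complex.normSq (autM M Z).det = detY Z := by
  have h1 := congrArg Matrix.det (imM_moebius h hZ)
  rw [Matrix.det_mul, Matrix.det_mul, Matrix.det_conjTranspose, imM_det, imM_det] at h1
  have h2 : ((detY (moebius M Z) * Complex.normSq (autM M Z).det : ℝ) : ℂ) = detY Z := by
    rw [← h1, Complex.ofReal_mul, ← Complex.mul_conj, Complex.star_def]; ring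
  exact_mod_cast h2

/-- The row vector `cZ + d` for `ℓ = (c, d)`. -/
def uvec (Z : Matrix (Fin 2) (Fin 2) ℂ) (l : Fin 4 → ℂ) : Fin 2 → ℂ :=
  ![l 0, l 1] ᵥ* Z + ![l 2, l 3]

/-- The Hermitian height `(cZ+d) Y⁻¹ (cZ+d)^*` of `ℓ = (c, d)`. -/
def hgt (Z : Matrix (Fin 2) (Fin 2) ℂ) (l : Fin 4 → ℂ) : ℝ :=
  (uvec Z l ᵥ* (imM Z)⁻¹ ⬝ᵥ star (uvec Z l)).re

theorem uvec_moebius {M : Matrix (Fin 4) (Fin 4) ℂ} (h : inU M)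
    {Z : Matrix (Fin 2) (Fin 2) ℂ} (hZ : Z ∈ HH2) (l : Fin 4 → ℂ) :
    uvec (moebius M Z) l ᵥ* autM M Z = uvec Z (l ᵥ* M) := by
  rw [uvec, Matrix.add_vecMul, Matrix.vecMul_vecMul, moebius_mul_autM h hZ]
  ext j
  fin_cases j <;>
  simp [numM, autM, blkA, blkB, blkC, blkD, uvec, Matrix.vecMul, dotProduct,
    Fin.sum_univ_two, Fin.sum_univ_four, Matrix.vecHead, Matrix.vecTail] <;> ring

theorem hgt_moebius {M : Matrix (Fin 4) (Fin 4) ℂ} (h : inU M)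
    {Z : Matrix (Fin 2) (Fin 2) ℂ} (hZ : Z ∈ HH2) (l : Fin 4 → ℂ) :
    hgt (moebius M Z) l = hgt Z (l ᵥ* M) := by
  have hu := (autM_det_ne_zero h hZ).isUnit
  have h1 : (imM (moebius M Z))⁻¹ = autM M Z * (imM Z)⁻¹ * (autM M Z)ᴴ := by
    rw [imM_moebius' h hZ, Matrix.mul_inv_rev, Matrix.mul_inv_rev,
      Matrix.nonsing_inv_nonsing_inv _ hu, ← Matrix.conjTranspose_nonsing_inv,
      Matrix.nonsing_inv_nonsing_inv _ hu, Matrix.mul_assoc]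
  rw [hgt, hgt, ← uvec_moebius h hZ, h1, Matrix.star_vecMul, ← Matrix.vecMul_vecMul,
    ← Matrix.vecMul_vecMul, ← Matrix.dotProduct_mulVec]

theorem hgt_eq (Z : Matrix (Fin 2) (Fin 2) ℂ) (l : Fin 4 → ℂ) :
    hgt Z l = ((Z 1 1).im * Complex.normSq (uvec Z l 0) + (Z 0 0).im * Complex.normSq (uvec Z l 1)
      - 2 * (uvec Z l 0 * imM Z 0 1 * (starRingEnd ℂ) (uvec Z l 1)).re) / detY Z := by
  have h10 : imM Z 1 0 = (starRingEnd ℂ) (imM Z 0 1) := by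
    rw [← (imM_isHermitian Z).apply 1 0]; rfl
  rw [hgt, Matrix.inv_def, Ring.inverse_eq_inv', Matrix.adjugate_fin_two, imM_det, imM_00, imM_11,
    h10, Matrix.vecMul_smul, smul_dotProduct, ← Complex.ofReal_inv, smul_eq_mul,
    Complex.re_ofReal_mul, div_eq_inv_mul]
  congr 1
  set a := uvec Z l 0 with ha
  set b := uvec Z l 1 with hb
  have h1 : uvec Z l = ![a, b] := by ext i; fin_cases i <;> rfl
  rw [h1]
  simp [Matrix.vecMul, dotProduct, Fin.sum_univ_two, Complex.normSq_apply]
  ring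

end Geometry

section Ring

/-- The generator `(1 + √-11)/2`. -/
abbrev om : ℂ := omg 11

theorem om_re : om.re = 1 / 2 := by
  simp [om, omg]

theorem om_im : om.im = Real.sqrt 11 / 2 := by
  simp [om, omg]

theorem sqrt11_sq : Real.sqrt 11 * Real.sqrt 11 = 11 := Real.mul_self_sqrt (by norm_num)

theorem om_mul_self : om * om = om - 3 := by
  have := sqrt11_sq
  apply Complex.ext
  · rw [Complex.mul_re, Complex.sub_re, om_re, om_im]
    simp; nlinarith
  · rw [Complex.mul_im, Complex.sub_im, om_re, om_im]
    simp; ring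

theorem conj_om : (starRingEnd ℂ) om = 1 - om := by
  apply Complex.ext
  · rw [Complex.conj_re, Complex.sub_re, om_re]; norm_num
  · rw [Complex.conj_im, Complex.sub_im, om_im]; simp

/-- The ring of integers as a subring of `ℂ`. -/
def OK : Subring ℂ where
  carrier := ringInts 11
  mul_mem' := by
    rintro _ _ ⟨a, b, rfl⟩ ⟨c, d, rfl⟩
    refine ⟨a * c - 3 * (b * d), a * d + b * c + b * d, ?_⟩
    push_cast
    linear_combination (b * d : ℂ) * om_mul_self
  one_mem' := ⟨1, 0, by simp⟩
  add_mem' := by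
    rintro _ _ ⟨a, b, rfl⟩ ⟨c, d, rfl⟩
    exact ⟨a + c, b + d, by push_cast; ring⟩
  zero_mem' := ⟨0, 0, by simp⟩
  neg_mem' := by
    rintro _ ⟨a, b, rfl⟩
    exact ⟨-a, -b, by push_cast; ring⟩

theorem mem_OK {x : ℂ} : x ∈ OK ↔ x ∈ ringInts 11 := Iff.rfl

theorem om_mem : om ∈ OK := ⟨0, 1, by simp⟩

theorem intCast_mem_OK (n : ℤ) : (n : ℂ) ∈ OK := ⟨n, 0, by simp⟩

theorem conj_mem_OK {x : ℂ} (h : x ∈ OK) : (starRingEnd ℂ) x ∈ OK := by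
  obtain ⟨a, b, rfl⟩ := h
  refine ⟨a + b, -b, ?_⟩
  rw [map_add, map_mul, conj_om]
  simp; ring

theorem normSq_coord (a b : ℝ) :
    Complex.normSq ((a : ℂ) + (b : ℂ) * om) = a ^ 2 + a * b + 3 * b ^ 2 := by
  have := sqrt11_sq
  rw [Complex.normSq_apply, Complex.add_re, Complex.add_im, Complex.re_ofReal_mul,
    Complex.im_ofReal_mul, om_re, om_im]
  simp; nlinarith

theorem exists_normSq_eq {x : ℂ} (h : x ∈ OK) : ∃ n : ℕ, Complex.normSq x = n := by
  obtain ⟨a, b, rfl⟩ := h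
  have h1 := normSq_coord a b
  push_cast at h1
  have h2 : (0 : ℤ) ≤ a ^ 2 + a * b + 3 * b ^ 2 := by nlinarith [sq_nonneg (2 * a + b), sq_nonneg b]
  refine ⟨(a ^ 2 + a * b + 3 * b ^ 2).toNat, ?_⟩
  change Complex.normSq ((a : ℂ) + (b : ℂ) * om) = _
  rw [h1]
  have h3 : (((a ^ 2 + a * b + 3 * b ^ 2).toNat : ℤ) : ℝ) = ((a ^ 2 + a * b + 3 * b ^ 2 : ℤ) : ℝ) := by
    rw [Int.toNat_of_nonneg h2]
  push_cast at h3
  exact h3.symm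

theorem exists_coord (z : ℂ) : ∃ a b : ℝ, z = (a : ℂ) + (b : ℂ) * om := by
  have h : Real.sqrt 11 ≠ 0 := by positivity
  refine ⟨z.re - z.im / Real.sqrt 11, 2 * z.im / Real.sqrt 11, ?_⟩
  apply Complex.ext
  · rw [Complex.add_re, Complex.re_ofReal_mul, om_re]; simp; ring
  · rw [Complex.add_im, Complex.im_ofReal_mul, om_im]; simp; field_simp

theorem exists_near (z : ℂ) : ∃ q ∈ OK, Complex.normSq (z - q) ≤ 15 / 16 := by
  obtain ⟨a, b, rfl⟩ := exists_coord z
  set n := round b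
  set e := b - n with he
  set m := round (a + e / 2)
  refine ⟨(m : ℂ) + (n : ℂ) * om, ⟨m, n, rfl⟩, ?_⟩
  have h1 : (a : ℂ) + b * om - (m + n * om) = ((a - m : ℝ) : ℂ) + ((b - n : ℝ) : ℂ) * om := by
    push_cast; ring
  rw [h1, normSq_coord]
  have h2 := abs_le.1 (abs_sub_round b)
  have h3 := abs_le.1 (abs_sub_round (a + e / 2))
  rw [← he] at h2 ⊢
  have h4 : (a - m) ^ 2 + (a - m) * e + 3 * e ^ 2 = (a + e / 2 - m) ^ 2 + 11 / 4 * e ^ 2 := by ring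
  rw [h4]
  nlinarith

/-- Elements of the ring of integers that are real are rational integers. -/
theorem exists_int_of_real {x : ℂ} (h : x ∈ OK) (him : x.im = 0) : ∃ n : ℤ, x = n := by
  obtain ⟨a, b, rfl⟩ := h
  have h1 : ((a : ℂ) + b * om).im = b * (Real.sqrt 11 / 2) := by
    rw [← om_im]; simp
  rw [show omg 11 = om from rfl, h1] at him
  have h : Real.sqrt 11 ≠ 0 := by positivity
  have : (b : ℝ) = 0 := by
    rcases mul_eq_zero.1 him with h2 | h2
    · exact h2
    · exact absurd h2 (by positivity)
  have : b = 0 := by exact_mod_cast this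
  exact ⟨a, by simp [this]⟩

theorem eq_one_or_neg_one {x y : ℂ} (hx : x ∈ OK) (hy : y ∈ OK) (h : x * y = 1) :
    x = 1 ∨ x = -1 := by
  obtain ⟨n, hn⟩ := exists_normSq_eq hx
  obtain ⟨m, hm⟩ := exists_normSq_eq hy
  have h1 : (n : ℝ) * m = 1 := by
    rw [← hn, ← hm, ← Complex.normSq_mul, h, Complex.normSq_one]
  have h2 : n * m = 1 := by exact_mod_cast h1
  have h3 : n = 1 := Nat.eq_one_of_mul_eq_one_right h2
  obtain ⟨a, b, rfl⟩ := hx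
  have h4 := normSq_coord a b
  rw [h3] at hn
  have h5 : a ^ 2 + a * b + 3 * b ^ 2 = 1 := by
    have : ((a ^ 2 + a * b + 3 * b ^ 2 : ℤ) : ℝ) = 1 := by
      push_cast
      rw [← h4]
      simpa using hn
    exact_mod_cast this
  have hb : b = 0 := by
    have : 11 * b ^ 2 ≤ 4 := by nlinarith [sq_nonneg (2 * a + b)]
    have h6 : b < 1 := by nlinarith
    have h7 : -1 < b := by nlinarith
    omega
  subst hb
  have : (a - 1) * (a + 1) = 0 := by linarith
  rcases mul_eq_zero.1 this with h | h
  · left; have : a = 1 := by omega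
    simp [this]
  · right; have : a = -1 := by omega
    simp [this]

end Ring

section Group

/-- Translation by the Hermitian matrix `[[p, x], [conj x, q]]`. -/
def tM (p : ℝ) (x : ℂ) (q : ℝ) : Matrix (Fin 4) (Fin 4) ℂ :=
  !![1, 0, p, x; 0, 1, (starRingEnd ℂ) x, q; 0, 0, 1, 0; 0, 0, 0, 1]

/-- The Levi element attached to `[[α, β], [γ, δ]]` of determinant one. -/
def lM (α β γ δ : ℂ) : Matrix (Fin 4) (Fin 4) ℂ :=
  !![α, β, 0, 0; γ, δ, 0, 0; 0, 0, (starRingEnd ℂ) δ, -(starRingEnd ℂ) γ;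
    0, 0, -(starRingEnd ℂ) β, (starRingEnd ℂ) α]

/-- The Levi element exchanging the two coordinates. -/
def sM : Matrix (Fin 4) (Fin 4) ℂ := !![0, 1, 0, 0; 1, 0, 0, 0; 0, 0, 0, 1; 0, 0, 1, 0]

/-- The embedded copy of `SL₂(ℝ)` acting on the first diagonal variable. -/
def jM (a b c d : ℝ) : Matrix (Fin 4) (Fin 4) ℂ :=
  !![a, 0, b, 0; 0, 1, 0, 0; c, 0, d, 0; 0, 0, 0, 1]

theorem inU_tM (p : ℝ) (x : ℂ) (q : ℝ) : inU (tM p x q) := by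
  apply inU_of_conj
  ext i j; fin_cases i <;> fin_cases j <;>
  simp [tM, Jmat, Matrix.mul_apply, Fin.sum_univ_four]

theorem inU_lM {α β γ δ : ℂ} (h : α * δ - β * γ = 1) : inU (lM α β γ δ) := by
  have h' := congrArg (starRingEnd ℂ) h
  simp only [map_sub, map_mul, map_one] at h'
  apply inU_of_conj
  ext i j; fin_cases i <;> fin_cases j <;>
  simp [lM, Jmat, Matrix.mul_apply, Fin.sum_univ_four] <;>
  first | ring1 | linear_combination h | linear_combination -h | linear_combination h' |
    linear_combination -h'

theorem inU_sM : inU sM := by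
  apply inU_of_conj
  ext i j; fin_cases i <;> fin_cases j <;>
  simp [sM, Jmat, Matrix.mul_apply, Fin.sum_univ_four]

theorem inU_jM {a b c d : ℝ} (h : a * d - b * c = 1) : inU (jM a b c d) := by
  have h' : (a * d - b * c : ℂ) = 1 := by exact_mod_cast h
  apply inU_of_conj
  ext i j; fin_cases i <;> fin_cases j <;>
  simp [jM, Jmat, Matrix.mul_apply, Fin.sum_univ_four] <;>
  first | ring1 | linear_combination h' | linear_combination -h'

theorem det_tM (p : ℝ) (x : ℂ) (q : ℝ) : (tM p x q).det = 1 := by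
  simp [tM, Matrix.det_succ_row_zero, Fin.sum_univ_succ]

theorem det_lM {α β γ δ : ℂ} (h : α * δ - β * γ = 1) : (lM α β γ δ).det = 1 := by
  have h' := congrArg (starRingEnd ℂ) h
  simp only [map_sub, map_mul, map_one] at h'
  simp [lM, Matrix.det_succ_row_zero, Fin.sum_univ_succ, Fin.succAbove]
  linear_combination (α * δ - β * γ) * h' + h

theorem det_sM : sM.det = 1 := by
  simp [sM, Matrix.det_succ_row_zero, Fin.sum_univ_succ, Fin.succAbove]

theorem det_jM {a b c d : ℝ} (h : a * d - b * c = 1) : (jM a b c d).det = 1 := by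
  have h' : (a * d - b * c : ℂ) = 1 := by exact_mod_cast h
  simp [jM, Matrix.det_succ_row_zero, Fin.sum_univ_succ, Fin.succAbove]
  linear_combination h'

theorem inSU_tM (p : ℤ) {x : ℂ} (hx : x ∈ OK) (q : ℤ) : inSU 11 (tM p x q) := by
  refine ⟨?_, det_tM _ _ _, inU_tM _ _ _⟩
  intro i j
  rw [← mem_OK]
  have := intCast_mem_OK p; have := intCast_mem_OK q; have := conj_mem_OK hx
  have := OK.zero_mem; have := OK.one_mem
  fin_cases i <;> fin_cases j <;> simp [tM] <;> assumption

theorem inSU_lM {α β γ δ : ℂ} (h : α * δ - β * γ = 1) (hα : α ∈ OK) (hβ : β ∈ OK) (hγ : γ ∈ OK)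
    (hδ : δ ∈ OK) : inSU 11 (lM α β γ δ) := by
  refine ⟨?_, det_lM h, inU_lM h⟩
  intro i j
  rw [← mem_OK]
  have := conj_mem_OK hα; have := conj_mem_OK hβ; have := conj_mem_OK hγ; have := conj_mem_OK hδ
  have := OK.zero_mem
  fin_cases i <;> fin_cases j <;> simp [lM] <;> assumption

theorem inSU_sM : inSU 11 sM := by
  refine ⟨?_, det_sM, inU_sM⟩
  intro i j
  rw [← mem_OK]
  have := OK.zero_mem; have := OK.one_mem
  fin_cases i <;> fin_cases j <;> simp [sM] <;> assumption

theorem inSU_jM {a b c d : ℤ} (h : a * d - b * c = 1) : inSU 11 (jM a b c d) := by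
  have h' : (a * d - b * c : ℝ) = 1 := by exact_mod_cast h
  refine ⟨?_, det_jM h', inU_jM h'⟩
  intro i j
  rw [← mem_OK]
  have := intCast_mem_OK a; have := intCast_mem_OK b; have := intCast_mem_OK c
  have := intCast_mem_OK d
  have := OK.zero_mem; have := OK.one_mem
  fin_cases i <;> fin_cases j <;> simp [jM] <;> assumption

theorem inSU.inU {M : Matrix (Fin 4) (Fin 4) ℂ} (h : inSU 11 M) : inU M := h.2.2

theorem inSU.mul {M N : Matrix (Fin 4) (Fin 4) ℂ} (hM : inSU 11 M) (hN : inSU 11 N) :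
    inSU 11 (M * N) := by
  refine ⟨fun i j => ?_, ?_, inU_mul hM.2.2 hN.2.2⟩
  · rw [← mem_OK, Matrix.mul_apply]
    exact OK.sum_mem fun k _ => OK.mul_mem (hM.1 i k) (hN.1 k j)
  · rw [Matrix.det_mul, hM.2.1, hN.2.1, one_mul]

theorem inSU_one : inSU 11 1 := by
  refine ⟨fun i j => ?_, Matrix.det_one, inU_one⟩
  rw [← mem_OK, Matrix.one_apply]
  split_ifs
  · exact OK.one_mem
  · exact OK.zero_mem

/-- Generators of the modular group. -/
inductive GenM : Matrix (Fin 4) (Fin 4) ℂ → Prop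
  | t (p : ℤ) (x : ℂ) (hx : x ∈ OK) (q : ℤ) : GenM (tM p x q)
  | l (s : ℂ) (hs : s ∈ OK) : GenM (lM 1 0 s 1)
  | s : GenM sM
  | j : GenM (jM 0 (-1) 1 0)
  | j' : GenM (jM 0 1 (-1) 0)

theorem GenM.inSU {M : Matrix (Fin 4) (Fin 4) ℂ} (h : GenM M) : inSU 11 M := by
  cases h with
  | t p x hx q => exact inSU_tM p hx q
  | l s hs => exact inSU_lM (by ring) OK.one_mem OK.zero_mem hs OK.one_mem
  | s => exact inSU_sM
  | j => exact_mod_cast inSU_jM (a := 0) (b := -1) (c := 1) (d := 0) (by norm_num)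
  | j' => exact_mod_cast inSU_jM (a := 0) (b := 1) (c := -1) (d := 0) (by norm_num)

theorem GenM.inv {M : Matrix (Fin 4) (Fin 4) ℂ} (h : GenM M) : ∃ N, GenM N ∧ M * N = 1 := by
  cases h with
  | t p x hx q =>
    refine ⟨_, GenM.t (-p) (-x) (OK.neg_mem hx) (-q), ?_⟩
    ext i j; fin_cases i <;> fin_cases j <;>
    simp [tM, Matrix.mul_apply, Fin.sum_univ_four]
  | l s hs =>
    refine ⟨_, GenM.l (-s) (OK.neg_mem hs), ?_⟩
    ext i j; fin_cases i <;> fin_cases j <;>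
    simp [lM, Matrix.mul_apply, Fin.sum_univ_four]
  | s =>
    refine ⟨_, GenM.s, ?_⟩
    ext i j; fin_cases i <;> fin_cases j <;>
    simp [sM, Matrix.mul_apply, Fin.sum_univ_four]
  | j =>
    refine ⟨_, GenM.j', ?_⟩
    ext i j; fin_cases i <;> fin_cases j <;>
    simp [jM, Matrix.mul_apply, Fin.sum_univ_four]
  | j' =>
    refine ⟨_, GenM.j, ?_⟩
    ext i j; fin_cases i <;> fin_cases j <;>
    simp [jM, Matrix.mul_apply, Fin.sum_univ_four]

/-- The monoid generated by the generators. -/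
def Gam : Submonoid (Matrix (Fin 4) (Fin 4) ℂ) := Submonoid.closure {M | GenM M}

theorem GenM.mem {M : Matrix (Fin 4) (Fin 4) ℂ} (h : GenM M) : M ∈ Gam :=
  Submonoid.subset_closure h

theorem Gam_inSU {M : Matrix (Fin 4) (Fin 4) ℂ} (h : M ∈ Gam) : inSU 11 M := by
  induction h using Submonoid.closure_induction with
  | mem x hx => exact GenM.inSU hx
  | one => exact inSU_one
  | mul x y _ _ hx hy => exact hx.mul hy

theorem Gam_inv {M : Matrix (Fin 4) (Fin 4) ℂ} (h : M ∈ Gam) : ∃ N ∈ Gam, M * N = 1 ∧ N * M = 1 := by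
  have : ∃ N ∈ Gam, M * N = 1 := by
    induction h using Submonoid.closure_induction with
    | mem x hx =>
      obtain ⟨N, hN, h1⟩ := GenM.inv hx
      exact ⟨N, hN.mem, h1⟩
    | one => exact ⟨1, Gam.one_mem, by simp⟩
    | mul x y _ _ hx hy =>
      obtain ⟨N, hN, h1⟩ := hx
      obtain ⟨N', hN', h1'⟩ := hy
      refine ⟨N' * N, Gam.mul_mem hN' hN, ?_⟩
      rw [Matrix.mul_assoc, ← Matrix.mul_assoc y, h1', Matrix.one_mul, h1]
  obtain ⟨N, hN, h1⟩ := this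
  exact ⟨N, hN, h1, mul_eq_one_comm.1 h1⟩

end Group

section Generation

theorem Jmat_mul_self : Jmat * Jmat = -1 := by
  ext i j; fin_cases i <;> fin_cases j <;> simp [Jmat, Matrix.mul_apply, Fin.sum_univ_four]

theorem inU.mul_conj {M : Matrix (Fin 4) (Fin 4) ℂ} (h : inU M) : M * Jmat * Mᴴ = Jmat := by
  have h1 := inU_conj h
  have h2 : (-(Jmat * Mᴴ * Jmat)) * M = 1 := by
    rw [Matrix.neg_mul, Matrix.mul_assoc, Matrix.mul_assoc, ← Matrix.mul_assoc Mᴴ, h1,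
      Jmat_mul_self, neg_neg]
  have h3 := mul_eq_one_comm.1 h2
  have h4 : M * Jmat * Mᴴ * Jmat = -1 := by
    rw [Matrix.mul_neg, neg_eq_iff_eq_neg] at h3
    rw [← h3]; simp only [Matrix.mul_assoc]
  calc M * Jmat * Mᴴ = -(M * Jmat * Mᴴ * (Jmat * Jmat)) := by
        rw [Jmat_mul_self, Matrix.mul_neg, Matrix.mul_one, neg_neg]
    _ = Jmat := by rw [← Matrix.mul_assoc, h4, Matrix.neg_mul, Matrix.one_mul, neg_neg]

/-- The skew-hermitian pairing of row vectors. -/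
def pr (r r' : Fin 4 → ℂ) : ℂ :=
  r 2 * star (r' 0) + r 3 * star (r' 1) - r 0 * star (r' 2) - r 1 * star (r' 3)

theorem pr_eq (r r' : Fin 4 → ℂ) : pr r r' = (r ᵥ* Jmat) ⬝ᵥ star r' := by
  simp [pr, Jmat, Matrix.vecMul, dotProduct, Fin.sum_univ_four]; ring

theorem pr_vecMul {M : Matrix (Fin 4) (Fin 4) ℂ} (h : inU M) (r r' : Fin 4 → ℂ) :
    pr (r ᵥ* M) (r' ᵥ* M) = pr r r' := by
  rw [pr_eq, pr_eq, Matrix.star_vecMul, Matrix.dotProduct_mulVec, Matrix.vecMul_vecMul,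
    Matrix.vecMul_vecMul, ← Matrix.mul_assoc, h.mul_conj]

theorem pr_row {M : Matrix (Fin 4) (Fin 4) ℂ} (h : inU M) (i j : Fin 4) :
    pr (M i) (M j) = Jmat i j := by
  have := pr_vecMul h (Pi.single i 1) (Pi.single j 1)
  rw [Matrix.single_one_vecMul, Matrix.single_one_vecMul] at this
  change pr (M i) (M j) = _ at this
  rw [this, pr]
  fin_cases i <;> fin_cases j <;> simp [Jmat]

theorem vecMul_tM (p : ℝ) (x : ℂ) (q : ℝ) (a b c d : ℂ) : ![a, b, c, d] ᵥ* tM p x q =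
    ![a, b, c + a * p + b * star x, d + a * x + b * q] := by
  ext i; fin_cases i <;> simp [tM, Matrix.vecMul, dotProduct, Fin.sum_univ_four] <;> ring

theorem vecMul_lM (s a b c d : ℂ) : ![a, b, c, d] ᵥ* lM 1 0 s 1 =
    ![a + b * s, b, c, d - c * star s] := by
  ext i; fin_cases i <;> simp [lM, Matrix.vecMul, dotProduct, Fin.sum_univ_four]; ring

theorem vecMul_sM (a b c d : ℂ) : ![a, b, c, d] ᵥ* sM = ![b, a, d, c] := by
  ext i; fin_cases i <;> simp [sM, Matrix.vecMul, dotProduct, Fin.sum_univ_four]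

theorem vecMul_jM (a b c d : ℂ) : ![a, b, c, d] ᵥ* jM 0 (-1) 1 0 = ![c, b, -a, d] := by
  ext i; fin_cases i <;> simp [jM, Matrix.vecMul, dotProduct, Fin.sum_univ_four]

theorem exists_near_mul {a b : ℂ} (hb : b ≠ 0) :
    ∃ s ∈ OK, Complex.normSq (a + b * s) < Complex.normSq b := by
  obtain ⟨q, hq, h⟩ := exists_near (a / b)
  refine ⟨-q, OK.neg_mem hq, ?_⟩
  have h1 : a + b * -q = b * (a / b - q) := by field_simp; ring
  rw [h1, Complex.normSq_mul]
  have := Complex.normSq_pos.2 hb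
  nlinarith

theorem reduce_second (n : ℕ) : ∀ a b c d : ℂ, a ∈ OK → b ∈ OK → Complex.normSq b = n →
    ∃ M ∈ Gam, ∃ a' c' d', ![a, b, c, d] ᵥ* M = ![a', 0, c', d'] := by
  induction n using Nat.strong_induction_on with
  | _ n ih =>
    intro a b c d ha hb hn
    rcases eq_or_ne b 0 with rfl | h0
    · exact ⟨1, Gam.one_mem, a, c, d, by simp⟩
    obtain ⟨s, hs, hlt⟩ := exists_near_mul (a := a) h0
    have hm : a + b * s ∈ OK := OK.add_mem ha (OK.mul_mem hb hs)
    obtain ⟨m, hm'⟩ := exists_normSq_eq hm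
    obtain ⟨M, hM, a', c', d', h⟩ := ih m (by rw [hn, hm'] at hlt; exact_mod_cast hlt)
      b (a + b * s) (d - c * star s) c hb hm hm'
    refine ⟨lM 1 0 s 1 * sM * M, Gam.mul_mem (Gam.mul_mem (GenM.l s hs).mem GenM.s.mem) hM,
      a', c', d', ?_⟩
    rw [← Matrix.vecMul_vecMul, ← Matrix.vecMul_vecMul, vecMul_lM, vecMul_sM, h]

theorem exists_real_mul {a c : ℂ} (ha : a ≠ 0) (h : c * star a = a * star c) :
    ∃ r : ℝ, c = r * a := by
  have h2 : star a ≠ 0 := by simpa using ha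
  refine ⟨(c / a).re, ?_⟩
  have : (starRingEnd ℂ) (c / a) = c / a := by
    rw [map_div₀]
    simp only [Complex.star_def] at h h2
    field_simp; linear_combination -h
  rw [Complex.conj_eq_iff_re.1 this]; field_simp

theorem reduce_isotropic_pair (n : ℕ) : ∀ a c : ℂ, a ∈ OK → c ∈ OK → c * star a = a * star c →
    Complex.normSq a = n → ∃ M ∈ Gam, ∃ g ∈ OK, ![a, 0, c, 0] ᵥ* M = ![0, 0, g, 0] ∧
      ![0, 0, 0, 1] ᵥ* M = ![0, 0, 0, 1] := by
  induction n using Nat.strong_induction_on with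
  | _ n ih =>
    intro a c ha hc hiso hn
    rcases eq_or_ne a 0 with rfl | h0
    · exact ⟨1, Gam.one_mem, c, hc, by simp, by simp⟩
    obtain ⟨r, hr⟩ := exists_real_mul h0 hiso
    set k := round r
    have hk : c + a * ((-k : ℤ) : ℝ) = (r - k : ℝ) * a := by rw [hr]; push_cast; ring
    have hm : c + a * ((-k : ℤ) : ℝ) ∈ OK := by
      refine OK.add_mem hc (OK.mul_mem ha ?_)
      exact_mod_cast intCast_mem_OK (-k)
    obtain ⟨m, hm'⟩ := exists_normSq_eq hm
    have hlt : m < n := by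
      have h1 := abs_le.1 (abs_sub_round r)
      have h2 : Complex.normSq (c + a * ((-k : ℤ) : ℝ)) < Complex.normSq a := by
        rw [hk, Complex.normSq_mul, Complex.normSq_ofReal]
        have := Complex.normSq_pos.2 h0
        have : (r - k) * (r - k) ≤ 1 / 4 := by nlinarith
        nlinarith
      rw [hm', hn] at h2; exact_mod_cast h2
    obtain ⟨M, hM, g, hg, h, h'⟩ := ih m hlt (c + a * ((-k : ℤ) : ℝ)) (-a) hm (OK.neg_mem ha) (by
      rw [hk]; simp; ring) hm'
    refine ⟨tM (-k : ℤ) 0 (0 : ℤ) * jM 0 (-1) 1 0 * M, Gam.mul_mem (Gam.mul_mem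
      (GenM.t (-k) 0 OK.zero_mem 0).mem GenM.j.mem) hM, g, hg, ?_, ?_⟩
    · rw [← Matrix.vecMul_vecMul, ← Matrix.vecMul_vecMul, vecMul_tM, vecMul_jM, ← h]
      simp
    · rw [← Matrix.vecMul_vecMul, ← Matrix.vecMul_vecMul, vecMul_tM, vecMul_jM]
      simpa using h'

theorem reduce_third (n : ℕ) : ∀ c d : ℂ, c ∈ OK → d ∈ OK → Complex.normSq c = n →
    ∃ M ∈ Gam, ∃ g, ![0, 0, c, d] ᵥ* M = ![0, 0, 0, g] := by
  induction n using Nat.strong_induction_on with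
  | _ n ih =>
    intro c d hc hd hn
    rcases eq_or_ne c 0 with rfl | h0
    · exact ⟨1, Gam.one_mem, d, by simp⟩
    obtain ⟨s, hs, hlt⟩ := exists_near_mul (a := d) h0
    have hm : d + c * s ∈ OK := OK.add_mem hd (OK.mul_mem hc hs)
    obtain ⟨m, hm'⟩ := exists_normSq_eq hm
    obtain ⟨M, hM, g, h⟩ := ih m (by rw [hn, hm'] at hlt; exact_mod_cast hlt)
      (d + c * s) c hm hc hm'
    have hs' : star (-s) ∈ OK := conj_mem_OK (OK.neg_mem hs)
    refine ⟨lM 1 0 (star (-s)) 1 * sM * M, Gam.mul_mem (Gam.mul_mem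
      (GenM.l _ hs').mem GenM.s.mem) hM, g, ?_⟩
    rw [← Matrix.vecMul_vecMul, ← Matrix.vecMul_vecMul, vecMul_lM, vecMul_sM, ← h]
    congr 2; simp

theorem vec4_eta (r : Fin 4 → ℂ) : r = ![r 0, r 1, r 2, r 3] := by
  ext i; fin_cases i <;> rfl

theorem vecMul_mem_OK {M : Matrix (Fin 4) (Fin 4) ℂ} (h : inSU 11 M) {r : Fin 4 → ℂ}
    (hr : ∀ i, r i ∈ OK) (i : Fin 4) : (r ᵥ* M) i ∈ OK := by
  rw [Matrix.vecMul, dotProduct]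
  exact OK.sum_mem fun k _ => OK.mul_mem (hr k) (h.1 k i)

/-- Isotropic integral vectors are equivalent to multiples of the last basis vector. -/
theorem cusp_transitive {r : Fin 4 → ℂ} (hr : ∀ i, r i ∈ OK) (hiso : pr r r = 0) :
    ∃ M ∈ Gam, ∃ g, r ᵥ* M = ![0, 0, 0, g] := by
  obtain ⟨n, hn⟩ := exists_normSq_eq (hr 1)
  obtain ⟨M, hM, a, c, d, h⟩ := reduce_second n (r 0) (r 1) (r 2) (r 3) (hr 0) (hr 1) hn
  rw [← vec4_eta] at h
  have hMs := Gam_inSU hM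
  have hO := vecMul_mem_OK hMs hr
  rw [h] at hO
  have ha : a ∈ OK := hO 0
  have hc : c ∈ OK := hO 2
  have hd : d ∈ OK := hO 3
  have hp := pr_vecMul hMs.inU r r
  rw [h, hiso] at hp
  obtain ⟨m, hm⟩ := exists_normSq_eq ha
  obtain ⟨N, hN, g, hg, h1, h2⟩ := reduce_isotropic_pair m a c ha hc (by
    simp [pr] at hp; simp; linear_combination hp) hm
  have h3 : ![a, 0, c, d] ᵥ* N = ![0, 0, g, d] := by
    have : ![a, 0, c, d] = ![a, 0, c, 0] + d • ![0, 0, 0, 1] := by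
      ext i; fin_cases i <;> simp
    rw [this, Matrix.add_vecMul, Matrix.smul_vecMul, h1, h2]
    ext i; fin_cases i <;> simp
  obtain ⟨k, hk⟩ := exists_normSq_eq hg
  obtain ⟨P, hP, g', h4⟩ := reduce_third k g d hg hd hk
  exact ⟨M * N * P, Gam.mul_mem (Gam.mul_mem hM hN) hP, g', by
    rw [← Matrix.vecMul_vecMul, ← Matrix.vecMul_vecMul, h, h3, h4]⟩

theorem mem_Gam_of_mul {M N : Matrix (Fin 4) (Fin 4) ℂ} (hN : N ∈ Gam) (h : M * N ∈ Gam) :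
    M ∈ Gam := by
  obtain ⟨P, hP, h1, -⟩ := Gam_inv hN
  have := Gam.mul_mem h hP
  rwa [Matrix.mul_assoc, h1, Matrix.mul_one] at this

theorem row_mul (M N : Matrix (Fin 4) (Fin 4) ℂ) (i : Fin 4) : (M * N) i = M i ᵥ* N := by
  rw [← Matrix.mul_apply_eq_vecMul]

theorem mem_Gam_of_rows {M : Matrix (Fin 4) (Fin 4) ℂ} (hM : inSU 11 M)
    (h3 : M 3 = ![0, 0, 0, 1]) (h2 : M 2 = ![0, 0, 1, 0]) : M ∈ Gam := by
  have hp := pr_row hM.inU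
  have c0 : ∀ j, star (M j 0) = Jmat 2 j := by
    intro j; rw [← hp 2 j, h2]; simp [pr]
  have c1 : ∀ j, star (M j 1) = Jmat 3 j := by
    intro j; rw [← hp 3 j, h3]; simp [pr]
  have e00 := c0 0; have e10 := c0 1; have e01 := c1 0; have e11 := c1 1
  simp [Jmat] at e00 e10 e01 e11
  replace e00 : M 0 0 = 1 := by simpa using congrArg (starRingEnd ℂ) e00
  replace e11 : M 1 1 = 1 := by simpa using congrArg (starRingEnd ℂ) e11
  have f0 := hp 0 0; have f1 := hp 1 1; have f2 := hp 0 1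
  simp [pr, Jmat, e00, e10, e01, e11] at f0 f1 f2
  have i0 : (M 0 2).im = 0 := by
    have := congrArg Complex.im f0; simp at this; linarith
  have i1 : (M 1 3).im = 0 := by
    have := congrArg Complex.im f1; simp at this; linarith
  obtain ⟨p, hpp⟩ := exists_int_of_real (hM.1 0 2) i0
  obtain ⟨q, hq⟩ := exists_int_of_real (hM.1 1 3) i1
  have h4 : M = tM p (M 0 3) q := by
    have e12 : M 1 2 = star (M 0 3) := by
      have := congrArg star f2; simp at this
      simp; linear_combination -this
    ext i j; fin_cases i <;> fin_cases j <;>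
      simp [tM, h2, h3, e00, e10, e01, e11, hpp, hq, e12]
  rw [h4]
  exact (GenM.t p _ (hM.1 0 3) q).mem

theorem mem_Gam_of_row3 {M : Matrix (Fin 4) (Fin 4) ℂ} (hM : inSU 11 M)
    (h3 : M 3 = ![0, 0, 0, 1]) (h2 : M 2 0 = 0) (h22 : M 2 2 = 1) : M ∈ Gam := by
  have hp := pr_row hM.inU
  have c1 : star (M 2 1) = Jmat 3 2 := by
    rw [← hp 3 2, h3]; simp [pr]
  simp [Jmat] at c1
  have hx : star (M 2 3) ∈ OK := conj_mem_OK (hM.1 2 3)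
  have hG := (GenM.l _ hx).mem
  refine mem_Gam_of_mul hG (mem_Gam_of_rows (hM.mul (Gam_inSU hG)) ?_ ?_)
  · rw [row_mul, h3, vecMul_lM]; simp
  · rw [row_mul, vec4_eta (M 2), vecMul_lM, h2, c1, h22]; simp

theorem vecMul_jM_sq (a b c d : ℂ) :
    ![a, b, c, d] ᵥ* (jM 0 (-1) 1 0 * jM 0 (-1) 1 0) = ![-a, b, -c, d] := by
  rw [← Matrix.vecMul_vecMul, vecMul_jM, vecMul_jM]

theorem mem_Gam_of_row3' {M : Matrix (Fin 4) (Fin 4) ℂ} (hM : inSU 11 M)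
    (h3 : M 3 = ![0, 0, 0, 1]) : M ∈ Gam := by
  have hp := pr_row hM.inU
  have c1 : star (M 2 1) = Jmat 3 2 := by
    rw [← hp 3 2, h3]; simp [pr]
  simp [Jmat] at c1
  have hiso := hp 2 2
  obtain ⟨n, hn⟩ := exists_normSq_eq (hM.1 2 0)
  obtain ⟨N, hN, g, hg, h1, h2⟩ := reduce_isotropic_pair n (M 2 0) (M 2 2) (hM.1 2 0) (hM.1 2 2)
    (by simp [pr, Jmat, c1] at hiso; simp; linear_combination hiso) hn
  refine mem_Gam_of_mul hN ?_
  have hMN := hM.mul (Gam_inSU hN)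
  have r3 : (M * N) 3 = ![0, 0, 0, 1] := by rw [row_mul, h3, h2]
  have r2 : (M * N) 2 = ![0, 0, g, M 2 3] := by
    have : M 2 = ![M 2 0, 0, M 2 2, 0] + M 2 3 • ![0, 0, 0, 1] := by
      ext i; fin_cases i <;> simp [c1]
    rw [row_mul, this, Matrix.add_vecMul, Matrix.smul_vecMul, h1, h2]
    ext i; fin_cases i <;> simp
  generalize M * N = M' at *
  have hp := pr_row hMN.inU
  have c1 : star (M' 0 1) = Jmat 3 0 := by
    rw [← hp 3 0, r3]; simp [pr]
  have c2 := hp 2 0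
  simp [Jmat] at c1
  rw [r2] at c2
  simp [pr, c1, Jmat] at c2
  rcases eq_one_or_neg_one hg (conj_mem_OK (hMN.1 0 0)) c2 with rfl | rfl
  · exact mem_Gam_of_row3 hMN r3 (by rw [r2]; simp) (by rw [r2]; simp)
  · have hG := Gam.mul_mem GenM.j.mem GenM.j.mem
    refine mem_Gam_of_mul hG (mem_Gam_of_row3 (hMN.mul (Gam_inSU hG)) ?_ ?_ ?_)
    · rw [row_mul, r3, vecMul_jM_sq]; simp
    · rw [row_mul, r2, vecMul_jM_sq]; simp
    · rw [row_mul, r2, vecMul_jM_sq]; simp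

theorem mem_Gam {M : Matrix (Fin 4) (Fin 4) ℂ} (hM : inSU 11 M) : M ∈ Gam := by
  obtain ⟨N, hN, g, h⟩ := cusp_transitive (r := M 3) (fun i => hM.1 3 i) (by
    rw [pr_row hM.inU]; simp [Jmat])
  refine mem_Gam_of_mul hN ?_
  have hMN := hM.mul (Gam_inSU hN)
  rw [← row_mul] at h
  generalize M * N = M' at *
  have hp := pr_row hMN.inU
  have c := hp 3 1
  rw [h] at c
  simp [pr, Jmat] at c
  have hg : g ∈ OK := by have := hMN.1 3 3; rw [h] at this; exact this
  rcases eq_one_or_neg_one hg (conj_mem_OK (hMN.1 1 1)) c with rfl | rfl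
  · exact mem_Gam_of_row3' hMN h
  · have hG := Gam.mul_mem (Gam.mul_mem GenM.s.mem (Gam.mul_mem GenM.j.mem GenM.j.mem)) GenM.s.mem
    refine mem_Gam_of_mul hG (mem_Gam_of_row3' (hMN.mul (Gam_inSU hG)) ?_)
    rw [row_mul, h, ← Matrix.vecMul_vecMul, ← Matrix.vecMul_vecMul, vecMul_sM, vecMul_jM_sq,
      vecMul_sM]
    simp

end Generation

section Theta

open Complex Real in
/-- The odd Jacobi theta function. -/
def th (τ u : ℂ) : ℂ := cexp (π * I * τ / 4 + π * I * u) * jacobiTheta₂ (u + τ / 2 + 1 / 2) τ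

open Complex Real in
/-- The derivative of the odd Jacobi theta function at the origin. -/
def thp (τ : ℂ) : ℂ := cexp (π * I * τ / 4) * (π * I * jacobiTheta₂ (τ / 2 + 1 / 2) τ +
  jacobiTheta₂' (τ / 2 + 1 / 2) τ)

open Complex Real

theorem differentiableAt_th {τ u : ℂ} (hτ : 0 < τ.im) :
    DifferentiableAt ℂ (fun p : ℂ × ℂ => th p.1 p.2) (τ, u) := by
  unfold th
  have h1 : DifferentiableAt ℂ (fun p : ℂ × ℂ => jacobiTheta₂ p.1 p.2) (u + τ / 2 + 1 / 2, τ) :=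
    (hasFDerivAt_jacobiTheta₂ _ hτ).differentiableAt
  have h2 : DifferentiableAt ℂ (fun p : ℂ × ℂ => (p.2 + p.1 / 2 + 1 / 2, p.1)) (τ, u) := by
    fun_prop
  have h3 := DifferentiableAt.comp (τ, u) (g := fun p : ℂ × ℂ => jacobiTheta₂ p.1 p.2) h1 h2
  refine DifferentiableAt.mul ?_ h3
  fun_prop

theorem hasDerivAt_th_zero {τ : ℂ} (hτ : 0 < τ.im) : HasDerivAt (th τ) (thp τ) 0 := by
  unfold th thp
  have h0 := hasDerivAt_jacobiTheta₂_fst (0 + τ / 2 + 1 / 2) hτ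
  have h1 : HasDerivAt (fun u : ℂ => jacobiTheta₂ (u + τ / 2 + 1 / 2) τ)
      (jacobiTheta₂' (0 + τ / 2 + 1 / 2) τ) 0 := by
    have := (h0.comp_add_const (0 + τ / 2 : ℂ) (1 / 2)).comp_add_const 0 (τ / 2)
    simpa using this
  have h2 : HasDerivAt (fun u : ℂ => cexp (π * I * τ / 4 + π * I * u))
      (cexp (π * I * τ / 4 + π * I * 0) * (π * I)) 0 := by
    apply HasDerivAt.cexp
    simpa using ((hasDerivAt_id (0 : ℂ)).const_mul (π * I : ℂ)).const_add (π * I * τ / 4)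
  refine (h2.mul h1).congr_deriv ?_
  simp; ring

theorem th_add_one_right (τ u : ℂ) : th τ (u + 1) = -th τ u := by
  unfold th
  rw [show u + 1 + τ / 2 + 1 / 2 = u + τ / 2 + 1 / 2 + 1 by ring, jacobiTheta₂_add_left,
    show (π * I * τ / 4 + π * I * (u + 1) : ℂ) = π * I * τ / 4 + π * I * u + π * I by ring,
    Complex.exp_add _ (π * I : ℂ), Complex.exp_pi_mul_I]
  ring

theorem th_neg (τ u : ℂ) : th τ (-u) = -th τ u := by
  unfold th
  have h1 := jacobiTheta₂_neg_left (u + τ / 2 + 1 / 2 - 1 - τ) τ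
  rw [show -(u + τ / 2 + 1 / 2 - 1 - τ) = -u + τ / 2 + 1 / 2 by ring] at h1
  have h2 := jacobiTheta₂_add_left' (u + τ / 2 + 1 / 2 - 1 - τ) τ
  have h3 := jacobiTheta₂_add_left (u + τ / 2 + 1 / 2 - 1) τ
  rw [sub_add_cancel] at h2 h3
  rw [h1, h3, h2, ← mul_assoc, ← Complex.exp_add, neg_mul_eq_neg_mul]
  congr 1
  rw [show (π * I * τ / 4 + π * I * u + -π * I * (τ + 2 * (u + τ / 2 + 1 / 2 - 1 - τ)) : ℂ)
    = π * I * τ / 4 + π * I * -u + π * I by ring, Complex.exp_add _ (π * I : ℂ),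
    Complex.exp_pi_mul_I]
  ring

theorem th_add_tau (τ u : ℂ) : th τ (u + τ) = -(cexp (-(π * I * (τ + 2 * u))) * th τ u) := by
  unfold th
  rw [show u + τ + τ / 2 + 1 / 2 = u + τ / 2 + 1 / 2 + τ by ring, jacobiTheta₂_add_left',
    ← mul_assoc, ← mul_assoc, ← Complex.exp_add, ← Complex.exp_add, neg_mul_eq_neg_mul]
  congr 1
  rw [show (π * I * τ / 4 + π * I * (u + τ) + -π * I * (τ + 2 * (u + τ / 2 + 1 / 2)) : ℂ) =
    -(π * I * (τ + 2 * u)) + (π * I * τ / 4 + π * I * u) - π * I by ring, Complex.exp_sub,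
    Complex.exp_pi_mul_I]
  ring

theorem th_zero (τ : ℂ) : th τ 0 = 0 := by
  have := th_neg τ 0
  rw [neg_zero] at this
  linear_combination this / 2

theorem th_S {τ : ℂ} (hτ : 0 < τ.im) (u : ℂ) : th (-1 / τ) (u / τ) =
    -I * (-I * τ) ^ (1 / 2 : ℂ) * cexp (π * I * u ^ 2 / τ) * th τ u := by
  have h0 : τ ≠ 0 := by rintro rfl; simp at hτ
  have h1 := jacobiTheta₂_functional_equation (u - 1 / 2 + τ / 2) τ
  have hk : (-I * τ) ^ (1 / 2 : ℂ) ≠ 0 := by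
    rw [Complex.cpow_ne_zero_iff]; left; simp [h0]
  have h3 := jacobiTheta₂_add_left (u - 1 / 2 + τ / 2) τ
  rw [show u - 1 / 2 + τ / 2 + 1 = u + τ / 2 + 1 / 2 by ring, h1] at h3
  unfold th
  rw [h3, show u / τ + -1 / τ / 2 + 1 / 2 = (u - 1 / 2 + τ / 2) / τ by field_simp; ring]
  generalize jacobiTheta₂ ((u - 1 / 2 + τ / 2) / τ) (-1 / τ) = X
  have h4 : cexp (π * I * (-1 / τ) / 4 + π * I * (u / τ)) = -I * (cexp (π * I * u ^ 2 / τ) *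
      (cexp (π * I * τ / 4 + π * I * u) * cexp (-π * I * (u - 1 / 2 + τ / 2) ^ 2 / τ))) := by
    rw [← Complex.exp_neg_pi_div_two_mul_I, ← Complex.exp_add, ← Complex.exp_add, ← Complex.exp_add]
    congr 1
    field_simp; ring
  rw [h4]
  field_simp

theorem th_T (τ u : ℂ) : th (τ + 1) u = cexp (π * I / 4) * th τ u := by
  have h1 : jacobiTheta₂ (u + (τ + 1) / 2 + 1 / 2) (τ + 1) = jacobiTheta₂ (u + τ / 2 + 1 / 2) τ := by
    refine tsum_congr fun n => ?_
    simp only [jacobiTheta₂_term]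
    obtain ⟨k, hk⟩ := Int.even_mul_succ_self n
    have hk' : (n : ℂ) * (n + 1) = k + k := by exact_mod_cast hk
    rw [show (2 * π * I * n * (u + (τ + 1) / 2 + 1 / 2) + π * I * n ^ 2 * (τ + 1) : ℂ) =
      2 * π * I * n * (u + τ / 2 + 1 / 2) + π * I * n ^ 2 * τ + k * (2 * π * I) by
        linear_combination (π * I : ℂ) * hk', Complex.exp_add, Complex.exp_int_mul_two_pi_mul_I,
      mul_one]
  unfold th
  rw [h1, ← mul_assoc, ← Complex.exp_add]
  congr 2; ring

theorem thp_S {τ : ℂ} (hτ : 0 < τ.im) : thp (-1 / τ) =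
    -I * (-I * τ) ^ (1 / 2 : ℂ) * τ * thp τ := by
  have h0 : τ ≠ 0 := by rintro rfl; simp at hτ
  have hτ' : 0 < (-1 / τ).im := by
    rw [neg_div, one_div, Complex.neg_im, Complex.inv_im, neg_div, neg_neg]
    exact div_pos hτ (Complex.normSq_pos.2 h0)
  have h1 : HasDerivAt (fun u : ℂ => th (-1 / τ) (u / τ)) (thp (-1 / τ) * (1 / τ)) 0 := by
    have h2 : HasDerivAt (fun u : ℂ => u / τ) (1 / τ) 0 := (hasDerivAt_id (0 : ℂ)).div_const τ
    have h3 := hasDerivAt_th_zero hτ'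
    exact HasDerivAt.comp (0 : ℂ) (h₂ := th (-1 / τ)) (by simpa using h3) h2
  have h4 : HasDerivAt (fun u : ℂ => th (-1 / τ) (u / τ))
      (-I * (-I * τ) ^ (1 / 2 : ℂ) * thp τ) 0 := by
    rw [show (fun u : ℂ => th (-1 / τ) (u / τ)) = fun u => -I * (-I * τ) ^ (1 / 2 : ℂ) *
      cexp (π * I * u ^ 2 / τ) * th τ u from funext fun u => th_S hτ u]
    have h5 : HasDerivAt (fun u : ℂ => -I * (-I * τ) ^ (1 / 2 : ℂ) * cexp (π * I * u ^ 2 / τ))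
        (-I * (-I * τ) ^ (1 / 2 : ℂ) * (cexp (π * I * 0 ^ 2 / τ) * 0)) 0 := by
      apply HasDerivAt.const_mul
      apply HasDerivAt.cexp
      simpa using (((hasDerivAt_id (0 : ℂ)).pow 2).const_mul (π * I : ℂ)).div_const τ
    refine (h5.mul (hasDerivAt_th_zero hτ)).congr_deriv ?_
    simp
  have h6 := h1.unique h4
  generalize thp (-1 / τ) = X at *
  rw [mul_one_div, div_eq_iff h0] at h6
  rw [h6]; ring

theorem thp_T {τ : ℂ} (hτ : 0 < τ.im) : thp (τ + 1) = cexp (π * I / 4) * thp τ := by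
  have h1 := hasDerivAt_th_zero (τ := τ + 1) (by simpa using hτ)
  have h2 := (hasDerivAt_th_zero hτ).const_mul (cexp (π * I / 4))
  rw [← show th (τ + 1) = fun u => cexp (π * I / 4) * th τ u from funext fun u => th_T τ u] at h2
  exact h1.unique h2

theorem th_term (τ u : ℂ) (n : ℤ) : cexp (π * I * τ / 4 + π * I * u) *
    jacobiTheta₂_term n (u + τ / 2 + 1 / 2) τ =
    cexp (π * I * τ * (n + 1 / 2) ^ 2 + 2 * π * I * (n + 1 / 2) * u) * cexp (n * (π * I)) := by
  rw [jacobiTheta₂_term, ← Complex.exp_add, ← Complex.exp_add]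
  congr 1; ring

theorem exp_int_mul_pi (n : ℤ) : cexp (n * (π * I)) = (-1) ^ n := by
  rw [Complex.exp_int_mul, Complex.exp_pi_mul_I]

theorem hasSum_th {τ : ℂ} (hτ : 0 < τ.im) (u : ℂ) :
    HasSum (fun n : ℕ => 2 * I * ((-1) ^ n * (cexp (π * I * τ * (n + 1 / 2) ^ 2) *
      Complex.sin (((2 * n + 1 : ℕ) : ℂ) * (π * u))))) (th τ u) := by
  have h := ((hasSum_jacobiTheta₂_term (u + τ / 2 + 1 / 2) hτ).mul_left
    (cexp (π * I * τ / 4 + π * I * u))).nat_add_neg_add_one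
  refine h.congr_fun ?_ |> id
  intro n
  rw [th_term, th_term, exp_int_mul_pi, exp_int_mul_pi, Complex.sin]
  have h1 : ((-1 : ℂ)) ^ (-((n : ℤ) + 1)) = -(-1) ^ n := by
    rw [_root_.zpow_neg, show ((n : ℤ) + 1) = ((n + 1 : ℕ) : ℤ) by simp, zpow_natCast, pow_succ]
    rcases neg_one_pow_eq_or ℂ n with h | h <;> rw [h] <;> norm_num
  rw [h1, zpow_natCast]
  push_cast
  rw [Complex.exp_add, Complex.exp_add]
  rw [show (π * I * τ * (-(n + 1) + 1 / 2) ^ 2 : ℂ) = π * I * τ * (n + 1 / 2) ^ 2 by ring,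
    show (2 * π * I * (-(n + 1) + 1 / 2) * u : ℂ) = -((2 * n + 1) * (π * u)) * I by ring,
    show (2 * π * I * (n + 1 / 2) * u : ℂ) = ((2 * n + 1) * (π * u)) * I by ring]
  linear_combination (-1) ^ n * cexp (π * I * τ * (n + 1 / 2) ^ 2) * (cexp (-((2 * n + 1) * (π * u)) * I) - cexp ((2 * n + 1) * (π * u) * I)) * I_sq

theorem hasSum_thp {τ : ℂ} (hτ : 0 < τ.im) :
    HasSum (fun n : ℕ => 2 * π * I * ((-1) ^ n * (cexp (π * I * τ * (n + 1 / 2) ^ 2) *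
      ((2 * n + 1 : ℕ) : ℂ)))) (thp τ) := by
  have h := ((((hasSum_jacobiTheta₂_term (τ / 2 + 1 / 2) hτ).mul_left (π * I : ℂ)).add
    (hasSum_jacobiTheta₂'_term (τ / 2 + 1 / 2) hτ)).mul_left
    (cexp (π * I * τ / 4))).nat_add_neg_add_one
  refine h.congr_fun ?_ |> id
  intro n
  have h2 : ∀ n : ℤ, cexp (π * I * τ / 4) * (π * I * jacobiTheta₂_term n (τ / 2 + 1 / 2) τ +
      jacobiTheta₂'_term n (τ / 2 + 1 / 2) τ) = π * I * (2 * n + 1) *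
      (cexp (π * I * τ * (n + 1 / 2) ^ 2) * (-1) ^ n) := by
    intro n
    have := th_term τ 0 n
    rw [mul_zero, add_zero, mul_zero, add_zero, zero_add, exp_int_mul_pi] at this
    rw [← this, jacobiTheta₂'_term]; ring
  rw [h2, h2]
  have h1 : ((-1 : ℂ)) ^ (-((n : ℤ) + 1)) = -(-1) ^ n := by
    rw [_root_.zpow_neg, show ((n : ℤ) + 1) = ((n + 1 : ℕ) : ℤ) by simp, zpow_natCast, pow_succ]
    rcases neg_one_pow_eq_or ℂ n with h | h <;> rw [h] <;> norm_num
  rw [h1, zpow_natCast]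
  push_cast
  rw [show (π * I * τ * (-(n + 1) + 1 / 2) ^ 2 : ℂ) = π * I * τ * (n + 1 / 2) ^ 2 by ring]
  ring

end Theta

section ThetaBounds

open Complex Real

theorem exp_geom_le {c : ℝ} (hc : 0 < c) : HasSum (fun n : ℕ => rexp (-(c * n))) (1 - rexp (-c))⁻¹ ∧
    (1 - rexp (-c))⁻¹ ≤ 1 + 1 / c := by
  have h1 : rexp (-c) < 1 := by rw [Real.exp_lt_one_iff]; linarith
  refine ⟨?_, ?_⟩
  · have := hasSum_geometric_of_lt_one (Real.exp_pos (-c)).le h1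
    refine this.congr_fun ?_ |> id
    intro n
    rw [← Real.exp_nat_mul]; congr 1; ring
  · have h2 := Real.add_one_le_exp c
    have h3 : rexp (-c) ≤ 1 / (c + 1) := by
      rw [Real.exp_neg, inv_eq_one_div]
      exact one_div_le_one_div_of_le (by linarith) h2
    have h4 : c / (c + 1) ≤ 1 - rexp (-c) := by
      have : c / (c + 1) = 1 - 1 / (c + 1) := by field_simp; ring
      linarith
    calc (1 - rexp (-c))⁻¹ ≤ (c / (c + 1))⁻¹ := inv_anti₀ (by positivity) h4
      _ = 1 + 1 / c := by field_simp

theorem gauss_le_aux {c x : ℝ} (hc : 0 < c) (hx0 : 0 ≤ x) (hx1 : x < 1) :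
    Summable (fun n : ℤ => rexp (-(c * (n + x) ^ 2))) ∧
    ∑' n : ℤ, rexp (-(c * (n + x) ^ 2)) ≤ 2 * (1 + 1 / c) := by
  obtain ⟨hg, hgle⟩ := exp_geom_le hc
  have h1 : ∀ n : ℕ, rexp (-(c * ((n : ℤ) + x) ^ 2)) ≤ rexp (-(c * n)) := by
    intro n
    apply Real.exp_le_exp.2
    have : (n : ℝ) ≤ n ^ 2 := by exact_mod_cast Nat.le_self_pow two_ne_zero n
    have h0 : (0 : ℝ) ≤ n := Nat.cast_nonneg n
    push_cast
    have h3 : (n : ℝ) ≤ (n + x) ^ 2 := this.trans (pow_le_pow_left₀ h0 (by linarith) 2)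
    linarith [mul_le_mul_of_nonneg_left h3 hc.le]
  have h2 : ∀ n : ℕ, rexp (-(c * (((-((n : ℤ) + 1) : ℤ) : ℝ) + x) ^ 2)) ≤ rexp (-(c * n)) := by
    intro n
    apply Real.exp_le_exp.2
    have : (n : ℝ) ≤ n ^ 2 := by exact_mod_cast Nat.le_self_pow two_ne_zero n
    have h0 : (0 : ℝ) ≤ n := Nat.cast_nonneg n
    push_cast
    have h3 : (n : ℝ) ≤ (n + (1 - x)) ^ 2 := this.trans (pow_le_pow_left₀ h0 (by linarith) 2)
    have h4 : (-((n : ℝ) + 1) + x) ^ 2 = (n + (1 - x)) ^ 2 := by ring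
    rw [h4]
    linarith [mul_le_mul_of_nonneg_left h3 hc.le]
  set f : ℤ → ℝ := fun n => rexp (-(c * (n + x) ^ 2)) with hf
  replace h1 : ∀ n : ℕ, f n ≤ rexp (-(c * n)) := h1
  replace h2 : ∀ n : ℕ, f (-((n : ℤ) + 1)) ≤ rexp (-(c * n)) := h2
  have h0 : ∀ n, 0 ≤ f n := fun _ => (Real.exp_pos _).le
  clear_value f
  have s1 : Summable fun n : ℕ => f n := Summable.of_nonneg_of_le (fun _ => h0 _) h1 hg.summable
  have s2 : Summable fun n : ℕ => f (-((n : ℤ) + 1)) :=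
    Summable.of_nonneg_of_le (fun _ => h0 _) h2 hg.summable
  refine ⟨Summable.of_nat_of_neg_add_one s1 s2, ?_⟩
  rw [tsum_of_nat_of_neg_add_one s1 s2, two_mul]
  have t1 := s1.tsum_le_tsum h1 hg.summable
  have t2 := s2.tsum_le_tsum h2 hg.summable
  rw [hg.tsum_eq] at t1 t2
  exact add_le_add (t1.trans hgle) (t2.trans hgle)

theorem gauss_le {c : ℝ} (hc : 0 < c) (x : ℝ) :
    Summable (fun n : ℤ => rexp (-(c * (n + x) ^ 2))) ∧
    ∑' n : ℤ, rexp (-(c * (n + x) ^ 2)) ≤ 2 * (1 + 1 / c) := by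
  have h := gauss_le_aux hc (Int.fract_nonneg x) (Int.fract_lt_one x)
  have h1 : (fun n : ℤ => rexp (-(c * (n + x) ^ 2))) =
      (fun n : ℤ => rexp (-(c * (n + Int.fract x) ^ 2))) ∘ Equiv.addRight ⌊x⌋ := by
    funext n
    simp only [Function.comp, Equiv.coe_addRight, Int.fract]
    push_cast; congr 3; ring
  rw [h1, (Equiv.addRight ⌊x⌋).summable_iff]
  refine ⟨h.1, ?_⟩
  have := (Equiv.addRight ⌊x⌋).tsum_eq (fun n : ℤ => rexp (-(c * (n + Int.fract x) ^ 2)))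
  exact this.le.trans h.2

theorem half_gauss_le {c : ℝ} (hc : 0 < c) (x : ℝ) :
    Summable (fun n : ℕ => rexp (-(c * (n + 1 / 2 - x) ^ 2))) ∧
    ∑' n : ℕ, rexp (-(c * (n + 1 / 2 - x) ^ 2)) ≤ 2 * (1 + 1 / c) := by
  obtain ⟨h1, h2⟩ := gauss_le hc (1 / 2 - x)
  have hi : Function.Injective (Nat.cast : ℕ → ℤ) := Nat.cast_injective
  have h3 := h1.comp_injective hi
  have h4 : (fun n : ℕ => rexp (-(c * (n + 1 / 2 - x) ^ 2))) =
      (fun n : ℤ => rexp (-(c * (n + (1 / 2 - x)) ^ 2))) ∘ (Nat.cast : ℕ → ℤ) := by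
    funext n; simp only [Function.comp, Int.cast_natCast]; congr 3; ring
  rw [h4]
  refine ⟨h3, le_trans ?_ h2⟩
  exact tsum_comp_le_tsum_of_inj h1 (fun _ => (Real.exp_pos _).le) hi

theorem weighted_gauss_le {c : ℝ} (hc : 0 < c) {x : ℝ} (hx : 0 ≤ x) :
    Summable (fun n : ℕ => (2 * n + 1 : ℝ) * rexp (-(c * (n + 1 / 2 - x) ^ 2))) ∧
    ∑' n : ℕ, (2 * n + 1 : ℝ) * rexp (-(c * (n + 1 / 2 - x) ^ 2)) ≤
      (2 + 4 / c + 2 * x) * (2 + 4 / c) := by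
  obtain ⟨h1, h2⟩ := half_gauss_le (half_pos hc) x
  have hb : ∀ n : ℕ, (2 * n + 1 : ℝ) * rexp (-(c * (n + 1 / 2 - x) ^ 2)) ≤
      (2 + 4 / c + 2 * x) * rexp (-(c / 2 * (n + 1 / 2 - x) ^ 2)) := by
    intro n
    set t : ℝ := n + 1 / 2 - x with ht
    have e1 : rexp (-(c * t ^ 2)) = rexp (-(c / 2 * t ^ 2)) * rexp (-(c / 2 * t ^ 2)) := by
      rw [← Real.exp_add]; congr 1; ring
    rw [e1, ← mul_assoc]
    refine mul_le_mul_of_nonneg_right ?_ (Real.exp_pos _).le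
    have e2 := Real.add_one_le_exp (c / 2 * t ^ 2)
    have e3 : t ^ 2 * rexp (-(c / 2 * t ^ 2)) ≤ 2 / c := by
      rw [Real.exp_neg, ← div_eq_mul_inv, div_le_div_iff₀ (Real.exp_pos _) hc]
      nlinarith
    have e4 : rexp (-(c / 2 * t ^ 2)) ≤ 1 := by
      rw [Real.exp_le_one_iff]; nlinarith [mul_nonneg hc.le (sq_nonneg t)]
    have e5 := Real.exp_pos (-(c / 2 * t ^ 2))
    have e6 : (2 * n + 1 : ℝ) ≤ 2 * (1 + t ^ 2) + 2 * x := by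
      have : (2 * n + 1 : ℝ) = 2 * t + 2 * x := by rw [ht]; ring
      nlinarith [sq_nonneg (t - 1)]
    calc (2 * n + 1 : ℝ) * rexp (-(c / 2 * t ^ 2))
        ≤ (2 * (1 + t ^ 2) + 2 * x) * rexp (-(c / 2 * t ^ 2)) :=
          mul_le_mul_of_nonneg_right e6 e5.le
      _ = 2 * (t ^ 2 * rexp (-(c / 2 * t ^ 2))) + (2 + 2 * x) * rexp (-(c / 2 * t ^ 2)) := by ring
      _ ≤ 2 * (2 / c) + (2 + 2 * x) * 1 := by gcongr
      _ = _ := by ring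
  have s := h1.mul_left (2 + 4 / c + 2 * x)
  have hs := Summable.of_nonneg_of_le (fun n => by positivity) hb s
  refine ⟨hs, (hs.tsum_le_tsum hb s).trans ?_⟩
  rw [tsum_mul_left]
  refine mul_le_mul_of_nonneg_left (h2.trans (le_of_eq ?_)) (by positivity)
  field_simp; ring

theorem norm_sin_le (w : ℂ) : ‖Complex.sin w‖ ≤ rexp |w.im| := by
  rw [Complex.sin, norm_div, norm_mul, Complex.norm_I, mul_one, Complex.norm_ofNat,
    div_le_iff₀ two_pos]
  have h1 := norm_sub_le (cexp (-w * I)) (cexp (w * I))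
  rw [Complex.norm_exp, Complex.norm_exp] at h1
  have h2 : (-w * I).re = w.im := by simp
  have h3 : (w * I).re = -w.im := by simp
  rw [h2, h3] at h1
  have h4 := Real.exp_le_exp.2 (le_abs_self w.im)
  have h5 := Real.exp_le_exp.2 (neg_le_abs w.im)
  linarith

theorem norm_cos_le (w : ℂ) : ‖Complex.cos w‖ ≤ rexp |w.im| := by
  rw [Complex.cos, norm_div, Complex.norm_ofNat, div_le_iff₀ two_pos]
  have h1 := norm_add_le (cexp (w * I)) (cexp (-w * I))
  rw [Complex.norm_exp, Complex.norm_exp] at h1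
  have h2 : (-w * I).re = w.im := by simp
  have h3 : (w * I).re = -w.im := by simp
  rw [h2, h3] at h1
  have h4 := Real.exp_le_exp.2 (le_abs_self w.im)
  have h5 := Real.exp_le_exp.2 (neg_le_abs w.im)
  linarith

theorem norm_sin_nat_mul_le (w : ℂ) (k : ℕ) : ‖Complex.sin ((k + 1 : ℕ) * w)‖ ≤
    (k + 1) * ‖Complex.sin w‖ * rexp (k * |w.im|) := by
  induction k with
  | zero => simp
  | succ k ih =>
    have h1 : ((k + 1 + 1 : ℕ) : ℂ) * w = (k + 1 : ℕ) * w + w := by push_cast; ring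
    rw [h1, Complex.sin_add]
    have hc := norm_cos_le ((k + 1 : ℕ) * w)
    have hi : |(((k + 1 : ℕ) : ℂ) * w).im| = (k + 1) * |w.im| := by
      rw [show (((k + 1 : ℕ) : ℂ) * w).im = (k + 1 : ℕ) * w.im by
        rw [← Complex.ofReal_natCast, Complex.im_ofReal_mul], abs_mul]
      congr 1
      rw [abs_of_nonneg (by positivity)]; push_cast; ring
    rw [hi] at hc
    calc _ ≤ ‖Complex.sin ((k + 1 : ℕ) * w)‖ * ‖Complex.cos w‖ +
          ‖Complex.cos ((k + 1 : ℕ) * w)‖ * ‖Complex.sin w‖ := by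
          rw [← norm_mul, ← norm_mul]; exact norm_add_le _ _
      _ ≤ (k + 1) * ‖Complex.sin w‖ * rexp (k * |w.im|) * rexp |w.im| +
          rexp ((k + 1) * |w.im|) * ‖Complex.sin w‖ := by
          gcongr
          exact norm_cos_le w
      _ = _ := by
          rw [mul_assoc, ← Real.exp_add, show k * |w.im| + |w.im| = (k + 1) * |w.im| by ring]
          push_cast; ring

theorem norm_exp_quad (τ : ℂ) (r : ℝ) : ‖cexp (π * I * τ * (r : ℂ) ^ 2)‖ = rexp (-(π * τ.im * r ^ 2)) := by
  rw [Complex.norm_exp]; congr 1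
  rw [show (π * I * τ * (r : ℂ) ^ 2 : ℂ) = ((π * r ^ 2 : ℝ) : ℂ) * (I * τ) by push_cast; ring,
    Complex.re_ofReal_mul]
  simp; ring

theorem norm_exp_quad' (τ : ℂ) (n : ℕ) : ‖cexp (π * I * τ * ((n : ℂ) + 1 / 2) ^ 2)‖ =
    rexp (-(π * τ.im * (n + 1 / 2) ^ 2)) := by
  rw [← norm_exp_quad]; push_cast; rfl

theorem norm_th_term (τ u : ℂ) (n : ℕ) : ‖2 * I * ((-1) ^ n * (cexp (π * I * τ * (n + 1 / 2) ^ 2) *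
    Complex.sin (((2 * n + 1 : ℕ) : ℂ) * (π * u))))‖ = 2 * (rexp (-(π * τ.im * (n + 1 / 2) ^ 2)) *
    ‖Complex.sin (((2 * n + 1 : ℕ) : ℂ) * (π * u))‖) := by
  rw [norm_mul, norm_mul, norm_mul, norm_mul, norm_exp_quad']
  simp

theorem im_pi_mul (u : ℂ) : ((π : ℂ) * u).im = π * u.im := Complex.im_ofReal_mul _ _

theorem th_bound {τ : ℂ} (hτ : 0 < τ.im) (u : ℂ) :
    ‖th τ u‖ ≤ 4 * (1 + 1 / τ.im) * rexp (π * u.im ^ 2 / τ.im) := by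
  have hc : 0 < π * τ.im := by positivity
  obtain ⟨h1, h2⟩ := half_gauss_le hc (|u.im| / τ.im)
  have hb : ∀ n : ℕ, ‖2 * I * ((-1) ^ n * (cexp (π * I * τ * (n + 1 / 2) ^ 2) *
      Complex.sin (((2 * n + 1 : ℕ) : ℂ) * (π * u))))‖ ≤ 2 * rexp (π * u.im ^ 2 / τ.im) *
      rexp (-(π * τ.im * (n + 1 / 2 - |u.im| / τ.im) ^ 2)) := by
    intro n
    rw [norm_th_term, mul_assoc 2]
    refine mul_le_mul_of_nonneg_left ?_ zero_le_two
    have := norm_sin_le (((2 * n + 1 : ℕ) : ℂ) * (π * u))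
    calc _ ≤ rexp (-(π * τ.im * (n + 1 / 2) ^ 2)) *
          rexp |(((2 * n + 1 : ℕ) : ℂ) * (π * u)).im| := by gcongr
      _ = _ := by
        rw [← Real.exp_add, ← Real.exp_add]
        congr 1
        rw [← Complex.ofReal_natCast, Complex.im_ofReal_mul, im_pi_mul, abs_mul, abs_mul,
          abs_of_pos Real.pi_pos, abs_of_nonneg (by positivity : (0 : ℝ) ≤ (2 * n + 1 : ℕ)),
          ← sq_abs u.im]
        push_cast
        field_simp; ring
  have h3 := tsum_of_norm_bounded (h1.mul_left (2 * rexp (π * u.im ^ 2 / τ.im))).hasSum hb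
  rw [(hasSum_th hτ u).tsum_eq, tsum_mul_left] at h3
  refine h3.trans ?_
  have h4 : 1 / (π * τ.im) ≤ 1 / τ.im := by
    apply one_div_le_one_div_of_le hτ
    nlinarith [Real.pi_gt_three]
  calc _ ≤ 2 * rexp (π * u.im ^ 2 / τ.im) * (2 * (1 + 1 / τ.im)) := by
        gcongr; exact h2.trans (by gcongr)
    _ = _ := by ring

theorem norm_thp_term (τ : ℂ) (n : ℕ) : ‖2 * π * I * ((-1) ^ n *
    (cexp (π * I * τ * (n + 1 / 2) ^ 2) * ((2 * n + 1 : ℕ) : ℂ)))‖ =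
    2 * π * ((2 * n + 1) * rexp (-(π * τ.im * (n + 1 / 2) ^ 2))) := by
  rw [norm_mul, norm_mul, norm_mul, norm_mul, norm_mul, norm_exp_quad', Complex.norm_natCast]
  simp [abs_of_pos Real.pi_pos]; ring

theorem thp_term_le {y τy : ℝ} (hy : 0 < y) (h : y ≤ τy) (n : ℕ) :
    (2 * n + 1) * rexp (-(π * τy * (n + 1 / 2) ^ 2)) ≤
    rexp (-(π * τy / 4)) * ((2 * n + 1) * rexp (-(π * y * (n + 1 / 2 - 1 / 2) ^ 2))) := by
  rw [mul_left_comm, ← Real.exp_add]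
  refine mul_le_mul_of_nonneg_left (Real.exp_le_exp.2 ?_) (by positivity)
  have h0 : (0 : ℝ) ≤ n := Nat.cast_nonneg n
  have := Real.pi_pos
  have h1 : 0 ≤ π * (τy - y) * n ^ 2 := by
    have : 0 ≤ τy - y := by linarith
    positivity
  have h2 : 0 ≤ π * τy * n := by
    have : 0 ≤ τy := by linarith
    positivity
  nlinarith

theorem thp_bound {τ : ℂ} (hτ : 0 < τ.im) :
    ‖thp τ‖ ≤ 2 * π * ((3 + 4 / τ.im) * (2 + 4 / τ.im)) * rexp (-(π * τ.im / 4)) := by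
  have hc : 0 < π * τ.im := by positivity
  obtain ⟨h1, h2⟩ := weighted_gauss_le hc (x := 1 / 2) (by norm_num)
  have hb : ∀ n : ℕ, ‖2 * π * I * ((-1) ^ n *
      (cexp (π * I * τ * (n + 1 / 2) ^ 2) * ((2 * n + 1 : ℕ) : ℂ)))‖ ≤
      2 * π * rexp (-(π * τ.im / 4)) * ((2 * n + 1 : ℝ) * rexp (-(π * τ.im * (n + 1 / 2 - 1 / 2) ^ 2))) := by
    intro n
    rw [norm_thp_term, mul_assoc (2 * π)]
    exact mul_le_mul_of_nonneg_left (thp_term_le hτ le_rfl n) (by positivity)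
  have h3 := tsum_of_norm_bounded (h1.mul_left (2 * π * rexp (-(π * τ.im / 4)))).hasSum hb
  rw [(hasSum_thp hτ).tsum_eq, tsum_mul_left] at h3
  refine h3.trans ?_
  have h4 : 4 / (π * τ.im) ≤ 4 / τ.im := by
    apply div_le_div_of_nonneg_left (by norm_num) hτ
    nlinarith [Real.pi_gt_three]
  calc _ ≤ 2 * π * rexp (-(π * τ.im / 4)) * ((3 + 4 / τ.im) * (2 + 4 / τ.im)) := by
        gcongr
        refine h2.trans ?_
        have h5 : 2 + 4 / (π * τ.im) + 2 * (1 / 2) ≤ 3 + 4 / τ.im := by linarith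
        exact mul_le_mul h5 (by linarith) (by positivity) (by positivity)
    _ = _ := by ring

theorem differentiableOn_thp : DifferentiableOn ℂ thp {τ | 0 < τ.im} := by
  have ho : IsOpen {τ : ℂ | 0 < τ.im} := isOpen_lt continuous_const Complex.continuous_im
  have h := differentiableOn_tsum_of_locally_bounded (s := {τ : ℂ | 0 < τ.im}) ho
    (f := fun (n : ℕ) (τ : ℂ) => 2 * π * I * ((-1) ^ n *
      (cexp (π * I * τ * (n + 1 / 2) ^ 2) * ((2 * n + 1 : ℕ) : ℂ))))
    (fun n => by fun_prop) (fun τ hτ => by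
      have hτ : 0 < τ.im := hτ
      have hc : 0 < π * (τ.im / 2) := by positivity
      obtain ⟨h1, h2⟩ := weighted_gauss_le hc (x := 1 / 2) (by norm_num)
      refine ⟨{σ | τ.im / 2 < σ.im}, (isOpen_lt continuous_const Complex.continuous_im).mem_nhds
        (by simp; linarith), _, h1.mul_left (2 * π), fun n σ hσ => ?_⟩
      have hσ : τ.im / 2 < σ.im := hσ
      rw [norm_thp_term]
      refine mul_le_mul_of_nonneg_left ((thp_term_le (half_pos hτ) hσ.le n).trans ?_)
        (by positivity)
      refine mul_le_of_le_one_left (by positivity) ?_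
      rw [Real.exp_le_one_iff]
      have : 0 < σ.im := by linarith
      have : 0 < π * σ.im / 4 := by positivity
      linarith)
  refine h.congr fun τ hτ => ?_
  exact (hasSum_thp hτ).tsum_eq.symm

theorem th_sin_bound {τ : ℂ} (hτ : 0 < τ.im) (u : ℂ) (k : ℕ) :
    ‖th τ ((k + 1 : ℕ) * u)‖ ≤ 2 * ‖Complex.sin (π * u)‖ * (k + 1) *
      rexp (-(π * |u.im|) + π * ((k + 1) * u.im) ^ 2 / τ.im) *
      ((2 + 4 / τ.im + 2 * ((k + 1) * |u.im| / τ.im)) * (2 + 4 / τ.im)) := by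
  have hc : 0 < π * τ.im := by positivity
  have hx : 0 ≤ (k + 1) * |u.im| / τ.im := by positivity
  obtain ⟨h1, h2⟩ := weighted_gauss_le hc hx
  set D := 2 * ‖Complex.sin (π * u)‖ * (k + 1) *
      rexp (-(π * |u.im|) + π * ((k + 1) * u.im) ^ 2 / τ.im) with hD
  have hb : ∀ n : ℕ, ‖2 * I * ((-1) ^ n * (cexp (π * I * τ * (n + 1 / 2) ^ 2) *
      Complex.sin (((2 * n + 1 : ℕ) : ℂ) * (π * ((k + 1 : ℕ) * u)))))‖ ≤ D *
      ((2 * n + 1 : ℝ) * rexp (-(π * τ.im * (n + 1 / 2 - (k + 1) * |u.im| / τ.im) ^ 2))) := by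
    intro n
    rw [norm_th_term]
    have e1 : ((2 * n + 1 : ℕ) : ℂ) * (π * ((k + 1 : ℕ) * u)) =
        (((2 * n + 1) * (k + 1) - 1 + 1 : ℕ) : ℂ) * (π * u) := by
      rw [Nat.sub_add_cancel (Nat.succ_le_of_lt (by positivity))]
      push_cast; ring
    have := norm_sin_nat_mul_le (π * u) ((2 * n + 1) * (k + 1) - 1)
    rw [← e1, Nat.cast_sub (Nat.succ_le_of_lt (by positivity)), im_pi_mul, abs_mul,
      abs_of_pos Real.pi_pos] at this
    push_cast at this
    calc _ ≤ 2 * (rexp (-(π * τ.im * (n + 1 / 2) ^ 2)) *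
          (((2 * n + 1) * (k + 1) - 1 + 1) * ‖Complex.sin (π * u)‖ *
          rexp (((2 * n + 1) * (k + 1) - 1) * (π * |u.im|)))) := by
          push_cast; gcongr
      _ = 2 * ‖Complex.sin (π * u)‖ * (k + 1) * (2 * n + 1) *
          (rexp (-(π * τ.im * (n + 1 / 2) ^ 2)) *
            rexp (((2 * n + 1) * (k + 1) - 1) * (π * |u.im|))) := by ring
      _ = 2 * ‖Complex.sin (π * u)‖ * (k + 1) * (2 * n + 1) *
          (rexp (-(π * |u.im|) + π * ((k + 1) * u.im) ^ 2 / τ.im) *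
            rexp (-(π * τ.im * (n + 1 / 2 - (k + 1) * |u.im| / τ.im) ^ 2))) := by
          rw [← Real.exp_add, ← Real.exp_add, mul_pow, ← sq_abs u.im]
          congr 2
          field_simp; ring
      _ = _ := by rw [hD]; ring
  have h3 := tsum_of_norm_bounded (h1.mul_left D).hasSum hb
  rw [(hasSum_th hτ _).tsum_eq, tsum_mul_left] at h3
  refine h3.trans ?_
  have h4 : 4 / (π * τ.im) ≤ 4 / τ.im := by
    apply div_le_div_of_nonneg_left (by norm_num) hτ
    nlinarith [Real.pi_gt_three]
  have hD0 : 0 ≤ D := by positivity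
  gcongr
  refine h2.trans ?_
  gcongr

end ThetaBounds

section ThetaRatio

open Complex Real

theorem norm_ge_of_hasSum {f : ℕ → ℂ} {S : ℂ} {c : ℝ} (hf : HasSum f S) (h0 : ‖f 0‖ = 2 * c)
    (hn : ∀ n : ℕ, ‖f (n + 1)‖ ≤ 2 * c * (1 / 4) ^ (n + 1)) : c ≤ ‖S‖ := by
  have h1 := (hasSum_nat_add_iff' 1).2 hf
  have hg := (hasSum_geometric_of_lt_one (r := (1 / 4 : ℝ)) (by norm_num) (by norm_num)).mul_left
    (2 * c * (1 / 4))
  have h2 : ‖S - ∑ i ∈ Finset.range 1, f i‖ ≤ 2 * c * (1 / 4) * (1 - 1 / 4)⁻¹ := by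
    rw [← h1.tsum_eq]
    refine tsum_of_norm_bounded hg fun n => (hn n).trans (le_of_eq ?_)
    rw [pow_succ]; ring
  rw [Finset.sum_range_one] at h2
  have h3 := norm_sub_norm_le (f 0) (f 0 - S)
  rw [sub_sub_cancel, norm_sub_rev (f 0) S] at h3
  have h4 : 0 ≤ c := by have := norm_nonneg (f 0); linarith
  norm_num at h2
  linarith

theorem exp_neg_pi_mul_le {y : ℝ} (hy : 4 / 5 ≤ y) (n : ℕ) :
    (2 * ((n + 1 : ℕ) : ℝ) + 1) * rexp (-(π * y * ((n + 1 : ℕ) : ℝ) ^ 2)) ≤ (1 / 4) ^ (n + 1) := by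
  have h1 : rexp (-(5 / 2)) ≤ 1 / 12 := by
    rw [Real.exp_neg, inv_eq_one_div]
    refine one_div_le_one_div_of_le (by norm_num) ?_
    have h2 := Real.exp_one_gt_d9
    have h3 : rexp (5 / 2) = rexp 1 ^ 2 * rexp (1 / 2) := by
      rw [← Real.exp_nat_mul, ← Real.exp_add]; norm_num
    have h4 : (1.648 : ℝ) ≤ rexp (1 / 2) := by
      have h5 : rexp (1 / 2) ^ 2 = rexp 1 := by rw [← Real.exp_nat_mul]; norm_num
      have h6 := Real.exp_pos (1 / 2 : ℝ)
      nlinarith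
    rw [h3]
    have h7 : (7.387 : ℝ) ≤ rexp 1 ^ 2 := by nlinarith
    nlinarith
  have h2 : rexp (-(π * y * ((n + 1 : ℕ) : ℝ) ^ 2)) ≤ rexp (-(5 / 2)) ^ (n + 1) := by
    rw [← Real.exp_nat_mul]
    apply Real.exp_le_exp.2
    have h3 : (5 / 2 : ℝ) ≤ π * y := by nlinarith [Real.pi_gt_d2]
    have h4 : ((n + 1 : ℕ) : ℝ) ≤ ((n + 1 : ℕ) : ℝ) ^ 2 := by
      exact_mod_cast Nat.le_self_pow two_ne_zero (n + 1)
    have h5 : (0 : ℝ) ≤ ((n + 1 : ℕ) : ℝ) := Nat.cast_nonneg _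
    have := mul_le_mul h3 h4 h5 (by linarith)
    linarith
  have h3 : (2 * ((n + 1 : ℕ) : ℝ) + 1) ≤ 3 ^ (n + 1) := by
    have := one_add_mul_le_pow (a := (2 : ℝ)) (by norm_num) (n + 1)
    norm_num at this ⊢
    linarith
  calc _ ≤ 3 ^ (n + 1) * (1 / 12 : ℝ) ^ (n + 1) := by
        refine mul_le_mul h3 (h2.trans (pow_le_pow_left₀ (Real.exp_pos _).le h1 _))
          (Real.exp_pos _).le (by positivity)
    _ = _ := by rw [← mul_pow]; norm_num

theorem th_lower {τ u : ℂ} (hτ : 4 / 5 ≤ τ.im) (hu : |u.im| ≤ τ.im / 2) :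
    ‖Complex.sin (π * u)‖ * rexp (-(π * τ.im / 4)) ≤ ‖th τ u‖ := by
  refine norm_ge_of_hasSum (hasSum_th (by linarith) u) ?_ fun n => ?_
  · rw [norm_th_term]; norm_num; ring_nf
  · rw [norm_th_term]
    have h1 := norm_sin_nat_mul_le (π * u) (2 * (n + 1))
    rw [im_pi_mul, abs_mul, abs_of_pos Real.pi_pos] at h1
    have h2 := exp_neg_pi_mul_le hτ n
    push_cast at h1 h2 ⊢
    have h3 : rexp (2 * (n + 1) * (π * |u.im|)) ≤ rexp (π * τ.im * (n + 1)) := by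
      apply Real.exp_le_exp.2
      have : 0 ≤ (n + 1 : ℝ) * π := by positivity
      nlinarith [mul_le_mul_of_nonneg_left hu this]
    calc _ ≤ 2 * (rexp (-(π * τ.im * (n + 1 + 1 / 2) ^ 2)) *
          ((2 * (n + 1) + 1) * ‖Complex.sin (π * u)‖ * rexp (π * τ.im * (n + 1)))) := by
          gcongr
          exact h1.trans (by gcongr)
      _ = 2 * ‖Complex.sin (π * u)‖ * (rexp (-(π * τ.im * (n + 1 + 1 / 2) ^ 2)) *
          rexp (π * τ.im * (n + 1))) * (2 * (n + 1) + 1) := by ring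
      _ = 2 * (‖Complex.sin (π * u)‖ * rexp (-(π * τ.im / 4))) *
          ((2 * (n + 1) + 1) * rexp (-(π * τ.im * (n + 1) ^ 2))) := by
          have : rexp (-(π * τ.im * (n + 1 + 1 / 2) ^ 2)) * rexp (π * τ.im * (n + 1)) =
              rexp (-(π * τ.im / 4)) * rexp (-(π * τ.im * (n + 1) ^ 2)) := by
            rw [← Real.exp_add, ← Real.exp_add]; congr 1; ring
          rw [this]; ring
      _ ≤ _ := by gcongr

theorem thp_lower {τ : ℂ} (hτ : 4 / 5 ≤ τ.im) : π * rexp (-(π * τ.im / 4)) ≤ ‖thp τ‖ := by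
  have hτ0 : 0 < τ.im := by linarith
  refine norm_ge_of_hasSum (hasSum_thp hτ0) ?_ fun n => ?_
  · rw [norm_thp_term]; norm_num; ring_nf
  · rw [norm_thp_term]
    have h1 := thp_term_le hτ0 le_rfl (n + 1)
    have h2 := exp_neg_pi_mul_le hτ n
    rw [add_sub_cancel_right] at h1
    calc _ ≤ 2 * π * (rexp (-(π * τ.im / 4)) * _) := by gcongr
      _ ≤ 2 * π * (rexp (-(π * τ.im / 4)) * (1 / 4) ^ (n + 1)) := by gcongr
      _ = _ := by ring

def Nth (τ u : ℂ) : ℝ := ‖th τ u‖ * rexp (-(π * u.im ^ 2 / τ.im))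

theorem Nth_nonneg (τ u : ℂ) : 0 ≤ Nth τ u := by unfold Nth; positivity

theorem norm_th_eq (τ u : ℂ) : ‖th τ u‖ = Nth τ u * rexp (π * u.im ^ 2 / τ.im) := by
  rw [Nth, mul_assoc, ← Real.exp_add, neg_add_cancel, Real.exp_zero, mul_one]

theorem Nth_neg (τ u : ℂ) : Nth τ (-u) = Nth τ u := by
  simp [Nth, th_neg]

theorem Nth_add_one (τ u : ℂ) : Nth τ (u + 1) = Nth τ u := by
  simp [Nth, th_add_one_right]

theorem Nth_add_tau {τ : ℂ} (hτ : 0 < τ.im) (u : ℂ) : Nth τ (u + τ) = Nth τ u := by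
  rw [Nth, th_add_tau, norm_neg, norm_mul, Complex.norm_exp, Nth,
    mul_comm (rexp _), mul_assoc, ← Real.exp_add]
  congr 2
  have h1 : (-(π * I * (τ + 2 * u)) : ℂ) = ((-π : ℝ) : ℂ) * (I * (τ + 2 * u)) := by
    push_cast; ring
  rw [h1, Complex.re_ofReal_mul]
  simp
  field_simp
  ring

theorem Nth_add_nat_mul {τ : ℂ} (hτ : 0 < τ.im) (u : ℂ) (n : ℕ) : Nth τ (u + n * τ) = Nth τ u := by
  induction n with
  | zero => simp
  | succ n ih =>
    rw [← ih, ← Nth_add_tau hτ (u + n * τ)]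
    congr 1; push_cast; ring

theorem Nth_add_nat (τ u : ℂ) (n : ℕ) : Nth τ (u + n) = Nth τ u := by
  induction n with
  | zero => simp
  | succ n ih =>
    rw [← ih, ← Nth_add_one τ (u + n)]
    congr 1; push_cast; ring

theorem im_of_hecke {τ τ' : ℂ} {a d b : ℕ} (hd : 1 ≤ d) (h : (d : ℂ) * τ' = a * τ + b) :
    τ'.im = a * τ.im / d := by
  have h1 := congrArg Complex.im h
  simp at h1
  have : (0 : ℝ) < d := by exact_mod_cast hd
  field_simp
  linarith

theorem Nth_hecke_le_aux {τ τ' u : ℂ} (hτ : 4 / 5 ≤ τ.im) (hu : |u.im| ≤ τ.im / 2) {a d b : ℕ}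
    (ha : 1 ≤ a) (hd : 1 ≤ d) (h : (d : ℂ) * τ' = a * τ + b) :
    Nth τ' (a * u) ≤ Nth τ u * (112 * a * d ^ 2) * rexp (π * τ.im * (|u.im| / τ.im - 1 / 2) ^ 2) := by
  have hy := im_of_hecke hd h
  have ha1 : (1 : ℝ) ≤ a := by exact_mod_cast ha
  have hd1 : (1 : ℝ) ≤ d := by exact_mod_cast hd
  have hτ0 : 0 < τ.im := by linarith
  have hy0 : 0 < τ'.im := by rw [hy]; positivity
  have h1 := th_sin_bound hy0 u (a - 1)
  have h2 := th_lower hτ hu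
  rw [Nat.sub_add_cancel ha] at h1
  rw [show ((a - 1 : ℕ) : ℝ) + 1 = a by rw [Nat.cast_sub ha]; push_cast; ring] at h1
  have h3 : 4 / τ'.im ≤ 5 * d := by
    rw [hy, div_le_iff₀ (by positivity)]
    have : (4 : ℝ) ≤ 5 * (a * τ.im) := by nlinarith
    calc (4 : ℝ) ≤ 5 * (a * τ.im) := this
      _ = _ := by field_simp
  have h4 : 2 * (a * |u.im| / τ'.im) ≤ d := by
    rw [hy]
    have : 2 * (a * |u.im| / (a * τ.im / d)) = d * (2 * |u.im| / τ.im) := by field_simp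
    rw [this]
    refine mul_le_of_le_one_right (by linarith) ?_
    rw [div_le_one hτ0]; linarith
  have h5 : (2 + 4 / τ'.im + 2 * (a * |u.im| / τ'.im)) * (2 + 4 / τ'.im) ≤ 56 * d ^ 2 := by
    have e1 : 2 + 4 / τ'.im + 2 * (a * |u.im| / τ'.im) ≤ 8 * d := by linarith
    have e2 : 2 + 4 / τ'.im ≤ 7 * d := by linarith
    calc _ ≤ (8 * d : ℝ) * (7 * d) := mul_le_mul e1 e2 (by positivity) (by positivity)
      _ = _ := by ring
  have him : ((a : ℂ) * u).im = a * u.im := by simp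
  rw [Nth, him]
  calc _ ≤ 2 * ‖Complex.sin (π * u)‖ * a * rexp (-(π * |u.im|) + π * (a * u.im) ^ 2 / τ'.im) *
        (56 * d ^ 2) * rexp (-(π * (a * u.im) ^ 2 / τ'.im)) := by
        gcongr
        exact h1.trans (by gcongr)
    _ = ‖Complex.sin (π * u)‖ * (112 * a * d ^ 2) *
        (rexp (-(π * |u.im|) + π * (a * u.im) ^ 2 / τ'.im) *
        rexp (-(π * (a * u.im) ^ 2 / τ'.im))) := by ring
    _ = ‖Complex.sin (π * u)‖ * (112 * a * d ^ 2) *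
        (rexp (-(π * τ.im / 4)) * rexp (-(π * u.im ^ 2 / τ.im)) *
          rexp (π * τ.im * (|u.im| / τ.im - 1 / 2) ^ 2)) := by
        rw [← Real.exp_add, ← Real.exp_add, ← Real.exp_add]
        congr 2
        rw [← sq_abs u.im]
        field_simp; ring
    _ = ‖Complex.sin (π * u)‖ * rexp (-(π * τ.im / 4)) * (rexp (-(π * u.im ^ 2 / τ.im)) *
          (112 * a * d ^ 2) * rexp (π * τ.im * (|u.im| / τ.im - 1 / 2) ^ 2)) := by ring
    _ ≤ ‖th τ u‖ * (rexp (-(π * u.im ^ 2 / τ.im)) *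
          (112 * a * d ^ 2) * rexp (π * τ.im * (|u.im| / τ.im - 1 / 2) ^ 2)) := by gcongr
    _ = _ := by rw [Nth]; ring

theorem Nth_hecke_le_aux' {τ τ' u : ℂ} (hτ : 4 / 5 ≤ τ.im) (hu0 : 0 ≤ u.im)
    (hu : u.im ≤ 3 / 2 * τ.im) {a d b : ℕ}
    (ha : 1 ≤ a) (hd : 1 ≤ d) (h : (d : ℂ) * τ' = a * τ + b) :
    Nth τ' (a * u) ≤ Nth τ u * (112 * a * d ^ 2) * rexp (π * τ.im * (u.im / τ.im - 1 / 2) ^ 2) := by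
  have hτ0 : 0 < τ.im := by linarith
  rcases le_or_gt u.im (τ.im / 2) with hc | hc
  · have := Nth_hecke_le_aux hτ (by rwa [abs_of_nonneg hu0]) ha hd h
    rwa [abs_of_nonneg hu0] at this
  · have hy := im_of_hecke hd h
    have ha1 : (1 : ℝ) ≤ a := by exact_mod_cast ha
    have hd1 : (1 : ℝ) ≤ d := by exact_mod_cast hd
    have hy0 : 0 < τ'.im := by rw [hy]; positivity
    have him : (u - τ).im = u.im - τ.im := by simp
    have h1 := Nth_hecke_le_aux (u := u - τ) hτ (by rw [him, abs_le]; constructor <;> linarith)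
      ha hd h
    have h2 : Nth τ (u - τ) = Nth τ u := by
      rw [← Nth_add_tau hτ0, sub_add_cancel]
    have h3 : Nth τ' (a * (u - τ)) = Nth τ' (a * u) := by
      rw [← Nth_add_nat_mul hy0 _ d, h, ← Nth_add_nat τ' (a * u) b]
      congr 1; ring
    rw [h2, h3] at h1
    refine h1.trans ?_
    have hN := Nth_nonneg τ u
    refine mul_le_mul_of_nonneg_left (Real.exp_le_exp.2 (mul_le_mul_of_nonneg_left ?_
      (by positivity))) (by positivity)
    rw [him]
    have hB : 1 / 2 < u.im / τ.im := by rw [lt_div_iff₀ hτ0]; linarith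
    have e1 : |u.im - τ.im| / τ.im = |u.im / τ.im - 1| := by
      rw [← abs_of_pos hτ0, ← abs_div, abs_of_pos hτ0, sub_div, div_self hτ0.ne']
    rw [e1]
    rcases le_or_gt (u.im / τ.im) 1 with h5 | h5
    · rw [abs_of_nonpos (by linarith)]
      nlinarith
    · rw [abs_of_pos (by linarith)]
      nlinarith

theorem Nth_hecke_le {τ τ' u : ℂ} (hτ : 4 / 5 ≤ τ.im)
    (hu : |u.im| ≤ 3 / 2 * τ.im) {a d b : ℕ}
    (ha : 1 ≤ a) (hd : 1 ≤ d) (h : (d : ℂ) * τ' = a * τ + b) :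
    Nth τ' (a * u) ≤ Nth τ u * (112 * a * d ^ 2) * rexp (π * τ.im * (|u.im| / τ.im - 1 / 2) ^ 2) := by
  rcases le_total 0 u.im with h0 | h0
  · rw [abs_of_nonneg h0] at hu ⊢
    exact Nth_hecke_le_aux' hτ h0 hu ha hd h
  · rw [abs_of_nonpos h0] at hu ⊢
    have := Nth_hecke_le_aux' (u := -u) hτ (by simpa using h0) (by simpa using hu) ha hd h
    rw [mul_neg, Nth_neg, Nth_neg] at this
    simpa using this

theorem thp_hecke_le {τ τ' : ℂ} (hτ : 4 / 5 ≤ τ.im) {a d b : ℕ}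
    (ha : 1 ≤ a) (hd : 1 ≤ d) (h : (d : ℂ) * τ' = a * τ + b) :
    ‖thp τ'‖ ≤ ‖thp τ‖ * (112 * d ^ 2) * rexp (π * τ.im / 4 - π * a * τ.im / (4 * d)) := by
  have hy := im_of_hecke hd h
  have ha1 : (1 : ℝ) ≤ a := by exact_mod_cast ha
  have hd1 : (1 : ℝ) ≤ d := by exact_mod_cast hd
  have hτ0 : 0 < τ.im := by linarith
  have hy0 : 0 < τ'.im := by rw [hy]; positivity
  have h1 := thp_bound hy0
  have h2 := thp_lower hτ
  have h3 : 4 / τ'.im ≤ 5 * d := by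
    rw [hy, div_le_iff₀ (by positivity)]
    have : (4 : ℝ) ≤ 5 * (a * τ.im) := by nlinarith
    calc (4 : ℝ) ≤ 5 * (a * τ.im) := this
      _ = _ := by field_simp
  have h5 : (3 + 4 / τ'.im) * (2 + 4 / τ'.im) ≤ 56 * d ^ 2 := by
    have e1 : 3 + 4 / τ'.im ≤ 8 * d := by linarith
    have e2 : 2 + 4 / τ'.im ≤ 7 * d := by linarith
    calc _ ≤ (8 * d : ℝ) * (7 * d) := mul_le_mul e1 e2 (by positivity) (by positivity)
      _ = _ := by ring
  calc _ ≤ 2 * π * (56 * d ^ 2) * rexp (-(π * τ'.im / 4)) := h1.trans (by gcongr)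
    _ = π * rexp (-(π * τ.im / 4)) * ((112 * d ^ 2) *
        rexp (π * τ.im / 4 - π * a * τ.im / (4 * d))) := by
        have : rexp (-(π * τ'.im / 4)) = rexp (-(π * τ.im / 4)) *
            rexp (π * τ.im / 4 - π * a * τ.im / (4 * d)) := by
          rw [← Real.exp_add, hy]; congr 1; field_simp; ring
        rw [this]; ring
    _ ≤ ‖thp τ‖ * ((112 * d ^ 2) * rexp (π * τ.im / 4 - π * a * τ.im / (4 * d))) := by gcongr
    _ = _ := by ring

end ThetaRatio

section PhiOne

open Complex Real

/-- The square root of `-11` with positive imaginary part. -/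
def s11 : ℂ := 2 * om - 1

theorem s11_sq : s11 * s11 = -11 := by
  unfold s11
  linear_combination 4 * om_mul_self

theorem s11_ne : s11 ≠ 0 := by
  intro h
  have := s11_sq
  rw [h] at this; norm_num at this

theorem conj_s11 : (starRingEnd ℂ) s11 = -s11 := by
  simp only [s11, map_sub, map_mul, conj_om, map_ofNat, map_one]; ring

def uA (z₁ z₂ : ℂ) : ℂ := (z₁ - z₂) / s11

def uB (z₁ z₂ : ℂ) : ℂ := (om * z₁ - (1 - om) * z₂) / s11

def uC (z₁ z₂ : ℂ) : ℂ := ((1 - om) * z₁ - om * z₂) / s11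

theorem uA_mul (c z₁ z₂ : ℂ) : uA (c * z₁) (c * z₂) = c * uA z₁ z₂ := by unfold uA; ring

theorem uB_mul (c z₁ z₂ : ℂ) : uB (c * z₁) (c * z₂) = c * uB z₁ z₂ := by unfold uB; ring

theorem uC_mul (c z₁ z₂ : ℂ) : uC (c * z₁) (c * z₂) = c * uC z₁ z₂ := by unfold uC; ring

theorem uA_add (x₁ x₂ z₁ z₂ : ℂ) : uA (x₁ + z₁) (x₂ + z₂) = uA x₁ x₂ + uA z₁ z₂ := by
  unfold uA; ring

theorem uB_add (x₁ x₂ z₁ z₂ : ℂ) : uB (x₁ + z₁) (x₂ + z₂) = uB x₁ x₂ + uB z₁ z₂ := by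
  unfold uB; ring

theorem uC_add (x₁ x₂ z₁ z₂ : ℂ) : uC (x₁ + z₁) (x₂ + z₂) = uC x₁ x₂ + uC z₁ z₂ := by
  unfold uC; ring

theorem uA_swap (z₁ z₂ : ℂ) : uA z₂ z₁ = -uA z₁ z₂ := by unfold uA; ring

theorem uB_swap (z₁ z₂ : ℂ) : uB z₂ z₁ = -uC z₁ z₂ := by unfold uB uC; ring

theorem uC_swap (z₁ z₂ : ℂ) : uC z₂ z₁ = -uB z₁ z₂ := by unfold uB uC; ring

theorem uB_add_uC (z₁ z₂ : ℂ) : uB z₁ z₂ + uC z₁ z₂ = uA z₁ z₂ := by unfold uA uB uC; ring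

theorem u_bilin (x₁ x₂ z₁ z₂ : ℂ) : 5 * (uA x₁ x₂ * uA z₁ z₂) + uB x₁ x₂ * uB z₁ z₂ +
    uC x₁ x₂ * uC z₁ z₂ = x₁ * z₂ + x₂ * z₁ := by
  have h := s11_ne
  have h1 := s11_sq
  have h2 := om_mul_self
  unfold uA uB uC
  field_simp
  linear_combination (2 * (x₁ * z₁ + x₂ * z₂) + 2 * (x₁ * z₂ + x₂ * z₁)) * h2 -
    (x₁ * z₂ + x₂ * z₁) * h1

theorem u_conj_int {x : ℂ} (hx : x ∈ OK) : ∃ n₁ n₂ n₃ : ℤ, uA x ((starRingEnd ℂ) x) = n₁ ∧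
    uB x ((starRingEnd ℂ) x) = n₂ ∧ uC x ((starRingEnd ℂ) x) = n₃ ∧ n₁ = n₂ + n₃ := by
  obtain ⟨a, b, rfl⟩ := hx
  have h1 := om_mul_self
  have hc : (starRingEnd ℂ) ((a : ℂ) + b * omg 11) = a + b * (1 - om) := by
    have := conj_om
    simp only [map_add, map_mul, map_intCast]
    rw [← this]
  rw [hc]
  refine ⟨b, a + b, -a, ?_, ?_, ?_, by ring⟩
  · unfold uA; rw [div_eq_iff s11_ne]; unfold s11; push_cast; ring
  · unfold uB; rw [div_eq_iff s11_ne]; unfold s11; push_cast; ring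
  · unfold uC; rw [div_eq_iff s11_ne]; unfold s11; push_cast; ring

/-- The first Fourier-Jacobi coefficient. -/
def phi1 (τ z₁ z₂ : ℂ) : ℂ := thp τ * th τ (uA z₁ z₂) ^ 5 * th τ (uB z₁ z₂) * th τ (uC z₁ z₂)

theorem phi1_T {τ : ℂ} (hτ : 0 < τ.im) (z₁ z₂ : ℂ) : phi1 (τ + 1) z₁ z₂ = phi1 τ z₁ z₂ := by
  unfold phi1
  rw [thp_T hτ, th_T, th_T, th_T]
  have h : cexp (π * I / 4) ^ 8 = 1 := by
    rw [← Complex.exp_nat_mul, ← Complex.exp_two_pi_mul_I]; congr 1; push_cast; ring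
  linear_combination (thp τ * th τ (uA z₁ z₂) ^ 5 * th τ (uB z₁ z₂) * th τ (uC z₁ z₂)) * h

theorem phi1_S {τ : ℂ} (hτ : 0 < τ.im) (z₁ z₂ : ℂ) : phi1 (-1 / τ) (z₁ / τ) (z₂ / τ) =
    τ ^ 5 * cexp (2 * π * I * (z₁ * z₂ / τ)) * phi1 τ z₁ z₂ := by
  have h0 : τ ≠ 0 := by rintro rfl; simp at hτ
  unfold phi1
  have e : ∀ z : ℂ, z / τ = τ⁻¹ * z := fun z => by ring
  rw [e z₁, e z₂, uA_mul, uB_mul, uC_mul, ← e, ← e, ← e, thp_S hτ, th_S hτ, th_S hτ, th_S hτ]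
  have h : ((-I * τ) ^ (1 / 2 : ℂ)) ^ 8 = τ ^ 4 := by
    rw [← Complex.cpow_nat_mul, show ((8 : ℕ) : ℂ) * (1 / 2) = ((4 : ℕ) : ℂ) by norm_num,
      Complex.cpow_natCast, mul_pow]
    have : (-I) ^ 4 = 1 := by rw [neg_pow, I_pow_four]; norm_num
    rw [this, one_mul]
  have h2 : cexp (π * I * uA z₁ z₂ ^ 2 / τ) ^ 5 * cexp (π * I * uB z₁ z₂ ^ 2 / τ) *
      cexp (π * I * uC z₁ z₂ ^ 2 / τ) = cexp (2 * π * I * (τ⁻¹ * z₁ * z₂)) := by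
    rw [← Complex.exp_nat_mul, ← Complex.exp_add, ← Complex.exp_add]
    congr 1
    have := u_bilin z₁ z₂ z₁ z₂
    field_simp
    push_cast
    linear_combination this
  rw [show z₁ * z₂ / τ = τ⁻¹ * z₁ * z₂ by ring, ← h2]
  have hI : (-I) ^ 8 = 1 := by rw [show (8 : ℕ) = 4 * 2 from rfl, pow_mul, neg_pow, I_pow_four]; norm_num
  set κ := (-I * τ) ^ (1 / 2 : ℂ)
  set A := cexp (π * I * uA z₁ z₂ ^ 2 / τ)
  set B := cexp (π * I * uB z₁ z₂ ^ 2 / τ)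
  set C := cexp (π * I * uC z₁ z₂ ^ 2 / τ)
  calc _ = (-I) ^ 8 * κ ^ 8 * (τ * (A ^ 5 * B * C) * (thp τ * th τ (uA z₁ z₂) ^ 5 *
        th τ (uB z₁ z₂) * th τ (uC z₁ z₂))) := by ring
    _ = _ := by rw [hI, h]; ring

theorem phi1_swap (τ z₁ z₂ : ℂ) : phi1 τ z₂ z₁ = -phi1 τ z₁ z₂ := by
  unfold phi1
  rw [uA_swap, uB_swap z₁ z₂, uC_swap z₁ z₂, th_neg, th_neg, th_neg]; ring

theorem th_add_int (τ u : ℂ) (n : ℤ) : th τ (u + n) = (-1) ^ n * th τ u := by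
  induction n with
  | zero => simp
  | succ n ih =>
    rw [zpow_add_one₀ (by norm_num), show (u + ((n + 1 : ℤ) : ℂ)) = u + (n : ℤ) + 1 by push_cast; ring,
      th_add_one_right, ih]
    ring
  | pred n ih =>
    have := th_add_one_right τ (u + ((-n - 1 : ℤ) : ℂ))
    rw [show u + ((-n - 1 : ℤ) : ℂ) + 1 = u + ((-n : ℤ) : ℂ) by push_cast; ring, ih] at this
    rw [zpow_sub_one₀ (by norm_num)]
    linear_combination this

theorem th_add_int_tau (τ u : ℂ) (n : ℤ) : th τ (u + n * τ) =
    (-1) ^ n * cexp (-(π * I * (n ^ 2 * τ + 2 * n * u))) * th τ u := by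
  induction n with
  | zero => simp
  | succ n ih =>
    rw [zpow_add_one₀ (by norm_num),
      show (u + ((n + 1 : ℤ) : ℂ) * τ) = u + (n : ℤ) * τ + τ by push_cast; ring,
      th_add_tau, ih]
    have : cexp (-(π * I * (((n + 1 : ℤ) : ℂ) ^ 2 * τ + 2 * ((n + 1 : ℤ) : ℂ) * u))) =
        cexp (-(π * I * (τ + 2 * (u + (n : ℤ) * τ)))) *
        cexp (-(π * I * (((n : ℤ) : ℂ) ^ 2 * τ + 2 * ((n : ℤ) : ℂ) * u))) := by
      rw [← Complex.exp_add]; congr 1; push_cast; ring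
    rw [this]; ring
  | pred n ih =>
    have h := th_add_tau τ (u + ((-n - 1 : ℤ) : ℂ) * τ)
    rw [show u + ((-n - 1 : ℤ) : ℂ) * τ + τ = u + ((-n : ℤ) : ℂ) * τ by push_cast; ring, ih] at h
    rw [zpow_sub_one₀ (by norm_num)]
    have : cexp (-(π * I * (((-n - 1 : ℤ) : ℂ) ^ 2 * τ + 2 * ((-n - 1 : ℤ) : ℂ) * u))) *
        cexp (-(π * I * (τ + 2 * (u + ((-n - 1 : ℤ) : ℂ) * τ)))) =
        cexp (-(π * I * (((-n : ℤ) : ℂ) ^ 2 * τ + 2 * ((-n : ℤ) : ℂ) * u))) := by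
      rw [← Complex.exp_add]; congr 1; push_cast; ring
    rw [← this] at h
    apply mul_left_cancel₀ (Complex.exp_ne_zero (-(π * I * (τ + 2 * (u + ((-n - 1 : ℤ) : ℂ) * τ)))))
    linear_combination h

theorem neg_one_zpow_aux {n₁ n₂ n₃ : ℤ} (h : n₁ = n₂ + n₃) (a : ℤ) :
    ((-1 : ℂ) ^ (a * n₁)) ^ 5 * (-1) ^ (a * n₂) * (-1) ^ (a * n₃) = 1 := by
  rw [← zpow_natCast, ← _root_.zpow_mul, ← zpow_add₀ (by norm_num), ← zpow_add₀ (by norm_num)]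
  apply Even.neg_one_zpow
  rw [h]
  exact ⟨a * (n₂ + n₃) * 3, by push_cast; ring⟩

/-- Invariance of the first coefficient under integral translations. -/
theorem phi1_trans (τ z₁ z₂ : ℂ) {x : ℂ} (hx : x ∈ OK) (a : ℤ) :
    phi1 τ (a * (z₁ + x)) (a * (z₂ + (starRingEnd ℂ) x)) = phi1 τ (a * z₁) (a * z₂) := by
  obtain ⟨n₁, n₂, n₃, h₁, h₂, h₃, h⟩ := u_conj_int hx
  unfold phi1
  simp only [uA_mul, uB_mul, uC_mul]
  rw [uA_add, uB_add, uC_add, h₁, h₂, h₃, mul_add, mul_add, mul_add, ← Int.cast_mul,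
    ← Int.cast_mul, ← Int.cast_mul, th_add_int, th_add_int, th_add_int, mul_pow]
  linear_combination (thp τ * th τ (a * uA z₁ z₂) ^ 5 * th τ (a * uB z₁ z₂) *
    th τ (a * uC z₁ z₂)) * neg_one_zpow_aux h a

theorem phi1_heis {τ τ' : ℂ} (z₁ z₂ : ℂ) {x : ℂ} (hx : x ∈ OK) {a b d : ℤ}
    (h : (d : ℂ) * τ' = a * τ + b) :
    phi1 τ' (a * (z₁ + x * τ)) (a * (z₂ + (starRingEnd ℂ) x * τ)) =
      cexp (-(2 * π * I * (a * d * ((starRingEnd ℂ) x * z₁ + x * z₂ + x * (starRingEnd ℂ) x * τ)))) *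
        phi1 τ' (a * z₁) (a * z₂) := by
  obtain ⟨n₁, n₂, n₃, h₁, h₂, h₃, hn⟩ := u_conj_int hx
  obtain ⟨k, hk⟩ := exists_normSq_eq hx
  have hxx : x * (starRingEnd ℂ) x = (k : ℤ) := by
    rw [Complex.mul_conj, hk]; simp
  unfold phi1
  have key : ∀ (n : ℤ) (u : ℂ), th τ' (a * (u + n * τ)) = (-1) ^ (b * n) * (-1) ^ (d * n) *
      cexp (-(π * I * (n ^ 2 * d * (a * τ + b) + 2 * n * d * a * u))) * th τ' (a * u) := by
    intro n u
    rw [show (a : ℂ) * (u + n * τ) = a * u + ((d * n : ℤ) : ℂ) * τ' + ((-(b * n) : ℤ) : ℂ) by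
      push_cast; linear_combination -(n : ℂ) * h, th_add_int, th_add_int_tau]
    have : (-1 : ℂ) ^ (-(b * n)) = (-1) ^ (b * n) := by
      rw [_root_.zpow_neg, ← _root_.inv_zpow]; norm_num
    rw [this, show ((d * n : ℤ) : ℂ) ^ 2 * τ' + 2 * ((d * n : ℤ) : ℂ) * (a * u) =
      n ^ 2 * d * (a * τ + b) + 2 * n * d * a * u by
        push_cast; linear_combination (n : ℂ) ^ 2 * d * h]
    ring
  simp only [uA_mul, uB_mul, uC_mul]
  rw [mul_comm x τ, mul_comm _ τ, uA_add, uB_add, uC_add, uA_mul, uB_mul, uC_mul, h₁, h₂, h₃,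
    mul_comm τ, mul_comm τ, mul_comm τ, key, key, key]
  have e1 := neg_one_zpow_aux hn b
  have e2 := neg_one_zpow_aux hn d
  set E : ℤ → ℂ → ℂ := fun n u => cexp (-(π * I * (n ^ 2 * d * (a * τ + b) + 2 * n * d * a * u))) with hE
  have e3 : E n₁ (uA z₁ z₂) ^ 5 * E n₂ (uB z₁ z₂) * E n₃ (uC z₁ z₂) =
      cexp (-(2 * π * I * (a * d * ((starRingEnd ℂ) x * z₁ + x * z₂ + x * (starRingEnd ℂ) x * τ)))) := by
    simp only [hE]
    rw [← Complex.exp_nat_mul, ← Complex.exp_add, ← Complex.exp_add]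
    have f1 := u_bilin x ((starRingEnd ℂ) x) x ((starRingEnd ℂ) x)
    have f2 := u_bilin x ((starRingEnd ℂ) x) z₁ z₂
    rw [h₁, h₂, h₃] at f1 f2
    rw [← mul_one (cexp (-(2 * π * I * _))), ← Complex.exp_int_mul_two_pi_mul_I (-(d * b * k)),
      ← Complex.exp_add]
    congr 1
    push_cast at hxx ⊢
    linear_combination (-(π * I * (d * (a * τ + b)))) * f1 - 2 * π * I * d * a * f2 -
      2 * π * I * d * b * hxx
  have e4 : ∀ (n : ℤ) (u : ℂ), cexp (-(π * I * (n ^ 2 * d * (a * τ + b) + 2 * n * d * a * u))) = E n u :=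
    fun _ _ => rfl
  rw [← e3]
  simp only [mul_pow, e4]
  set B₁ := ((-1 : ℂ) ^ (b * n₁)) ^ 5
  set D₁ := ((-1 : ℂ) ^ (d * n₁)) ^ 5
  set B₂ := (-1 : ℂ) ^ (b * n₂)
  set D₂ := (-1 : ℂ) ^ (d * n₂)
  set B₃ := (-1 : ℂ) ^ (b * n₃)
  set D₃ := (-1 : ℂ) ^ (d * n₃)
  calc _ = (B₁ * B₂ * B₃) * (D₁ * D₂ * D₃) * (E n₁ (uA z₁ z₂) ^ 5 * E n₂ (uB z₁ z₂) *
        E n₃ (uC z₁ z₂) * (thp τ' * th τ' (a * uA z₁ z₂) ^ 5 * th τ' (a * uB z₁ z₂) *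
        th τ' (a * uC z₁ z₂))) := by ring
    _ = _ := by rw [e1, e2]; ring

end PhiOne

section Hecke

open Complex Real

theorem jfac_ne_zero {g : Matrix (Fin 2) (Fin 2) ℤ} (hg : 0 < g.det) {τ : ℂ} (hτ : 0 < τ.im) :
    (g 1 0 : ℂ) * τ + g 1 1 ≠ 0 := by
  intro h
  have h1 := congrArg Complex.im h
  have h2 := congrArg Complex.re h
  simp at h1 h2
  have h3 : g 1 0 = 0 := by
    rcases h1 with h | h
    · exact h
    · exact absurd h hτ.ne'
  rw [h3] at h2
  simp at h2
  rw [Matrix.det_fin_two, h3, h2] at hg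
  simp at hg

theorem im_mob {g : Matrix (Fin 2) (Fin 2) ℤ} (hg : 0 < g.det) {τ : ℂ} (hτ : 0 < τ.im) :
    0 < (((g 0 0 : ℂ) * τ + g 0 1) / (g 1 0 * τ + g 1 1)).im := by
  have h := jfac_ne_zero hg hτ
  have h1 : (((g 0 0 : ℂ) * τ + g 0 1) / (g 1 0 * τ + g 1 1)).im =
      g.det * τ.im / Complex.normSq (g 1 0 * τ + g 1 1) := by
    rw [Complex.div_im, Matrix.det_fin_two]
    simp
    ring
  rw [h1]
  have : (0 : ℝ) < g.det := by exact_mod_cast hg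
  have := Complex.normSq_pos.2 h
  positivity

/-- The summand of the lift attached to an integral matrix. -/
def PhiM (M : Matrix (Fin 2) (Fin 2) ℤ) (Z : Matrix (Fin 2) (Fin 2) ℂ) : ℂ :=
  (M.det : ℂ) ^ 4 / (M 1 0 * Z 0 0 + M 1 1) ^ 5 *
    phi1 ((M 0 0 * Z 0 0 + M 0 1) / (M 1 0 * Z 0 0 + M 1 1))
      (M.det / (M 1 0 * Z 0 0 + M 1 1) * Z 0 1) (M.det / (M 1 0 * Z 0 0 + M 1 1) * Z 1 0) *
    cexp (2 * π * I * (M.det * (Z 1 1 - M 1 0 * Z 0 1 * Z 1 0 / (M 1 0 * Z 0 0 + M 1 1))))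

def gact (g : Matrix (Fin 2) (Fin 2) ℤ) (Z : Matrix (Fin 2) (Fin 2) ℂ) : Matrix (Fin 2) (Fin 2) ℂ :=
  !![(g 0 0 * Z 0 0 + g 0 1) / (g 1 0 * Z 0 0 + g 1 1), Z 0 1 / (g 1 0 * Z 0 0 + g 1 1);
    Z 1 0 / (g 1 0 * Z 0 0 + g 1 1), Z 1 1 - g 1 0 * Z 0 1 * Z 1 0 / (g 1 0 * Z 0 0 + g 1 1)]

theorem PhiM_gact {M g : Matrix (Fin 2) (Fin 2) ℤ} (hM : 0 < M.det) (hg : g.det = 1)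
    {Z : Matrix (Fin 2) (Fin 2) ℂ} (hZ : 0 < (Z 0 0).im) :
    PhiM M (gact g Z) = (g 1 0 * Z 0 0 + g 1 1) ^ 5 * PhiM (M * g) Z := by
  have hg0 : 0 < g.det := by rw [hg]; exact one_pos
  have h1 := jfac_ne_zero hg0 hZ
  have h2 := jfac_ne_zero hM (im_mob hg0 hZ)
  have h3 : 0 < (M * g).det := by rw [Matrix.det_mul, hg, mul_one]; exact hM
  have h4 := jfac_ne_zero h3 hZ
  have e0 : (M * g).det = M.det := by rw [Matrix.det_mul, hg, mul_one]
  have hgd : (g 0 0 : ℂ) * g 1 1 - g 0 1 * g 1 0 = 1 := by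
    rw [Matrix.det_fin_two] at hg; exact_mod_cast hg
  unfold PhiM
  simp only [gact, e0]
  simp only [Matrix.of_apply, Matrix.cons_val', Matrix.cons_val_zero, Matrix.cons_val_one,
    Matrix.cons_val_fin_one]
  set τ := Z 0 0
  set J := (g 1 0 : ℂ) * τ + g 1 1 with hJ
  set σ := ((g 0 0 : ℂ) * τ + g 0 1) / J with hσ
  set j := (M 1 0 : ℂ) * σ + M 1 1 with hj
  have e1 : (((M * g) 1 0 : ℤ) : ℂ) * τ + ((M * g) 1 1 : ℤ) = j * J := by
    rw [hj, hσ]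
    simp only [Matrix.mul_apply, Fin.sum_univ_two]
    push_cast
    field_simp
    rw [hJ]; ring
  have e2 : (((M * g) 0 0 : ℤ) : ℂ) * τ + ((M * g) 0 1 : ℤ) = (M 0 0 * σ + M 0 1) * J := by
    rw [hσ]
    simp only [Matrix.mul_apply, Fin.sum_univ_two]
    push_cast
    field_simp
    rw [hJ]; ring
  rw [e1, e2, mul_div_mul_right _ _ h1]
  have e3 : (M.det : ℂ) / j * (Z 0 1 / J) = M.det / (j * J) * Z 0 1 := by field_simp
  have e4 : (M.det : ℂ) / j * (Z 1 0 / J) = M.det / (j * J) * Z 1 0 := by field_simp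
  rw [e3, e4]
  have e5 : Z 1 1 - (g 1 0 : ℂ) * Z 0 1 * Z 1 0 / J - M 1 0 * (Z 0 1 / J) * (Z 1 0 / J) / j =
      Z 1 1 - ((M * g) 1 0 : ℤ) * Z 0 1 * Z 1 0 / (j * J) := by
    have : (((M * g) 1 0 : ℤ) : ℂ) = g 1 0 * j + M 1 0 / J := by
      rw [hj, hσ]
      simp only [Matrix.mul_apply, Fin.sum_univ_two]
      push_cast
      field_simp
      rw [hJ]; linear_combination (M 1 0 : ℂ) * hgd
    rw [this]
    field_simp
    ring
  rw [e5]
  field_simp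

theorem PhiM_T {M : Matrix (Fin 2) (Fin 2) ℤ} (hM : 0 < M.det)
    {Z : Matrix (Fin 2) (Fin 2) ℂ} (hZ : 0 < (Z 0 0).im) :
    PhiM (!![1, 1; 0, 1] * M) Z = PhiM M Z := by
  have h1 := jfac_ne_zero hM hZ
  have e0 : (!![1, 1; 0, 1] * M).det = M.det := by
    rw [Matrix.det_mul, Matrix.det_fin_two_of]; norm_num
  unfold PhiM
  rw [e0]
  have e1 : (!![1, 1; 0, 1] * M : Matrix (Fin 2) (Fin 2) ℤ) 1 0 = M 1 0 := by simp [Matrix.mul_apply, Fin.sum_univ_two]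
  have e2 : (!![1, 1; 0, 1] * M : Matrix (Fin 2) (Fin 2) ℤ) 1 1 = M 1 1 := by simp [Matrix.mul_apply, Fin.sum_univ_two]
  have e3 : (!![1, 1; 0, 1] * M : Matrix (Fin 2) (Fin 2) ℤ) 0 0 = M 0 0 + M 1 0 := by simp [Matrix.mul_apply, Fin.sum_univ_two]
  have e4 : (!![1, 1; 0, 1] * M : Matrix (Fin 2) (Fin 2) ℤ) 0 1 = M 0 1 + M 1 1 := by simp [Matrix.mul_apply, Fin.sum_univ_two]
  rw [e1, e2, e3, e4]
  have : (((M 0 0 + M 1 0 : ℤ) : ℂ) * Z 0 0 + (M 0 1 + M 1 1 : ℤ)) / (M 1 0 * Z 0 0 + M 1 1) =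
      (M 0 0 * Z 0 0 + M 0 1) / (M 1 0 * Z 0 0 + M 1 1) + 1 := by
    rw [div_add_one h1]; push_cast; ring
  rw [this, phi1_T (im_mob hM hZ)]

theorem PhiM_S {M : Matrix (Fin 2) (Fin 2) ℤ} (hM : 0 < M.det)
    {Z : Matrix (Fin 2) (Fin 2) ℂ} (hZ : 0 < (Z 0 0).im) :
    PhiM (!![0, -1; 1, 0] * M) Z = PhiM M Z := by
  have h1 := jfac_ne_zero hM hZ
  have him := im_mob hM hZ
  have e0 : (!![0, -1; 1, 0] * M).det = M.det := by
    rw [Matrix.det_mul, Matrix.det_fin_two_of]; norm_num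
  unfold PhiM
  rw [e0]
  have e1 : (!![0, -1; 1, 0] * M : Matrix (Fin 2) (Fin 2) ℤ) 1 0 = M 0 0 := by simp [Matrix.mul_apply, Fin.sum_univ_two]
  have e2 : (!![0, -1; 1, 0] * M : Matrix (Fin 2) (Fin 2) ℤ) 1 1 = M 0 1 := by simp [Matrix.mul_apply, Fin.sum_univ_two]
  have e3 : (!![0, -1; 1, 0] * M : Matrix (Fin 2) (Fin 2) ℤ) 0 0 = -M 1 0 := by simp [Matrix.mul_apply, Fin.sum_univ_two]
  have e4 : (!![0, -1; 1, 0] * M : Matrix (Fin 2) (Fin 2) ℤ) 0 1 = -M 1 1 := by simp [Matrix.mul_apply, Fin.sum_univ_two]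
  rw [e1, e2, e3, e4]
  set τ := Z 0 0
  set j := (M 1 0 : ℂ) * τ + M 1 1 with hj
  set σ := ((M 0 0 : ℂ) * τ + M 0 1) / j with hσ
  have hσ0 : σ ≠ 0 := by
    intro h; rw [h] at him; simp at him
  have e5 : (M 0 0 : ℂ) * τ + M 0 1 = σ * j := by rw [hσ]; field_simp
  have e6 : (((-M 1 0 : ℤ) : ℂ) * τ + (-M 1 1 : ℤ)) / (σ * j) = -1 / σ := by
    have : ((-M 1 0 : ℤ) : ℂ) * τ + (-M 1 1 : ℤ) = -j := by rw [hj]; push_cast; ring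
    rw [this]; field_simp
  rw [e5, e6]
  have e7 : ∀ z : ℂ, (M.det : ℂ) / (σ * j) * z = (M.det / j * z) / σ := fun z => by field_simp
  rw [e7, e7, phi1_S him]
  have hm : (M.det : ℂ) = M 0 0 * j - M 1 0 * (σ * j) := by
    rw [← e5, hj, Matrix.det_fin_two]; push_cast; ring
  have e8 : cexp (2 * π * I * (M.det / j * Z 0 1 * (M.det / j * Z 1 0) / σ)) *
      cexp (2 * π * I * (M.det * (Z 1 1 - M 0 0 * Z 0 1 * Z 1 0 / (σ * j)))) =
      cexp (2 * π * I * (M.det * (Z 1 1 - M 1 0 * Z 0 1 * Z 1 0 / j))) := by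
    rw [← Complex.exp_add]
    congr 1
    rw [← mul_add]
    congr 1
    have e9 : (M.det : ℂ) / (j * j * σ) = M 0 0 / (σ * j) - M 1 0 / j := by
      rw [hm]; field_simp
    have e10 : (M.det : ℂ) / j * Z 0 1 * (M.det / j * Z 1 0) / σ =
        M.det * Z 0 1 * Z 1 0 * (M.det / (j * j * σ)) := by field_simp
    rw [e10, e9]
    clear_value σ j
    ring
  rw [← e8]
  field_simp

open FixedDetMatrices in
/-- Every integral matrix of positive determinant reduces to a Hermite normal form. -/
theorem exists_reduced {m : ℕ} (hm : 0 < m) (A : Matrix (Fin 2) (Fin 2) ℤ) (hA : A.det = m) :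
    ∃ a d b : ℕ, b < d ∧ a * d = m ∧
      (∃ g : Matrix (Fin 2) (Fin 2) ℤ, g.det = 1 ∧ A = g * !![(a : ℤ), b; 0, d]) ∧
      ∀ Z : Matrix (Fin 2) (Fin 2) ℂ, 0 < (Z 0 0).im → PhiM A Z = PhiM !![(a : ℤ), b; 0, d] Z := by
  have key := induction_on (m := (m : ℤ)) (A := ⟨A, hA⟩) (C := fun B => ∃ a d b : ℕ, b < d ∧ a * d = m ∧
      (∃ g : Matrix (Fin 2) (Fin 2) ℤ, g.det = 1 ∧ B.1 = g * !![(a : ℤ), b; 0, d]) ∧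
      ∀ Z : Matrix (Fin 2) (Fin 2) ℂ, 0 < (Z 0 0).im → PhiM B.1 Z = PhiM !![(a : ℤ), b; 0, d] Z)
    (by exact_mod_cast hm.ne') ?_ ?_ ?_
  · exact key
  · intro B h1 h2 h3 h4
    have hB := B.2
    rw [Matrix.det_fin_two, h1, mul_zero, sub_zero] at hB
    have h5 : 0 < B.1 1 1 := by
      have : (0 : ℤ) < m := by exact_mod_cast hm
      rw [← hB] at this
      exact (pos_iff_pos_of_mul_pos this).1 h2
    rw [abs_of_nonneg h3, abs_of_pos h5] at h4
    have e1 : ((B.1 0 0).toNat : ℤ) = B.1 0 0 := Int.toNat_of_nonneg h2.le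
    have e2 : ((B.1 1 1).toNat : ℤ) = B.1 1 1 := Int.toNat_of_nonneg h5.le
    have e3 : ((B.1 0 1).toNat : ℤ) = B.1 0 1 := Int.toNat_of_nonneg h3
    have e4 : B.1 = !![((B.1 0 0).toNat : ℤ), ((B.1 0 1).toNat : ℤ); 0, ((B.1 1 1).toNat : ℤ)] := by
      rw [e1, e2, e3]
      ext i j; fin_cases i <;> fin_cases j <;> simp [h1]
    refine ⟨(B.1 0 0).toNat, (B.1 1 1).toNat, (B.1 0 1).toNat, by zify; rw [e2, e3]; exact h4,
      by zify; rw [e1, e2]; exact hB, ⟨1, by simp, ?_⟩, ?_⟩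
    · rw [one_mul]; exact e4
    · intro Z hZ
      rw [← e4]
  · rintro B ⟨a, d, b, h1, h2, ⟨g, hg, h3⟩, h4⟩
    have hB : 0 < B.1.det := by rw [B.2]; exact_mod_cast hm
    have e : (ModularGroup.S • B).1 = !![0, -1; 1, 0] * B.1 := rfl
    refine ⟨a, d, b, h1, h2, ⟨!![0, -1; 1, 0] * g, ?_, ?_⟩, fun Z hZ => ?_⟩
    · rw [Matrix.det_mul, hg, Matrix.det_fin_two_of]; norm_num
    · rw [e, h3, Matrix.mul_assoc]
    · rw [e, PhiM_S hB hZ, h4 Z hZ]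
  · rintro B ⟨a, d, b, h1, h2, ⟨g, hg, h3⟩, h4⟩
    have hB : 0 < B.1.det := by rw [B.2]; exact_mod_cast hm
    have e : (ModularGroup.T • B).1 = !![1, 1; 0, 1] * B.1 := rfl
    refine ⟨a, d, b, h1, h2, ⟨!![1, 1; 0, 1] * g, ?_, ?_⟩, fun Z hZ => ?_⟩
    · rw [Matrix.det_mul, hg, Matrix.det_fin_two_of]; norm_num
    · rw [e, h3, Matrix.mul_assoc]
    · rw [e, PhiM_T hB hZ, h4 Z hZ]

theorem reduced_unique {a d b a' d' b' : ℕ} (hb : b < d) (hb' : b' < d') (ha : 0 < a) (ha' : 0 < a')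
    {g : Matrix (Fin 2) (Fin 2) ℤ} (hg : g.det = 1)
    (h : !![(a : ℤ), b; 0, d] = g * !![(a' : ℤ), b'; 0, d']) : a = a' ∧ d = d' ∧ b = b' := by
  have h00 := congrFun (congrFun h 0) 0
  have h01 := congrFun (congrFun h 0) 1
  have h10 := congrFun (congrFun h 1) 0
  have h11 := congrFun (congrFun h 1) 1
  simp [Matrix.mul_apply, Fin.sum_univ_two] at h00 h01 h10 h11
  have hg10 : g 1 0 = 0 := by
    rcases h10 with h | h
    · exact h
    · omega
  rw [Matrix.det_fin_two, hg10, mul_zero, sub_zero] at hg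
  rw [hg10, zero_mul, zero_add] at h11
  have hp : 0 < g 0 0 := by
    have : 0 < g 0 0 * a' := by rw [← h00]; exact_mod_cast ha
    exact pos_of_mul_pos_left this (by positivity)
  have h1 : g 0 0 = 1 ∧ g 1 1 = 1 := by
    rcases Int.mul_eq_one_iff_eq_one_or_neg_one.1 hg with h | h
    · exact h
    · omega
  rw [h1.1, one_mul] at h00 h01
  rw [h1.2, one_mul] at h11
  have e1 : a = a' := by exact_mod_cast h00
  have e2 : d = d' := by exact_mod_cast h11
  refine ⟨e1, e2, ?_⟩
  have e3 : g 0 1 = 0 := by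
    rw [← h11] at h01
    have hb1 : (b : ℤ) < d := by exact_mod_cast hb
    have hb2 : (b' : ℤ) < d := by rw [e2]; exact_mod_cast hb'
    by_contra hne
    rcases lt_or_gt_of_ne hne with h | h
    · nlinarith
    · nlinarith
  rw [e3] at h01
  simpa using h01

/-- The index set of Hermite normal forms `[[p + 1, b], [0, q + 1]]`, `0 ≤ b ≤ q`. -/
abbrev HIdx := Σ p : ℕ × ℕ, Fin (p.2 + 1)

def HIdx.a (i : HIdx) : ℕ := i.1.1 + 1
def HIdx.d (i : HIdx) : ℕ := i.1.2 + 1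
def HIdx.b (i : HIdx) : ℕ := i.2

theorem HIdx.a_pos (i : HIdx) : 1 ≤ i.a := Nat.succ_pos _
theorem HIdx.d_pos (i : HIdx) : 1 ≤ i.d := Nat.succ_pos _

def HIdx.mat (i : HIdx) : Matrix (Fin 2) (Fin 2) ℤ := !![(i.a : ℤ), (i.b : ℤ); 0, (i.d : ℤ)]

theorem HIdx.det (i : HIdx) : i.mat.det = (i.a * i.d : ℕ) := by
  rw [HIdx.mat, Matrix.det_fin_two_of]; push_cast; ring

theorem HIdx.det_pos (i : HIdx) : 0 < i.mat.det := by
  rw [i.det]; exact_mod_cast Nat.mul_pos i.a_pos i.d_pos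

theorem HIdx.exists_rep (A : Matrix (Fin 2) (Fin 2) ℤ) (hA : 0 < A.det) : ∃ i : HIdx,
    (∃ g : Matrix (Fin 2) (Fin 2) ℤ, g.det = 1 ∧ A = g * i.mat) ∧
      ∀ Z : Matrix (Fin 2) (Fin 2) ℂ, 0 < (Z 0 0).im → PhiM A Z = PhiM i.mat Z := by
  obtain ⟨m, hm⟩ := Int.eq_ofNat_of_zero_le hA.le
  have hm0 : 0 < m := by omega
  obtain ⟨a, d, b, h1, h2, h3, h4⟩ := exists_reduced hm0 A hm
  obtain ⟨a, rfl⟩ : ∃ k, a = k + 1 := Nat.exists_eq_succ_of_ne_zero (by rintro rfl; omega)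
  obtain ⟨d, rfl⟩ : ∃ k, d = k + 1 := Nat.exists_eq_succ_of_ne_zero (by omega)
  exact ⟨⟨(a, d), ⟨b, h1⟩⟩, h3, h4⟩

theorem HIdx.unique {i j : HIdx} {g : Matrix (Fin 2) (Fin 2) ℤ} (hg : g.det = 1)
    (h : i.mat = g * j.mat) : i = j := by
  obtain ⟨⟨a, d⟩, ⟨b, hb⟩⟩ := i
  obtain ⟨⟨a', d'⟩, ⟨b', hb'⟩⟩ := j
  obtain ⟨h1, h2, h3⟩ := reduced_unique (a := a + 1) (d := d + 1) (a' := a' + 1) (d' := d' + 1)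
    hb hb' (by omega) (by omega) hg h
  obtain rfl : a = a' := by omega
  obtain rfl : d = d' := by omega
  obtain rfl : b = b' := h3
  rfl

/-- The permutation of normal forms induced by right multiplication. -/
theorem HIdx.exists_perm {g : Matrix (Fin 2) (Fin 2) ℤ} (hg : g.det = 1) : ∃ e : HIdx ≃ HIdx,
    ∀ i : HIdx, ∀ Z : Matrix (Fin 2) (Fin 2) ℂ, 0 < (Z 0 0).im →
      PhiM (i.mat * g) Z = PhiM (e i).mat Z := by
  have hdet : ∀ g : Matrix (Fin 2) (Fin 2) ℤ, g.det = 1 → ∀ i : HIdx, 0 < (i.mat * g).det :=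
    fun g hg i => by rw [Matrix.det_mul, hg, mul_one]; exact i.det_pos
  have hg' : g.adjugate.det = 1 := by rw [Matrix.det_adjugate, hg]; simp
  choose f hf1 hf2 using fun i : HIdx => HIdx.exists_rep (i.mat * g) (hdet g hg i)
  choose f' hf1' hf2' using fun i : HIdx => HIdx.exists_rep (i.mat * g.adjugate) (hdet _ hg' i)
  refine ⟨⟨f, f', fun i => ?_, fun i => ?_⟩, hf2⟩
  · obtain ⟨u, hu, e1⟩ := hf1 i
    obtain ⟨v, hv, e2⟩ := hf1' (f i)
    refine (HIdx.unique (i := i) (j := f' (f i)) (g := u * v) (by rw [Matrix.det_mul, hu, hv, one_mul]) ?_).symm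
    rw [Matrix.mul_assoc, ← e2, ← Matrix.mul_assoc, ← e1, Matrix.mul_assoc, Matrix.mul_adjugate, hg,
      one_smul, Matrix.mul_one]
  · obtain ⟨u, hu, e1⟩ := hf1' i
    obtain ⟨v, hv, e2⟩ := hf1 (f' i)
    refine (HIdx.unique (i := i) (j := f (f' i)) (g := u * v) (by rw [Matrix.det_mul, hu, hv, one_mul]) ?_).symm
    rw [Matrix.mul_assoc, ← e2, ← Matrix.mul_assoc, ← e1, Matrix.mul_assoc, Matrix.adjugate_mul, hg,
      one_smul, Matrix.mul_one]

/-- The additive lift of `phi1`. -/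
def b5 (Z : Matrix (Fin 2) (Fin 2) ℂ) : ℂ := ∑' i : HIdx, PhiM i.mat Z

theorem b5_gact {g : Matrix (Fin 2) (Fin 2) ℤ} (hg : g.det = 1)
    {Z : Matrix (Fin 2) (Fin 2) ℂ} (hZ : 0 < (Z 0 0).im) :
    b5 (gact g Z) = (g 1 0 * Z 0 0 + g 1 1) ^ 5 * b5 Z := by
  obtain ⟨e, he⟩ := HIdx.exists_perm hg
  unfold b5
  rw [← e.tsum_eq (fun i => PhiM i.mat Z), ← tsum_mul_left]
  refine tsum_congr fun i => ?_
  rw [PhiM_gact i.det_pos hg hZ, he i Z hZ]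

theorem PhiM_mat (i : HIdx) (Z : Matrix (Fin 2) (Fin 2) ℂ) : PhiM i.mat Z =
    (i.a : ℂ) ^ 4 / (i.d : ℂ) *
    phi1 (((i.a : ℂ) * Z 0 0 + (i.b : ℂ)) / (i.d : ℂ)) ((i.a : ℂ) * Z 0 1) ((i.a : ℂ) * Z 1 0) *
    cexp (2 * π * I * ((i.a : ℂ) * (i.d : ℂ) * Z 1 1)) := by
  have h0 : (i.d : ℂ) ≠ 0 := by
    have := i.d_pos
    exact_mod_cast (by omega : i.d ≠ 0)
  unfold PhiM
  rw [i.det]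
  simp only [HIdx.mat, Matrix.of_apply, Matrix.cons_val', Matrix.cons_val_zero, Matrix.cons_val_one,
    Matrix.cons_val_fin_one]
  generalize i.a = a
  generalize i.d = d at h0
  have e1 : (((a * d : ℕ) : ℤ) : ℂ) / (((0 : ℤ) : ℂ) * Z 0 0 + ((d : ℤ) : ℂ)) = a := by
    push_cast; rw [zero_mul, zero_add]; field_simp
  rw [e1]
  push_cast
  simp only [zero_mul, zero_add, zero_div, sub_zero]
  congr 2
  field_simp

theorem b5_transpose (Z : Matrix (Fin 2) (Fin 2) ℂ) : b5 Zᵀ = -b5 Z := by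
  unfold b5
  rw [← tsum_neg]
  refine tsum_congr fun i => ?_
  rw [PhiM_mat, PhiM_mat]
  simp only [Matrix.transpose_apply]
  rw [show ∀ c : ℂ, phi1 c ((i.a : ℂ) * Z 1 0) ((i.a : ℂ) * Z 0 1) =
    -phi1 c ((i.a : ℂ) * Z 0 1) ((i.a : ℂ) * Z 1 0) from fun c => phi1_swap _ _ _]
  ring

end Hecke

section Convergence

open Complex Real

theorem im_u_eq (z₁ z₂ : ℂ) :
    ((uA z₁ z₂).im : ℂ) = uA (z₁ - (starRingEnd ℂ) z₂) (z₂ - (starRingEnd ℂ) z₁) / (2 * I) ∧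
    ((uB z₁ z₂).im : ℂ) = uB (z₁ - (starRingEnd ℂ) z₂) (z₂ - (starRingEnd ℂ) z₁) / (2 * I) ∧
    ((uC z₁ z₂).im : ℂ) = uC (z₁ - (starRingEnd ℂ) z₂) (z₂ - (starRingEnd ℂ) z₁) / (2 * I) := by
  have h : ∀ u : ℂ, (u.im : ℂ) = (u - (starRingEnd ℂ) u) / (2 * I) := fun u => by
    rw [Complex.im_eq_sub_conj]
  have hs := s11_ne
  refine ⟨?_, ?_, ?_⟩
  all_goals
    rw [h]
    congr 1
    first
      | unfold uA
      | unfold uB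
      | unfold uC
    simp only [map_div₀, map_sub, map_mul, map_one, conj_om, conj_s11]
    field_simp
    ring

theorem im_u_sq (z₁ z₂ : ℂ) : 5 * (uA z₁ z₂).im ^ 2 + (uB z₁ z₂).im ^ 2 + (uC z₁ z₂).im ^ 2 =
    Complex.normSq (z₁ - (starRingEnd ℂ) z₂) / 2 := by
  obtain ⟨h1, h2, h3⟩ := im_u_eq z₁ z₂
  set x := z₁ - (starRingEnd ℂ) z₂ with hx
  have hy : z₂ - (starRingEnd ℂ) z₁ = -(starRingEnd ℂ) x := by
    rw [hx]; simp
  rw [hy] at h1 h2 h3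
  have h := u_bilin x (-(starRingEnd ℂ) x) x (-(starRingEnd ℂ) x)
  have hn := Complex.mul_conj x
  have : ((5 * (uA z₁ z₂).im ^ 2 + (uB z₁ z₂).im ^ 2 + (uC z₁ z₂).im ^ 2 : ℝ) : ℂ) =
      ((Complex.normSq x / 2 : ℝ) : ℂ) := by
    push_cast
    rw [h1, h2, h3, ← hn]
    have hI := Complex.I_sq
    simp only [div_pow, mul_pow, hI]
    linear_combination -1 / 4 * h
  exact_mod_cast this

def pphi (t : ℝ) : ℝ := 2 * π * ((3 + 4 * t) * (2 + 4 * t)) * (4 * (1 + t)) ^ 7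

theorem pphi_pos {t : ℝ} (ht : 0 ≤ t) : 0 < pphi t := by
  unfold pphi; positivity

theorem pphi_mul_le {m t s : ℝ} (hm : 1 ≤ m) (ht : 0 ≤ t) (hts : t ≤ s) :
    pphi (m * t) ≤ m ^ 9 * pphi s := by
  have h1 : 3 + 4 * (m * t) ≤ m * (3 + 4 * s) := by nlinarith
  have h2 : 2 + 4 * (m * t) ≤ m * (2 + 4 * s) := by nlinarith
  have h3 : 4 * (1 + m * t) ≤ m * (4 * (1 + s)) := by nlinarith
  have hs : 0 ≤ s := ht.trans hts
  have h0 : 0 ≤ m * t := by positivity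
  unfold pphi
  calc 2 * π * ((3 + 4 * (m * t)) * (2 + 4 * (m * t))) * (4 * (1 + m * t)) ^ 7
      ≤ 2 * π * ((m * (3 + 4 * s)) * (m * (2 + 4 * s))) * (m * (4 * (1 + s))) ^ 7 := by
        refine mul_le_mul ?_ (pow_le_pow_left₀ (by positivity) h3 _) (by positivity) (by positivity)
        exact mul_le_mul_of_nonneg_left (mul_le_mul h1 h2 (by positivity) (by positivity))
          (by positivity)
    _ = _ := by ring

theorem phi1_bound' {τ : ℂ} (hτ : 0 < τ.im) (z₁ z₂ : ℂ) : ‖phi1 τ z₁ z₂‖ ≤ pphi (1 / τ.im) *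
    rexp (π * Complex.normSq (z₁ - (starRingEnd ℂ) z₂) / (2 * τ.im)) * rexp (-(π * τ.im / 4)) := by
  have h0 : ‖thp τ‖ ≤ 2 * π * ((3 + 4 * (1 / τ.im)) * (2 + 4 * (1 / τ.im))) * rexp (-(π * τ.im / 4)) := by
    refine (thp_bound hτ).trans (le_of_eq ?_)
    rw [mul_one_div]
  unfold phi1 pphi
  rw [norm_mul, norm_mul, norm_mul, norm_pow]
  have e : rexp (π * Complex.normSq (z₁ - (starRingEnd ℂ) z₂) / (2 * τ.im)) =
      rexp (π * (uA z₁ z₂).im ^ 2 / τ.im) ^ 5 * rexp (π * (uB z₁ z₂).im ^ 2 / τ.im) *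
        rexp (π * (uC z₁ z₂).im ^ 2 / τ.im) := by
    rw [← Real.exp_nat_mul, ← Real.exp_add, ← Real.exp_add]
    congr 1
    have := im_u_sq z₁ z₂
    field_simp
    push_cast
    linear_combination -2 * this
  rw [e]
  have hA := th_bound hτ (uA z₁ z₂)
  have hB := th_bound hτ (uB z₁ z₂)
  have hC := th_bound hτ (uC z₁ z₂)
  have hp : 0 ≤ 4 * (1 + 1 / τ.im) := by positivity
  calc ‖thp τ‖ * ‖th τ (uA z₁ z₂)‖ ^ 5 * ‖th τ (uB z₁ z₂)‖ * ‖th τ (uC z₁ z₂)‖ ≤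
      (2 * π * ((3 + 4 * (1 / τ.im)) * (2 + 4 * (1 / τ.im))) * rexp (-(π * τ.im / 4))) *
        (4 * (1 + 1 / τ.im) * rexp (π * (uA z₁ z₂).im ^ 2 / τ.im)) ^ 5 *
        (4 * (1 + 1 / τ.im) * rexp (π * (uB z₁ z₂).im ^ 2 / τ.im)) *
        (4 * (1 + 1 / τ.im) * rexp (π * (uC z₁ z₂).im ^ 2 / τ.im)) := by
        refine mul_le_mul (mul_le_mul (mul_le_mul h0 (pow_le_pow_left₀ (norm_nonneg _) hA _)
          (by positivity) (by positivity)) hB (norm_nonneg _) (by positivity)) hC (norm_nonneg _)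
          (by positivity)
    _ = _ := by ring

theorem phi1_bound {τ : ℂ} (hτ : 0 < τ.im) (z₁ z₂ : ℂ) : ‖phi1 τ z₁ z₂‖ ≤ pphi (1 / τ.im) *
    rexp (π * Complex.normSq (z₁ - (starRingEnd ℂ) z₂) / (2 * τ.im)) := by
  have hp : 0 < pphi (1 / τ.im) := pphi_pos (by positivity)
  refine (phi1_bound' hτ z₁ z₂).trans (mul_le_of_le_one_right (by positivity) ?_)
  refine Real.exp_le_one_iff.2 ?_
  have : 0 ≤ π * τ.im / 4 := by positivity
  linarith

theorem im_hecke {τ : ℂ} (a b d : ℕ) (hd : 1 ≤ d) : (((a : ℂ) * τ + b) / d).im = a * τ.im / d := by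
  have : (((a : ℂ) * τ + b) / d) = (((a : ℂ) * τ + b) / ((d : ℝ) : ℂ)) := by push_cast; rfl
  rw [this, Complex.div_ofReal_im]
  simp

/-- The height `det Y / y₁` of the standard cusp. -/
def vht (Z : Matrix (Fin 2) (Fin 2) ℂ) : ℝ := detY Z / (Z 0 0).im

theorem norm_cexp_two_pi (z : ℂ) : ‖cexp (2 * π * I * z)‖ = rexp (-(2 * π * z.im)) := by
  rw [Complex.norm_exp]
  congr 1
  simp [mul_assoc, Complex.mul_re]

def HIdx.m (i : HIdx) : ℕ := i.a * i.d

theorem HIdx.one_le_m (i : HIdx) : 1 ≤ i.m := Nat.mul_pos i.a_pos i.d_pos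

theorem PhiM_bound (i : HIdx) {Z : Matrix (Fin 2) (Fin 2) ℂ} {y₀ : ℝ} (hy₀ : 0 < y₀)
    (hy : y₀ ≤ (Z 0 0).im) : ‖PhiM i.mat Z‖ ≤
      pphi (1 / y₀) * ((i.m : ℝ) ^ 13 * rexp (-(2 * π * i.m * vht Z))) := by
  have hy' := hy₀.trans_le hy
  have ha : (1 : ℝ) ≤ i.a := by exact_mod_cast i.a_pos
  have hd : (1 : ℝ) ≤ i.d := by exact_mod_cast i.d_pos
  have hm : (i.m : ℝ) = i.a * i.d := by unfold HIdx.m; push_cast; ring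
  have him : 0 < (((i.a : ℂ) * Z 0 0 + i.b) / i.d).im := by
    rw [im_hecke _ _ _ i.d_pos]; positivity
  rw [PhiM_mat, norm_mul, norm_mul, norm_cexp_two_pi]
  have h1 := phi1_bound him (i.a * Z 0 1) (i.a * Z 1 0)
  rw [im_hecke _ _ _ i.d_pos] at h1
  have h2 : (i.a : ℂ) * Z 0 1 - (starRingEnd ℂ) (i.a * Z 1 0) =
      (i.a : ℂ) * (Z 0 1 - (starRingEnd ℂ) (Z 1 0)) := by
    simp; ring
  rw [h2, Complex.normSq_mul] at h1
  have h3 : Complex.normSq (i.a : ℂ) = (i.a : ℝ) ^ 2 := by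
    rw [Complex.normSq_natCast]; ring
  rw [h3] at h1
  set n := Complex.normSq (Z 0 1 - (starRingEnd ℂ) (Z 1 0)) with hn
  have h4 : pphi (1 / (i.a * (Z 0 0).im / i.d)) ≤ (i.m : ℝ) ^ 9 * pphi (1 / y₀) := by
    have e : 1 / (i.a * (Z 0 0).im / i.d) = (i.m : ℝ) * (1 / (i.a ^ 2 * (Z 0 0).im)) := by
      rw [hm]; field_simp
    rw [e]
    refine pphi_mul_le (by rw [hm]; nlinarith) (by positivity) ?_
    refine one_div_le_one_div_of_le hy₀ ?_
    nlinarith [one_le_pow₀ ha (n := 2)]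
  have h5 : ‖(i.a : ℂ) ^ 4 / (i.d : ℂ)‖ ≤ (i.m : ℝ) ^ 4 := by
    rw [norm_div, norm_pow, Complex.norm_natCast, Complex.norm_natCast, hm]
    refine (div_le_self (by positivity) hd).trans ?_
    exact pow_le_pow_left₀ (by positivity) (le_mul_of_one_le_right (by positivity) hd) _
  have h6 : rexp (π * (i.a ^ 2 * n) / (2 * (i.a * (Z 0 0).im / i.d))) *
      rexp (-(2 * π * ((i.a : ℂ) * (i.d : ℂ) * Z 1 1).im)) = rexp (-(2 * π * i.m * vht Z)) := by
    rw [← Real.exp_add]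
    congr 1
    have e : ((i.a : ℂ) * (i.d : ℂ) * Z 1 1).im = i.a * i.d * (Z 1 1).im := by
      have : (i.a : ℂ) * (i.d : ℂ) = ((i.a * i.d : ℝ) : ℂ) := by push_cast; rfl
      rw [this, Complex.im_ofReal_mul]
    rw [e, hm, vht, detY, ← hn]
    field_simp
    ring
  have hp : 0 < pphi (1 / y₀) := pphi_pos (by positivity)
  calc _ ≤ (i.m : ℝ) ^ 4 * (((i.m : ℝ) ^ 9 * pphi (1 / y₀)) *
        rexp (π * (i.a ^ 2 * n) / (2 * (i.a * (Z 0 0).im / i.d)))) *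
        rexp (-(2 * π * ((i.a : ℂ) * (i.d : ℂ) * Z 1 1).im)) := by
        refine mul_le_mul_of_nonneg_right (mul_le_mul h5 (h1.trans ?_) (norm_nonneg _)
          (by positivity)) (Real.exp_pos _).le
        exact mul_le_mul_of_nonneg_right h4 (Real.exp_pos _).le
    _ = _ := by rw [← h6]; ring

theorem pow_mul_exp_le (k : ℕ) {c : ℝ} (hc : 0 < c) {x : ℝ} (hx : 0 ≤ x) :
    x ^ k * rexp (-(c * x)) ≤ (k.factorial * (2 / c) ^ k) * rexp (-(c / 2 * x)) := by
  have h := Real.pow_div_factorial_le_exp (x := c / 2 * x) (by positivity) k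
  rw [div_le_iff₀ (by positivity)] at h
  have h1 : x ^ k = (2 / c) ^ k * (c / 2 * x) ^ k := by
    rw [← mul_pow]; congr 1; field_simp
  have h2 : rexp (-(c * x)) = rexp (-(c / 2 * x)) * rexp (-(c / 2 * x)) := by
    rw [← Real.exp_add]; congr 1; ring
  have h3 : rexp (c / 2 * x) * rexp (-(c / 2 * x)) = 1 := by rw [← Real.exp_add]; simp
  rw [h1, h2]
  calc (2 / c) ^ k * (c / 2 * x) ^ k * (rexp (-(c / 2 * x)) * rexp (-(c / 2 * x)))
      ≤ (2 / c) ^ k * (rexp (c / 2 * x) * k.factorial) * (rexp (-(c / 2 * x)) * rexp (-(c / 2 * x))) := by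
        refine mul_le_mul_of_nonneg_right (mul_le_mul_of_nonneg_left h (by positivity)) (by positivity)
    _ = k.factorial * (2 / c) ^ k * (rexp (c / 2 * x) * rexp (-(c / 2 * x))) * rexp (-(c / 2 * x)) := by ring
    _ = _ := by rw [h3, mul_one]

theorem summable_exp_prod {c : ℝ} (hc : 0 < c) :
    Summable fun p : ℕ × ℕ => rexp (-(c * ((p.1 + 1) * (p.2 + 1)))) := by
  have h1 : Summable fun n : ℕ => rexp (-(c * n)) := (exp_geom_le hc).1.summable
  have h2 := h1.mul_of_nonneg h1 (fun _ => (Real.exp_pos _).le) (fun _ => (Real.exp_pos _).le)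
  refine Summable.of_nonneg_of_le (fun _ => (Real.exp_pos _).le) (fun p => ?_) h2
  rw [← Real.exp_add]
  refine Real.exp_le_exp.2 ?_
  have : (0 : ℝ) ≤ c * (p.1 * p.2 + 1) := by positivity
  nlinarith

theorem HIdx.summable (k : ℕ) {c : ℝ} (hc : 0 < c) :
    Summable fun i : HIdx => (i.m : ℝ) ^ k * rexp (-(c * i.m)) := by
  refine (summable_sigma_of_nonneg (fun _ => by positivity)).2 ⟨fun p => (hasSum_fintype _).summable, ?_⟩
  have h := (summable_exp_prod (half_pos hc)).mul_left (((k + 1).factorial : ℝ) * (2 / c) ^ (k + 1))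
  refine Summable.of_nonneg_of_le (fun p => tsum_nonneg fun _ => by positivity) (fun p => ?_) h
  rw [tsum_fintype]
  have e : ∀ x : Fin (p.2 + 1), (HIdx.m ⟨p, x⟩ : ℝ) = (p.1 + 1) * (p.2 + 1) := fun x => by
    unfold HIdx.m HIdx.a HIdx.d; push_cast; ring
  simp only [e, Finset.sum_const, Finset.card_univ, Fintype.card_fin, nsmul_eq_mul]
  refine le_trans ?_ (pow_mul_exp_le (k + 1) hc (x := (p.1 + 1) * (p.2 + 1)) (by positivity))
  rw [pow_succ', ← mul_assoc]
  refine mul_le_mul_of_nonneg_right (mul_le_mul_of_nonneg_right ?_ (by positivity)) (Real.exp_pos _).le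
  push_cast
  nlinarith [(Nat.cast_nonneg p.1 : (0 : ℝ) ≤ p.1), (Nat.cast_nonneg p.2 : (0 : ℝ) ≤ p.2)]

theorem differentiableAt_phi1 {E : Type*} [NormedAddCommGroup E] [NormedSpace ℂ E] {f g h : E → ℂ}
    {x : E} (hx : 0 < (f x).im) (hf : DifferentiableAt ℂ f x) (hg : DifferentiableAt ℂ g x)
    (hh : DifferentiableAt ℂ h x) : DifferentiableAt ℂ (fun y => phi1 (f y) (g y) (h y)) x := by
  have hth : ∀ u : E → ℂ, DifferentiableAt ℂ u x → DifferentiableAt ℂ (fun y => th (f y) (u y)) x :=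
    fun u hu => by
      have h1 : DifferentiableAt ℂ (fun p : ℂ × ℂ => th p.1 p.2) ((fun y => (f y, u y)) x) :=
        differentiableAt_th hx
      have h2 : DifferentiableAt ℂ (fun y => (f y, u y)) x := hf.prodMk hu
      exact h1.comp x h2
  have hthp : DifferentiableAt ℂ (fun y => thp (f y)) x :=
    DifferentiableAt.comp (g := thp) x
      (differentiableOn_thp.differentiableAt ((isOpen_lt continuous_const Complex.continuous_im).mem_nhds hx)) hf
  unfold phi1
  refine ((hthp.mul ((hth _ ?_).pow 5)).mul (hth _ ?_)).mul (hth _ ?_)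
  · unfold uA
    simp only [div_eq_mul_inv]
    exact (hg.sub hh).mul_const _
  · unfold uB
    simp only [div_eq_mul_inv]
    exact ((hg.const_mul _).sub (hh.const_mul _)).mul_const _
  · unfold uC
    simp only [div_eq_mul_inv]
    exact ((hg.const_mul _).sub (hh.const_mul _)).mul_const _

theorem differentiableAt_PhiM (i : HIdx) {Z : Matrix (Fin 2) (Fin 2) ℂ} (hZ : 0 < (Z 0 0).im) :
    DifferentiableAt ℂ (PhiM i.mat) Z := by
  rw [show PhiM i.mat = _ from funext (PhiM_mat i)]
  have ha : (1 : ℝ) ≤ i.a := by exact_mod_cast i.a_pos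
  have hd : (1 : ℝ) ≤ i.d := by exact_mod_cast i.d_pos
  have him : 0 < (((i.a : ℂ) * Z 0 0 + i.b) / i.d).im := by
    rw [im_hecke _ _ _ i.d_pos]; positivity
  have h := fun p q => (differentiable_entry p q) Z
  have h1 : DifferentiableAt ℂ (fun Z : Matrix (Fin 2) (Fin 2) ℂ => ((i.a : ℂ) * Z 0 0 + i.b) / i.d) Z :=
    by
      simp only [div_eq_mul_inv]
      exact (((h 0 0).const_mul _).fun_add (differentiableAt_const _)).mul_const _
  exact ((differentiableAt_phi1 (f := fun Z : Matrix (Fin 2) (Fin 2) ℂ => ((i.a : ℂ) * Z 0 0 + i.b) / i.d)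
    him h1 ((h 0 1).const_mul _) ((h 1 0).const_mul _)).const_mul _).mul
    (((h 1 1).const_mul _).const_mul _).cexp

theorem continuous_im_entry (p q : Fin 2) :
    Continuous fun Z : Matrix (Fin 2) (Fin 2) ℂ => (Z p q).im :=
  Complex.continuous_im.comp (differentiable_entry p q).continuous

theorem vht_pos {Z : Matrix (Fin 2) (Fin 2) ℂ} (hZ : Z ∈ HH2) : 0 < vht Z :=
  div_pos (HH2_detY_pos hZ) (HH2_im_pos hZ)

theorem continuousAt_vht {Z : Matrix (Fin 2) (Fin 2) ℂ} (hZ : Z ∈ HH2) : ContinuousAt vht Z :=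
  continuous_detY.continuousAt.div (continuous_im_entry 0 0).continuousAt (HH2_im_pos hZ).ne'

theorem b5_locally_bounded {Z : Matrix (Fin 2) (Fin 2) ℂ} (hZ : Z ∈ HH2) :
    ∃ U ∈ 𝓝 Z, ∃ u : HIdx → ℝ, Summable u ∧ ∀ i, ∀ W ∈ U, ‖PhiM i.mat W‖ ≤ u i := by
  have hy := HH2_im_pos hZ
  have hv := vht_pos hZ
  have h1 : ∀ᶠ W in 𝓝 Z, (Z 0 0).im / 2 < (W 0 0).im :=
    (continuous_im_entry 0 0).continuousAt.eventually (lt_mem_nhds (half_lt_self hy))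
  have h2 : ∀ᶠ W in 𝓝 Z, vht Z / 2 < vht W :=
    (continuousAt_vht hZ).eventually (lt_mem_nhds (half_lt_self hv))
  refine ⟨_, h1.and h2, _, ((HIdx.summable 13 (c := π * vht Z) (by positivity)).mul_left
    (pphi (1 / ((Z 0 0).im / 2)))), fun i W hW => ?_⟩
  refine (PhiM_bound i (half_pos hy) hW.1.le).trans ?_
  have hp : 0 < pphi (1 / ((Z 0 0).im / 2)) := pphi_pos (by positivity)
  refine mul_le_mul_of_nonneg_left (mul_le_mul_of_nonneg_left (Real.exp_le_exp.2 ?_) (by positivity)) hp.le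
  have hm : (1 : ℝ) ≤ i.m := by exact_mod_cast i.one_le_m
  have : π * i.m * (2 * (vht W - vht Z / 2)) ≥ 0 := by
    have := hW.2
    have : 0 ≤ vht W - vht Z / 2 := by linarith
    positivity
  linarith

theorem summable_PhiM {Z : Matrix (Fin 2) (Fin 2) ℂ} (hZ : Z ∈ HH2) :
    Summable fun i : HIdx => PhiM i.mat Z := by
  obtain ⟨U, hU, u, hu, h⟩ := b5_locally_bounded hZ
  exact Summable.of_norm_bounded hu fun i => h i Z (mem_of_mem_nhds hU)

theorem differentiableOn_b5 : DifferentiableOn ℂ b5 HH2 :=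
  differentiableOn_tsum_of_locally_bounded isOpen_HH2
    (fun i _ hZ => (differentiableAt_PhiM i (HH2_im_pos hZ)).differentiableWithinAt)
    (fun _ hZ => b5_locally_bounded hZ)

end Convergence

section Generators

open Complex Real

theorem moebius_of_mul {M : Matrix (Fin 4) (Fin 4) ℂ} {Z W : Matrix (Fin 2) (Fin 2) ℂ}
    (h : (autM M Z).det ≠ 0) (hW : W * autM M Z = numM M Z) : moebius M Z = W := by
  rw [moebius_eq, ← hW, Matrix.mul_assoc, Matrix.mul_nonsing_inv _ h.isUnit, Matrix.mul_one]

theorem autM_tM (p : ℝ) (x : ℂ) (q : ℝ) (Z : Matrix (Fin 2) (Fin 2) ℂ) : autM (tM p x q) Z = 1 := by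
  ext i j; fin_cases i <;> fin_cases j <;>
  simp [autM, blkC, blkD, tM, Fin.sum_univ_two, Matrix.vecMul, dotProduct]

theorem moebius_tM (p : ℝ) (x : ℂ) (q : ℝ) (Z : Matrix (Fin 2) (Fin 2) ℂ) :
    moebius (tM p x q) Z = Z + !![(p : ℂ), x; (starRingEnd ℂ) x, (q : ℂ)] := by
  refine moebius_of_mul (by rw [autM_tM]; simp) ?_
  rw [autM_tM, Matrix.mul_one]
  ext i j; fin_cases i <;> fin_cases j <;>
  simp [numM, blkA, blkB, tM, Fin.sum_univ_two, Matrix.vecMul, dotProduct]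

theorem autM_lM (α β γ δ : ℂ) (Z : Matrix (Fin 2) (Fin 2) ℂ) :
    autM (lM α β γ δ) Z = !![(starRingEnd ℂ) δ, -(starRingEnd ℂ) γ; -(starRingEnd ℂ) β, (starRingEnd ℂ) α] := by
  ext i j; fin_cases i <;> fin_cases j <;>
  simp [autM, blkC, blkD, lM, Fin.sum_univ_two, Matrix.vecMul, dotProduct]

theorem det_autM_lM {α β γ δ : ℂ} (h : α * δ - β * γ = 1) (Z : Matrix (Fin 2) (Fin 2) ℂ) :
    (autM (lM α β γ δ) Z).det = 1 := by
  rw [autM_lM, Matrix.det_fin_two_of]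
  have := congrArg (starRingEnd ℂ) h
  simp only [map_sub, map_mul, map_one] at this
  linear_combination this

theorem conj_fin_two (α β γ δ : ℂ) (Z : Matrix (Fin 2) (Fin 2) ℂ) (i j : Fin 2) :
    (!![α, β; γ, δ] * Z * !![α, β; γ, δ]ᴴ) i j =
      (!![α, β; γ, δ] i 0 * Z 0 0 + !![α, β; γ, δ] i 1 * Z 1 0) * (starRingEnd ℂ) (!![α, β; γ, δ] j 0) +
      (!![α, β; γ, δ] i 0 * Z 0 1 + !![α, β; γ, δ] i 1 * Z 1 1) * (starRingEnd ℂ) (!![α, β; γ, δ] j 1) := by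
  simp only [Matrix.mul_apply, Fin.sum_univ_two, Matrix.conjTranspose_apply]
  rfl

theorem moebius_lM {α β γ δ : ℂ} (h : α * δ - β * γ = 1) (Z : Matrix (Fin 2) (Fin 2) ℂ) :
    moebius (lM α β γ δ) Z = !![α, β; γ, δ] * Z * !![α, β; γ, δ]ᴴ := by
  refine moebius_of_mul (by rw [det_autM_lM h]; simp) ?_
  have e : !![α, β; γ, δ]ᴴ * autM (lM α β γ δ) Z = 1 := by
    have := congrArg (starRingEnd ℂ) h
    simp only [map_sub, map_mul, map_one] at this
    rw [autM_lM]
    ext i j; fin_cases i <;> fin_cases j <;>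
    simp [Matrix.mul_apply, Fin.sum_univ_two] <;> first | linear_combination this | ring
  rw [Matrix.mul_assoc, e, Matrix.mul_one]
  ext i j; fin_cases i <;> fin_cases j <;>
  simp [numM, blkA, blkB, lM, Matrix.mul_apply, Fin.sum_univ_two, Matrix.vecMul, dotProduct]

theorem autM_sM (Z : Matrix (Fin 2) (Fin 2) ℂ) : autM sM Z = !![0, 1; 1, 0] := by
  ext i j; fin_cases i <;> fin_cases j <;>
  simp [autM, blkC, blkD, sM, Fin.sum_univ_two, Matrix.vecMul, dotProduct]

theorem moebius_sM (Z : Matrix (Fin 2) (Fin 2) ℂ) :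
    moebius sM Z = !![Z 1 1, Z 1 0; Z 0 1, Z 0 0] := by
  refine moebius_of_mul (by rw [autM_sM, Matrix.det_fin_two_of]; norm_num) ?_
  rw [autM_sM]
  ext i j; fin_cases i <;> fin_cases j <;>
  simp [numM, blkA, blkB, sM, Matrix.mul_apply, Fin.sum_univ_two, Matrix.vecMul, dotProduct]

theorem autM_jM (a b c d : ℝ) (Z : Matrix (Fin 2) (Fin 2) ℂ) :
    autM (jM a b c d) Z = !![(c : ℂ) * Z 0 0 + d, c * Z 0 1; 0, 1] := by
  ext i j; fin_cases i <;> fin_cases j <;>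
  simp [autM, blkC, blkD, jM, Fin.sum_univ_two, Matrix.vecMul, dotProduct]

theorem det_autM_jM (a b c d : ℝ) (Z : Matrix (Fin 2) (Fin 2) ℂ) :
    (autM (jM a b c d) Z).det = (c : ℂ) * Z 0 0 + d := by
  rw [autM_jM, Matrix.det_fin_two_of]; ring

theorem moebius_jM {a b c d : ℝ} (h : a * d - b * c = 1) {Z : Matrix (Fin 2) (Fin 2) ℂ}
    (h0 : (c : ℂ) * Z 0 0 + d ≠ 0) :
    moebius (jM a b c d) Z = !![(a * Z 0 0 + b) / (c * Z 0 0 + d), Z 0 1 / (c * Z 0 0 + d);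
      Z 1 0 / (c * Z 0 0 + d), Z 1 1 - c * Z 0 1 * Z 1 0 / (c * Z 0 0 + d)] := by
  refine moebius_of_mul (by rw [det_autM_jM]; exact h0) ?_
  have h' : (a : ℂ) * d - b * c = 1 := by exact_mod_cast h
  rw [autM_jM]
  ext i j; fin_cases i <;> fin_cases j <;>
  simp [numM, blkA, blkB, jM, Matrix.mul_apply, Fin.sum_univ_two, Matrix.vecMul, dotProduct]
  · rw [mul_comm (c : ℂ)] at h0 ⊢
    rw [div_mul_cancel₀ _ h0]
  · rw [mul_comm (c : ℂ) (Z 0 0)] at h0 ⊢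
    rw [div_mul_eq_mul_div, div_add_div _ _ h0 h0, div_eq_iff (mul_ne_zero h0 h0)]
    linear_combination -(Z 0 1) * (Z 0 0 * c + d) * h'
  · rw [mul_comm (c : ℂ)] at h0 ⊢
    rw [div_mul_cancel₀ _ h0]
  · ring

theorem moebius_jM_int {g : Matrix (Fin 2) (Fin 2) ℤ} (hg : g.det = 1)
    {Z : Matrix (Fin 2) (Fin 2) ℂ} (hZ : 0 < (Z 0 0).im) :
    moebius (jM (g 0 0) (g 0 1) (g 1 0) (g 1 1)) Z = gact g Z := by
  rw [moebius_jM]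
  · simp [gact]
  · rw [Matrix.det_fin_two] at hg; exact_mod_cast hg
  · have := jfac_ne_zero (g := g) (by rw [hg]; exact one_pos) hZ
    exact_mod_cast this

theorem b5_jM {g : Matrix (Fin 2) (Fin 2) ℤ} (hg : g.det = 1)
    {Z : Matrix (Fin 2) (Fin 2) ℂ} (hZ : 0 < (Z 0 0).im) :
    b5 (moebius (jM (g 0 0) (g 0 1) (g 1 0) (g 1 1)) Z) =
      (autM (jM (g 0 0) (g 0 1) (g 1 0) (g 1 1)) Z).det ^ 5 * b5 Z := by
  rw [moebius_jM_int hg hZ, det_autM_jM, b5_gact hg hZ]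
  simp

theorem b5_tM (p : ℤ) {x : ℂ} (hx : x ∈ OK) (q : ℤ) {Z : Matrix (Fin 2) (Fin 2) ℂ}
    (hZ : 0 < (Z 0 0).im) : b5 (moebius (tM p x q) Z) = b5 Z := by
  have h1 : b5 (gact !![1, p; 0, 1] Z) = b5 Z := by
    rw [b5_gact (by simp [Matrix.det_fin_two_of]) hZ]; simp
  rw [← h1, moebius_tM]
  unfold b5
  refine tsum_congr fun i => ?_
  rw [PhiM_mat, PhiM_mat]
  have e00 : (Z + !![((p : ℝ) : ℂ), x; (starRingEnd ℂ) x, ((q : ℝ) : ℂ)]) 0 0 = (gact !![1, p; 0, 1] Z) 0 0 := by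
    simp [gact]
  have e01 : (Z + !![((p : ℝ) : ℂ), x; (starRingEnd ℂ) x, ((q : ℝ) : ℂ)]) 0 1 = Z 0 1 + x := by simp
  have e10 : (Z + !![((p : ℝ) : ℂ), x; (starRingEnd ℂ) x, ((q : ℝ) : ℂ)]) 1 0 = Z 1 0 + (starRingEnd ℂ) x := by simp
  have e11 : (Z + !![((p : ℝ) : ℂ), x; (starRingEnd ℂ) x, ((q : ℝ) : ℂ)]) 1 1 = Z 1 1 + q := by simp
  have f01 : (gact !![1, p; 0, 1] Z) 0 1 = Z 0 1 := by simp [gact]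
  have f10 : (gact !![1, p; 0, 1] Z) 1 0 = Z 1 0 := by simp [gact]
  have f11 : (gact !![1, p; 0, 1] Z) 1 1 = Z 1 1 := by simp [gact]
  rw [e00, e01, e10, e11, f01, f10, f11]
  have ht := phi1_trans (((i.a : ℂ) * gact !![1, p; 0, 1] Z 0 0 + (i.b : ℂ)) / (i.d : ℂ)) (Z 0 1) (Z 1 0) hx i.a
  push_cast at ht
  rw [ht]
  congr 1
  rw [show 2 * (π : ℂ) * I * (i.a * i.d * (Z 1 1 + q)) =
    2 * π * I * (i.a * i.d * Z 1 1) + ((i.a * i.d * q : ℤ) : ℂ) * (2 * π * I) by push_cast; ring]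
  exact Complex.exp_periodic.int_mul _ _

theorem b5_lM {s : ℂ} (hs : s ∈ OK) (Z : Matrix (Fin 2) (Fin 2) ℂ) :
    b5 (moebius (lM 1 0 s 1) Z) = b5 Z := by
  rw [moebius_lM (by ring)]
  unfold b5
  refine tsum_congr fun i => ?_
  rw [PhiM_mat, PhiM_mat]
  set W := !![1, 0; s, 1] * Z * !![1, 0; s, 1]ᴴ with hW
  have e00 : W 0 0 = Z 0 0 := by
    rw [hW, conj_fin_two]; simp
  have e01 : W 0 1 = Z 0 1 + (starRingEnd ℂ) s * Z 0 0 := by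
    rw [hW, conj_fin_two]; simp; ring
  have e10 : W 1 0 = Z 1 0 + s * Z 0 0 := by
    rw [hW, conj_fin_two]; simp; ring
  have e11 : W 1 1 = Z 1 1 + (s * Z 0 1 + (starRingEnd ℂ) s * Z 1 0 + (starRingEnd ℂ) s * s * Z 0 0) := by
    rw [hW, conj_fin_two]; simp; ring
  rw [e00, e01, e10, e11]
  have hd : ((i.d : ℤ) : ℂ) ≠ 0 := by
    have := i.d_pos
    exact_mod_cast (by omega : i.d ≠ 0)
  have ht := phi1_heis (τ := Z 0 0) (τ' := ((i.a : ℂ) * Z 0 0 + (i.b : ℂ)) / (i.d : ℂ)) (Z 0 1) (Z 1 0)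
    (conj_mem_OK hs) (a := i.a) (b := i.b) (d := i.d) (by push_cast at hd ⊢; field_simp)
  simp only [Complex.conj_conj] at ht
  push_cast at ht
  rw [ht]
  rw [show 2 * (π : ℂ) * I * (i.a * i.d * (Z 1 1 + (s * Z 0 1 + (starRingEnd ℂ) s * Z 1 0 +
      (starRingEnd ℂ) s * s * Z 0 0))) = 2 * π * I * (i.a * i.d * Z 1 1) + 2 * π * I * (i.a * i.d *
      (s * Z 0 1 + (starRingEnd ℂ) s * Z 1 0 + (starRingEnd ℂ) s * s * Z 0 0)) by ring,
    Complex.exp_add, Complex.exp_neg]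
  have := Complex.exp_ne_zero (2 * π * I * (i.a * i.d *
      (s * Z 0 1 + (starRingEnd ℂ) s * Z 1 0 + (starRingEnd ℂ) s * s * Z 0 0)))
  field_simp

end Generators

section Symmetry

open Complex Real

theorem qexp_exists {f : ℂ → ℂ} (hf : DifferentiableOn ℂ f {τ | 0 < τ.im})
    (hper : ∀ τ : ℂ, 0 < τ.im → f (τ + 1) = f τ) (h0 : Tendsto f (comap Complex.im atTop) (𝓝 0)) :
    ∃ c : ℕ → ℂ, c 0 = 0 ∧
      (∀ τ : ℂ, 0 < τ.im → HasSum (fun n : ℕ => c n * cexp (2 * π * I * (n * τ))) (f τ)) ∧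
      ∀ y : ℝ, 0 < y → ∀ B : ℝ, (∀ τ : ℂ, τ.im = y → ‖f τ‖ ≤ B) →
        ∀ n : ℕ, ‖c n‖ ≤ B * rexp (2 * π * n * y) := by
  have hopen : IsOpen {τ : ℂ | 0 < τ.im} := isOpen_lt continuous_const Complex.continuous_im
  set g : ℂ → ℂ := fun τ => if 0 < τ.im then f τ else 0 with hg
  have hgf : ∀ τ : ℂ, 0 < τ.im → g τ = f τ := fun τ h => if_pos h
  have hgp : Function.Periodic g (1 : ℝ) := by
    intro τ
    simp only [hg]
    have : (τ + (1 : ℝ)).im = τ.im := by simp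
    rw [this]
    split_ifs with h
    · have := hper τ h
      push_cast; exact this
    · rfl
  have hgd : ∀ τ : ℂ, 0 < τ.im → DifferentiableAt ℂ g τ := fun τ h =>
    (hf.differentiableAt (hopen.mem_nhds h)).congr_of_eventuallyEq
      ((hopen.eventually_mem h).mono fun z hz => hgf z hz)
  have hev : ∀ᶠ τ in comap Complex.im atTop, 0 < τ.im :=
    (eventually_gt_atTop 0).comap _
  have hg0 : Tendsto g (comap Complex.im atTop) (𝓝 0) :=
    h0.congr' (hev.mono fun z hz => (hgf z hz).symm)
  set Φ := Function.Periodic.cuspFunction 1 g with hΦ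
  have hΦq : ∀ τ : ℂ, 0 < τ.im → Φ (cexp (2 * π * I * τ)) = f τ := by
    intro τ h
    have := Function.Periodic.eq_cuspFunction one_ne_zero hgp τ
    rw [hgf τ h] at this
    rw [← this]
    simp [hΦ, Function.Periodic.qParam]
  have hsurj : ∀ q : ℂ, q ≠ 0 → ‖q‖ < 1 → ∃ τ : ℂ, τ.im = -Real.log ‖q‖ / (2 * π) ∧ 0 < τ.im ∧
      cexp (2 * π * I * τ) = q := by
    intro q hq hq1
    have e1 := Function.Periodic.im_invQParam 1 q
    refine ⟨Function.Periodic.invQParam 1 q, ?_, ?_, ?_⟩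
    · rw [e1]; ring
    · rw [e1]
      have := Real.log_neg (norm_pos_iff.2 hq) hq1
      have h2 : -1 / (2 * π) * Real.log ‖q‖ = (-Real.log ‖q‖) / (2 * π) := by ring
      rw [h2]
      exact div_pos (by linarith) (by positivity)
    · have := Function.Periodic.qParam_right_inv (h := 1) one_ne_zero hq
      simpa [Function.Periodic.qParam] using this
  have hΦd : DifferentiableOn ℂ Φ (Metric.ball 0 1) := by
    intro q hq
    refine DifferentiableAt.differentiableWithinAt ?_
    by_cases hq0 : q = 0
    · rw [hq0]
      refine Function.Periodic.differentiableAt_cuspFunction_zero one_pos hgp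
        (hev.mono fun z hz => hgd z hz) ?_
      exact hg0.isBigO_one ℝ
    · obtain ⟨τ, -, h2, h3⟩ := hsurj q hq0 (by simpa using hq)
      have := Function.Periodic.differentiableAt_cuspFunction (h := 1) one_ne_zero hgp (hgd τ h2)
      simp only [Function.Periodic.qParam, Complex.ofReal_one, div_one] at this
      rw [h3] at this
      exact this
  have hexp : ∀ τ : ℂ, 0 < τ.im → ‖cexp (2 * π * I * τ)‖ < 1 := fun τ h => by
    rw [norm_cexp_two_pi, Real.exp_lt_one_iff]
    have : 0 < 2 * π * τ.im := by positivity
    linarith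
  refine ⟨fun n => (n.factorial : ℂ)⁻¹ * iteratedDeriv n Φ 0, ?_, fun τ h => ?_, fun y hy B hB n => ?_⟩
  · have := Function.Periodic.cuspFunction_zero_of_zero_at_inf (h := 1) one_pos hg0
    simp [hΦ, this]
  · have h1 := Complex.hasSum_taylorSeries_on_ball hΦd (z := cexp (2 * π * I * τ)) (by simpa using hexp τ h)
    rw [hΦq τ h] at h1
    refine h1.congr_fun ?_
    intro n
    simp only [smul_eq_mul, sub_zero]
    rw [← Complex.exp_nat_mul, show (n : ℂ) * (2 * π * I * τ) = 2 * π * I * (n * τ) by ring]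
    ring
  · set R := rexp (-(2 * π * y)) with hR
    have hR0 : 0 < R := Real.exp_pos _
    have hR1 : R < 1 := by
      rw [hR, Real.exp_lt_one_iff]
      have : 0 < 2 * π * y := by positivity
      linarith
    have h1 := Complex.norm_iteratedDeriv_le_of_forall_mem_sphere_norm_le (C := B) n hR0
      (f := Φ) (c := 0) ?_ ?_
    · rw [norm_mul, norm_inv, Complex.norm_natCast]
      have h2 : (0 : ℝ) < n.factorial := by positivity
      have h3 : rexp (2 * π * n * y) = (R ^ n)⁻¹ := by
        rw [hR, ← Real.exp_nat_mul, ← Real.exp_neg]; congr 1; ring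
      rw [h3]
      refine (mul_le_mul_of_nonneg_left h1 (by positivity)).trans (le_of_eq ?_)
      field_simp
    · refine (hΦd.mono ?_).diffContOnCl_ball (subset_refl _)
      exact Metric.closedBall_subset_ball hR1
    · intro q hq
      have hqn : ‖q‖ = R := by simpa using hq
      obtain ⟨τ, h1, h2, h3⟩ := hsurj q (by rw [← norm_pos_iff, hqn]; exact hR0) (by rw [hqn]; exact hR1)
      rw [← h3, hΦq τ h2]
      refine hB τ ?_
      rw [h1, hqn, hR, Real.log_exp]
      field_simp

theorem sum_roots (d n : ℕ) (hd : 1 ≤ d) : ∑ b ∈ Finset.range d, cexp (2 * π * I * (n * (b / d))) =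
    if d ∣ n then (d : ℂ) else 0 := by
  have hd0 : (d : ℂ) ≠ 0 := by exact_mod_cast (by omega : d ≠ 0)
  set ζ := cexp (2 * π * I * (n / d)) with hζ
  have h1 : ∀ b ∈ Finset.range d, cexp (2 * π * I * (n * (b / d))) = ζ ^ b := fun b _ => by
    rw [hζ, ← Complex.exp_nat_mul]; congr 1; field_simp
  rw [Finset.sum_congr rfl h1]
  have hζd : ζ ^ d = 1 := by
    rw [hζ, ← Complex.exp_nat_mul, Complex.exp_eq_one_iff]
    exact ⟨n, by push_cast; field_simp⟩
  split_ifs with h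
  · obtain ⟨k, rfl⟩ := h
    have : ζ = 1 := by
      rw [hζ, Complex.exp_eq_one_iff]
      exact ⟨k, by push_cast; field_simp⟩
    simp [this]
  · have hne : ζ ≠ 1 := by
      intro h1
      rw [hζ, Complex.exp_eq_one_iff] at h1
      obtain ⟨k, hk⟩ := h1
      apply h
      have h2 : (n : ℂ) = d * k := by
        have h3 : (2 * π * I : ℂ) ≠ 0 := Complex.two_pi_I_ne_zero
        rw [mul_comm (k : ℂ)] at hk
        have := mul_left_cancel₀ h3 hk
        rw [div_eq_iff hd0] at this
        rw [this]; ring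
      have h3 : (n : ℤ) = d * k := by exact_mod_cast h2
      exact Int.natCast_dvd_natCast.1 ⟨k, h3⟩
    have := mul_geom_sum ζ d
    rw [hζd, sub_self] at this
    exact (mul_eq_zero.1 this).resolve_left (sub_ne_zero.2 hne)

theorem hecke_hasSum {f : ℂ → ℂ} {c : ℕ → ℂ} (hc0 : c 0 = 0)
    (hc : ∀ τ : ℂ, 0 < τ.im → HasSum (fun n : ℕ => c n * cexp (2 * π * I * (n * τ))) (f τ))
    {d : ℕ} (hd : 1 ≤ d) {s : ℂ} (hs : 0 < s.im) :
    HasSum (fun q : ℕ => c (d * (q + 1)) * cexp (2 * π * I * ((q + 1 : ℕ) * s)))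
      (1 / d * ∑ b ∈ Finset.range d, f ((s + b) / d)) := by
  have hd0 : (d : ℂ) ≠ 0 := by exact_mod_cast (by omega : d ≠ 0)
  have him : ∀ b : ℕ, 0 < ((s + b) / d).im := fun b => by
    have := im_hecke (τ := s) 1 b d hd
    simp only [Nat.cast_one, one_mul] at this
    rw [this]
    have : (0 : ℝ) < d := by exact_mod_cast hd
    positivity
  have h1 := (hasSum_sum fun b (_ : b ∈ Finset.range d) => hc _ (him b)).mul_left (1 / (d : ℂ))
  have h2 : ∀ n : ℕ, 1 / (d : ℂ) * ∑ b ∈ Finset.range d, c n * cexp (2 * π * I * (n * ((s + b) / d))) =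
      if d ∣ n then c n * cexp (2 * π * I * (n * s / d)) else 0 := by
    intro n
    have : ∀ b ∈ Finset.range d, c n * cexp (2 * π * I * (n * ((s + b) / d))) =
        c n * cexp (2 * π * I * (n * s / d)) * cexp (2 * π * I * (n * (b / d))) := fun b _ => by
      rw [mul_assoc (c n), ← Complex.exp_add]; congr 2; field_simp
    rw [Finset.sum_congr rfl this, ← Finset.mul_sum, sum_roots d n hd]
    split_ifs
    · field_simp
    · simp
  simp only [h2] at h1
  have hinj : Function.Injective fun q : ℕ => d * (q + 1) := fun p q h => by
    have := Nat.eq_of_mul_eq_mul_left hd h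
    omega
  rw [← hinj.hasSum_iff] at h1
  · refine h1.congr_fun fun q => ?_
    simp only [Function.comp_apply, dvd_mul_right, if_true]
    congr 3
    push_cast; field_simp
  · intro n hn
    split_ifs with h
    · obtain ⟨k, rfl⟩ := h
      rcases Nat.eq_zero_or_pos k with rfl | hk
      · simp [hc0]
      · exact absurd ⟨k - 1, by simp only; congr 1; omega⟩ hn
    · rfl

end Symmetry

section Swap

open Complex Real

theorem coef_exists (z₁ z₂ : ℂ) : ∃ c : ℕ → ℂ, c 0 = 0 ∧
      (∀ τ : ℂ, 0 < τ.im → HasSum (fun n : ℕ => c n * cexp (2 * π * I * (n * τ))) (phi1 τ z₁ z₂)) ∧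
      ∀ y : ℝ, 0 < y → ∀ n : ℕ, ‖c n‖ ≤
        pphi (1 / y) * rexp (π * Complex.normSq (z₁ - (starRingEnd ℂ) z₂) / (2 * y)) *
          rexp (2 * π * n * y) := by
  have hd : DifferentiableOn ℂ (fun τ => phi1 τ z₁ z₂) {τ | 0 < τ.im} := fun τ hτ =>
    (differentiableAt_phi1 (f := fun τ => τ) (g := fun _ => z₁) (h := fun _ => z₂) hτ
      differentiableAt_id (differentiableAt_const _) (differentiableAt_const _)).differentiableWithinAt
  have h0 : Tendsto (fun τ => phi1 τ z₁ z₂) (comap Complex.im atTop) (𝓝 0) := by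
    rw [tendsto_zero_iff_norm_tendsto_zero]
    have hlim : Tendsto (fun τ : ℂ => pphi 1 *
        rexp (π * Complex.normSq (z₁ - (starRingEnd ℂ) z₂) / 2) * rexp (-(π * τ.im / 4)))
        (comap Complex.im atTop) (𝓝 0) := by
      rw [← mul_zero (pphi 1 * rexp (π * Complex.normSq (z₁ - (starRingEnd ℂ) z₂) / 2))]
      refine Tendsto.const_mul _ ?_
      have h1 : Tendsto (fun y : ℝ => rexp (-(π * y / 4))) atTop (𝓝 0) := by
        refine Real.tendsto_exp_neg_atTop_nhds_zero.comp ?_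
        refine (tendsto_id.const_mul_atTop (by positivity : 0 < π / 4)).congr fun y => ?_
        simp only [id]; ring
      exact h1.comp tendsto_comap
    refine squeeze_zero' (Eventually.of_forall fun _ => norm_nonneg _) ?_ hlim
    have hev : ∀ᶠ τ : ℂ in comap Complex.im atTop, 1 ≤ τ.im :=
      tendsto_comap.eventually (eventually_ge_atTop 1)
    filter_upwards [hev] with τ hτ
    have hpos : 0 < τ.im := by linarith
    refine (phi1_bound' hpos z₁ z₂).trans ?_
    have h1 : pphi (1 / τ.im) ≤ pphi 1 := by
      have := pphi_mul_le (m := 1) (t := 1 / τ.im) (s := 1) le_rfl (by positivity)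
        (by rw [div_le_one hpos]; exact hτ)
      simpa using this
    have h2 : rexp (π * Complex.normSq (z₁ - (starRingEnd ℂ) z₂) / (2 * τ.im)) ≤
        rexp (π * Complex.normSq (z₁ - (starRingEnd ℂ) z₂) / 2) := by
      apply Real.exp_le_exp.2
      have := Complex.normSq_nonneg (z₁ - (starRingEnd ℂ) z₂)
      apply div_le_div_of_nonneg_left (by positivity) (by norm_num) (by linarith)
    have h3 := (pphi_pos zero_le_one).le
    exact mul_le_mul_of_nonneg_right (mul_le_mul h1 h2 (Real.exp_pos _).le h3) (Real.exp_pos _).le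
  obtain ⟨c, hc0, hc, hb⟩ := qexp_exists hd (fun τ hτ => phi1_T hτ z₁ z₂) h0
  refine ⟨c, hc0, hc, fun y hy n => hb y hy _ (fun τ hτ => ?_) n⟩
  subst hτ
  exact phi1_bound hy z₁ z₂

theorem summable_pow_exp_succ (k : ℕ) {c : ℝ} (hc : 0 < c) :
    Summable fun n : ℕ => ((n + 1 : ℕ) : ℝ) ^ k * rexp (-(c * (n + 1 : ℕ))) := by
  have := Real.summable_pow_mul_exp_neg_nat_mul k hc
  refine ((summable_nat_add_iff 1).2 this).congr fun n => ?_
  congr 2; ring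

theorem coef_summable {c : ℕ → ℂ} {z₁ z₂ : ℂ} {Y₁ Y₂ : ℝ} (hY₁ : 0 < Y₁) (hY₂ : 0 < Y₂)
    (hz : Complex.normSq (z₁ - (starRingEnd ℂ) z₂) < 4 * (Y₁ * Y₂))
    (hc : ∀ y : ℝ, 0 < y → ∀ n : ℕ, ‖c n‖ ≤
        pphi (1 / y) * rexp (π * Complex.normSq (z₁ - (starRingEnd ℂ) z₂) / (2 * y)) *
          rexp (2 * π * n * y)) :
    Summable fun p : ℕ × ℕ => ‖c ((p.1 + 1) * (p.2 + 1))‖ *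
      rexp (-(2 * π * ((p.2 + 1 : ℕ) * Y₁ + (p.1 + 1 : ℕ) * Y₂))) := by
  set N := Complex.normSq (z₁ - (starRingEnd ℂ) z₂) with hN
  have hN0 : 0 ≤ N := Complex.normSq_nonneg _
  set R := √(Y₁ * Y₂) with hR
  have hRR : R * R = Y₁ * Y₂ := Real.mul_self_sqrt (by positivity)
  have hR0 : 0 < R := Real.sqrt_pos.2 (by positivity)
  set θ := N / (4 * (R * R)) with hθ
  have hθN : N = 4 * θ * (R * R) := by rw [hθ]; field_simp
  have hθ1 : θ < 1 := by rw [hθ, div_lt_one (by positivity), hRR]; exact hz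
  have hθ0 : 0 ≤ θ := by positivity
  have hδ : 0 < π * (1 - θ) := mul_pos pi_pos (by linarith)
  have hs := ((summable_pow_exp_succ 9 (mul_pos hδ hY₂)).mul_of_nonneg
    (summable_pow_exp_succ 9 (mul_pos hδ hY₁)) (fun n => by positivity)
    (fun n => by positivity)).mul_left (pphi (1 / R))
  refine Summable.of_nonneg_of_le (fun p => by positivity) (fun p => ?_) hs
  obtain ⟨d, e⟩ := p
  simp only
  generalize hD : (((d + 1 : ℕ) : ℝ)) = D
  generalize hE : (((e + 1 : ℕ) : ℝ)) = E'
  have hD1 : 1 ≤ D := by rw [← hD]; exact_mod_cast Nat.succ_pos d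
  have hE1 : 1 ≤ E' := by rw [← hE]; exact_mod_cast Nat.succ_pos e
  set S := √(D * E') with hS
  have hSS : S * S = D * E' := Real.mul_self_sqrt (by positivity)
  have hDE : 1 ≤ D * E' := by nlinarith
  have hS1 : 1 ≤ S := Real.one_le_sqrt.2 hDE
  have hS0 : 0 < S := by linarith
  have hSle : S ≤ D * E' := by rw [← hSS]; nlinarith
  have h1 := hc (R / S) (by positivity) ((d + 1) * (e + 1))
  have hcast : (((d + 1) * (e + 1) : ℕ) : ℝ) = S * S := by
    rw [hSS, ← hD, ← hE]; push_cast; ring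
  rw [hcast] at h1
  have h2 : pphi (1 / (R / S)) ≤ (D * E') ^ 9 * pphi (1 / R) := by
    rw [show 1 / (R / S) = S * (1 / R) by field_simp]
    refine (pphi_mul_le hS1 (by positivity) le_rfl).trans ?_
    have := (pphi_pos (show 0 ≤ 1 / R by positivity)).le
    exact mul_le_mul_of_nonneg_right (pow_le_pow_left₀ hS0.le hSle 9) this
  have hRS : R * S ≤ (E' * Y₁ + D * Y₂) / 2 := by
    refine (pow_le_pow_iff_left₀ (by positivity) (by positivity) two_ne_zero).1 ?_
    have : (R * S) ^ 2 = Y₁ * Y₂ * (D * E') := by rw [← hRR, ← hSS]; ring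
    rw [this]; nlinarith [sq_nonneg (E' * Y₁ - D * Y₂)]
  have e1 : π * N / (2 * (R / S)) = 2 * π * θ * (R * S) := by rw [hθN]; field_simp; ring
  have e2 : 2 * π * (S * S) * (R / S) = 2 * π * (R * S) := by field_simp
  rw [e1, e2] at h1
  have h3 : rexp (2 * π * θ * (R * S)) * rexp (2 * π * (R * S)) *
      rexp (-(2 * π * (E' * Y₁ + D * Y₂))) ≤
      rexp (-(π * (1 - θ) * Y₂ * D)) * rexp (-(π * (1 - θ) * Y₁ * E')) := by
    rw [← Real.exp_add, ← Real.exp_add, ← Real.exp_add]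
    apply Real.exp_le_exp.2
    have : 0 ≤ (2 * π * (1 + θ)) * ((E' * Y₁ + D * Y₂) / 2 - R * S) :=
      mul_nonneg (by positivity) (by linarith)
    linarith
  calc ‖c ((d + 1) * (e + 1))‖ * rexp (-(2 * π * (E' * Y₁ + D * Y₂)))
      ≤ (pphi (1 / (R / S)) * rexp (2 * π * θ * (R * S)) * rexp (2 * π * (R * S))) *
          rexp (-(2 * π * (E' * Y₁ + D * Y₂))) :=
        mul_le_mul_of_nonneg_right h1 (Real.exp_pos _).le
    _ = pphi (1 / (R / S)) * (rexp (2 * π * θ * (R * S)) * rexp (2 * π * (R * S)) *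
          rexp (-(2 * π * (E' * Y₁ + D * Y₂)))) := by ring
    _ ≤ ((D * E') ^ 9 * pphi (1 / R)) *
          (rexp (-(π * (1 - θ) * Y₂ * D)) * rexp (-(π * (1 - θ) * Y₁ * E'))) := by
        have := (pphi_pos (show 0 ≤ 1 / R by positivity)).le
        exact mul_le_mul h2 h3 (by positivity) (by positivity)
    _ = _ := by rw [mul_pow]; ring

def fterm (c : ℕ → ℕ → ℂ) (τ w : ℂ) (a d e : ℕ) : ℂ :=
  ((a + 1 : ℕ) : ℂ) ^ 4 * (c a ((d + 1) * (e + 1)) *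
    cexp (2 * π * I * ((a + 1 : ℕ) * ((e + 1 : ℕ) * τ + (d + 1 : ℕ) * w))))

theorem b5_expansion {Z : Matrix (Fin 2) (Fin 2) ℂ} (hZ : Z ∈ HH2) {c : ℕ → ℕ → ℂ}
    (hc0 : ∀ a, c a 0 = 0)
    (hc : ∀ a : ℕ, ∀ τ : ℂ, 0 < τ.im → HasSum (fun n : ℕ => c a n * cexp (2 * π * I * (n * τ)))
      (phi1 τ ((a + 1 : ℕ) * Z 0 1) ((a + 1 : ℕ) * Z 1 0))) :
    b5 Z = ∑' a, ∑' d, ∑' e, fterm c (Z 0 0) (Z 1 1) a d e := by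
  have hs := summable_PhiM hZ
  unfold b5
  rw [hs.tsum_sigma, (hs.sigma).tsum_prod]
  refine tsum_congr fun a => tsum_congr fun d => ?_
  have hy : 0 < (((a + 1 : ℕ) : ℂ) * Z 0 0).im := by
    have h1 := HH2_im_pos hZ
    rw [← Complex.ofReal_natCast, Complex.im_ofReal_mul]
    positivity
  have h := (hecke_hasSum (hc0 a) (hc a) (Nat.succ_pos d) hy).mul_left
    (((a + 1 : ℕ) : ℂ) ^ 4 * cexp (2 * π * I * ((a + 1 : ℕ) * (d + 1 : ℕ) * Z 1 1)))
  have e1 : ∀ e : ℕ, ((a + 1 : ℕ) : ℂ) ^ 4 * cexp (2 * π * I * ((a + 1 : ℕ) * (d + 1 : ℕ) * Z 1 1)) *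
      (c a ((d + 1) * (e + 1)) * cexp (2 * π * I * ((e + 1 : ℕ) * ((a + 1 : ℕ) * Z 0 0)))) =
      fterm c (Z 0 0) (Z 1 1) a d e := fun e => by
    unfold fterm
    rw [show 2 * π * I * (((a + 1 : ℕ) : ℂ) * ((e + 1 : ℕ) * Z 0 0 + (d + 1 : ℕ) * Z 1 1)) =
      2 * π * I * ((a + 1 : ℕ) * (d + 1 : ℕ) * Z 1 1) +
        2 * π * I * ((e + 1 : ℕ) * ((a + 1 : ℕ) * Z 0 0)) by ring, Complex.exp_add]
    ring
  have h' := (tsum_congr e1).symm.trans h.tsum_eq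
  rw [h', tsum_fintype, Finset.mul_sum, Finset.mul_sum,
    ← Fin.sum_univ_eq_sum_range (fun b => ((a + 1 : ℕ) : ℂ) ^ 4 *
      cexp (2 * π * I * ((a + 1 : ℕ) * (d + 1 : ℕ) * Z 1 1)) * (1 / ((d.succ : ℕ) : ℂ) *
        phi1 ((((a + 1 : ℕ) : ℂ) * Z 0 0 + b) / (d.succ : ℕ)) ((a + 1 : ℕ) * Z 0 1)
          ((a + 1 : ℕ) * Z 1 0)))]
  refine Finset.sum_congr rfl fun b _ => ?_
  rw [PhiM_mat]
  simp only [HIdx.a, HIdx.d, HIdx.b, Nat.succ_eq_add_one]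
  ring

theorem b5_swap {Z : Matrix (Fin 2) (Fin 2) ℂ} (hZ : Z ∈ HH2) :
    b5 !![Z 1 1, Z 0 1; Z 1 0, Z 0 0] = b5 Z := by
  choose c hc0 hc hb using fun a : ℕ => coef_exists ((a + 1 : ℕ) * Z 0 1) ((a + 1 : ℕ) * Z 1 0)
  have h1 := HH2_im_pos hZ
  have h2 := HH2_im_pos' hZ
  have hdet : Complex.normSq (Z 0 1 - (starRingEnd ℂ) (Z 1 0)) < 4 * ((Z 0 0).im * (Z 1 1).im) := by
    have := HH2_detY_pos hZ
    unfold detY at this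
    linarith
  have hZ' : !![Z 1 1, Z 0 1; Z 1 0, Z 0 0] ∈ HH2 := by
    rw [mem_HH2_iff]
    refine ⟨by simpa using h2, ?_⟩
    unfold detY
    simp
    linarith
  rw [b5_expansion hZ' hc0 (by simpa using hc), b5_expansion hZ hc0 hc]
  refine tsum_congr fun a => ?_
  have ha : (0 : ℝ) < (a + 1 : ℕ) := by positivity
  have hsum : Summable (Function.uncurry (fterm c (Z 0 0) (Z 1 1) a)) := by
    have hY : Complex.normSq (((a + 1 : ℕ) : ℂ) * Z 0 1 - (starRingEnd ℂ) ((a + 1 : ℕ) * Z 1 0)) <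
        4 * ((((a + 1 : ℕ) : ℝ) * (Z 0 0).im) * ((a + 1 : ℕ) * (Z 1 1).im)) := by
      rw [map_mul, Complex.conj_natCast, ← mul_sub, map_mul, Complex.normSq_natCast]
      have := mul_lt_mul_of_pos_left hdet (mul_pos ha ha)
      linarith
    have := (coef_summable (mul_pos ha h1) (mul_pos ha h2) hY (hb a)).mul_left
      (((a + 1 : ℕ) : ℝ) ^ 4)
    refine Summable.of_norm (this.congr fun p => ?_)
    obtain ⟨d, e⟩ := p
    simp only [Function.uncurry, fterm, norm_mul, norm_pow, Complex.norm_natCast, norm_cexp_two_pi]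
    congr 4
    rw [← Complex.ofReal_natCast, ← Complex.ofReal_natCast, ← Complex.ofReal_natCast]
    simp
    ring
  have := hsum.tsum_comm
  rw [← this]
  refine tsum_congr fun d => tsum_congr fun e => ?_
  unfold fterm
  simp only [of_apply, cons_val', cons_val_zero, cons_val_one, cons_val_fin_one]
  rw [mul_comm (d + 1) (e + 1)]
  congr 4
  ring

theorem b5_sM {Z : Matrix (Fin 2) (Fin 2) ℂ} (hZ : Z ∈ HH2) : b5 (moebius sM Z) = -b5 Z := by
  rw [moebius_sM, ← b5_swap hZ, ← b5_transpose]
  congr 1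
  ext i j
  fin_cases i <;> fin_cases j <;> rfl

end Swap

section B5Modular

open Complex Real Asymptotics Metric

theorem b5_gen {M : Matrix (Fin 4) (Fin 4) ℂ} (h : GenM M) {Z : Matrix (Fin 2) (Fin 2) ℂ}
    (hZ : Z ∈ HH2) : b5 (moebius M Z) = (autM M Z).det ^ 5 * b5 Z := by
  have h1 := HH2_im_pos hZ
  cases h with
  | t p x hx q => rw [b5_tM p hx q h1, autM_tM]; simp
  | l s hs => rw [b5_lM hs, det_autM_lM (by ring)]; simp
  | s => rw [b5_sM hZ, autM_sM, Matrix.det_fin_two_of]; norm_num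
  | j =>
    have := b5_jM (g := !![0, -1; 1, 0]) (by simp [Matrix.det_fin_two_of]) h1
    simpa using this
  | j' =>
    have := b5_jM (g := !![0, 1; -1, 0]) (by simp [Matrix.det_fin_two_of]) h1
    simpa using this

theorem isHMF_b5 : IsHMF 11 5 b5 := by
  refine ⟨differentiableOn_b5, fun M hM => ?_⟩
  have hM' := mem_Gam hM
  clear hM
  change ∀ τ ∈ HH2, b5 (moebius M τ) = (autM M τ).det ^ 5 * b5 τ
  induction hM' using Submonoid.closure_induction with
  | mem M h => exact fun τ hτ => b5_gen h hτ
  | one => exact fun τ hτ => by rw [moebius_one, autM_one]; simp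
  | mul M N hM hN hM' hN' =>
    intro τ hτ
    have hu := (Gam_inSU hN).inU
    rw [moebius_mul hu hτ, hM' _ (moebius_mem hu hτ), hN' τ hτ, autM_mul hu hτ, Matrix.det_mul]
    ring

theorem isSymHMF_b5 : IsSymHMF 11 5 b5 :=
  ⟨isHMF_b5, fun τ _ => by rw [b5_transpose]; norm_num⟩

theorem norm_le_of_order {f : ℂ → ℂ} {r M : ℝ} {n : ℕ} (hd : DifferentiableOn ℂ f (ball 0 r))
    (hM : ∀ t ∈ ball (0 : ℂ) r, ‖f t‖ ≤ M) (hn : (n : ℕ∞) ≤ analyticOrderAt f 0) {t : ℂ}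
    (ht : t ∈ ball (0 : ℂ) r) : ‖f t‖ ≤ M * (‖t‖ / r) ^ n := by
  cases n with
  | zero => simpa using hM t ht
  | succ n =>
    have hr : 0 < r := nonempty_ball.1 ⟨t, ht⟩
    have ha : AnalyticAt ℂ f 0 := hd.analyticAt (ball_mem_nhds 0 hr)
    obtain ⟨g, hg, hfg⟩ := (natCast_le_analyticOrderAt ha).1 hn
    have h0 : f 0 = 0 := by simpa using hfg.self_of_nhds
    have hO : (fun w => f w - f 0) =o[𝓝 0] (fun w : ℂ => ‖w - 0‖ ^ n) := by
      simp only [h0, sub_zero]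
      have h1 : (fun w : ℂ => w ^ (n + 1) * g w) =o[𝓝 0] fun w : ℂ => w ^ n := by
        have h2 : Tendsto (fun w : ℂ => w * g w) (𝓝 0) (𝓝 0) := by
          have := (continuous_id.continuousAt (x := (0 : ℂ))).mul hg.continuousAt
          have h' : Tendsto (fun w : ℂ => w * g w) (𝓝 0) (𝓝 (0 * g 0)) := this
          rwa [zero_mul] at h'
        have h3 : (fun w : ℂ => w * g w) =o[𝓝 0] fun _ : ℂ => (1 : ℂ) :=
          (isLittleO_one_iff ℂ).2 h2
        have h4 := (isBigO_refl (fun w : ℂ => w ^ n) (𝓝 0)).mul_isLittleO h3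
        refine (h4.congr (fun w => ?_) fun w => ?_)
        · ring
        · ring
      refine IsLittleO.congr' (h1.norm_right.congr (fun _ => rfl) fun w => norm_pow _ _) ?_
        EventuallyEq.rfl
      filter_upwards [hfg] with w hw
      rw [hw]; simp
    have := Complex.dist_le_mul_div_pow_of_mapsTo_ball_of_isLittleO hd (R₂ := M) (fun w hw => by
      rw [h0, mem_closedBall, dist_zero_right]; exact hM w hw) hO ht
    simpa [h0] using this

theorem le_order_of_bound {f : ℂ → ℂ} {t₀ : ℂ} (hf : AnalyticAt ℂ f t₀) {n : ℕ}
    (h : f =O[𝓝 t₀] fun t => (t - t₀) ^ n) : (n : ℕ∞) ≤ analyticOrderAt f t₀ := by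
  by_contra hlt
  rw [not_le] at hlt
  obtain ⟨m, hm⟩ := ENat.ne_top_iff_exists.1 hlt.ne_top
  rw [← hm] at hlt
  have hmn : m < n := by exact_mod_cast hlt
  obtain ⟨g, hg, hg0, hfg⟩ := (hf.analyticOrderAt_eq_natCast).1 hm.symm
  have h1 : g =O[𝓝[≠] t₀] fun t => (t - t₀) ^ (n - m) := by
    have h2 := (h.mono nhdsWithin_le_nhds : f =O[𝓝[≠] t₀] _)
    have h3 := h2.mul (isBigO_refl (fun t => ((t - t₀) ^ m)⁻¹) (𝓝[≠] t₀))
    refine h3.congr' ?_ ?_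
    · filter_upwards [nhdsWithin_le_nhds hfg, self_mem_nhdsWithin] with t ht hne
      have : (t - t₀) ≠ 0 := sub_ne_zero.2 hne
      rw [ht, smul_eq_mul]; field_simp
    · filter_upwards [self_mem_nhdsWithin] with t hne
      have : (t - t₀) ≠ 0 := sub_ne_zero.2 hne
      rw [pow_sub₀ _ this hmn.le]
  have h2 : Tendsto (fun t => (t - t₀) ^ (n - m)) (𝓝[≠] t₀) (𝓝 0) := by
    have : ContinuousAt (fun t : ℂ => (t - t₀) ^ (n - m)) t₀ := by fun_prop
    have h := this.tendsto.mono_left (nhdsWithin_le_nhds (s := {t₀}ᶜ))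
    simpa [Nat.sub_ne_zero_of_lt hmn] using h
  have h3 := h1.trans_tendsto h2
  have h4 := hg.continuousAt.tendsto.mono_left (nhdsWithin_le_nhds (s := {t₀}ᶜ))
  exact hg0 (tendsto_nhds_unique h4 h3)

theorem differentiableAt_th' {E : Type*} [NormedAddCommGroup E] [NormedSpace ℂ E] {f u : E → ℂ}
    {x : E} (hx : 0 < (f x).im) (hf : DifferentiableAt ℂ f x) (hu : DifferentiableAt ℂ u x) :
    DifferentiableAt ℂ (fun y => th (f y) (u y)) x := by
  have h1 : DifferentiableAt ℂ (fun p : ℂ × ℂ => th p.1 p.2) ((fun y => (f y, u y)) x) :=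
    differentiableAt_th hx
  exact h1.comp x (hf.prodMk hu)

theorem uA_add_matA (Z : Matrix (Fin 2) (Fin 2) ℂ) (t : ℂ) :
    uA ((Z + t • matA) 0 1) ((Z + t • matA) 1 0) = uA (Z 0 1) (Z 1 0) + t * (2 / s11) := by
  simp [uA, matA]; ring

theorem uB_add_matA (Z : Matrix (Fin 2) (Fin 2) ℂ) (t : ℂ) :
    uB ((Z + t • matA) 0 1) ((Z + t • matA) 1 0) = uB (Z 0 1) (Z 1 0) + t * (1 / s11) := by
  simp [uB, matA]; ring

theorem uC_add_matA (Z : Matrix (Fin 2) (Fin 2) ℂ) (t : ℂ) :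
    uC ((Z + t • matA) 0 1) ((Z + t • matA) 1 0) = uC (Z 0 1) (Z 1 0) + t * (1 / s11) := by
  simp [uC, matA]; ring

theorem differentiable_line (Z A : Matrix (Fin 2) (Fin 2) ℂ) :
    Differentiable ℂ fun t : ℂ => Z + t • A :=
  (differentiable_const _).add (differentiable_id.smul_const _)

theorem PhiM_order (i : HIdx) {Z : Matrix (Fin 2) (Fin 2) ℂ} (hZ : Z ∈ HH2) (hs : Zᵀ = Z) :
    ((5 : ℕ) : ℕ∞) ≤ analyticOrderAt (fun t : ℂ => PhiM i.mat (Z + t • matA)) 0 := by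
  have hy := HH2_im_pos hZ
  have h00 : ∀ t : ℂ, (Z + t • matA) 0 0 = Z 0 0 := fun t => by simp [matA]
  have h11 : ∀ t : ℂ, (Z + t • matA) 1 1 = Z 1 1 := fun t => by simp [matA]
  set τ' := ((i.a : ℂ) * Z 0 0 + (i.b : ℂ)) / (i.d : ℂ) with hτ'
  have hτ0 : 0 < τ'.im := by
    rw [hτ', im_hecke _ _ _ i.d_pos]
    have h1 : (0 : ℝ) < i.a := by exact_mod_cast i.a_pos
    have h2 : (0 : ℝ) < i.d := by exact_mod_cast i.d_pos
    positivity
  have hdl : DifferentiableAt ℂ (fun t : ℂ => PhiM i.mat (Z + t • matA)) 0 := by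
    have h1 : DifferentiableAt ℂ (PhiM i.mat) ((fun t : ℂ => Z + t • matA) 0) :=
      differentiableAt_PhiM i (by simpa using hy)
    exact h1.comp 0 (differentiable_line Z matA 0)
  have hdl' : ∀ t : ℂ, DifferentiableAt ℂ (fun t : ℂ => PhiM i.mat (Z + t • matA)) t := fun t => by
    have h1 : DifferentiableAt ℂ (PhiM i.mat) ((fun t : ℂ => Z + t • matA) t) :=
      differentiableAt_PhiM i (by simpa [h00] using hy)
    exact h1.comp t (differentiable_line Z matA t)
  have han : AnalyticAt ℂ (fun t : ℂ => PhiM i.mat (Z + t • matA)) 0 :=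
    Differentiable.analyticAt hdl' 0
  refine le_order_of_bound han ?_
  have hsym : Z 1 0 = Z 0 1 := congrFun (congrFun hs 0) 1
  have huA : ∀ t : ℂ, uA (i.a * (Z + t • matA) 0 1) (i.a * (Z + t • matA) 1 0) =
      t * (i.a * (2 / s11)) := fun t => by
    rw [uA_mul, uA_add_matA, hsym]; simp [uA]; ring
  have hth : (fun t : ℂ => th τ' (t * (i.a * (2 / s11)))) =O[𝓝 0] fun t => t - 0 := by
    have h1 : DifferentiableAt ℂ (fun t : ℂ => th τ' (t * (i.a * (2 / s11)))) 0 :=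
      differentiableAt_th' (f := fun _ => τ') hτ0 (by fun_prop) (by fun_prop)
    have := h1.isBigO_sub
    simpa [th_zero] using this
  have hrest : (fun t : ℂ => (i.a : ℂ) ^ 4 / (i.d : ℂ) * thp τ' *
      th τ' (uB (i.a * (Z + t • matA) 0 1) (i.a * (Z + t • matA) 1 0)) *
      th τ' (uC (i.a * (Z + t • matA) 0 1) (i.a * (Z + t • matA) 1 0)) *
      cexp (2 * π * I * (i.a * i.d * Z 1 1))) =O[𝓝 0] fun _ => (1 : ℂ) := by
    refine Tendsto.isBigO_one ℂ (ContinuousAt.tendsto ?_)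
    have hB : ContinuousAt (fun t : ℂ =>
        th τ' (uB (i.a * (Z + t • matA) 0 1) (i.a * (Z + t • matA) 1 0))) 0 := by
      refine (differentiableAt_th' (f := fun _ => τ') hτ0 (by fun_prop) ?_).continuousAt
      simp only [uB_mul, uB_add_matA]; fun_prop
    have hC : ContinuousAt (fun t : ℂ =>
        th τ' (uC (i.a * (Z + t • matA) 0 1) (i.a * (Z + t • matA) 1 0))) 0 := by
      refine (differentiableAt_th' (f := fun _ => τ') hτ0 (by fun_prop) ?_).continuousAt
      simp only [uC_mul, uC_add_matA]; fun_prop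
    exact ((continuousAt_const.mul hB).mul hC).mul continuousAt_const
  refine ((hth.pow 5).mul hrest).congr (fun t => ?_) fun t => by ring
  rw [PhiM_mat, h00, h11, ← hτ']
  unfold phi1
  rw [huA]
  ring

theorem line_eventually_mem {Z : Matrix (Fin 2) (Fin 2) ℂ} {U : Set (Matrix (Fin 2) (Fin 2) ℂ)}
    (hU : U ∈ 𝓝 Z) (A : Matrix (Fin 2) (Fin 2) ℂ) :
    ∃ r > 0, ∀ t ∈ ball (0 : ℂ) r, Z + t • A ∈ U := by
  have h : (fun t : ℂ => Z + t • A) ⁻¹' U ∈ 𝓝 (0 : ℂ) :=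
    (differentiable_line Z A).continuous.continuousAt.preimage_mem_nhds (by simpa using hU)
  exact Metric.mem_nhds_iff.1 h

theorem vanishesAlongH1_b5 : VanishesAlongH1 b5 5 := by
  intro Z hZ hs
  obtain ⟨U, hU, u, hu, hbd⟩ := b5_locally_bounded hZ
  obtain ⟨r, hr, hrU⟩ := line_eventually_mem (inter_mem hU (isOpen_HH2.mem_nhds hZ)) matA
  have hdi : ∀ i : HIdx, DifferentiableOn ℂ (fun t : ℂ => PhiM i.mat (Z + t • matA)) (ball 0 r) := by
    intro i t ht
    have h1 : DifferentiableAt ℂ (PhiM i.mat) ((fun t : ℂ => Z + t • matA) t) :=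
      differentiableAt_PhiM i (HH2_im_pos (hrU t ht).2)
    exact (h1.comp t (differentiable_line Z matA t)).differentiableWithinAt
  have hb : ∀ t ∈ ball (0 : ℂ) r, ‖b5 (Z + t • matA)‖ ≤ (∑' i, u i) * (‖t‖ / r) ^ 5 := by
    intro t ht
    have h1 : ∀ i : HIdx, ‖PhiM i.mat (Z + t • matA)‖ ≤ u i * (‖t‖ / r) ^ 5 := fun i =>
      norm_le_of_order (hdi i) (fun t ht => hbd i _ (hrU t ht).1) (PhiM_order i hZ hs) ht
    rw [← tsum_mul_right]
    exact tsum_of_norm_bounded (hu.mul_right _).hasSum h1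
  have han : AnalyticAt ℂ (fun t : ℂ => b5 (Z + t • matA)) 0 := by
    have : DifferentiableOn ℂ (fun t : ℂ => b5 (Z + t • matA)) (ball 0 r) := by
      intro t ht
      have h1 : DifferentiableAt ℂ b5 ((fun t : ℂ => Z + t • matA) t) :=
        differentiableOn_b5.differentiableAt (isOpen_HH2.mem_nhds (hrU t ht).2)
      exact (h1.comp t (differentiable_line Z matA t)).differentiableWithinAt
    exact this.analyticAt (ball_mem_nhds 0 hr)
  refine (natCast_le_analyticOrderAt_iff_iteratedDeriv_eq_zero (n := 5) han).1
    (le_order_of_bound han ?_)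
  refine IsBigO.of_bound ((∑' i, u i) / r ^ 5) ?_
  filter_upwards [ball_mem_nhds (0 : ℂ) hr] with t ht
  refine (hb t ht).trans (le_of_eq ?_)
  rw [sub_zero, norm_pow, div_pow]; ring

theorem vanishesOnHeegner_b5 : VanishesOnHeegner (omg 11) b5 := by
  intro Z hZ hs
  unfold b5
  rw [← tsum_zero (α := ℂ) (β := HIdx)]
  refine tsum_congr fun i => ?_
  rw [PhiM_mat]
  have : uB (i.a * (phiLam (omg 11) Z) 0 1) (i.a * (phiLam (omg 11) Z) 1 0) = 0 := by
    rw [uB_mul]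
    have h : (starRingEnd ℂ) (omg 11) = 1 - om := conj_om
    simp [uB, phiLam, h]
    right; left
    ring
  unfold phi1
  rw [this, th_zero]
  simp

end B5Modular

section NearCusp

open Complex Real

theorem norm_th_hecke_le {τ τ' u : ℂ} (hτ : 4 / 5 ≤ τ.im)
    (hu : |u.im| ≤ 3 / 2 * τ.im) {a d b : ℕ}
    (ha : 1 ≤ a) (hd : 1 ≤ d) (h : (d : ℂ) * τ' = a * τ + b) :
    ‖th τ' (a * u)‖ ≤ ‖th τ u‖ * (112 * a * d ^ 2) *
      rexp (π * (τ.im * (|u.im| / τ.im - 1 / 2) ^ 2 + ((a * d : ℕ) - 1) * u.im ^ 2 / τ.im)) := by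
  have hy := im_of_hecke hd h
  have ha1 : (1 : ℝ) ≤ a := by exact_mod_cast ha
  have hd1 : (1 : ℝ) ≤ d := by exact_mod_cast hd
  have hτ0 : 0 < τ.im := by linarith
  rw [norm_th_eq τ', norm_th_eq τ]
  have e : π * ((a : ℂ) * u).im ^ 2 / τ'.im = π * ((a * d : ℕ) * u.im ^ 2 / τ.im) := by
    have : ((a : ℂ) * u).im = a * u.im := by
      rw [← Complex.ofReal_natCast, Complex.im_ofReal_mul]
    rw [this, hy]
    push_cast
    field_simp
  rw [e]
  refine (mul_le_mul_of_nonneg_right (Nth_hecke_le hτ hu ha hd h) (Real.exp_pos _).le).trans_eq ?_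
  have e2 : rexp (π * (τ.im * (|u.im| / τ.im - 1 / 2) ^ 2 + ((a * d : ℕ) - 1) * u.im ^ 2 / τ.im)) *
      rexp (π * u.im ^ 2 / τ.im) = rexp (π * τ.im * (|u.im| / τ.im - 1 / 2) ^ 2) *
      rexp (π * ((a * d : ℕ) * u.im ^ 2 / τ.im)) := by
    rw [← Real.exp_add, ← Real.exp_add]
    congr 1
    ring
  linear_combination -(Nth τ u * (112 * a * d ^ 2)) * e2

def sgm (Z : Matrix (Fin 2) (Fin 2) ℂ) : ℝ :=
  5 * (|(uA (Z 0 1) (Z 1 0)).im| / (Z 0 0).im - 1 / 2) ^ 2 +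
  (|(uB (Z 0 1) (Z 1 0)).im| / (Z 0 0).im - 1 / 2) ^ 2 +
  (|(uC (Z 0 1) (Z 1 0)).im| / (Z 0 0).im - 1 / 2) ^ 2

structure NearCusp (C : ℝ) (Z : Matrix (Fin 2) (Fin 2) ℂ) : Prop where
  hy : 4 / 5 < (Z 0 0).im
  hC : C < vht Z
  hv : (Z 0 0).im / 20 < vht Z
  hA : |(uA (Z 0 1) (Z 1 0)).im| < 3 / 2 * (Z 0 0).im
  hB : |(uB (Z 0 1) (Z 1 0)).im| < 3 / 2 * (Z 0 0).im
  hC' : |(uC (Z 0 1) (Z 1 0)).im| < 3 / 2 * (Z 0 0).im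
  hs : (Z 0 0).im * (1 / 8 + sgm Z / 2) < vht Z + (Z 0 0).im / 100

def lead (Z : Matrix (Fin 2) (Fin 2) ℂ) : ℂ :=
  phi1 (Z 0 0) (Z 0 1) (Z 1 0) * cexp (2 * π * I * Z 1 1)

theorem PhiM_le_lead (i : HIdx) {Z : Matrix (Fin 2) (Fin 2) ℂ} (hy : 4 / 5 < (Z 0 0).im)
    (hA : |(uA (Z 0 1) (Z 1 0)).im| < 3 / 2 * (Z 0 0).im)
    (hB : |(uB (Z 0 1) (Z 1 0)).im| < 3 / 2 * (Z 0 0).im)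
    (hC : |(uC (Z 0 1) (Z 1 0)).im| < 3 / 2 * (Z 0 0).im) :
    ‖PhiM i.mat Z‖ ≤ ‖lead Z‖ * (112 ^ 8 * (i.m : ℝ) ^ 15 *
      rexp (-(2 * π * ((i.m - 1) * vht Z - (Z 0 0).im / 8 + i.a * (Z 0 0).im / (8 * i.d)
        - (Z 0 0).im * sgm Z / 2)))) := by
  have hy' : 0 < (Z 0 0).im := by linarith
  have ha : (1 : ℝ) ≤ i.a := by exact_mod_cast i.a_pos
  have hd : (1 : ℝ) ≤ i.d := by exact_mod_cast i.d_pos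
  have hm : (i.m : ℝ) = i.a * i.d := by unfold HIdx.m; push_cast; ring
  have hd0 : (i.d : ℂ) ≠ 0 := by
    have := i.d_pos
    exact_mod_cast (by omega : i.d ≠ 0)
  set τ' := ((i.a : ℂ) * Z 0 0 + i.b) / i.d with hτ'
  have hτ : (i.d : ℂ) * τ' = i.a * Z 0 0 + i.b := by rw [hτ']; field_simp
  rw [PhiM_mat, norm_mul, norm_mul, norm_cexp_two_pi, lead, norm_mul, norm_cexp_two_pi]
  unfold phi1
  rw [uA_mul, uB_mul, uC_mul]
  simp only [norm_mul, norm_pow, norm_div, Complex.norm_natCast]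
  have t0 := thp_hecke_le hy.le i.a_pos i.d_pos hτ
  have tA := norm_th_hecke_le hy.le hA.le i.a_pos i.d_pos hτ
  have tB := norm_th_hecke_le hy.le hB.le i.a_pos i.d_pos hτ
  have tC := norm_th_hecke_le hy.le hC.le i.a_pos i.d_pos hτ
  have hS := im_u_sq (Z 0 1) (Z 1 0)
  obtain ⟨sg, hsg0⟩ : ∃ s, s = sgm Z := ⟨_, rfl⟩
  obtain ⟨v, hv0⟩ : ∃ s, s = vht Z := ⟨_, rfl⟩
  rw [← hsg0, ← hv0]
  have hsg := hsg0
  unfold sgm at hsg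
  have hv := hv0
  rw [vht, detY] at hv
  change ‖th τ' _‖ ≤ _ * _ * rexp (π * (_ + ((i.m : ℕ) - 1) * _ / _)) at tA tB tC
  set n := Complex.normSq (Z 0 1 - (starRingEnd ℂ) (Z 1 0)) with hn
  set a := uA (Z 0 1) (Z 1 0)
  set b := uB (Z 0 1) (Z 1 0)
  set c := uC (Z 0 1) (Z 1 0)
  have ew : ((i.a : ℂ) * (i.d : ℂ) * Z 1 1).im = i.m * (Z 1 1).im := by
    have : (i.a : ℂ) * (i.d : ℂ) = ((i.m : ℝ) : ℂ) := by rw [hm]; push_cast; rfl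
    rw [this, Complex.im_ofReal_mul]
  rw [ew]
  set y := (Z 0 0).im with hyd
  set w := (Z 1 1).im with hwd
  set XA := π * (y * (|a.im| / y - 1 / 2) ^ 2 + (i.m - 1) * a.im ^ 2 / y)
  set XB := π * (y * (|b.im| / y - 1 / 2) ^ 2 + (i.m - 1) * b.im ^ 2 / y)
  set XC := π * (y * (|c.im| / y - 1 / 2) ^ 2 + (i.m - 1) * c.im ^ 2 / y)
  set X0 := π * y / 4 - π * i.a * y / (4 * i.d)
  have key : X0 + (5 : ℕ) * XA + XB + XC + -(2 * π * (i.m * w)) =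
      -(2 * π * w) + -(2 * π * ((i.m - 1) * v - y / 8 + i.a * y / (8 * i.d) - y * sg / 2)) := by
    have hS' : n = 2 * (5 * a.im ^ 2 + b.im ^ 2 + c.im ^ 2) := by linarith
    rw [hv, hsg, hS']
    simp only [X0, XA, XB, XC]
    field_simp
    ring
  have hpow : (i.a : ℝ) ^ 11 * i.d ^ 15 ≤ (i.m : ℝ) ^ 15 := by
    rw [hm, mul_pow]
    exact mul_le_mul_of_nonneg_right (pow_le_pow_right₀ ha (by norm_num)) (by positivity)
  calc _ ≤ (i.a : ℝ) ^ 4 / i.d * ((‖thp (Z 0 0)‖ * (112 * i.d ^ 2) * rexp X0) *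
        (‖th (Z 0 0) a‖ * (112 * i.a * i.d ^ 2) * rexp XA) ^ 5 *
        (‖th (Z 0 0) b‖ * (112 * i.a * i.d ^ 2) * rexp XB) *
        (‖th (Z 0 0) c‖ * (112 * i.a * i.d ^ 2) * rexp XC)) * rexp (-(2 * π * (i.m * w))) := by
        refine mul_le_mul_of_nonneg_right (mul_le_mul_of_nonneg_left ?_ (by positivity))
          (Real.exp_pos _).le
        refine mul_le_mul (mul_le_mul (mul_le_mul t0 (pow_le_pow_left₀ (norm_nonneg _) tA 5)
          (by positivity) (by positivity)) tB (by positivity) (by positivity)) tC (by positivity)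
          (by positivity)
    _ = (‖thp (Z 0 0)‖ * ‖th (Z 0 0) a‖ ^ 5 * ‖th (Z 0 0) b‖ * ‖th (Z 0 0) c‖) *
        (112 ^ 8 * ((i.a : ℝ) ^ 11 * i.d ^ 15)) *
        rexp (X0 + (5 : ℕ) * XA + XB + XC + -(2 * π * (i.m * w))) := by
        rw [Real.exp_add, Real.exp_add, Real.exp_add, Real.exp_add, Real.exp_nat_mul]
        field_simp
    _ ≤ (‖thp (Z 0 0)‖ * ‖th (Z 0 0) a‖ ^ 5 * ‖th (Z 0 0) b‖ * ‖th (Z 0 0) c‖) *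
        (112 ^ 8 * (i.m : ℝ) ^ 15) *
        rexp (X0 + (5 : ℕ) * XA + XB + XC + -(2 * π * (i.m * w))) := by
        refine mul_le_mul_of_nonneg_right (mul_le_mul_of_nonneg_left ?_ (by positivity))
          (Real.exp_pos _).le
        exact mul_le_mul_of_nonneg_left hpow (by positivity)
    _ = _ := by
        rw [key, Real.exp_add]
        ring

theorem dom_exponent {y v S r A : ℝ} {m : ℕ} (hy : 4 / 5 < y) (hv : y / 20 < v) (hA : 0 < A)
    (hvA : 8 * A < v) (hS : S ≤ 7) (hs : y * (1 / 8 + S / 2) < v + y / 100)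
    (hm : 2 ≤ m) (hr : 1 / m ≤ r) :
    1 / 50 * A * (m - 1) ≤ (m - 1) * v - y / 8 + r * y / 8 - y * S / 2 := by
  have hm2 : (2 : ℝ) ≤ m := by exact_mod_cast hm
  have hy0 : 0 < y := by linarith
  have hr0 : 0 ≤ r := le_trans (by positivity) hr
  rcases lt_or_ge y A with h | h
  · nlinarith [mul_nonneg hr0 hy0.le]
  · have : 1 / 50 * y * (m - 1) ≤ (m - 1) * v - y / 8 + r * y / 8 - y * S / 2 := by
      rcases hm.eq_or_lt with h2 | h3
      · subst h2
        norm_num at hr ⊢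
        nlinarith
      · have hm3 : (3 : ℝ) ≤ m := by exact_mod_cast h3
        have h1 : (m - 2) * (y / 20) ≤ (m - 2) * v :=
          mul_le_mul_of_nonneg_left hv.le (by linarith)
        nlinarith [mul_nonneg hr0 hy0.le]
    nlinarith

def iZero : HIdx := ⟨(0, 0), 0⟩

theorem PhiM_iZero (Z : Matrix (Fin 2) (Fin 2) ℂ) : PhiM iZero.mat Z = lead Z := by
  rw [PhiM_mat, lead]
  simp [iZero, HIdx.a, HIdx.d, HIdx.b]

theorem HIdx.two_le_m {i : HIdx} (hi : i ≠ iZero) : 2 ≤ i.m := by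
  by_contra! h
  apply hi
  obtain ⟨⟨p, q⟩, x⟩ := i
  unfold HIdx.m HIdx.a HIdx.d at h
  simp only at h
  have hp : p = 0 := by nlinarith
  have hq : q = 0 := by nlinarith
  subst hp hq
  have : x = 0 := Subsingleton.elim (α := Fin 1) _ _
  rw [this]; rfl

theorem exists_dominance : ∃ C : ℝ, 0 < C ∧ ∀ Z ∈ HH2, NearCusp C Z →
    ‖b5 Z - lead Z‖ ≤ 1 / 2 * ‖lead Z‖ := by
  have hp := Real.pi_pos
  have hc : 0 < π / 25 := by positivity
  set T := 112 ^ 8 * rexp (π / 25) * ∑' i : HIdx, (i.m : ℝ) ^ 15 * rexp (-(π / 25 * i.m)) with hT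
  have hlim : Tendsto (fun A : ℝ => T * rexp (-(π / 25 * A))) atTop (𝓝 0) := by
    have h1 : Tendsto (fun A : ℝ => rexp (-(π / 25 * A))) atTop (𝓝 0) :=
      Real.tendsto_exp_neg_atTop_nhds_zero.comp (tendsto_id.const_mul_atTop hc)
    simpa using h1.const_mul T
  obtain ⟨A, hA0, hA⟩ := ((eventually_ge_atTop (0 : ℝ)).and
    (hlim.eventually (gt_mem_nhds (show (0 : ℝ) < 1 / 2 by norm_num)))).exists
  refine ⟨8 * (1 + A), by positivity, fun Z hZ h => ?_⟩
  have hsum := summable_PhiM hZ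
  have hS7 : sgm Z ≤ 7 := by
    have hy0 : 0 < (Z 0 0).im := by linarith [h.hy]
    have aux : ∀ x : ℝ, |x| < 3 / 2 * (Z 0 0).im → (|x| / (Z 0 0).im - 1 / 2) ^ 2 ≤ 1 := fun x hx => by
      have h1 : |x| / (Z 0 0).im < 3 / 2 := by rwa [div_lt_iff₀ hy0]
      have h2 : 0 ≤ |x| / (Z 0 0).im := by positivity
      nlinarith
    unfold sgm
    linarith [aux _ h.hA, aux _ h.hB, aux _ h.hC']
  have e : b5 Z - lead Z = ∑' i, if i = iZero then 0 else PhiM i.mat Z := by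
    rw [b5, hsum.tsum_eq_add_tsum_ite iZero, PhiM_iZero]
    ring
  have hbd : ∀ i : HIdx, ‖(if i = iZero then 0 else PhiM i.mat Z)‖ ≤
      ‖lead Z‖ * (112 ^ 8 * rexp (π / 25) * rexp (-(π / 25 * A))) *
        ((i.m : ℝ) ^ 15 * rexp (-(π / 25 * i.m))) := by
    intro i
    split_ifs with hi
    · rw [norm_zero]; positivity
    · have hm := HIdx.two_le_m hi
      have hm2 : (2 : ℝ) ≤ i.m := by exact_mod_cast hm
      have ha : (1 : ℝ) ≤ i.a := by exact_mod_cast i.a_pos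
      have hd : (1 : ℝ) ≤ i.d := by exact_mod_cast i.d_pos
      have hm' : (i.m : ℝ) = i.a * i.d := by unfold HIdx.m; push_cast; ring
      have hr : 1 / (i.m : ℝ) ≤ i.a / i.d := by
        rw [hm', div_le_div_iff₀ (by positivity) (by positivity)]
        nlinarith [mul_le_mul ha ha zero_le_one (by linarith)]
      have hE := dom_exponent h.hy h.hv (A := 1 + A) (by positivity) h.hC hS7 h.hs hm hr
      refine (PhiM_le_lead i h.hy h.hA h.hB h.hC').trans ?_
      rw [mul_assoc ‖lead Z‖]
      refine mul_le_mul_of_nonneg_left ?_ (norm_nonneg (lead Z))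
      have h2 : rexp (-(2 * π * ((i.m - 1) * vht Z - (Z 0 0).im / 8 + i.a * (Z 0 0).im / (8 * i.d)
        - (Z 0 0).im * sgm Z / 2))) ≤
          rexp (π / 25) * rexp (-(π / 25 * A)) * rexp (-(π / 25 * i.m)) := by
        rw [← Real.exp_add, ← Real.exp_add]
        refine Real.exp_le_exp.2 ?_
        have e2 : (i.a : ℝ) * (Z 0 0).im / (8 * i.d) = i.a / i.d * (Z 0 0).im / 8 := by
          field_simp
        rw [e2]
        have h3 := mul_le_mul_of_nonneg_left hE (show 0 ≤ 2 * π by positivity)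
        have h4 : 0 ≤ π * A * (i.m - 2) := mul_nonneg (by positivity) (by linarith)
        nlinarith
      calc _ ≤ 112 ^ 8 * (i.m : ℝ) ^ 15 * (rexp (π / 25) * rexp (-(π / 25 * A)) * rexp (-(π / 25 * i.m))) :=
            mul_le_mul_of_nonneg_left h2 (by positivity)
        _ = _ := by ring
  rw [e]
  have hfin := tsum_of_norm_bounded ((HIdx.summable 15 hc).hasSum.mul_left
    (‖lead Z‖ * (112 ^ 8 * rexp (π / 25) * rexp (-(π / 25 * A))))) hbd
  refine hfin.trans ?_
  have : ‖lead Z‖ * (112 ^ 8 * rexp (π / 25) * rexp (-(π / 25 * A))) *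
      ∑' i : HIdx, (i.m : ℝ) ^ 15 * rexp (-(π / 25 * i.m)) = (T * rexp (-(π / 25 * A))) * ‖lead Z‖ := by
    rw [hT]; ring
  rw [this]
  exact mul_le_mul_of_nonneg_right hA.le (norm_nonneg _)

end NearCusp

section Vanishing

open Complex Real Asymptotics Metric

theorem norm_matA_le : ‖matA‖ ≤ 1 := by
  refine (Matrix.norm_le_iff zero_le_one).2 fun i j => ?_
  fin_cases i <;> fin_cases j <;> simp [matA]

/-- The coordinate data of a linear form in the off-diagonal entries. -/
structure OffForm (u : ℂ → ℂ → ℂ) (c : ℂ) : Prop where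
  add : ∀ a b a' b', u (a + a') (b + b') = u a b + u a' b'
  mul : ∀ t a b, u (t * a) (t * b) = t * u a b
  cont : Continuous fun p : ℂ × ℂ => u p.1 p.2
  dir : u 1 (-1) = c
  ne : c ≠ 0
  unit : ∃ e ∈ OK, u e ((starRingEnd ℂ) e) = 1

theorem OffForm.line {u : ℂ → ℂ → ℂ} {c : ℂ} (h : OffForm u c) (Z : Matrix (Fin 2) (Fin 2) ℂ) (t : ℂ) :
    u ((Z + t • matA) 0 1) ((Z + t • matA) 1 0) = u (Z 0 1) (Z 1 0) + t * c := by
  rw [← h.dir, ← h.mul, ← h.add]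
  simp [matA]

theorem offForm_uA : OffForm uA (2 / s11) where
  add a b a' b' := uA_add a b a' b'
  mul := uA_mul
  cont := by unfold uA; fun_prop
  dir := by unfold uA; norm_num
  ne := div_ne_zero two_ne_zero s11_ne
  unit := ⟨om, om_mem, by
    have := s11_ne
    rw [uA, conj_om, div_eq_one_iff_eq s11_ne, s11]; ring⟩

theorem offForm_uB : OffForm uB (1 / s11) where
  add a b a' b' := uB_add a b a' b'
  mul := uB_mul
  cont := by unfold uB; fun_prop
  dir := by unfold uB; ring
  ne := div_ne_zero one_ne_zero s11_ne
  unit := ⟨1, OK.one_mem, by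
    rw [uB, map_one, div_eq_one_iff_eq s11_ne, s11]; ring⟩

theorem offForm_uC : OffForm uC (1 / s11) where
  add a b a' b' := uC_add a b a' b'
  mul := uC_mul
  cont := by unfold uC; fun_prop
  dir := by unfold uC; ring
  ne := div_ne_zero one_ne_zero s11_ne
  unit := ⟨-1, OK.neg_mem OK.one_mem, by
    rw [uC, map_neg, map_one, div_eq_one_iff_eq s11_ne, s11]; ring⟩

theorem analyticAt_line {F : Matrix (Fin 2) (Fin 2) ℂ → ℂ} (hF : DifferentiableOn ℂ F HH2)
    {Z A : Matrix (Fin 2) (Fin 2) ℂ} {t₀ : ℂ} (hZ : Z + t₀ • A ∈ HH2) :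
    AnalyticAt ℂ (fun t : ℂ => F (Z + t • A)) t₀ := by
  have hU : IsOpen ((fun t : ℂ => Z + t • A) ⁻¹' HH2) :=
    isOpen_HH2.preimage (differentiable_line Z A).continuous
  have : DifferentiableOn ℂ (fun t : ℂ => F (Z + t • A)) ((fun t : ℂ => Z + t • A) ⁻¹' HH2) := by
    intro t ht
    have h1 : DifferentiableAt ℂ F ((fun t : ℂ => Z + t • A) t) :=
      hF.differentiableAt (isOpen_HH2.mem_nhds ht)
    exact (h1.comp t (differentiable_line Z A t)).differentiableWithinAt
  exact this.analyticAt (hU.mem_nhds hZ)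

theorem isBigO_of_order {F : Matrix (Fin 2) (Fin 2) ℂ → ℂ} (hF : DifferentiableOn ℂ F HH2) {n : ℕ}
    {u : ℂ → ℂ → ℂ} {c : ℂ} (h : OffForm u c)
    (hord : ∀ Z ∈ HH2, u (Z 0 1) (Z 1 0) = 0 →
      (n : ℕ∞) ≤ analyticOrderAt (fun t : ℂ => F (Z + t • matA)) 0)
    {Z₀ : Matrix (Fin 2) (Fin 2) ℂ} (hZ₀ : Z₀ ∈ HH2) (h0 : u (Z₀ 0 1) (Z₀ 1 0) = 0) :
    F =O[𝓝 Z₀] fun Z => u (Z 0 1) (Z 1 0) ^ n := by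
  have hc := h.ne
  have hFc : ContinuousAt F Z₀ := (hF.differentiableAt (isOpen_HH2.mem_nhds hZ₀)).continuousAt
  have hM : ∀ᶠ Z in 𝓝 Z₀, Z ∈ HH2 ∧ ‖F Z‖ < ‖F Z₀‖ + 1 :=
    (isOpen_HH2.eventually_mem hZ₀).and (hFc.norm.eventually (gt_mem_nhds (by linarith)))
  obtain ⟨r, hr, hrU⟩ := Metric.eventually_nhds_iff_ball.1 hM
  let tt : Matrix (Fin 2) (Fin 2) ℂ → ℂ := fun Z => u (Z 0 1) (Z 1 0) / c
  have htc : Continuous tt := by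
    have h1 : Continuous fun Z : Matrix (Fin 2) (Fin 2) ℂ => (Z 0 1, Z 1 0) :=
      (differentiable_entry 0 1).continuous.prodMk (differentiable_entry 1 0).continuous
    exact (h.cont.comp h1).div_const c
  let P : Matrix (Fin 2) (Fin 2) ℂ → Matrix (Fin 2) (Fin 2) ℂ := fun Z => Z + (-tt Z) • matA
  have hPc : Continuous P := continuous_id.add (htc.neg.smul continuous_const)
  have htt0 : tt Z₀ = 0 := by simp [tt, h0]
  have hP0 : P Z₀ = Z₀ := by simp [P, htt0]
  have e1 : ∀ᶠ Z in 𝓝 Z₀, P Z ∈ ball Z₀ (r / 2) :=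
    hPc.continuousAt.eventually_mem (by rw [hP0]; exact ball_mem_nhds _ (by positivity))
  have e2 : ∀ᶠ Z in 𝓝 Z₀, tt Z ∈ ball (0 : ℂ) (r / 2) :=
    htc.continuousAt.eventually_mem (by rw [htt0]; exact ball_mem_nhds _ (by positivity))
  refine IsBigO.of_bound ((‖F Z₀‖ + 1) / (‖c‖ * (r / 2)) ^ n) ?_
  filter_upwards [e1, e2] with Z h1 h2
  have hball : ∀ t ∈ ball (0 : ℂ) (r / 2), P Z + t • matA ∈ ball Z₀ r := by
    intro t ht
    rw [mem_ball_iff_norm] at h1 ⊢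
    rw [mem_ball_zero_iff] at ht
    calc ‖P Z + t • matA - Z₀‖ = ‖(P Z - Z₀) + t • matA‖ := by congr 1; abel
      _ ≤ ‖P Z - Z₀‖ + ‖t‖ * ‖matA‖ := (norm_add_le _ _).trans_eq (by rw [norm_smul])
      _ < r := by nlinarith [norm_matA_le, norm_nonneg t]
  have hPH : P Z ∈ HH2 := by
    have := (hrU _ (hball 0 (mem_ball_self (by positivity)))).1
    simpa using this
  have hPu : u (P Z 0 1) (P Z 1 0) = 0 := by
    rw [h.line]; simp only [tt]; field_simp; ring
  have hb := norm_le_of_order (f := fun t : ℂ => F (P Z + t • matA)) (r := r / 2)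
    (M := ‖F Z₀‖ + 1) (n := n)
    (fun t ht => (analyticAt_line hF (hrU _ (hball t ht)).1).differentiableAt.differentiableWithinAt)
    (fun t ht => (hrU _ (hball t ht)).2.le) (hord _ hPH hPu) h2
  have e : P Z + tt Z • matA = Z := by simp [P, add_assoc]
  rw [e] at hb
  refine hb.trans_eq ?_
  simp only [tt, norm_div, norm_pow, div_pow, mul_pow]
  have := norm_ne_zero_iff.2 hc
  field_simp

theorem moebius_shift {x s : ℂ} (Z : Matrix (Fin 2) (Fin 2) ℂ) (hZ : Z ∈ HH2) :
    let M := tM 0 x 0 * lM 1 0 s 1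
    (autM M Z).det = 1 ∧ moebius M Z 0 0 = Z 0 0 ∧
    moebius M Z 0 1 = Z 0 1 + ((starRingEnd ℂ) s * Z 0 0 + x) ∧
    moebius M Z 1 0 = Z 1 0 + (s * Z 0 0 + (starRingEnd ℂ) x) := by
  intro M
  have hl : (1 : ℂ) * 1 - 0 * s = 1 := by ring
  have hU : inU (lM 1 0 s 1) := inU_lM hl
  refine ⟨?_, ?_⟩
  · rw [autM_mul hU hZ, Matrix.det_mul, autM_tM, det_autM_lM hl, Matrix.det_one, one_mul]
  · rw [moebius_mul hU hZ, moebius_tM, moebius_lM hl]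
    simp only [Matrix.add_apply, conj_fin_two]
    simp
    constructor <;> ring

theorem th_eq_zero_iff {τ u : ℂ} (hτ : 4 / 5 ≤ τ.im) : th τ u = 0 ↔ ∃ m n : ℤ, u = m + n * τ := by
  have hy : 0 < τ.im := by linarith
  constructor
  · intro h0
    set n := round (u.im / τ.im) with hn
    set v := u + ((-n : ℤ) : ℂ) * τ with hv
    have h1 : th τ v = 0 := by rw [hv, th_add_int_tau, h0, mul_zero]
    have h2 : |v.im| ≤ τ.im / 2 := by
      have h3 : v.im = τ.im * (u.im / τ.im - n) := by
        rw [hv]; simp; field_simp; ring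
      rw [h3, abs_mul, abs_of_pos hy]
      have := abs_sub_round (u.im / τ.im)
      nlinarith
    have h3 := th_lower hτ h2
    rw [h1, norm_zero] at h3
    have h4 : Complex.sin (π * v) = 0 := by
      rw [← norm_le_zero_iff]
      exact nonpos_of_mul_nonpos_left h3 (Real.exp_pos _)
    obtain ⟨k, hk⟩ := Complex.sin_eq_zero_iff.1 h4
    have hk' : v = k := by
      have hp : (π : ℂ) ≠ 0 := by exact_mod_cast Real.pi_ne_zero
      exact mul_left_cancel₀ hp (hk.trans (mul_comm _ _))
    refine ⟨k, n, ?_⟩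
    rw [← hk', hv]; push_cast; ring
  · rintro ⟨m, n, rfl⟩
    have := th_add_int τ 0 m
    rw [th_add_int_tau]
    rw [zero_add, th_zero, mul_zero] at this
    rw [this, mul_zero]

theorem thp_ne_zero {τ : ℂ} (hτ : 4 / 5 ≤ τ.im) : thp τ ≠ 0 := by
  have := thp_lower hτ
  have h2 : 0 < π * rexp (-(π * τ.im / 4)) := by positivity
  exact norm_pos_iff.1 (h2.trans_le this)

theorem isBigO_th {τ u c : ℂ} (hτ : 4 / 5 ≤ τ.im) (hc : c ≠ 0) (h0 : th τ u = 0) :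
    (fun t : ℂ => t) =O[𝓝 0] fun t => th τ (u + t * c) := by
  have hy : 0 < τ.im := by linarith
  obtain ⟨m, n, rfl⟩ := (th_eq_zero_iff hτ).1 h0
  have e : ∀ t : ℂ, th τ (m + n * τ + t * c) =
      ((-1) ^ n * cexp (-(π * I * (n ^ 2 * τ + 2 * n * (t * c + m)))) * (-1) ^ m) * th τ (t * c) := by
    intro t
    rw [show (m + n * τ + t * c : ℂ) = (t * c + m) + n * τ by ring, th_add_int_tau, th_add_int]
    ring
  simp only [e]
  have h1 : HasDerivAt (fun t : ℂ => t * c) c 0 := by simpa using (hasDerivAt_id (0 : ℂ)).mul_const c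
  have h2 : HasDerivAt (fun t : ℂ => th τ (t * c)) (thp τ * c) 0 :=
    HasDerivAt.comp (0 : ℂ) (h₂ := th τ) (by simpa using hasDerivAt_th_zero hy) h1
  have hE : HasDerivAt (fun t : ℂ => ((-1) ^ n * cexp (-(π * I * (n ^ 2 * τ + 2 * n * (t * c + m)))) *
      (-1) ^ m : ℂ)) _ 0 := (DifferentiableAt.hasDerivAt (by fun_prop))
  have h3 := hE.fun_mul h2
  have h4 := HasDerivAtFilter.isTheta_sub h3 (by
    simp only [zero_mul, th_zero, mul_zero, zero_add]
    have := thp_ne_zero hτ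
    have h5 : ∀ k : ℤ, ((-1 : ℂ)) ^ k ≠ 0 := fun k => zpow_ne_zero _ (by norm_num)
    exact mul_ne_zero (mul_ne_zero (mul_ne_zero (h5 _) (Complex.exp_ne_zero _)) (h5 _))
      (mul_ne_zero this hc))
  have h5 : Tendsto (fun t : ℂ => (t, (0 : ℂ))) (𝓝 0) (𝓝 0 ×ˢ pure 0) :=
    tendsto_id.prodMk tendsto_const_pure
  simpa [Function.comp_def, th_zero] using h4.isBigO_symm.comp_tendsto h5

theorem isBigO_line {F : Matrix (Fin 2) (Fin 2) ℂ → ℂ} {k n : ℕ} (hF : IsHMF 11 k F)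
    {u : ℂ → ℂ → ℂ} {c : ℂ} (h : OffForm u c)
    (hord : ∀ Z ∈ HH2, u (Z 0 1) (Z 1 0) = 0 →
      (n : ℕ∞) ≤ analyticOrderAt (fun t : ℂ => F (Z + t • matA)) 0)
    {Z : Matrix (Fin 2) (Fin 2) ℂ} (hZ : Z ∈ HH2) (hy : 4 / 5 ≤ (Z 0 0).im)
    (h0 : th (Z 0 0) (u (Z 0 1) (Z 1 0)) = 0) :
    (fun t : ℂ => F (Z + t • matA)) =O[𝓝 0]
      fun t => th (Z 0 0) (u (Z 0 1) (Z 1 0) + t * c) ^ n := by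
  obtain ⟨p, q, hpq⟩ := (th_eq_zero_iff hy).1 h0
  obtain ⟨e, he, he1⟩ := h.unit
  set s : ℂ := -q * (starRingEnd ℂ) e with hs
  set x : ℂ := -p * e with hx
  have hsm : s ∈ OK := OK.mul_mem (OK.neg_mem (intCast_mem_OK q)) (conj_mem_OK he)
  have hxm : x ∈ OK := OK.mul_mem (OK.neg_mem (intCast_mem_OK p)) he
  set M := tM 0 x 0 * lM 1 0 s 1 with hM
  have hl : (1 : ℂ) * 1 - 0 * s = 1 := by ring
  have hSU : inSU 11 M := by
    have h1 := inSU_tM 0 hxm 0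
    simp only [Int.cast_zero] at h1
    exact h1.mul (inSU_lM hl OK.one_mem OK.zero_mem hsm OK.one_mem)
  have hval : ∀ W ∈ HH2, u (moebius M W 0 1) (moebius M W 1 0) =
      u (W 0 1) (W 1 0) - p - q * W 0 0 := by
    intro W hW
    obtain ⟨-, -, h2, h3⟩ := moebius_shift (x := x) (s := s) W hW
    rw [h2, h3, h.add, h.add]
    have a1 : (starRingEnd ℂ) s * W 0 0 = (-q * W 0 0) * e := by simp [hs]; ring
    have a2 : s * W 0 0 = (-q * W 0 0) * (starRingEnd ℂ) e := by simp [hs]; ring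
    have a3 : (starRingEnd ℂ) x = -p * (starRingEnd ℂ) e := by simp [hx]
    rw [a1, a2, a3, hx, h.mul, h.mul, he1]
    ring
  have hFM : ∀ W ∈ HH2, F (moebius M W) = F W := by
    intro W hW
    have h1 := hF.2 M hSU W hW
    have h2 := (moebius_shift (x := x) (s := s) W hW).1
    rw [autM] at h2
    rw [h1, h2, one_pow, one_mul]
  have hB := isBigO_of_order hF.1 h hord (moebius_mem hSU.inU hZ) (by
    rw [hval Z hZ, hpq]; ring)
  have hcont : Tendsto (fun t : ℂ => moebius M (Z + t • matA)) (𝓝 0) (𝓝 (moebius M Z)) := by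
    have h1 : ContinuousAt (moebius M) ((fun t : ℂ => Z + t • matA) 0) :=
      (differentiableAt_moebius hSU.inU (by simpa using hZ)).continuousAt
    have h2 : ContinuousAt (fun t : ℂ => moebius M (Z + t • matA)) 0 :=
      ContinuousAt.comp (f := fun t : ℂ => Z + t • matA) h1
        (differentiable_line Z matA).continuous.continuousAt
    have h3 := h2.tendsto
    rwa [zero_smul, add_zero] at h3
  have hB2 := hB.comp_tendsto hcont
  have hin : ∀ᶠ t : ℂ in 𝓝 0, Z + t • matA ∈ HH2 :=
    (differentiable_line Z matA).continuous.continuousAt.preimage_mem_nhds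
      (by simpa using isOpen_HH2.mem_nhds hZ)
  have h00 : ∀ t : ℂ, (Z + t • matA) 0 0 = Z 0 0 := fun t => by simp [matA]
  have hB3 : (fun t : ℂ => F (Z + t • matA)) =O[𝓝 0] fun t : ℂ => t ^ n := by
    refine (hB2.congr' ?_ ?_).trans (isBigO_const_mul_self (c ^ n) (fun t : ℂ => t ^ n) (𝓝 0))
    · filter_upwards [hin] with t ht using hFM _ ht
    · filter_upwards [hin] with t ht
      simp only [Function.comp_apply]
      rw [hval _ ht, h.line, h00, hpq]
      ring
  exact hB3.trans ((isBigO_th hy h.ne h0).pow n)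

theorem order_uA {F : Matrix (Fin 2) (Fin 2) ℂ → ℂ} (hF : DifferentiableOn ℂ F HH2)
    (hV : VanishesAlongH1 F 5) {Z : Matrix (Fin 2) (Fin 2) ℂ} (hZ : Z ∈ HH2)
    (h0 : uA (Z 0 1) (Z 1 0) = 0) :
    ((5 : ℕ) : ℕ∞) ≤ analyticOrderAt (fun t : ℂ => F (Z + t • matA)) 0 := by
  have han : AnalyticAt ℂ (fun t : ℂ => F (Z + t • matA)) 0 := analyticAt_line hF (by simpa using hZ)
  have hs : Z 0 1 = Z 1 0 := by
    rw [uA, div_eq_zero_iff] at h0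
    exact sub_eq_zero.1 (h0.resolve_right s11_ne)
  refine (natCast_le_analyticOrderAt_iff_iteratedDeriv_eq_zero (n := 5) han).2 (hV Z hZ ?_)
  ext i j; fin_cases i <;> fin_cases j <;> simp [hs]

theorem order_one {F : Matrix (Fin 2) (Fin 2) ℂ → ℂ} (hF : DifferentiableOn ℂ F HH2)
    {Z : Matrix (Fin 2) (Fin 2) ℂ} (hZ : Z ∈ HH2) (h0 : F Z = 0) :
    ((1 : ℕ) : ℕ∞) ≤ analyticOrderAt (fun t : ℂ => F (Z + t • matA)) 0 := by
  have han : AnalyticAt ℂ (fun t : ℂ => F (Z + t • matA)) 0 := analyticAt_line hF (by simpa using hZ)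
  refine (natCast_le_analyticOrderAt_iff_iteratedDeriv_eq_zero (n := 1) han).2 fun m hm => ?_
  obtain rfl : m = 0 := by omega
  simpa using h0

theorem eq_zero_of_uB {F : Matrix (Fin 2) (Fin 2) ℂ → ℂ} (hV : VanishesOnHeegner (omg 11) F)
    {Z : Matrix (Fin 2) (Fin 2) ℂ} (hZ : Z ∈ HH2) (h0 : uB (Z 0 1) (Z 1 0) = 0) : F Z = 0 := by
  have h1 : om * Z 0 1 = (1 - om) * Z 1 0 := by
    rw [uB, div_eq_zero_iff] at h0
    exact sub_eq_zero.1 (h0.resolve_right s11_ne)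
  have hn : om * (1 - om) = 3 := by linear_combination -om_mul_self
  have hom : om ≠ 0 := fun h => by rw [h] at hn; norm_num at hn
  set z := Z 1 0 / om with hz
  have e10 : Z 1 0 = om * z := by rw [hz]; field_simp
  have e01 : Z 0 1 = (1 - om) * z := by
    have : om * Z 0 1 = om * ((1 - om) * z) := by rw [h1, e10]; ring
    exact mul_left_cancel₀ hom this
  set τ : Matrix (Fin 2) (Fin 2) ℂ := !![Z 0 0, z; z, Z 1 1 / 3] with hτ
  have hphi : phiLam om τ = Z := by
    ext i j; fin_cases i <;> fin_cases j <;>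
    simp [phiLam, hτ, conj_om, e01, e10, hn]
    field_simp
  have hns : Complex.normSq om = 3 := by
    have := Complex.mul_conj om
    rw [conj_om, hn] at this
    exact_mod_cast this.symm
  have hτm : τ ∈ HH2 := by
    rw [mem_HH2_iff] at hZ ⊢
    refine ⟨by simpa [hτ] using hZ.1, ?_⟩
    have e : Z 0 1 - (starRingEnd ℂ) (Z 1 0) = (1 - om) * (z - (starRingEnd ℂ) z) := by
      rw [e01, e10, map_mul, conj_om]; ring
    have hns' : Complex.normSq (1 - om) = 3 := by rw [← conj_om, Complex.normSq_conj, hns]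
    have h2 := hZ.2
    rw [detY, e, Complex.normSq_mul, hns'] at h2
    have h3 : (Z 1 1 / 3).im = (Z 1 1).im / 3 := by
      rw [show (3 : ℂ) = ((3 : ℝ) : ℂ) by norm_num, Complex.div_ofReal_im]
    rw [detY]
    simp only [hτ, Matrix.of_apply, Matrix.cons_val_zero, Matrix.cons_val_one, Matrix.cons_val',
      Matrix.cons_val_fin_one]
    rw [h3]
    linarith
  have h4 := hV τ hτm (by ext i j; fin_cases i <;> fin_cases j <;> simp [hτ])
  rwa [show omg 11 = om from rfl, hphi] at h4

theorem eq_zero_of_uC {F : Matrix (Fin 2) (Fin 2) ℂ → ℂ} {k : ℕ} (hF : IsHMF 11 k F)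
    (hV : VanishesOnHeegner (omg 11) F)
    {Z : Matrix (Fin 2) (Fin 2) ℂ} (hZ : Z ∈ HH2) (h0 : uC (Z 0 1) (Z 1 0) = 0) : F Z = 0 := by
  have hm := moebius_mem inU_sM hZ
  have h1 := hF.2 sM inSU_sM Z hZ
  have h2 : F (moebius sM Z) = 0 := by
    refine eq_zero_of_uB hV hm ?_
    rw [moebius_sM]
    change uB (Z 1 0) (Z 0 1) = 0
    rw [uB_swap, h0, neg_zero]
  rw [h2] at h1
  exact (mul_eq_zero.1 h1.symm).resolve_left (pow_ne_zero _ (autM_det_ne_zero inU_sM hZ))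

end Vanishing

section NearCuspGood

open Complex Real Asymptotics Metric

theorem exists_disc_quotient {f g : ℂ → ℂ} {ρ : ℝ} (hρ : 0 < ρ)
    (hf : AnalyticOnNhd ℂ f (closedBall 0 ρ)) (hg : AnalyticOnNhd ℂ g (closedBall 0 ρ))
    (hO : ∀ t ∈ closedBall (0 : ℂ) ρ, f =O[𝓝 t] g) (hne : ∀ t : ℂ, ‖t‖ = ρ → g t ≠ 0) :
    ∃ h : ℂ → ℂ, DiffContOnCl ℂ h (ball 0 ρ) ∧ (∀ t : ℂ, ‖t‖ = ρ → h t = f t / g t) ∧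
      f 0 = g 0 * h 0 := by
  set q : ℂ → ℂ := fun t => f t / g t with hq
  have hg0 : ∀ t ∈ closedBall (0 : ℂ) ρ, ∀ᶠ z in 𝓝[≠] t, g z ≠ 0 := by
    intro t ht
    refine (hg t ht).eventually_eq_zero_or_eventually_ne_zero.resolve_left fun h0 => ?_
    have h1 := hg.eqOn_zero_of_preconnected_of_eventuallyEq_zero
      (convex_closedBall (0 : ℂ) ρ).isPreconnected ht h0
    have h2 : ‖(ρ : ℂ)‖ = ρ := by simp [abs_of_pos hρ]
    exact hne ρ h2 (h1 (by rw [mem_closedBall_zero_iff, h2]))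
  have key : ∀ t ∈ closedBall (0 : ℂ) ρ,
      DifferentiableAt ℂ (fun z => limUnder (𝓝[≠] z) q) t ∧ f t = g t * limUnder (𝓝[≠] t) q ∧
      (g t ≠ 0 → limUnder (𝓝[≠] t) q = q t) := by
    intro t ht
    obtain ⟨C, hC⟩ := (hO t ht).bound
    have hall : ∀ᶠ z in 𝓝 t, AnalyticAt ℂ f z ∧ AnalyticAt ℂ g z ∧ ‖f z‖ ≤ C * ‖g z‖ ∧ (z ≠ t → g z ≠ 0) := by
      filter_upwards [(hf t ht).eventually_analyticAt, (hg t ht).eventually_analyticAt, hC,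
        eventually_nhdsWithin_iff.1 (hg0 t ht)] with z a b c d using ⟨a, b, c, d⟩
    obtain ⟨s, hs, hso, hts⟩ := _root_.eventually_nhds_iff.1 hall
    have hqd : ∀ z ∈ s, g z ≠ 0 → DifferentiableAt ℂ q z := fun z hz hgz =>
      (hs z hz).1.differentiableAt.div (hs z hz).2.1.differentiableAt hgz
    have hlim : ∀ z ∈ s, g z ≠ 0 → limUnder (𝓝[≠] z) q = q z := fun z hz hgz =>
      ((hqd z hz hgz).continuousAt.tendsto.mono_left nhdsWithin_le_nhds).limUnder_eq
    have hU := Complex.differentiableOn_update_limUnder_of_bddAbove (f := q) (hso.mem_nhds hts)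
      (fun z hz => (hqd z hz.1 ((hs z hz.1).2.2.2 hz.2)).differentiableWithinAt)
      ⟨C, by
        rintro _ ⟨z, hz, rfl⟩
        have h1 := (hs z hz.1).2.2.2 hz.2
        simp only [Function.comp_apply, hq, norm_div]
        rw [div_le_iff₀ (norm_pos_iff.2 h1)]
        exact (hs z hz.1).2.2.1⟩
    have hUt := (hU t hts).differentiableAt (hso.mem_nhds hts)
    have hev : (fun z => limUnder (𝓝[≠] z) q) =ᶠ[𝓝 t] Function.update q t (limUnder (𝓝[≠] t) q) := by
      filter_upwards [hso.mem_nhds hts] with z hz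
      by_cases hzt : z = t
      · subst hzt; simp
      · rw [Function.update_of_ne hzt, hlim z hz ((hs z hz).2.2.2 hzt)]
    refine ⟨hUt.congr_of_eventuallyEq hev, ?_, hlim t hts⟩
    have hT : Tendsto q (𝓝[≠] t) (𝓝 (limUnder (𝓝[≠] t) q)) := by
      have := continuousAt_update_same.1 hUt.continuousAt
      exact this
    have h1 : Tendsto (fun z => g z * q z) (𝓝[≠] t) (𝓝 (g t * limUnder (𝓝[≠] t) q)) :=
      ((hg t ht).continuousAt.tendsto.mono_left nhdsWithin_le_nhds).mul hT
    have h2 : Tendsto f (𝓝[≠] t) (𝓝 (f t)) :=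
      (hf t ht).continuousAt.tendsto.mono_left nhdsWithin_le_nhds
    refine tendsto_nhds_unique (h2.congr' ?_) h1
    filter_upwards [hg0 t ht] with z hz
    simp only [hq]
    field_simp
  refine ⟨fun z => limUnder (𝓝[≠] z) q, ?_, fun t ht => ?_, ?_⟩
  · refine DifferentiableOn.diffContOnCl ?_
    rw [closure_ball _ hρ.ne']
    exact fun t ht => (key t ht).1.differentiableWithinAt
  · exact (key t (by rw [mem_closedBall_zero_iff, ht])).2.2 (hne t ht)
  · exact (key 0 (mem_closedBall_self hρ.le)).2.1

theorem th_line_eventually_ne {τ u c : ℂ} (hτ : 4 / 5 ≤ τ.im) (hc : c ≠ 0) :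
    ∀ᶠ t : ℂ in 𝓝[≠] 0, th τ (u + t * c) ≠ 0 := by
  have hy : 0 < τ.im := by linarith
  by_cases h0 : th τ u = 0
  · obtain ⟨C, hC⟩ := (isBigO_th hτ hc h0).bound
    rw [eventually_nhdsWithin_iff]
    filter_upwards [hC] with t ht ht0 h
    rw [h, norm_zero, mul_zero] at ht
    exact ht0 (norm_le_zero_iff.1 ht)
  · have h1 : DifferentiableAt ℂ (fun t : ℂ => th τ (u + t * c)) 0 :=
      differentiableAt_th' (f := fun _ => τ) hy (by fun_prop) (by fun_prop)
    exact (h1.continuousAt.eventually_ne (by simpa using h0)).filter_mono nhdsWithin_le_nhds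

theorem lead_line (Z : Matrix (Fin 2) (Fin 2) ℂ) (t : ℂ) : lead (Z + t • matA) =
    thp (Z 0 0) * th (Z 0 0) (uA (Z 0 1) (Z 1 0) + t * (2 / s11)) ^ 5 *
    th (Z 0 0) (uB (Z 0 1) (Z 1 0) + t * (1 / s11)) *
    th (Z 0 0) (uC (Z 0 1) (Z 1 0) + t * (1 / s11)) * cexp (2 * π * I * Z 1 1) := by
  rw [lead, phi1, uA_add_matA, uB_add_matA, uC_add_matA]
  simp [matA]

theorem lead_line_eventually_ne {Z : Matrix (Fin 2) (Fin 2) ℂ} (hy : 4 / 5 ≤ (Z 0 0).im) :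
    ∀ᶠ t : ℂ in 𝓝[≠] 0, lead (Z + t • matA) ≠ 0 := by
  filter_upwards [th_line_eventually_ne (u := uA (Z 0 1) (Z 1 0)) hy offForm_uA.ne,
    th_line_eventually_ne (u := uB (Z 0 1) (Z 1 0)) hy offForm_uB.ne,
    th_line_eventually_ne (u := uC (Z 0 1) (Z 1 0)) hy offForm_uC.ne] with t h1 h2 h3
  rw [lead_line]
  exact mul_ne_zero (mul_ne_zero (mul_ne_zero (mul_ne_zero (thp_ne_zero hy) (pow_ne_zero _ h1)) h2) h3)
    (Complex.exp_ne_zero _)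

theorem isBigO_mul_of_ne {f g₁ g₂ : ℂ → ℂ} {t : ℂ} (h : f =O[𝓝 t] g₁) (hc : ContinuousAt g₂ t)
    (h0 : g₂ t ≠ 0) : f =O[𝓝 t] fun z => g₁ z * g₂ z := by
  have h1 : (fun _ : ℂ => (1 : ℂ)) =O[𝓝 t] g₂ := by
    refine IsBigO.of_bound (2 / ‖g₂ t‖) ?_
    have hp := norm_pos_iff.2 h0
    filter_upwards [hc.norm.eventually (lt_mem_nhds (show ‖g₂ t‖ / 2 < ‖g₂ t‖ by linarith))] with z hz
    rw [norm_one, div_mul_eq_mul_div, one_le_div hp]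
    linarith
  have := h.mul h1
  simpa using this

theorem isBigO_lead {F : Matrix (Fin 2) (Fin 2) ℂ → ℂ} {k : ℕ} (hF : IsHMF 11 k F)
    (hV1 : VanishesAlongH1 F 5) (hV3 : VanishesOnHeegner (omg 11) F)
    {Z : Matrix (Fin 2) (Fin 2) ℂ} (hZ : Z ∈ HH2) (hy : 4 / 5 ≤ (Z 0 0).im)
    (hne : th (Z 0 0) (Z 0 1 + Z 1 0) ≠ 0) :
    (fun t : ℂ => F (Z + t • matA)) =O[𝓝 0] fun t => lead (Z + t • matA) := by
  have hy0 : 0 < (Z 0 0).im := by linarith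
  have hc : ∀ u c : ℂ, ContinuousAt (fun t : ℂ => th (Z 0 0) (u + t * c)) 0 := fun u c =>
    (differentiableAt_th' (f := fun _ => Z 0 0) hy0 (by fun_prop) (by fun_prop)).continuousAt
  have hne' : ¬ ∃ m n : ℤ, Z 0 1 + Z 1 0 = m + n * Z 0 0 := fun h => hne ((th_eq_zero_iff hy).2 h)
  have hBC : uB (Z 0 1) (Z 1 0) - uC (Z 0 1) (Z 1 0) = Z 0 1 + Z 1 0 := by
    have := s11_ne
    unfold uB uC
    field_simp
    rw [s11]; ring
  have hA := uB_add_uC (Z 0 1) (Z 1 0)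
  simp only [lead_line]
  set a := uA (Z 0 1) (Z 1 0) with ha
  set b := uB (Z 0 1) (Z 1 0) with hb
  set c := uC (Z 0 1) (Z 1 0) with hc'
  have hAB : th (Z 0 0) a = 0 → th (Z 0 0) b ≠ 0 := fun h1 h2 => by
    obtain ⟨m, n, e1⟩ := (th_eq_zero_iff hy).1 h1
    obtain ⟨m', n', e2⟩ := (th_eq_zero_iff hy).1 h2
    exact hne' ⟨2 * m' - m, 2 * n' - n, by push_cast; linear_combination -hBC - hA - e1 + 2 * e2⟩
  have hAC : th (Z 0 0) a = 0 → th (Z 0 0) c ≠ 0 := fun h1 h2 => by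
    obtain ⟨m, n, e1⟩ := (th_eq_zero_iff hy).1 h1
    obtain ⟨m', n', e2⟩ := (th_eq_zero_iff hy).1 h2
    exact hne' ⟨m - 2 * m', n - 2 * n', by push_cast; linear_combination -hBC + hA + e1 - 2 * e2⟩
  have hBC' : th (Z 0 0) b = 0 → th (Z 0 0) c ≠ 0 := fun h1 h2 => by
    obtain ⟨m, n, e1⟩ := (th_eq_zero_iff hy).1 h1
    obtain ⟨m', n', e2⟩ := (th_eq_zero_iff hy).1 h2
    exact hne' ⟨m - m', n - n', by push_cast; linear_combination -hBC + e1 - e2⟩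
  have hp := thp_ne_zero hy
  have hE : cexp (2 * π * I * Z 1 1) ≠ 0 := Complex.exp_ne_zero _
  have hA0 := hc a (2 / s11)
  have hB0 := hc b (1 / s11)
  have hC0 := hc c (1 / s11)
  by_cases h1 : th (Z 0 0) a = 0
  · have h := isBigO_mul_of_ne (isBigO_line hF offForm_uA (fun W hW h0 => order_uA hF.1 hV1 hW h0) hZ hy h1)
      (g₂ := fun t : ℂ => thp (Z 0 0) * th (Z 0 0) (b + t * (1 / s11)) *
        th (Z 0 0) (c + t * (1 / s11)) * cexp (2 * π * I * Z 1 1))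
      (((continuousAt_const.mul hB0).mul hC0).mul continuousAt_const) (by
        simp only [zero_mul, add_zero]
        exact mul_ne_zero (mul_ne_zero (mul_ne_zero hp (hAB h1)) (hAC h1)) hE)
    refine h.congr_right fun t => ?_
    ring
  by_cases h2 : th (Z 0 0) b = 0
  · have h := isBigO_mul_of_ne (isBigO_line hF offForm_uB
      (fun W hW h0 => order_one hF.1 hW (eq_zero_of_uB hV3 hW h0)) hZ hy h2)
      (g₂ := fun t : ℂ => thp (Z 0 0) * th (Z 0 0) (a + t * (2 / s11)) ^ 5 *
        th (Z 0 0) (c + t * (1 / s11)) * cexp (2 * π * I * Z 1 1))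
      (((continuousAt_const.mul (hA0.pow 5)).mul hC0).mul continuousAt_const) (by
        simp only [zero_mul, add_zero]
        exact mul_ne_zero (mul_ne_zero (mul_ne_zero hp (pow_ne_zero _ h1)) (hBC' h2)) hE)
    refine h.congr_right fun t => ?_
    ring
  by_cases h3 : th (Z 0 0) c = 0
  · have h := isBigO_mul_of_ne (isBigO_line hF offForm_uC
      (fun W hW h0 => order_one hF.1 hW (eq_zero_of_uC hF hV3 hW h0)) hZ hy h3)
      (g₂ := fun t : ℂ => thp (Z 0 0) * th (Z 0 0) (a + t * (2 / s11)) ^ 5 *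
        th (Z 0 0) (b + t * (1 / s11)) * cexp (2 * π * I * Z 1 1))
      (((continuousAt_const.mul (hA0.pow 5)).mul hB0).mul continuousAt_const) (by
        simp only [zero_mul, add_zero]
        exact mul_ne_zero (mul_ne_zero (mul_ne_zero hp (pow_ne_zero _ h1)) h2) hE)
    refine h.congr_right fun t => ?_
    ring
  · have hFc : ContinuousAt (fun t : ℂ => F (Z + t • matA)) 0 :=
      (analyticAt_line hF.1 (by simpa using hZ)).continuousAt
    have h := isBigO_mul_of_ne (g₁ := fun _ => 1) (hFc.isBigO_one ℂ)
      (g₂ := fun t : ℂ => thp (Z 0 0) * th (Z 0 0) (a + t * (2 / s11)) ^ 5 *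
        th (Z 0 0) (b + t * (1 / s11)) *
        th (Z 0 0) (c + t * (1 / s11)) * cexp (2 * π * I * Z 1 1))
      ((((continuousAt_const.mul (hA0.pow 5)).mul hB0).mul hC0).mul continuousAt_const) (by
        simp only [zero_mul, add_zero]
        exact mul_ne_zero (mul_ne_zero (mul_ne_zero (mul_ne_zero hp (pow_ne_zero _ h1)) h2) h3) hE)
    refine h.congr_right fun t => ?_
    ring

end NearCuspGood

section Discs

variable {E : Type*} [NormedAddCommGroup E]

theorem eventually_forall_add_mem {O : Set E} (hO : IsOpen O) {γ : ℂ → E} (hγ : Continuous γ)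
    {K : Set ℂ} (hK : IsCompact K) {x : E} (h : ∀ ζ ∈ K, x + γ ζ ∈ O) :
    ∀ᶠ e in 𝓝 x, ∀ ζ ∈ K, e + γ ζ ∈ O := by
  refine hK.eventually_forall_of_forall_eventually fun ζ hζ => ?_
  have hc : Continuous fun p : E × ℂ => p.1 + γ p.2 := by fun_prop
  exact (hO.preimage hc).mem_nhds (h ζ hζ)

variable [NormedSpace ℂ E] [FiniteDimensional ℂ E] [NormedSpace ℝ E] [IsScalarTower ℝ ℂ E]

theorem goodAt_of_frequently_disc {F b : E → ℂ} {Ω : Set E} (hΩ : IsOpen Ω)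
    (hF : DifferentiableOn ℂ F Ω) (hb : DifferentiableOn ℂ b Ω)
    (hbd : ∀ x ∈ Ω, ∃ᶠ y in 𝓝 x, b y ≠ 0) {γ : ℂ → E} (hγ : Differentiable ℂ γ) (hγ0 : γ 0 = 0)
    {ρ : ℝ} (hρ : 0 < ρ) {x : E} (hx : x ∈ Ω)
    (hcirc : ∀ ζ : ℂ, ‖ζ‖ = ρ → x + γ ζ ∈ Ω ∧ GoodAt F b (x + γ ζ))
    (hf : ∃ᶠ e in 𝓝 x, ∀ ζ : ℂ, ‖ζ‖ ≤ ρ → e + γ ζ ∈ Ω ∧ GoodAt F b (e + γ ζ)) :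
    GoodAt F b x := by
  have hO : IsOpen (Ω ∩ {x | GoodAt F b x}) := hΩ.inter (isOpen_goodAt F b)
  have h1 : ∀ᶠ e in 𝓝 x, ∀ ζ ∈ Metric.sphere (0 : ℂ) ρ, e + γ ζ ∈ Ω ∩ {x | GoodAt F b x} :=
    eventually_forall_add_mem hO hγ.continuous (isCompact_sphere _ _)
      fun ζ hζ => hcirc ζ (by simpa using hζ)
  obtain ⟨r, hr, hr'⟩ := Metric.eventually_nhds_iff_ball.1 (h1.and (hΩ.mem_nhds hx))
  obtain ⟨e₀, he₀, he₀r⟩ := (hf.and_eventually (Metric.ball_mem_nhds x hr)).exists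
  have h2 : ∀ᶠ e in 𝓝 e₀, ∀ ζ ∈ Metric.closedBall (0 : ℂ) ρ, e + γ ζ ∈ Ω ∩ {x | GoodAt F b x} :=
    eventually_forall_add_mem hO hγ.continuous (isCompact_closedBall _ _)
      fun ζ hζ => he₀ ζ (by simpa using hζ)
  obtain ⟨s, hs, hs'⟩ := Metric.eventually_nhds_iff_ball.1 h2
  refine goodAt_of_discs hΩ hF hb hbd Metric.isOpen_ball (convex_ball x r) (fun e he => (hr' e he).2)
    hγ.continuous hρ (fun e he ζ hζ => ((hr' e he).1 ζ (by simpa using hζ)).1)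
    (fun e he ζ hζ => ((hr' e he).1 ζ (by simpa using hζ)).2)
    (W := Metric.ball e₀ s ∩ Metric.ball x r) (Metric.isOpen_ball.inter Metric.isOpen_ball)
    Set.inter_subset_right ⟨e₀, Metric.mem_ball_self hs, he₀r⟩ (fun e he => ?_) x
    (Metric.mem_ball_self hr)
  have h3 : ∀ ζ ∈ Metric.closedBall (0 : ℂ) ρ,
      DifferentiableAt ℂ (fun ζ => quo F b (e + γ ζ)) ζ := fun ζ hζ => by
    obtain ⟨a, b'⟩ := hs' e he.1 ζ hζ
    exact (b'.differentiableAt_quo hΩ hbd a).comp ζ ((differentiableAt_const e).add (hγ ζ))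
  refine ⟨fun ζ => quo F b (e + γ ζ), DifferentiableOn.diffContOnCl ?_, fun _ _ => rfl, ?_⟩
  · rw [closure_ball _ hρ.ne']
    exact fun ζ hζ => (h3 ζ hζ).differentiableWithinAt
  · obtain ⟨a, b'⟩ := hs' e he.1 0 (Metric.mem_closedBall_self hρ.le)
    rw [hγ0, add_zero] at a b'
    simpa [hγ0] using b'.eq_mul_quo hΩ hbd a

end Discs

section NearCuspGood2

open Complex Real Asymptotics

theorem b5_ne_of_lead {Z : Matrix (Fin 2) (Fin 2) ℂ} (h : ‖b5 Z - lead Z‖ ≤ 1 / 2 * ‖lead Z‖)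
    (h0 : lead Z ≠ 0) : b5 Z ≠ 0 := by
  intro hb
  rw [hb, zero_sub, norm_neg] at h
  have := norm_pos_iff.2 h0
  linarith

theorem lead_le_b5 {Z : Matrix (Fin 2) (Fin 2) ℂ} (h : ‖b5 Z - lead Z‖ ≤ 1 / 2 * ‖lead Z‖) :
    ‖lead Z‖ ≤ 2 * ‖b5 Z‖ := by
  have := norm_sub_norm_le (lead Z) (b5 Z)
  rw [norm_sub_rev] at this
  linarith

theorem continuous_uIm : Continuous (fun Z : Matrix (Fin 2) (Fin 2) ℂ => (uA (Z 0 1) (Z 1 0)).im) ∧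
    Continuous (fun Z : Matrix (Fin 2) (Fin 2) ℂ => (uB (Z 0 1) (Z 1 0)).im) ∧
    Continuous (fun Z : Matrix (Fin 2) (Fin 2) ℂ => (uC (Z 0 1) (Z 1 0)).im) := by
  have hc : ∀ i j, Continuous fun Z : Matrix (Fin 2) (Fin 2) ℂ => Z i j := fun i j =>
    (differentiable_entry i j).continuous
  have h1 := hc 0 1
  have h2 := hc 1 0
  unfold uA uB uC
  simp only [div_eq_mul_inv]
  refine ⟨?_, ?_, ?_⟩ <;> fun_prop

theorem eventually_nearCusp {C : ℝ} {Z : Matrix (Fin 2) (Fin 2) ℂ} (hZ : Z ∈ HH2)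
    (h : NearCusp C Z) : ∀ᶠ W in 𝓝 Z, W ∈ HH2 ∧ NearCusp C W := by
  have hy : Continuous fun Z : Matrix (Fin 2) (Fin 2) ℂ => (Z 0 0).im := continuous_im_entry 0 0
  have hv := continuousAt_vht hZ
  have hA := continuous_uIm.1
  have hB := continuous_uIm.2.1
  have hC := continuous_uIm.2.2
  have hs : ContinuousAt sgm Z := by
    have h0 : (Z 0 0).im ≠ 0 := (HH2_im_pos hZ).ne'
    unfold sgm
    fun_prop (disch := assumption)
  filter_upwards [isOpen_HH2.eventually_mem hZ,
    continuousAt_const.eventually_lt hy.continuousAt h.hy,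
    continuousAt_const.eventually_lt hv h.hC,
    (hy.continuousAt.div_const 20).eventually_lt hv h.hv,
    hA.continuousAt.abs.eventually_lt (continuousAt_const.mul hy.continuousAt) h.hA,
    hB.continuousAt.abs.eventually_lt (continuousAt_const.mul hy.continuousAt) h.hB,
    hC.continuousAt.abs.eventually_lt (continuousAt_const.mul hy.continuousAt) h.hC',
    (hy.continuousAt.mul (continuousAt_const.add (hs.div_const 2))).eventually_lt
      (hv.add (hy.continuousAt.div_const 100)) h.hs] with W a b c d e f g i
  exact ⟨a, b, c, d, e, f, g, i⟩

theorem exists_b5_ne_zero : ∃ Z ∈ HH2, b5 Z ≠ 0 := by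
  obtain ⟨C, hC, hdom⟩ := exists_dominance
  have h11 := s11_ne
  set Z : Matrix (Fin 2) (Fin 2) ℂ := !![I, s11 / 4; -s11 / 4, ((C + 2 : ℝ) : ℂ) * I] with hZd
  have hA : uA (Z 0 1) (Z 1 0) = 1 / 2 := by
    simp only [hZd, uA, of_apply, cons_val', cons_val_zero, cons_val_one, cons_val_fin_one]
    field_simp; ring
  have hB : uB (Z 0 1) (Z 1 0) = 1 / 4 := by
    simp only [hZd, uB, om, omg, of_apply, cons_val', cons_val_zero, cons_val_one, cons_val_fin_one]
    field_simp; ring_nf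
  have hCc : uC (Z 0 1) (Z 1 0) = 1 / 4 := by
    have := uB_add_uC (Z 0 1) (Z 1 0)
    rw [hA, hB] at this
    linear_combination this
  have h00 : Z 0 0 = I := by simp [hZd]
  have h11' : Z 1 1 = ((C + 2 : ℝ) : ℂ) * I := by simp [hZd]
  have hdet : detY Z = C + 2 := by
    unfold detY
    have h4 : (starRingEnd ℂ) (4 : ℂ) = 4 := Complex.conj_ofNat 4
    simp [hZd, conj_s11, neg_div, h4]
  have hv : vht Z = C + 2 := by rw [vht, hdet, h00]; simp
  have hZ : Z ∈ HH2 := (mem_HH2_iff Z).2 ⟨by rw [h00]; simp, by rw [hdet]; linarith⟩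
  have hsg : sgm Z = 7 / 4 := by
    unfold sgm
    rw [hA, hB, hCc]
    norm_num
  have hN : NearCusp C Z := by
    refine ⟨?_, ?_, ?_, ?_, ?_, ?_, ?_⟩ <;> (try rw [h00]) <;> (try rw [hv]) <;> (try rw [hsg]) <;>
      (try rw [hA]) <;> (try rw [hB]) <;> (try rw [hCc]) <;> norm_num <;> linarith
  refine ⟨Z, hZ, b5_ne_of_lead (hdom Z hZ hN) ?_⟩
  have hth : ∀ u : ℂ, u = 1 / 2 ∨ u = 1 / 4 → th (Z 0 0) u ≠ 0 := by
    intro u hu h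
    rw [h00, th_eq_zero_iff (by norm_num)] at h
    obtain ⟨m, n, e⟩ := h
    have e1 := congrArg Complex.re e
    rcases hu with rfl | rfl
    · norm_num at e1
      have : (1 : ℤ) = 2 * m := by exact_mod_cast (by linarith : (1 : ℝ) = 2 * m)
      omega
    · norm_num at e1
      have : (1 : ℤ) = 4 * m := by exact_mod_cast (by linarith : (1 : ℝ) = 4 * m)
      omega
  rw [lead, phi1, hA, hB, hCc]
  have := thp_ne_zero (τ := Z 0 0) (by rw [h00]; norm_num)
  exact mul_ne_zero (mul_ne_zero (mul_ne_zero (mul_ne_zero this (pow_ne_zero _ (hth _ (Or.inl rfl))))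
    (hth _ (Or.inr rfl))) (hth _ (Or.inr rfl))) (Complex.exp_ne_zero _)

theorem frequently_b5_ne_zero : ∀ Z ∈ HH2, ∃ᶠ W in 𝓝 Z, b5 W ≠ 0 := by
  obtain ⟨Z₁, h1, h2⟩ := exists_b5_ne_zero
  exact fun Z hZ => frequently_ne_zero_of_convex isOpen_HH2 convex_HH2 differentiableOn_b5 h1 h2 hZ

theorem goodAt_of_nearCusp : ∃ C : ℝ, 0 < C ∧ ∀ k F, IsHMF 11 k F → VanishesAlongH1 F 5 →
    VanishesOnHeegner (omg 11) F → ∀ Z ∈ HH2, NearCusp C Z → GoodAt F b5 Z := by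
  obtain ⟨C, hC, hdom⟩ := exists_dominance
  refine ⟨C, hC, fun k F hF hV1 hV3 Z hZ hN => ?_⟩
  have hγ : Continuous fun t : ℂ => t • matA := by fun_prop
  have hnear : ∀ᶠ t : ℂ in 𝓝 0, Z + t • matA ∈ {W | W ∈ HH2 ∧ NearCusp C W} := by
    have h1 : ContinuousAt (fun t : ℂ => Z + t • matA) 0 := by fun_prop
    refine h1.eventually ?_
    simpa using eventually_nearCusp hZ hN
  obtain ⟨r, hr, hr'⟩ := Metric.eventually_nhds_iff_ball.1
    (hnear.and (eventually_nhdsWithin_iff.1 (lead_line_eventually_ne hN.hy.le)))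
  set ρ := r / 2 with hρd
  have hρ : 0 < ρ := by positivity
  have hO : IsOpen {W | W ∈ HH2 ∧ NearCusp C W} :=
    isOpen_iff_mem_nhds.2 fun W hW => eventually_nearCusp hW.1 hW.2 |>.mono fun _ h => h
  have hO2 : IsOpen (HH2 ∩ {W | b5 W ≠ 0}) :=
    differentiableOn_b5.continuousOn.isOpen_inter_preimage isOpen_HH2 isOpen_compl_singleton
  have hb : ∀ t : ℂ, ‖t‖ ≤ ρ → t ∈ Metric.ball (0 : ℂ) r := fun t ht => by
    rw [mem_ball_zero_iff]; linarith
  have h1 := eventually_forall_add_mem hO hγ (isCompact_closedBall (0 : ℂ) ρ) (x := Z)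
    fun t ht => (hr' t (hb t (by simpa using ht))).1
  have h2 := eventually_forall_add_mem hO2 hγ (isCompact_sphere (0 : ℂ) ρ) (x := Z)
    fun t ht => by
      have ht' : ‖t‖ = ρ := by simpa using ht
      obtain ⟨⟨a, b⟩, c⟩ := hr' t (hb t ht'.le)
      refine ⟨a, b5_ne_of_lead (hdom _ a b) (c fun h => ?_)⟩
      rw [Set.mem_singleton_iff] at h
      rw [h, norm_zero] at ht'
      exact hρ.ne ht'
  obtain ⟨s, hs, hs'⟩ := Metric.eventually_nhds_iff_ball.1 (h1.and h2)
  have hVH : ∀ e ∈ Metric.ball Z s, e ∈ HH2 ∧ NearCusp C e := fun e he => by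
    simpa using (hs' e he).1 0 (Metric.mem_closedBall_self hρ.le)
  have hcircne : ∀ e ∈ Metric.ball Z s, ∀ t : ℂ, ‖t‖ = ρ → e + t • matA ∈ HH2 ∧ b5 (e + t • matA) ≠ 0 :=
    fun e he t ht => (hs' e he).2 t (by simpa using ht)
  have hcircgood : ∀ e ∈ Metric.ball Z s, ∀ t : ℂ, ‖t‖ = ρ → GoodAt F b5 (e + t • matA) :=
    fun e he t ht => GoodAt.of_ne_zero isOpen_HH2 hF.1 differentiableOn_b5 (hcircne e he t ht).1
      (hcircne e he t ht).2
  set g : Matrix (Fin 2) (Fin 2) ℂ → ℂ := fun e => th (e 0 0) (e 0 1 + e 1 0) with hg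
  have hgc : ContinuousOn g (Metric.ball Z s) := fun e he => by
    have := (HH2_im_pos (hVH e he).1)
    exact (differentiableAt_th' (f := fun e : Matrix (Fin 2) (Fin 2) ℂ => e 0 0) this
      (differentiable_entry 0 0).differentiableAt
      ((differentiable_entry 0 1).add (differentiable_entry 1 0)).differentiableAt).continuousAt.continuousWithinAt
  have hWne : (Metric.ball Z s ∩ g ⁻¹' {0}ᶜ).Nonempty := by
    have h3 := th_line_eventually_ne (τ := Z 0 0) (u := Z 0 1 + Z 1 0) hN.hy.le one_ne_zero
    have h4 : ∀ᶠ t : ℂ in 𝓝[≠] 0, Z + t • !![0, 1; 0, 0] ∈ Metric.ball Z s := by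
      have h5 : ContinuousAt (fun t : ℂ => Z + t • (!![0, 1; 0, 0] : Matrix (Fin 2) (Fin 2) ℂ)) 0 := by
        fun_prop
      refine (h5.eventually ?_).filter_mono nhdsWithin_le_nhds
      simp only [zero_smul, add_zero]
      exact Metric.ball_mem_nhds Z hs
    obtain ⟨t, a, b⟩ := (h3.and h4).exists
    refine ⟨_, b, ?_⟩
    simp only [hg, Set.mem_preimage, Set.mem_compl_iff, Set.mem_singleton_iff]
    convert a using 3
    · simp
    · simp; ring
  refine goodAt_of_discs isOpen_HH2 hF.1 differentiableOn_b5 frequently_b5_ne_zero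
    Metric.isOpen_ball (convex_ball Z s) (fun e he => (hVH e he).1) hγ hρ
    (fun e he t ht => (hcircne e he t ht).1) hcircgood
    (hgc.isOpen_inter_preimage Metric.isOpen_ball isOpen_compl_singleton)
    Set.inter_subset_left hWne (fun e he => ?_) Z (Metric.mem_ball_self hs)
  have hdisc := (hs' e he.1).1
  obtain ⟨h, hh1, hh2, hh3⟩ := exists_disc_quotient (f := fun t : ℂ => F (e + t • matA))
    (g := fun t : ℂ => b5 (e + t • matA)) hρ
    (fun t ht => analyticAt_line hF.1 (hdisc t ht).1)
    (fun t ht => analyticAt_line differentiableOn_b5 (hdisc t ht).1)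
    (fun t ht => by
      have hc : ∀ i j, (e + t • matA) i j = e i j + t * matA i j := fun i j => rfl
      have h6 := isBigO_lead hF hV1 hV3 (hdisc t ht).1 (hdisc t ht).2.hy.le (by
        have : g e ≠ 0 := he.2
        rw [hg] at this
        rw [hc, hc, hc]
        convert this using 2
        · simp [matA]
        · simp [matA]
          ring)
      have h7 : (fun z : ℂ => F (e + z • matA)) =O[𝓝 t] fun z => lead (e + z • matA) := by
        have ht0 : Tendsto (fun z : ℂ => z - t) (𝓝 t) (𝓝 0) := by
          have : ContinuousAt (fun z : ℂ => z - t) t := by fun_prop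
          simpa [ContinuousAt] using this
        refine (h6.comp_tendsto ht0).congr (fun z => ?_) (fun z => ?_) <;>
        · simp only [Function.comp_apply]
          congr 1
          rw [add_assoc, ← add_smul]
          simp
      refine h7.trans (IsBigO.of_bound 2 ?_)
      have hcont : ContinuousAt (fun z : ℂ => e + z • matA) t := by fun_prop
      filter_upwards [hcont.eventually (hO.mem_nhds (hdisc t ht))] with z hz
      exact lead_le_b5 (hdom _ hz.1 hz.2))
    (fun t ht => (hcircne e he.1 t (by simpa using ht)).2)
  refine ⟨h, hh1, fun t ht => ?_, by simpa using hh3⟩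
  rw [hh2 t (by simpa using ht), quo_eq_div isOpen_HH2 frequently_b5_ne_zero
    (hcircne e he.1 t ht).1 (hcircgood e he.1 t ht) (hcircne e he.1 t ht).2]

end NearCuspGood2

section Reduction

open Complex

theorem herm_form_le (y₁ y₂ : ℝ) (p a b : ℂ) :
    (y₁ * y₂ - normSq p) * (normSq a + normSq b) ≤
      (y₁ + y₂) * (y₂ * normSq a + y₁ * normSq b - 2 * (a * p * (starRingEnd ℂ) b).re) := by
  have h1 := normSq_nonneg ((y₂ : ℂ) * a - (starRingEnd ℂ) p * b)
  have h2 := normSq_nonneg ((y₁ : ℂ) * b - p * a)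
  simp only [normSq_apply, sub_re, sub_im, mul_re, mul_im, conj_re, conj_im, ofReal_re, ofReal_im] at *
  nlinarith

theorem cauchy_normSq (a b c d : ℂ) :
    (a * (starRingEnd ℂ) c + b * (starRingEnd ℂ) d).im ^ 2 ≤
      (normSq a + normSq b) * (normSq c + normSq d) := by
  have h1 := normSq_nonneg (a * d - b * c)
  have h2 := sq_nonneg (a * (starRingEnd ℂ) c + b * (starRingEnd ℂ) d).re
  simp only [normSq_apply, add_im, add_re, sub_re, sub_im, mul_re, mul_im, conj_re, conj_im] at *
  nlinarith

theorem normSq_uvec_le_hgt {Z : Matrix (Fin 2) (Fin 2) ℂ} (hZ : Z ∈ HH2) (l : Fin 4 → ℂ) :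
    normSq (uvec Z l 0) + normSq (uvec Z l 1) ≤ ((Z 0 0).im + (Z 1 1).im) * hgt Z l := by
  have hd := HH2_detY_pos hZ
  have hn : normSq (imM Z 0 1) = normSq (Z 0 1 - (starRingEnd ℂ) (Z 1 0)) / 4 := by
    simp [imM, normSq_mul]; norm_num
  have h := herm_form_le (Z 0 0).im (Z 1 1).im (imM Z 0 1) (uvec Z l 0) (uvec Z l 1)
  rw [hn] at h
  rw [hgt_eq, ← mul_div_assoc, le_div_iff₀ hd, mul_comm]
  exact h

theorem one_le_normSq {x : ℂ} (h : x ∈ OK) (h0 : x ≠ 0) : 1 ≤ normSq x := by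
  obtain ⟨n, hn⟩ := exists_normSq_eq h
  have := normSq_pos.2 h0
  rw [hn] at this ⊢
  exact_mod_cast this

theorem exists_hgt_lower {Z : Matrix (Fin 2) (Fin 2) ℂ} (hZ : Z ∈ HH2) : ∃ c : ℝ, 0 < c ∧
    ∀ l : Fin 4 → ℂ, (∀ i, l i ∈ OK) → l ≠ 0 → pr l l = 0 → c ≤ hgt Z l := by
  have h1 := HH2_im_pos hZ
  have h2 := HH2_im_pos' hZ
  have hd := HH2_detY_pos hZ
  set T := (Z 0 0).im + (Z 1 1).im with hT
  have hTp : 0 < T := by positivity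
  refine ⟨min 1 ((detY Z / T) ^ 2) / T, by positivity, fun l hl hl0 hpr => ?_⟩
  rw [div_le_iff₀ hTp, mul_comm]
  refine le_trans ?_ (normSq_uvec_le_hgt hZ l)
  have e0 : uvec Z l 0 = l 0 * Z 0 0 + l 1 * Z 1 0 + l 2 := by
    simp [uvec, Matrix.vecMul, dotProduct, Fin.sum_univ_two]
  have e1 : uvec Z l 1 = l 0 * Z 0 1 + l 1 * Z 1 1 + l 3 := by
    simp [uvec, Matrix.vecMul, dotProduct, Fin.sum_univ_two]
  by_cases hc : l 0 = 0 ∧ l 1 = 0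
  · have hd0 : l 2 ≠ 0 ∨ l 3 ≠ 0 := by
      by_contra! h
      exact hl0 (by ext i; fin_cases i <;> simp [hc.1, hc.2, h.1, h.2])
    refine (min_le_left _ _).trans ?_
    rw [e0, e1, hc.1, hc.2]
    simp only [zero_mul, zero_add]
    rcases hd0 with h | h
    · linarith [one_le_normSq (hl 2) h, normSq_nonneg (l 3)]
    · linarith [one_le_normSq (hl 3) h, normSq_nonneg (l 2)]
  · have hcn : 1 ≤ normSq (l 0) + normSq (l 1) := by
      by_cases h : l 0 = 0
      · linarith [one_le_normSq (hl 1) fun h' => hc ⟨h, h'⟩, normSq_nonneg (l 0)]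
      · linarith [one_le_normSq (hl 0) h, normSq_nonneg (l 1)]
    refine (min_le_right _ _).trans ?_
    set p := imM Z 0 1 with hp
    have hn : normSq p = normSq (Z 0 1 - (starRingEnd ℂ) (Z 1 0)) / 4 := by
      simp [hp, imM, normSq_mul]; norm_num
    have hform := herm_form_le (Z 1 1).im (Z 0 0).im (-p) (l 0) (l 1)
    set q := (Z 0 0).im * normSq (l 0) + (Z 1 1).im * normSq (l 1) -
      2 * (l 0 * (-p) * (starRingEnd ℂ) (l 1)).re with hq
    have hq' : (uvec Z l 0 * (starRingEnd ℂ) (l 0) + uvec Z l 1 * (starRingEnd ℂ) (l 1)).im = q := by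
      have hz := congrArg Complex.im hpr
      have hp' : p = (Z 0 1 - (starRingEnd ℂ) (Z 1 0)) * (-I / 2) := by
        rw [hp, imM, Matrix.of_apply]
        field_simp
        rw [I_sq]; ring
      simp only [pr, RCLike.star_def] at hz
      rw [hq, hp', e0, e1]
      simp only [normSq_apply, add_im, add_re, sub_re, sub_im, mul_re, mul_im, conj_re, conj_im,
        neg_re, neg_im, I_re, I_im, div_ofNat_re, div_ofNat_im, zero_im] at *
      linarith
    have hcs := cauchy_normSq (uvec Z l 0) (uvec Z l 1) (l 0) (l 1)
    rw [hq'] at hcs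
    rw [normSq_neg, hn, add_comm (Z 1 1).im, mul_comm (Z 1 1).im] at hform
    have hd' : detY Z * (normSq (l 0) + normSq (l 1)) ≤ T * q := hform
    set nc := normSq (l 0) + normSq (l 1) with hnc
    set nu := normSq (uvec Z l 0) + normSq (uvec Z l 1)
    have h5 : detY Z / T * nc ≤ q := by
      rw [div_mul_eq_mul_div, div_le_iff₀ hTp]; linarith
    have h6 : 0 < detY Z / T := by positivity
    have h7 : (detY Z / T * nc) ^ 2 ≤ nu * nc :=
      (pow_le_pow_left₀ (by positivity) h5 2).trans hcs
    have h8 : (detY Z / T) ^ 2 * nc ≤ nu := by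
      have : ((detY Z / T) ^ 2 * nc) * nc ≤ nu * nc := by linarith
      exact le_of_mul_le_mul_right this (by linarith)
    have h9 : 0 < (detY Z / T) ^ 2 := by positivity
    nlinarith

/-- The last standard basis row vector. -/
def e4 : Fin 4 → ℂ := ![0, 0, 0, 1]

theorem hgt_std (Z : Matrix (Fin 2) (Fin 2) ℂ) (g : ℂ) :
    hgt Z ![0, 0, 0, g] = normSq g * ((Z 0 0).im / detY Z) := by
  have h0 : uvec Z ![0, 0, 0, g] 0 = 0 := by
    simp [uvec, Matrix.vecMul, dotProduct, Fin.sum_univ_two]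
  have h1 : uvec Z ![0, 0, 0, g] 1 = g := by
    simp [uvec, Matrix.vecMul, dotProduct, Fin.sum_univ_two]
  rw [hgt_eq, h0, h1]
  simp
  ring

theorem hgt_e4 (Z : Matrix (Fin 2) (Fin 2) ℂ) : hgt Z e4 = (vht Z)⁻¹ := by
  rw [e4, hgt_std, vht, inv_div]; simp

theorem vht_moebius {M : Matrix (Fin 4) (Fin 4) ℂ} (h : inU M)
    {Z : Matrix (Fin 2) (Fin 2) ℂ} (hZ : Z ∈ HH2) : (vht (moebius M Z))⁻¹ = hgt Z (e4 ᵥ* M) := by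
  rw [← hgt_e4, hgt_moebius h hZ]

theorem vht_eq_of_fix {M : Matrix (Fin 4) (Fin 4) ℂ} (h : inU M)
    {Z : Matrix (Fin 2) (Fin 2) ℂ} (hZ : Z ∈ HH2) (hM : e4 ᵥ* M = e4) :
    vht (moebius M Z) = vht Z := by
  have := vht_moebius h hZ
  rw [hM, hgt_e4] at this
  exact inv_inj.1 this

theorem e4_lM (s : ℂ) : e4 ᵥ* lM 1 0 s 1 = e4 := by
  rw [e4, vecMul_lM]; simp

theorem e4_jM (a b c d : ℝ) : e4 ᵥ* jM a b c d = e4 := by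
  ext i; fin_cases i <;> simp [e4, jM, Matrix.vecMul, dotProduct, Fin.sum_univ_four]

theorem e4_ne : e4 ≠ 0 := fun h => by
  have := congrFun h 3
  simp [e4] at this

theorem vecMul_ne_zero_of_mem {M : Matrix (Fin 4) (Fin 4) ℂ} (h : M ∈ Gam) {r : Fin 4 → ℂ}
    (hr : r ≠ 0) : r ᵥ* M ≠ 0 := by
  obtain ⟨N, -, hN, -⟩ := Gam_inv h
  intro h0
  apply hr
  rw [← Matrix.vecMul_one r, ← hN, ← Matrix.vecMul_vecMul, h0, Matrix.zero_vecMul]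

theorem exists_vht_bound {Z : Matrix (Fin 2) (Fin 2) ℂ} (hZ : Z ∈ HH2) :
    ∃ B : ℝ, ∀ M ∈ Gam, vht (moebius M Z) ≤ B := by
  obtain ⟨c, hc, h⟩ := exists_hgt_lower hZ
  refine ⟨c⁻¹, fun M hM => ?_⟩
  have hU := (Gam_inSU hM).inU
  have h1 := h (e4 ᵥ* M) (vecMul_mem_OK (Gam_inSU hM) fun i => by
    fin_cases i <;> simp [e4, OK.zero_mem, OK.one_mem]) (vecMul_ne_zero_of_mem hM e4_ne)
    (by rw [pr_vecMul hU]; simp [pr, e4])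
  rw [← vht_moebius hU hZ] at h1
  have h2 := vht_pos (moebius_mem hU hZ)
  rwa [le_inv_comm₀ hc h2] at h1

theorem exists_near_max {Z : Matrix (Fin 2) (Fin 2) ℂ} (hZ : Z ∈ HH2) :
    ∃ M ∈ Gam, ∀ N ∈ Gam, vht (moebius N Z) ≤ 200 / 199 * vht (moebius M Z) := by
  obtain ⟨B, hB⟩ := exists_vht_bound hZ
  set S : Set ℝ := {v | ∃ M ∈ Gam, v = vht (moebius M Z)} with hS
  have hne : S.Nonempty := ⟨_, 1, Gam.one_mem, rfl⟩
  have hbd : BddAbove S := ⟨B, by rintro _ ⟨M, hM, rfl⟩; exact hB M hM⟩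
  have h0 : 0 < sSup S := lt_of_lt_of_le (vht_pos (moebius_mem inU_one hZ))
    (le_csSup hbd ⟨1, Gam.one_mem, rfl⟩)
  obtain ⟨_, ⟨M, hM, rfl⟩, h1⟩ := exists_lt_of_lt_csSup hne (show 199 / 200 * sSup S < sSup S by linarith)
  refine ⟨M, hM, fun N hN => ?_⟩
  have := le_csSup hbd ⟨N, hN, rfl⟩
  linarith

theorem exists_voronoi (β : ℂ) : ∃ q ∈ OK, ∃ a b : ℝ, β - q = a + b * om ∧
    |2 * a + b| ≤ 1 ∧ |a + 6 * b| ≤ 3 ∧ |-a + 5 * b| ≤ 3 := by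
  obtain ⟨a, b, rfl⟩ := exists_coord β
  set e := b - round b with he
  have hb := abs_le.1 (abs_sub_round b)
  set a₀ := a - round (a + e / 2) with ha
  have ha1 := abs_le.1 (abs_sub_round (a + e / 2))
  have key : ∃ m n : ℤ, |2 * (a₀ - m) + (e - n)| ≤ 1 ∧ |(a₀ - m) + 6 * (e - n)| ≤ 3 ∧
      |-(a₀ - m) + 5 * (e - n)| ≤ 3 := by
    simp only [abs_le]
    by_cases h1 : a₀ + 6 * e > 3
    · exact ⟨0, 1, by push_cast; constructor <;> linarith, by push_cast; constructor <;> linarith,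
        by push_cast; constructor <;> linarith⟩
    by_cases h2 : a₀ + 6 * e < -3
    · exact ⟨0, -1, by push_cast; constructor <;> linarith, by push_cast; constructor <;> linarith,
        by push_cast; constructor <;> linarith⟩
    by_cases h3 : -a₀ + 5 * e > 3
    · exact ⟨-1, 1, by push_cast; constructor <;> linarith, by push_cast; constructor <;> linarith,
        by push_cast; constructor <;> linarith⟩
    by_cases h4 : -a₀ + 5 * e < -3
    · exact ⟨1, -1, by push_cast; constructor <;> linarith, by push_cast; constructor <;> linarith,
        by push_cast; constructor <;> linarith⟩
    exact ⟨0, 0, by push_cast; constructor <;> linarith, by push_cast; constructor <;> linarith,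
      by push_cast; constructor <;> linarith⟩
  obtain ⟨m, n, hk⟩ := key
  refine ⟨((round (a + e / 2) + m : ℤ) : ℂ) + ((round b + n : ℤ) : ℂ) * om,
    ⟨_, _, rfl⟩, a₀ - m, e - n, ?_, hk⟩
  simp only [ha, he]
  push_cast
  ring

theorem voronoi_bound {a b : ℝ} (h1 : |2 * a + b| ≤ 1) (h2 : |a + 6 * b| ≤ 3)
    (h3 : |-a + 5 * b| ≤ 3) : 4 * (a ^ 2 + a * b + 3 * b ^ 2) ≤ 5 * |b| + |a + b| + |a| ∧
      |b| ≤ 6 / 11 ∧ |a| ≤ 1 ∧ |a + b| ≤ 1 ∧ a ^ 2 + a * b + 3 * b ^ 2 ≤ 15 / 16 := by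
  have key : ∀ c b : ℝ, 0 ≤ c → 0 ≤ b → c ≤ 1 → c + 11 * b ≤ 6 →
      c ^ 2 + 11 * b ^ 2 ≤ 5 * b + max c b := by
    intro c b hc hb hc1 h
    rcases le_total b c with hbc | hbc
    · rw [max_eq_left hbc]
      nlinarith [mul_nonneg hb (sub_nonneg.2 h), mul_nonneg (sub_nonneg.2 hbc) (sub_nonneg.2 hc1)]
    · rw [max_eq_right hbc]
      nlinarith [mul_nonneg hb (sub_nonneg.2 h), mul_nonneg (sub_nonneg.2 hbc) hc]
  have hc11 : |2 * a + b| + 11 * |b| ≤ 6 := by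
    rw [abs_le] at h2 h3
    rcases abs_cases (2 * a + b) with ⟨e, -⟩ | ⟨e, -⟩ <;> rcases abs_cases b with ⟨e', -⟩ | ⟨e', -⟩ <;>
      rw [e, e'] <;> linarith
  have hk := key |2 * a + b| |b| (abs_nonneg _) (abs_nonneg _) h1 hc11
  rw [sq_abs, sq_abs] at hk
  have hmax : max |2 * a + b| |b| ≤ |a + b| + |a| := by
    refine max_le ?_ ?_
    · calc |2 * a + b| = |(a + b) + a| := by ring_nf
        _ ≤ _ := abs_add_le _ _
    · calc |b| = |(a + b) - a| := by ring_nf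
        _ ≤ _ := abs_sub _ _
  have hb : |b| ≤ 6 / 11 := by linarith [abs_nonneg (2 * a + b)]
  have hmax1 : max |2 * a + b| |b| ≤ 1 := max_le h1 (by linarith)
  have hb' := abs_le.1 hb
  have h1' := abs_le.1 h1
  refine ⟨by nlinarith, hb, abs_le.2 ⟨by linarith, by linarith⟩, abs_le.2 ⟨by linarith, by linarith⟩, ?_⟩
  nlinarith

theorem im_u_coord {z₁ z₂ : ℂ} {y a b : ℝ}
    (h : z₁ - (starRingEnd ℂ) z₂ = 2 * I * y * (a + b * om)) :
    (uA z₁ z₂).im = y * b ∧ (uB z₁ z₂).im = y * (a + b) ∧ (uC z₁ z₂).im = -(y * a) := by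
  have h2 : z₂ - (starRingEnd ℂ) z₁ = 2 * I * y * (a + b * (1 - om)) := by
    have := congrArg (starRingEnd ℂ) h
    simp only [map_sub, map_mul, map_add, conj_om, conj_I, conj_ofReal, conj_conj, map_ofNat] at this
    linear_combination -this
  obtain ⟨hA, hB, hC⟩ := im_u_eq z₁ z₂
  rw [h, h2] at hA hB hC
  have hs := s11_ne
  have hs' : s11 = 2 * om - 1 := rfl
  have h3 := om_mul_self
  have hI := I_ne_zero
  refine ⟨?_, ?_, ?_⟩ <;> apply ofReal_injective
  · rw [hA, uA]
    push_cast
    field_simp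
    rw [hs']; ring
  · rw [hB, uB]
    push_cast
    field_simp
    rw [hs']; linear_combination 0 * h3
  · rw [hC, uC]
    push_cast
    field_simp
    rw [hs']; linear_combination 0 * h3

/-- The reduction conditions at the standard cusp. -/
structure Reduced (Z : Matrix (Fin 2) (Fin 2) ℂ) : Prop where
  hy : 4 / 5 < (Z 0 0).im
  hv : (Z 0 0).im / 20 < vht Z
  hA : |(uA (Z 0 1) (Z 1 0)).im| < 3 / 2 * (Z 0 0).im
  hB : |(uB (Z 0 1) (Z 1 0)).im| < 3 / 2 * (Z 0 0).im
  hC' : |(uC (Z 0 1) (Z 1 0)).im| < 3 / 2 * (Z 0 0).im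
  hs : (Z 0 0).im * (1 / 8 + sgm Z / 2) < vht Z + (Z 0 0).im / 100

theorem Reduced.nearCusp {Z : Matrix (Fin 2) (Fin 2) ℂ} (h : Reduced Z) {C : ℝ} (hC : C < vht Z) :
    NearCusp C Z := ⟨h.hy, hC, h.hv, h.hA, h.hB, h.hC', h.hs⟩

theorem reduced_of_voronoi {Z : Matrix (Fin 2) (Fin 2) ℂ} (hZ : Z ∈ HH2)
    (hy : 4 / 5 < (Z 0 0).im) (h21 : 199 / 200 * (Z 0 0).im ≤ (Z 1 1).im) {a b : ℝ}
    (hx : Z 0 1 - (starRingEnd ℂ) (Z 1 0) = 2 * I * (Z 0 0).im * (a + b * om))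
    (h1 : |2 * a + b| ≤ 1) (h2 : |a + 6 * b| ≤ 3) (h3 : |-a + 5 * b| ≤ 3) : Reduced Z := by
  obtain ⟨k1, k2, k3, k4, k5⟩ := voronoi_bound h1 h2 h3
  obtain ⟨eA, eB, eC⟩ := im_u_coord hx
  set y := (Z 0 0).im with hyd
  have hy0 : 0 < y := by linarith
  have hv : vht Z = (Z 1 1).im - y * (a ^ 2 + a * b + 3 * b ^ 2) := by
    rw [vht, detY, hx, normSq_mul, normSq_coord, ← hyd]
    simp only [normSq_mul, normSq_I, normSq_ofReal, normSq_ofNat]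
    field_simp
    ring
  have habs : ∀ t : ℝ, |y * t| = y * |t| := fun t => by rw [abs_mul, abs_of_pos hy0]
  have hsg : sgm Z = 2 * (a ^ 2 + a * b + 3 * b ^ 2) - (5 * |b| + |a + b| + |a|) + 7 / 4 := by
    rw [sgm, eA, eB, eC, abs_neg, habs, habs, habs, ← hyd]
    have e : ∀ t : ℝ, y * |t| / y = |t| := fun t => by field_simp
    rw [e, e, e]
    have := sq_abs a
    have := sq_abs b
    have := sq_abs (a + b)
    nlinarith
  refine ⟨hy, ?_, ?_, ?_, ?_, ?_⟩
  · rw [hv, ← hyd]; nlinarith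
  · rw [eA, habs, ← hyd]; nlinarith
  · rw [eB, habs, ← hyd]; nlinarith
  · rw [eC, abs_neg, habs, ← hyd]; nlinarith
  · rw [hv, hsg, ← hyd]; nlinarith

theorem exists_jM_im {Z : Matrix (Fin 2) (Fin 2) ℂ} (hZ : Z ∈ HH2) :
    ∃ a b c d : ℤ, a * d - b * c = 1 ∧ 4 / 5 < (moebius (jM a b c d) Z 0 0).im := by
  have hy := HH2_im_pos hZ
  obtain ⟨g, hg⟩ := ModularGroup.exists_smul_mem_fd (UpperHalfPlane.mk (Z 0 0) hy)
  have h1 := ModularGroup.three_le_four_mul_im_sq_of_mem_fd hg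
  have h2 := UpperHalfPlane.im_pos (g • UpperHalfPlane.mk (Z 0 0) hy)
  have hdet : (g.1 0 0) * (g.1 1 1) - (g.1 0 1) * (g.1 1 0) = 1 := by
    have := g.2
    rwa [Matrix.det_fin_two] at this
  refine ⟨g.1 0 0, g.1 0 1, g.1 1 0, g.1 1 1, hdet, ?_⟩
  have h3 : moebius (jM (g.1 0 0) (g.1 0 1) (g.1 1 0) (g.1 1 1)) Z 0 0 =
      ((g • UpperHalfPlane.mk (Z 0 0) hy : UpperHalfPlane) : ℂ) := by
    rw [moebius_jM_int g.2 hy, UpperHalfPlane.specialLinearGroup_apply]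
    simp [gact]
  rw [h3, UpperHalfPlane.coe_im]
  nlinarith

theorem exists_reduced_moebius {Z : Matrix (Fin 2) (Fin 2) ℂ} (hZ : Z ∈ HH2) :
    ∃ M ∈ Gam, Reduced (moebius M Z) ∧
      ∀ N ∈ Gam, vht (moebius N Z) ≤ 200 / 199 * vht (moebius M Z) := by
  obtain ⟨M₁, hM₁, hmax⟩ := exists_near_max hZ
  have hU₁ := (Gam_inSU hM₁).inU
  set Z₁ := moebius M₁ Z with hZ₁
  have hZ₁m : Z₁ ∈ HH2 := moebius_mem hU₁ hZ
  obtain ⟨a, b, c, d, hdet, hy⟩ := exists_jM_im hZ₁m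
  have hJ := inSU_jM hdet
  set Z₂ := moebius (jM a b c d) Z₁ with hZ₂
  have hZ₂m : Z₂ ∈ HH2 := moebius_mem hJ.inU hZ₁m
  set y := (Z₂ 0 0).im with hyd
  have hy0 : (y : ℂ) ≠ 0 := by
    have : 0 < y := by linarith
    exact_mod_cast this.ne'
  obtain ⟨q, hq, α, β, hαβ, h1, h2, h3⟩ :=
    exists_voronoi ((Z₂ 0 1 - (starRingEnd ℂ) (Z₂ 1 0)) / (2 * I * y))
  set s := -(starRingEnd ℂ) q with hs
  have hsO : s ∈ OK := OK.neg_mem (conj_mem_OK hq)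
  have hL := (GenM.l s hsO).mem
  have hLU := (Gam_inSU hL).inU
  set Z₃ := moebius (lM 1 0 s 1) Z₂ with hZ₃
  have hZ₃m : Z₃ ∈ HH2 := moebius_mem hLU hZ₂m
  have hM : lM 1 0 s 1 * (jM a b c d * M₁) ∈ Gam :=
    Gam.mul_mem hL (Gam.mul_mem (mem_Gam hJ) hM₁)
  have hJM : inU (jM a b c d * M₁) := inU_mul hJ.inU hU₁
  have e3 : moebius (lM 1 0 s 1 * (jM a b c d * M₁)) Z = Z₃ := by
    rw [moebius_mul hJM hZ, moebius_mul hU₁ hZ]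
  have hv : vht Z₃ = vht Z₁ := by
    rw [hZ₃, vht_eq_of_fix hLU hZ₂m (e4_lM s), hZ₂, vht_eq_of_fix hJ.inU hZ₁m (e4_jM _ _ _ _)]
  refine ⟨_, hM, ?_, fun N hN => ?_⟩
  · rw [e3]
    have h00 : Z₃ 0 0 = Z₂ 0 0 := by
      rw [hZ₃, moebius_lM (by ring), conj_fin_two]; simp
    have h01 : Z₃ 0 1 = Z₂ 0 1 + Z₂ 0 0 * (starRingEnd ℂ) s := by
      rw [hZ₃, moebius_lM (by ring), conj_fin_two]; simp; ring
    have h10 : Z₃ 1 0 = Z₂ 1 0 + Z₂ 0 0 * s := by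
      rw [hZ₃, moebius_lM (by ring), conj_fin_two]; simp; ring
    have hswap := hmax (sM * (lM 1 0 s 1 * (jM a b c d * M₁))) (Gam.mul_mem GenM.s.mem hM)
    rw [moebius_mul (Gam_inSU hM).inU hZ, e3, ← hv, moebius_sM] at hswap
    have hd : detY !![Z₃ 1 1, Z₃ 1 0; Z₃ 0 1, Z₃ 0 0] = detY Z₃ := by
      have : normSq (Z₃ 1 0 - (starRingEnd ℂ) (Z₃ 0 1)) = normSq (Z₃ 0 1 - (starRingEnd ℂ) (Z₃ 1 0)) := by
        rw [← normSq_conj, ← normSq_neg]; simp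
      simp [detY, this]; ring
    have hp1 := HH2_im_pos hZ₃m
    have hp2 := HH2_im_pos' hZ₃m
    have hp3 := HH2_detY_pos hZ₃m
    refine reduced_of_voronoi hZ₃m (by rw [h00]; exact hy) ?_ (a := α) (b := β) ?_ h1 h2 h3
    · rw [vht, vht, hd] at hswap
      simp only [Matrix.of_apply, Matrix.cons_val', Matrix.cons_val_zero, Matrix.cons_val_fin_one] at hswap
      rw [← mul_div_assoc, div_le_div_iff₀ hp2 hp1] at hswap
      have : detY Z₃ * (Z₃ 0 0).im ≤ detY Z₃ * (200 / 199 * (Z₃ 1 1).im) := by linarith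
      have := le_of_mul_le_mul_left this hp3
      linarith
    · rw [← hαβ, h01, h10, h00, ← hyd, hs]
      have him : Z₂ 0 0 - (starRingEnd ℂ) (Z₂ 0 0) = 2 * I * y := by
        rw [hyd, Complex.im_eq_sub_conj]; field_simp
      simp only [map_add, map_mul, map_neg, conj_conj]
      field_simp
      linear_combination -q * him
  · rw [e3, hv]; exact hmax N hN

end Reduction

section GoodInvariance

open Complex

theorem GoodAt.of_comp_moebius {F b : Matrix (Fin 2) (Fin 2) ℂ → ℂ} {M M' : Matrix (Fin 4) (Fin 4) ℂ}
    (hM : inU M) (hM' : inU M') (h1 : M * M' = 1) (h2 : M' * M = 1)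
    {Z : Matrix (Fin 2) (Fin 2) ℂ} (hZ : Z ∈ HH2)
    (h : GoodAt (fun W => F (moebius M W)) (fun W => b (moebius M W)) Z) :
    GoodAt F b (moebius M Z) := by
  obtain ⟨G, U, hU, hZU, hG, hF⟩ := h
  have hd : DifferentiableOn ℂ (moebius M') HH2 :=
    fun W hW => (differentiableAt_moebius hM' hW).differentiableWithinAt
  have hZ' : moebius M' (moebius M Z) = Z := by rw [← moebius_mul hM hZ, h2, moebius_one]
  refine ⟨fun W => G (moebius M' W), HH2 ∩ moebius M' ⁻¹' U,
    hd.continuousOn.isOpen_inter_preimage isOpen_HH2 hU, ⟨moebius_mem hM hZ, ?_⟩, ?_, ?_⟩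
  · simpa [hZ'] using hZU
  · exact hG.comp (hd.mono Set.inter_subset_left) fun W hW => hW.2
  · intro W hW
    have := hF _ hW.2
    simpa only [← moebius_mul hM' hW.1, h1, moebius_one] using this

theorem GoodAt.of_moebius_Gam {F : Matrix (Fin 2) (Fin 2) ℂ → ℂ} {k : ℕ} (hF : IsHMF 11 k F)
    {M : Matrix (Fin 4) (Fin 4) ℂ} (hM : M ∈ Gam) {Z : Matrix (Fin 2) (Fin 2) ℂ} (hZ : Z ∈ HH2)
    (h : GoodAt F b5 (moebius M Z)) : GoodAt F b5 Z := by
  obtain ⟨G, U, hU, hZU, hG, hGF⟩ := h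
  have hS := Gam_inSU hM
  have hd : DifferentiableOn ℂ (moebius M) HH2 :=
    fun W hW => (differentiableAt_moebius hS.inU hW).differentiableWithinAt
  have hdet : Differentiable ℂ fun W => (autM M W).det := by
    simp only [autM, Matrix.det_fin_two, Matrix.add_apply, Matrix.mul_apply, Fin.sum_univ_two]
    have := differentiable_entry
    intro W
    have a := (this 0 0) W
    have b := (this 0 1) W
    have c := (this 1 0) W
    have d := (this 1 1) W
    fun_prop
  refine ⟨fun W => G (moebius M W) * (autM M W).det ^ 5 / (autM M W).det ^ k, HH2 ∩ moebius M ⁻¹' U,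
    hd.continuousOn.isOpen_inter_preimage isOpen_HH2 hU, ⟨hZ, hZU⟩, ?_, ?_⟩
  · have e1 : DifferentiableOn ℂ (fun W => G (moebius M W)) (HH2 ∩ moebius M ⁻¹' U) :=
      hG.comp (hd.mono Set.inter_subset_left) fun W hW => hW.2
    have e2 : Differentiable ℂ fun W => (autM M W).det ^ k := hdet.pow k
    simp only [div_eq_mul_inv]
    exact (e1.mul (hdet.pow 5).differentiableOn).mul (e2.differentiableOn.inv
      fun W hW => pow_ne_zero _ (autM_det_ne_zero hS.inU hW.1))
  · intro W hW
    have h0 := autM_det_ne_zero hS.inU hW.1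
    have e1 := hF.2 M hS W hW.1
    have e2 := isHMF_b5.2 M hS W hW.1
    have e3 := hGF _ hW.2
    rw [e1, e2] at e3
    change (autM M W).det ^ k * F W = (autM M W).det ^ 5 * b5 W * _ at e3
    field_simp
    linear_combination e3

theorem exists_hgt_bound_of_not_goodAt : ∃ B : ℝ, 0 < B ∧ ∀ k F, IsHMF 11 k F → VanishesAlongH1 F 5 →
    VanishesOnHeegner (omg 11) F → ∀ Z ∈ HH2, ¬ GoodAt F b5 Z →
    ∀ l : Fin 4 → ℂ, (∀ i, l i ∈ OK) → l ≠ 0 → pr l l = 0 → B⁻¹ ≤ hgt Z l := by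
  obtain ⟨C, hC, h⟩ := goodAt_of_nearCusp
  refine ⟨200 / 199 * C, by positivity, fun k F hF hV1 hV3 Z hZ hbad l hl hl0 hiso => ?_⟩
  obtain ⟨M, hM, hred, hmax⟩ := exists_reduced_moebius hZ
  have hvC : vht (moebius M Z) ≤ C := by
    by_contra! hlt
    exact hbad (GoodAt.of_moebius_Gam hF hM hZ
      (h k F hF hV1 hV3 _ (moebius_mem (Gam_inSU hM).inU hZ) (hred.nearCusp hlt)))
  obtain ⟨M₁, hM₁, g, hg⟩ := cusp_transitive hl hiso
  obtain ⟨N, hN, h1, h2⟩ := Gam_inv hM₁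
  have hl' : l = ![0, 0, 0, g] ᵥ* N := by
    rw [← hg, Matrix.vecMul_vecMul, h1, Matrix.vecMul_one]
  have hgO : g ∈ OK := by
    have := vecMul_mem_OK (Gam_inSU hM₁) hl 3
    rw [hg] at this
    simpa using this
  have hg0 : g ≠ 0 := by
    rintro rfl
    apply hl0
    rw [hl']
    have : (![0, 0, 0, 0] : Fin 4 → ℂ) = 0 := by ext i; fin_cases i <;> rfl
    rw [this, Matrix.zero_vecMul]
  have hNU := (Gam_inSU hN).inU
  have hm := moebius_mem hNU hZ
  have hv := vht_pos hm
  rw [hl', ← hgt_moebius hNU hZ, hgt_std]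
  have e : (moebius N Z 0 0).im / detY (moebius N Z) = (vht (moebius N Z))⁻¹ := by rw [vht, inv_div]
  rw [e]
  calc (200 / 199 * C)⁻¹ ≤ (vht (moebius N Z))⁻¹ :=
        inv_anti₀ hv ((hmax N hN).trans (by linarith))
    _ ≤ _ := le_mul_of_one_le_left (inv_pos.2 hv).le (one_le_normSq hgO hg0)

/-- Unitary matrices over `K` whose inverse has denominator dividing `n`. -/
def RatU (n : ℕ) (M : Matrix (Fin 4) (Fin 4) ℂ) : Prop :=
  inU M ∧ ∃ M', inU M' ∧ M * M' = 1 ∧ M' * M = 1 ∧ ∀ i j, (n : ℂ) * M' i j ∈ OK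

theorem RatU.mul_Gam {n : ℕ} {M N : Matrix (Fin 4) (Fin 4) ℂ} (h : RatU n M) (hN : N ∈ Gam) :
    RatU n (M * N) := by
  obtain ⟨hM, M', hM', h1, h2, h3⟩ := h
  obtain ⟨N', hN', k1, k2⟩ := Gam_inv hN
  refine ⟨inU_mul hM (Gam_inSU hN).inU, N' * M', inU_mul (Gam_inSU hN').inU hM', ?_, ?_, fun i j => ?_⟩
  · rw [Matrix.mul_assoc, ← Matrix.mul_assoc N, k1, Matrix.one_mul, h1]
  · rw [Matrix.mul_assoc, ← Matrix.mul_assoc M', h2, Matrix.one_mul, k2]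
  · rw [Matrix.mul_apply, Finset.mul_sum]
    refine OK.sum_mem fun x _ => ?_
    rw [mul_left_comm]
    exact OK.mul_mem ((Gam_inSU hN').1 i x) (h3 x j)

/-- Diagonal points. -/
def dg (σ ω : ℂ) : Matrix (Fin 2) (Fin 2) ℂ := !![σ, 0; 0, ω]

theorem detY_dg (σ ω : ℂ) : detY (dg σ ω) = σ.im * ω.im := by
  simp [detY, dg]

theorem dg_mem_iff {σ ω : ℂ} : dg σ ω ∈ HH2 ↔ 0 < σ.im ∧ 0 < ω.im := by
  rw [mem_HH2_iff, detY_dg]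
  constructor
  · rintro ⟨h1, h2⟩
    have h1' : 0 < σ.im := h1
    exact ⟨h1', pos_of_mul_pos_right h2 h1'.le⟩
  · rintro ⟨h1, h2⟩
    exact ⟨h1, mul_pos h1 h2⟩

theorem moebius_sM_dg (σ ω : ℂ) : moebius sM (dg σ ω) = dg ω σ := by
  rw [moebius_sM]; simp [dg]

theorem im_le_of_bad {n : ℕ} (hn : 0 < n) {M : Matrix (Fin 4) (Fin 4) ℂ} (hM : RatU n M) {B : ℝ}
    (hB : 0 < B) {σ ω : ℂ} (hσ : 0 < σ.im) (hω : 0 < ω.im)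
    (h : ∀ l : Fin 4 → ℂ, (∀ i, l i ∈ OK) → l ≠ 0 → pr l l = 0 →
      B⁻¹ ≤ hgt (moebius M (dg σ ω)) l) : ω.im ≤ B * n ^ 2 := by
  obtain ⟨hMU, M', hM', h1, h2, h3⟩ := hM
  have hZ := dg_mem_iff.2 ⟨hσ, hω⟩
  have hn' : (n : ℂ) ≠ 0 := by exact_mod_cast hn.ne'
  set l : Fin 4 → ℂ := ![0, 0, 0, (n : ℂ)] ᵥ* M' with hl
  have hlM : l ᵥ* M = ![0, 0, 0, (n : ℂ)] := by rw [hl, Matrix.vecMul_vecMul, h2, Matrix.vecMul_one]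
  have := h l (fun i => by
      rw [hl, Matrix.vecMul, dotProduct, Fin.sum_univ_four]
      simpa using h3 3 i) (fun h0 => by
      rw [h0, Matrix.zero_vecMul] at hlM
      have := congrFun hlM 3
      simp at this
      exact hn' (by exact_mod_cast this.symm)) (by
      rw [hl, pr_vecMul hM']; simp [pr])
  rw [hgt_moebius hMU hZ, hlM, hgt_std, detY_dg] at this
  simp only [dg, Matrix.of_apply, Matrix.cons_val', Matrix.cons_val_zero, Matrix.cons_val_fin_one,
    Complex.normSq_natCast] at this
  have e : (n : ℝ) * n * (σ.im / (σ.im * ω.im)) = n ^ 2 / ω.im := by field_simp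
  rw [e, inv_eq_one_div, div_le_div_iff₀ hB hω] at this
  linarith

theorem raise_im {n : ℕ} {M : Matrix (Fin 4) (Fin 4) ℂ} (hM : RatU n M) {σ ω : ℂ}
    (hσ : 0 < σ.im) (hω : 0 < ω.im) : ∃ M₁ σ₁, RatU n M₁ ∧ 4 / 5 < σ₁.im ∧ σ.im ≤ σ₁.im ∧
      moebius M₁ (dg σ₁ ω) = moebius M (dg σ ω) := by
  by_cases hlt : 4 / 5 < σ.im
  · exact ⟨M, σ, hM, hlt, le_rfl, rfl⟩
  have hZ := dg_mem_iff.2 ⟨hσ, hω⟩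
  obtain ⟨a, b, c, d, hdet, him⟩ := exists_jM_im hZ
  have hJ := mem_Gam (inSU_jM hdet)
  have hJU := (Gam_inSU hJ).inU
  obtain ⟨N, hN, h1, h2⟩ := Gam_inv hJ
  have h0 : ((c : ℝ) : ℂ) * dg σ ω 0 0 + ((d : ℝ) : ℂ) ≠ 0 := by
    rw [← det_autM_jM a b]; exact autM_det_ne_zero hJU hZ
  have hm : moebius (jM a b c d) (dg σ ω) = dg ((moebius (jM a b c d) (dg σ ω)) 0 0) ω := by
    rw [moebius_jM (by exact_mod_cast hdet) h0]
    simp [dg]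
  refine ⟨M * N, _, hM.mul_Gam hN, him, (not_lt.1 hlt).trans him.le, ?_⟩
  rw [← hm, moebius_mul (Gam_inSU hN).inU (moebius_mem hJU hZ), ← moebius_mul hJU hZ, h2, moebius_one]

theorem raise_im_both {n : ℕ} {M : Matrix (Fin 4) (Fin 4) ℂ} (hM : RatU n M) {σ ω : ℂ}
    (hσ : 0 < σ.im) (hω : 0 < ω.im) : ∃ M₁ σ₁ ω₁, RatU n M₁ ∧ 4 / 5 < σ₁.im ∧ 4 / 5 < ω₁.im ∧
      σ.im ≤ σ₁.im ∧ ω.im ≤ ω₁.im ∧ moebius M₁ (dg σ₁ ω₁) = moebius M (dg σ ω) := by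
  obtain ⟨M₁, σ₁, hM₁, k1, k2, k3⟩ := raise_im hM hσ hω
  have hσ₁ := hσ.trans_le k2
  obtain ⟨M₂, ω₁, hM₂, l1, l2, l3⟩ := raise_im (hM₁.mul_Gam GenM.s.mem) hω hσ₁
  have hs := (Gam_inSU GenM.s.mem).inU
  refine ⟨M₂ * sM, σ₁, ω₁, hM₂.mul_Gam GenM.s.mem, k1, l1, k2, l2, ?_⟩
  rw [moebius_mul hs (dg_mem_iff.2 ⟨hσ₁, hω.trans_le l2⟩), moebius_sM_dg, l3,
    moebius_mul hs (dg_mem_iff.2 ⟨hω, hσ₁⟩), moebius_sM_dg, k3]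

end GoodInvariance

section SegmentDiscs

variable {E : Type*} [NormedAddCommGroup E] [NormedSpace ℂ E] [FiniteDimensional ℂ E]
  [NormedSpace ℝ E] [IsScalarTower ℝ ℂ E]

/-- Hartogs continuity principle for discs translated along a segment. -/
theorem goodAt_of_segment_disc {F b : E → ℂ} {Ω : Set E} (hΩ : IsOpen Ω)
    (hF : DifferentiableOn ℂ F Ω) (hb : DifferentiableOn ℂ b Ω)
    (hbd : ∀ x ∈ Ω, ∃ᶠ y in 𝓝 x, b y ≠ 0) {γ : ℂ → E} (hγ : Differentiable ℂ γ) (hγ0 : γ 0 = 0)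
    {ρ : ℝ} (hρ : 0 < ρ) {x v : E}
    (hx : ∀ s ∈ Set.Icc (0 : ℝ) 1, x + s • v ∈ Ω)
    (hcirc : ∀ s ∈ Set.Icc (0 : ℝ) 1, ∀ ζ : ℂ, ‖ζ‖ = ρ →
      x + s • v + γ ζ ∈ Ω ∧ GoodAt F b (x + s • v + γ ζ))
    (hf : ∀ ζ : ℂ, ‖ζ‖ ≤ ρ → x + v + γ ζ ∈ Ω ∧ GoodAt F b (x + v + γ ζ)) :
    GoodAt F b x := by
  have hO : IsOpen (Ω ∩ {x | GoodAt F b x}) := hΩ.inter (isOpen_goodAt F b)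
  set K := segment ℝ x (x + v) with hK
  have hKi : K = (fun s : ℝ => x + s • v) '' Set.Icc 0 1 := by
    rw [hK, segment_eq_image']; simp
  have hKc : IsCompact K := by
    rw [hKi]; exact isCompact_Icc.image (by fun_prop)
  set O' := {e | (∀ ζ ∈ Metric.sphere (0 : ℂ) ρ, e + γ ζ ∈ Ω ∩ {x | GoodAt F b x}) ∧ e ∈ Ω} with hO'
  have h1 : K ⊆ interior O' := by
    rw [hKi]
    rintro _ ⟨s, hs, rfl⟩
    rw [mem_interior_iff_mem_nhds]
    exact (eventually_forall_add_mem hO hγ.continuous (isCompact_sphere _ _)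
      fun ζ hζ => hcirc s hs ζ (by simpa using hζ)).and (hΩ.mem_nhds (hx s hs))
  obtain ⟨r, hr, hr'⟩ := hKc.exists_thickening_subset_open isOpen_interior h1
  have hV : ∀ e ∈ Metric.thickening r K, e ∈ O' := fun e he => interior_subset (hr' he)
  have hxK : x ∈ K := left_mem_segment _ _ _
  have hxK' : x + v ∈ K := right_mem_segment _ _ _
  have h2 : ∀ᶠ e in 𝓝 (x + v), ∀ ζ ∈ Metric.closedBall (0 : ℂ) ρ,
      e + γ ζ ∈ Ω ∩ {x | GoodAt F b x} :=
    eventually_forall_add_mem hO hγ.continuous (isCompact_closedBall _ _)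
      fun ζ hζ => hf ζ (by simpa using hζ)
  obtain ⟨s, hs, hs'⟩ := Metric.eventually_nhds_iff_ball.1 h2
  refine goodAt_of_discs hΩ hF hb hbd Metric.isOpen_thickening
    ((convex_segment _ _).thickening r) (fun e he => (hV e he).2)
    hγ.continuous hρ (fun e he ζ hζ => ((hV e he).1 ζ (by simpa using hζ)).1)
    (fun e he ζ hζ => ((hV e he).1 ζ (by simpa using hζ)).2)
    (W := Metric.ball (x + v) s ∩ Metric.thickening r K)
    (Metric.isOpen_ball.inter Metric.isOpen_thickening)
    Set.inter_subset_right ⟨x + v, Metric.mem_ball_self hs, Metric.self_subset_thickening hr _ hxK'⟩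
    (fun e he => ?_) x (Metric.self_subset_thickening hr _ hxK)
  have h3 : ∀ ζ ∈ Metric.closedBall (0 : ℂ) ρ,
      DifferentiableAt ℂ (fun ζ => quo F b (e + γ ζ)) ζ := fun ζ hζ => by
    obtain ⟨a, b'⟩ := hs' e he.1 ζ hζ
    exact (b'.differentiableAt_quo hΩ hbd a).comp ζ ((differentiableAt_const e).add (hγ ζ))
  refine ⟨fun ζ => quo F b (e + γ ζ), DifferentiableOn.diffContOnCl ?_, fun _ _ => rfl, ?_⟩
  · rw [closure_ball _ hρ.ne']
    exact fun ζ hζ => (h3 ζ hζ).differentiableWithinAt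
  · obtain ⟨a, b'⟩ := hs' e he.1 0 (Metric.mem_closedBall_self hρ.le)
    rw [hγ0, add_zero] at a b'
    simpa [hγ0] using b'.eq_mul_quo hΩ hbd a

end SegmentDiscs

section RationalSurfaces

open Complex

theorem GoodAt.comp_moebius {F b : Matrix (Fin 2) (Fin 2) ℂ → ℂ} {M : Matrix (Fin 4) (Fin 4) ℂ}
    (hM : inU M) {Z : Matrix (Fin 2) (Fin 2) ℂ} (hZ : Z ∈ HH2) (h : GoodAt F b (moebius M Z)) :
    GoodAt (fun W => F (moebius M W)) (fun W => b (moebius M W)) Z := by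
  obtain ⟨G, U, hU, hZU, hG, hF⟩ := h
  have hd : DifferentiableOn ℂ (moebius M) HH2 :=
    fun W hW => (differentiableAt_moebius hM hW).differentiableWithinAt
  exact ⟨fun W => G (moebius M W), HH2 ∩ moebius M ⁻¹' U,
    hd.continuousOn.isOpen_inter_preimage isOpen_HH2 hU, ⟨hZ, hZU⟩,
    hG.comp (hd.mono Set.inter_subset_left) fun W hW => hW.2, fun W hW => hF _ hW.2⟩

theorem differentiableOn_comp_moebius {F : Matrix (Fin 2) (Fin 2) ℂ → ℂ}
    (hF : DifferentiableOn ℂ F HH2) {M : Matrix (Fin 4) (Fin 4) ℂ} (hM : inU M) :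
    DifferentiableOn ℂ (fun W => F (moebius M W)) HH2 :=
  hF.comp (fun W hW => (differentiableAt_moebius hM hW).differentiableWithinAt)
    fun W hW => moebius_mem hM hW

theorem frequently_comp_moebius_ne_zero {b : Matrix (Fin 2) (Fin 2) ℂ → ℂ}
    (hb : ∀ Z ∈ HH2, ∃ᶠ W in 𝓝 Z, b W ≠ 0) {M M' : Matrix (Fin 4) (Fin 4) ℂ}
    (hM : inU M) (hM' : inU M') (h1 : M * M' = 1) (h2 : M' * M = 1) :
    ∀ Z ∈ HH2, ∃ᶠ W in 𝓝 Z, b (moebius M W) ≠ 0 := by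
  intro Z hZ
  have hm := moebius_mem hM hZ
  have hZ' : moebius M' (moebius M Z) = Z := by rw [← moebius_mul hM hZ, h2, moebius_one]
  have ht : Tendsto (moebius M') (𝓝 (moebius M Z)) (𝓝 Z) := by
    have := (differentiableAt_moebius hM' hm).continuousAt.tendsto
    rwa [hZ'] at this
  refine ht.frequently (((hb _ hm).and_eventually (isOpen_HH2.eventually_mem hm)).mono ?_)
  rintro W ⟨hW, hWm⟩
  rwa [← moebius_mul hM' hWm, h1, moebius_one]

theorem dg_add (a b c d : ℂ) : dg a b + dg c d = dg (a + c) (b + d) := by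
  ext i j; fin_cases i <;> fin_cases j <;> simp [dg]

theorem smul_dg (s : ℝ) (a b : ℂ) : s • dg a b = dg (s * a) (s * b) := by
  ext i j; fin_cases i <;> fin_cases j <;> simp [dg]

theorem differentiable_dg {f g : ℂ → ℂ} (hf : Differentiable ℂ f) (hg : Differentiable ℂ g) :
    Differentiable ℂ fun z => dg (f z) (g z) := by
  intro z
  refine differentiableAt_of_entries fun i j => ?_
  fin_cases i <;> fin_cases j <;> simp [dg] <;> first | exact hf z | exact hg z

/-- Size of the curved disc used on the product of two upper half-planes. -/
theorem disc_size {y₁ y₂ R ρ ξ η s : ℝ} (h1 : 4 / 5 < y₁) (h2 : 4 / 5 < y₂) (h3 : y₁ ≤ R) (h4 : y₂ ≤ R)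
    (hρ : ρ = 1 / (5 * R)) (h : ξ ^ 2 + η ^ 2 ≤ ρ ^ 2) (hs : 0 ≤ s) :
    s < y₁ + s + (y₂ * η + y₁ / 4 * (ξ ^ 2 - η ^ 2)) ∧ 0 < y₂ - y₁ * η ∧
    y₁ ^ 2 + y₂ ^ 2 + y₁ ^ 2 / 2 * (ξ ^ 2 + η ^ 2) ≤
      (y₁ + s + (y₂ * η + y₁ / 4 * (ξ ^ 2 - η ^ 2))) ^ 2 + (y₂ - y₁ * η) ^ 2 := by
  have hR : 0 < R := by linarith
  have hρR : ρ * R = 1 / 5 := by rw [hρ]; field_simp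
  have hρ0 : 0 < ρ := by rw [hρ]; positivity
  have hρ4 : ρ ≤ 1 / 4 := by nlinarith
  have hη : |η| ≤ ρ := abs_le_of_sq_le_sq (by nlinarith [sq_nonneg ξ]) hρ0.le
  obtain ⟨hη1, hη2⟩ := abs_le.1 hη
  have ha : |y₂ * η| ≤ 1 / 5 := by
    rw [abs_mul, abs_of_pos (by linarith)]
    nlinarith [abs_nonneg η]
  have hb : |y₁ * η| ≤ 1 / 5 := by
    rw [abs_mul, abs_of_pos (by linarith)]
    nlinarith [abs_nonneg η]
  have hρ2 : ρ ^ 2 ≤ 1 / 16 := by nlinarith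
  have hc : -(1 / 16) ≤ ξ ^ 2 - η ^ 2 := by nlinarith [sq_nonneg ξ]
  have hd : -(y₁ / 64) ≤ y₁ / 4 * (ξ ^ 2 - η ^ 2) := by nlinarith
  have ha' := abs_le.1 ha
  have hb' := abs_le.1 hb
  have hpos : 0 < y₁ + (y₂ * η + y₁ / 4 * (ξ ^ 2 - η ^ 2)) := by linarith
  refine ⟨by linarith, by linarith, ?_⟩
  have e1 : (y₁ + (y₂ * η + y₁ / 4 * (ξ ^ 2 - η ^ 2))) ^ 2 ≤
      (y₁ + s + (y₂ * η + y₁ / 4 * (ξ ^ 2 - η ^ 2))) ^ 2 :=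
    pow_le_pow_left₀ hpos.le (by linarith) 2
  nlinarith [sq_nonneg (y₂ * η + y₁ / 4 * (ξ ^ 2 - η ^ 2))]

theorem goodAt_moebius_dg {k : ℕ} {F : Matrix (Fin 2) (Fin 2) ℂ → ℂ} (hF : IsHMF 11 k F)
    (hV1 : VanishesAlongH1 F 5) (hV3 : VanishesOnHeegner (omg 11) F) {n : ℕ} (hn : 0 < n)
    {M : Matrix (Fin 4) (Fin 4) ℂ} (hM : RatU n M) {σ ω : ℂ} (hσ : 0 < σ.im) (hω : 0 < ω.im) :
    GoodAt F b5 (moebius M (dg σ ω)) := by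
  obtain ⟨B, hB, hbound⟩ := exists_hgt_bound_of_not_goodAt
  by_contra hbad
  set T : Set ℝ := {q | ∃ M σ ω, RatU n M ∧ 0 < σ.im ∧ 0 < ω.im ∧ q = σ.im ^ 2 + ω.im ^ 2 ∧
    ¬ GoodAt F b5 (moebius M (dg σ ω))} with hT
  set R : ℝ := B * n ^ 2 with hR
  have him : ∀ M σ ω, RatU n M → 0 < σ.im → 0 < ω.im → ¬ GoodAt F b5 (moebius M (dg σ ω)) →
      σ.im ≤ R ∧ ω.im ≤ R := by
    intro M σ ω hM hσ hω hb
    have hZ := dg_mem_iff.2 ⟨hσ, hω⟩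
    have h1 := hbound k F hF hV1 hV3 _ (moebius_mem hM.1 hZ) hb
    have hs := (Gam_inSU GenM.s.mem).inU
    have e : moebius (M * sM) (dg ω σ) = moebius M (dg σ ω) := by
      rw [moebius_mul hs (dg_mem_iff.2 ⟨hω, hσ⟩), moebius_sM_dg]
    exact ⟨im_le_of_bad hn (hM.mul_Gam GenM.s.mem) hB hω hσ (by rw [e]; exact h1),
      im_le_of_bad hn hM hB hσ hω h1⟩
  have hbdd : BddAbove T := by
    refine ⟨R ^ 2 + R ^ 2, ?_⟩
    rintro q ⟨M, σ, ω, hM, hσ, hω, rfl, hb⟩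
    obtain ⟨h1, h2⟩ := him M σ ω hM hσ hω hb
    exact add_le_add (pow_le_pow_left₀ hσ.le h1 2) (pow_le_pow_left₀ hω.le h2 2)
  have hne : T.Nonempty := ⟨_, M, σ, ω, hM, hσ, hω, rfl, hbad⟩
  have hgood : ∀ M σ ω, RatU n M → 0 < σ.im → 0 < ω.im → sSup T < σ.im ^ 2 + ω.im ^ 2 →
      GoodAt F b5 (moebius M (dg σ ω)) := by
    intro M σ ω hM hσ hω hq
    by_contra hb
    exact absurd (le_csSup hbdd ⟨M, σ, ω, hM, hσ, hω, rfl, hb⟩) (not_le.2 hq)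
  have hR0 : 0 < R := by positivity
  set ρ : ℝ := 1 / (5 * R) with hρ
  have hρ0 : 0 < ρ := by positivity
  obtain ⟨q, ⟨M₀, σ₀, ω₀, hM₀, hσ₀, hω₀, rfl, hbad₀⟩, hq⟩ :=
    exists_lt_of_lt_csSup hne (show sSup T - 8 / 25 * ρ ^ 2 < sSup T by
      have : 0 < 8 / 25 * ρ ^ 2 := by positivity
      linarith)
  obtain ⟨M₁, σ₁, ω₁, hM₁, hy₁, hy₂, h1, h2, e⟩ := raise_im_both hM₀ hσ₀ hω₀
  rw [← e] at hbad₀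
  have hσ₁ := hσ₀.trans_le h1
  have hω₁ := hω₀.trans_le h2
  obtain ⟨hR1, hR2⟩ := him M₁ σ₁ ω₁ hM₁ hσ₁ hω₁ hbad₀
  have hq' : sSup T - 8 / 25 * ρ ^ 2 < σ₁.im ^ 2 + ω₁.im ^ 2 :=
    hq.trans_le (add_le_add (pow_le_pow_left₀ hσ₀.le h1 2) (pow_le_pow_left₀ hω₀.le h2 2))
  have hT0 : 0 ≤ sSup T :=
    le_trans (by positivity) (le_csSup hbdd ⟨M₁, σ₁, ω₁, hM₁, hσ₁, hω₁, rfl, hbad₀⟩)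
  apply hbad₀
  obtain ⟨hU, M', hU', k1, k2, -⟩ := id hM₁
  set y₁ := σ₁.im
  set y₂ := ω₁.im
  refine GoodAt.of_comp_moebius hU hU' k1 k2 (dg_mem_iff.2 ⟨hσ₁, hω₁⟩) ?_
  have hpt : ∀ (s : ℝ) (ζ : ℂ), dg σ₁ ω₁ + s • dg ((sSup T + 1 : ℝ) * I) 0 +
      dg (y₂ * ζ + I * (y₁ / 4) * ζ ^ 2) (-y₁ * ζ) =
      dg (σ₁ + s * ((sSup T + 1 : ℝ) * I) + (y₂ * ζ + I * (y₁ / 4) * ζ ^ 2)) (ω₁ - y₁ * ζ) := by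
    intro s ζ
    rw [smul_dg, dg_add, dg_add]
    congr 1; ring
  have him1 : ∀ (s : ℝ) (ζ : ℂ), (σ₁ + s * ((sSup T + 1 : ℝ) * I) +
      (y₂ * ζ + I * (y₁ / 4) * ζ ^ 2)).im =
      y₁ + s * (sSup T + 1) + (y₂ * ζ.im + y₁ / 4 * (ζ.re ^ 2 - ζ.im ^ 2)) := by
    intro s ζ
    have e4 : (y₁ / 4 : ℂ) = ((y₁ / 4 : ℝ) : ℂ) := by push_cast; rfl
    rw [e4]
    simp [pow_two]
    ring
  have him2 : ∀ ζ : ℂ, (ω₁ - y₁ * ζ).im = y₂ - y₁ * ζ.im := by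
    intro ζ; simp [y₂]
  have hsq : ∀ ζ : ℂ, ζ.re ^ 2 + ζ.im ^ 2 = ‖ζ‖ ^ 2 := fun ζ => by
    rw [← Complex.normSq_eq_norm_sq, Complex.normSq_apply]; ring
  have hall : ∀ s ∈ Set.Icc (0 : ℝ) 1, ∀ ζ : ℂ, ‖ζ‖ ≤ ρ →
      (sSup T < (y₁ + s * (sSup T + 1) + (y₂ * ζ.im + y₁ / 4 * (ζ.re ^ 2 - ζ.im ^ 2))) ^ 2 +
        (y₂ - y₁ * ζ.im) ^ 2) →
      dg σ₁ ω₁ + s • dg ((sSup T + 1 : ℝ) * I) 0 + dg (y₂ * ζ + I * (y₁ / 4) * ζ ^ 2) (-y₁ * ζ) ∈ HH2 ∧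
      GoodAt (fun W => F (moebius M₁ W)) (fun W => b5 (moebius M₁ W))
        (dg σ₁ ω₁ + s • dg ((sSup T + 1 : ℝ) * I) 0 +
          dg (y₂ * ζ + I * (y₁ / 4) * ζ ^ 2) (-y₁ * ζ)) := by
    intro s hs ζ hζ hlt
    have hs0 : 0 ≤ s * (sSup T + 1) := mul_nonneg hs.1 (by linarith)
    obtain ⟨d1, d2, -⟩ := disc_size (s := s * (sSup T + 1)) hy₁ hy₂ hR1 hR2 hρ
      (by rw [hsq]; exact pow_le_pow_left₀ (norm_nonneg _) hζ 2) hs0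
    rw [hpt]
    have a1 : 0 < (σ₁ + s * ((sSup T + 1 : ℝ) * I) + (y₂ * ζ + I * (y₁ / 4) * ζ ^ 2)).im := by
      rw [him1]; linarith
    have a2 : 0 < (ω₁ - y₁ * ζ).im := by rw [him2]; exact d2
    have hm := dg_mem_iff.2 ⟨a1, a2⟩
    refine ⟨hm, GoodAt.comp_moebius hU hm (hgood M₁ _ _ hM₁ a1 a2 ?_)⟩
    rw [him1, him2]; exact hlt
  refine goodAt_of_segment_disc isOpen_HH2 (differentiableOn_comp_moebius hF.1 hU)
    (differentiableOn_comp_moebius isHMF_b5.1 hU)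
    (frequently_comp_moebius_ne_zero frequently_b5_ne_zero hU hU' k1 k2)
    (γ := fun ζ => dg (y₂ * ζ + I * (y₁ / 4) * ζ ^ 2) (-y₁ * ζ))
    (differentiable_dg (by fun_prop) (by fun_prop)) ?_ hρ0 (v := dg ((sSup T + 1 : ℝ) * I) 0) ?_ ?_ ?_
  · ext i j; fin_cases i <;> fin_cases j <;> simp [dg]
  · intro s hs
    rw [smul_dg, dg_add]
    have hs0 : 0 ≤ s * (sSup T + 1) := mul_nonneg hs.1 (by linarith)
    refine dg_mem_iff.2 ⟨?_, by simpa using hω₁⟩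
    have : (σ₁ + s * ((sSup T + 1 : ℝ) * I)).im = y₁ + s * (sSup T + 1) := by simp [y₁]
    rw [this]; linarith
  · intro s hs ζ hζ
    refine hall s hs ζ hζ.le ?_
    have hs0 : 0 ≤ s * (sSup T + 1) := mul_nonneg hs.1 (by linarith)
    obtain ⟨-, -, d3⟩ := disc_size (s := s * (sSup T + 1)) hy₁ hy₂ hR1 hR2 hρ
      (by rw [hsq, hζ]) hs0
    refine lt_of_lt_of_le ?_ d3
    rw [hsq, hζ]
    have : 16 / 25 < y₁ ^ 2 := by nlinarith
    have hρ2 : 0 < ρ ^ 2 := by positivity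
    nlinarith
  · intro ζ hζ
    have := hall 1 ⟨zero_le_one, le_rfl⟩ ζ hζ ?_
    · simpa only [one_smul] using this
    · obtain ⟨d1, d2, -⟩ := disc_size (s := 1 * (sSup T + 1)) hy₁ hy₂ hR1 hR2 hρ
        (by rw [hsq]; exact pow_le_pow_left₀ (norm_nonneg _) hζ 2) (by linarith)
      nlinarith [sq_nonneg (y₂ - y₁ * ζ.im)]

end RationalSurfaces

section RationalPoints

open Complex

/-- The field `K = ℚ(√-11)`, as a subring of `ℂ`. -/
def KK : Subring ℂ where
  carrier := {z | ∃ n : ℕ, 0 < n ∧ (n : ℂ) * z ∈ OK}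
  zero_mem' := ⟨1, one_pos, by simpa using OK.zero_mem⟩
  one_mem' := ⟨1, one_pos, by simpa using OK.one_mem⟩
  neg_mem' := by
    rintro z ⟨n, hn, h⟩
    exact ⟨n, hn, by simpa using OK.neg_mem h⟩
  add_mem' := by
    rintro z w ⟨n, hn, h⟩ ⟨m, hm, h'⟩
    refine ⟨n * m, Nat.mul_pos hn hm, ?_⟩
    have := OK.add_mem (OK.mul_mem (intCast_mem_OK m) h) (OK.mul_mem (intCast_mem_OK n) h')
    push_cast at this ⊢
    convert this using 1
    ring
  mul_mem' := by
    rintro z w ⟨n, hn, h⟩ ⟨m, hm, h'⟩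
    refine ⟨n * m, Nat.mul_pos hn hm, ?_⟩
    have := OK.mul_mem h h'
    push_cast at this ⊢
    convert this using 1
    ring

theorem OK_le_KK {z : ℂ} (h : z ∈ OK) : z ∈ KK := ⟨1, one_pos, by simpa using h⟩

theorem ratCast_mem_KK (q : ℚ) : (q : ℂ) ∈ KK := by
  refine ⟨q.den, q.den_pos, ?_⟩
  have : (q.den : ℂ) * q = (q.num : ℤ) := by
    rw [mul_comm]; exact_mod_cast Rat.mul_den_eq_num q
  rw [this]
  exact intCast_mem_OK _

theorem conj_mem_KK {z : ℂ} (h : z ∈ KK) : (starRingEnd ℂ) z ∈ KK := by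
  obtain ⟨n, hn, h⟩ := h
  exact ⟨n, hn, by simpa using conj_mem_OK h⟩

theorem inv_mem_KK {z : ℂ} (h : z ∈ KK) : z⁻¹ ∈ KK := by
  rcases eq_or_ne z 0 with rfl | h0
  · simpa using KK.zero_mem
  obtain ⟨n, hn, h⟩ := h
  obtain ⟨m, hm⟩ := exists_normSq_eq h
  have hn' : (n : ℂ) ≠ 0 := by exact_mod_cast hn.ne'
  have ha : (n : ℂ) * z ≠ 0 := mul_ne_zero hn' h0
  have hm0 : m ≠ 0 := by
    rintro rfl
    rw [Nat.cast_zero, normSq_eq_zero] at hm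
    exact ha hm
  refine ⟨m, Nat.pos_of_ne_zero hm0, ?_⟩
  have e : (m : ℂ) * z⁻¹ = ((n : ℤ) : ℂ) * (starRingEnd ℂ) ((n : ℂ) * z) := by
    have : (m : ℂ) = (starRingEnd ℂ) ((n : ℂ) * z) * ((n : ℂ) * z) := by
      rw [← Complex.normSq_eq_conj_mul_self, hm]; simp
    rw [this]; field_simp; push_cast; ring
  rw [e]
  exact OK.mul_mem (intCast_mem_OK _) (conj_mem_OK h)

theorem dense_KK : Dense (KK : Set ℂ) := by
  have hf : Continuous fun t : ℝ × ℝ => (t.1 : ℂ) + (t.2 : ℂ) * om := by fun_prop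
  have hs : Function.Surjective fun t : ℝ × ℝ => (t.1 : ℂ) + (t.2 : ℂ) * om := fun z => by
    obtain ⟨a, b, h⟩ := exists_coord z
    exact ⟨(a, b), h.symm⟩
  have hq : DenseRange (Prod.map ((↑) : ℚ → ℝ) ((↑) : ℚ → ℝ)) :=
    Rat.denseRange_cast.prodMap Rat.denseRange_cast
  refine (hs.denseRange.comp hq hf).mono ?_
  rintro _ ⟨⟨a, b⟩, rfl⟩
  have : ((a : ℝ) : ℂ) + ((b : ℝ) : ℂ) * om = (a : ℂ) + (b : ℂ) * om := by push_cast; rfl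
  simp only [Function.comp, Prod.map, SetLike.mem_coe, this]
  exact KK.add_mem (ratCast_mem_KK a) (KK.mul_mem (ratCast_mem_KK b) (OK_le_KK om_mem))

theorem ratU_of_mem_KK {M M' : Matrix (Fin 4) (Fin 4) ℂ} (hM : inU M) (hM' : inU M')
    (h1 : M * M' = 1) (h2 : M' * M = 1) (h : ∀ i j, M' i j ∈ KK) : ∃ n : ℕ, 0 < n ∧ RatU n M := by
  choose n hn hn' using h
  refine ⟨∏ i, ∏ j, n i j, Finset.prod_pos fun i _ => Finset.prod_pos fun j _ => hn i j,
    hM, M', hM', h1, h2, fun i j => ?_⟩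
  obtain ⟨k, hk⟩ : n i j ∣ ∏ i, ∏ j, n i j :=
    (Finset.dvd_prod_of_mem (n i) (Finset.mem_univ j)).trans
      (Finset.dvd_prod_of_mem (fun i => ∏ j, n i j) (Finset.mem_univ i))
  rw [hk]
  have := OK.mul_mem (intCast_mem_OK k) (hn' i j)
  push_cast at this ⊢
  convert this using 1
  ring

theorem tM_mul_neg (p : ℝ) (x : ℂ) (q : ℝ) : tM p x q * tM (-p) (-x) (-q) = 1 := by
  ext i j; fin_cases i <;> fin_cases j <;> simp [tM, Matrix.mul_apply, Fin.sum_univ_four]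

theorem tM_neg_mul (p : ℝ) (x : ℂ) (q : ℝ) : tM (-p) (-x) (-q) * tM p x q = 1 := by
  ext i j; fin_cases i <;> fin_cases j <;> simp [tM, Matrix.mul_apply, Fin.sum_univ_four]

theorem lM_mul_inv {α β γ δ : ℂ} (h : α * δ - β * γ = 1) : lM α β γ δ * lM δ (-β) (-γ) α = 1 := by
  have h' := congrArg (starRingEnd ℂ) h
  simp only [map_sub, map_mul, map_one] at h'
  ext i j; fin_cases i <;> fin_cases j <;> simp [lM, Matrix.mul_apply, Fin.sum_univ_four] <;>
    first | linear_combination h | linear_combination h' | ring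

theorem goodAt_rational_surface {k : ℕ} {F : Matrix (Fin 2) (Fin 2) ℂ → ℂ} (hF : IsHMF 11 k F)
    (hV1 : VanishesAlongH1 F 5) (hV3 : VanishesOnHeegner (omg 11) F)
    {V : Matrix (Fin 2) (Fin 2) ℂ} (hV : V.det = 1) (hVK : ∀ i j, V i j ∈ KK)
    {a c : ℚ} {x : ℂ} (hx : x ∈ KK) {σ ω : ℂ}
    (hZ : !![((a : ℝ) : ℂ), x; (starRingEnd ℂ) x, ((c : ℝ) : ℂ)] +
      V.adjugate * dg σ ω * V.adjugateᴴ ∈ HH2) :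
    GoodAt F b5 (!![((a : ℝ) : ℂ), x; (starRingEnd ℂ) x, ((c : ℝ) : ℂ)] +
      V.adjugate * dg σ ω * V.adjugateᴴ) := by
  have hd : V 1 1 * V 0 0 - (-V 0 1) * (-V 1 0) = 1 := by
    rw [Matrix.det_fin_two] at hV; linear_combination hV
  have hd' : V 0 0 * V 1 1 - V 0 1 * V 1 0 = 1 := by
    rw [Matrix.det_fin_two] at hV; exact hV
  have hL := inU_lM hd
  have hL' := inU_lM hd'
  have hT := inU_tM (a : ℝ) x (c : ℝ)
  have hT' := inU_tM (-(a : ℝ)) (-x) (-(c : ℝ))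
  have l1 := lM_mul_inv hd
  have l2 := lM_mul_inv hd'
  rw [neg_neg, neg_neg] at l1
  have hadj : !![V 1 1, -V 0 1; -V 1 0, V 0 0] = V.adjugate := (Matrix.adjugate_fin_two V).symm
  have hVe : !![V 0 0, V 0 1; V 1 0, V 1 1] = V := (Matrix.eta_fin_two V).symm
  have hm : moebius (lM (V 1 1) (-V 0 1) (-V 1 0) (V 0 0)) (dg σ ω) =
      V.adjugate * dg σ ω * V.adjugateᴴ := by rw [moebius_lM hd, hadj]
  have hUd : V.adjugate * dg σ ω * V.adjugateᴴ ∈ HH2 := by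
    have := moebius_mem hT' hZ
    rw [moebius_tM] at this
    convert this using 1
    ext i j; fin_cases i <;> fin_cases j <;> simp
  have hdg : dg σ ω ∈ HH2 := by
    have := moebius_mem hL' hUd
    rw [← hm, moebius_lM hd, moebius_lM hd', hadj, hVe] at this
    have e : V * (V.adjugate * dg σ ω * V.adjugateᴴ) * Vᴴ =
        (V * V.adjugate) * dg σ ω * (V * V.adjugate)ᴴ := by
      rw [Matrix.conjTranspose_mul]; simp only [Matrix.mul_assoc]
    rw [e, Matrix.mul_adjugate, hV, one_smul, Matrix.conjTranspose_one, Matrix.one_mul,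
      Matrix.mul_one] at this
    exact this
  obtain ⟨n, hn, hR⟩ := ratU_of_mem_KK (inU_mul hT hL) (inU_mul hL' hT')
    (by rw [Matrix.mul_assoc, ← Matrix.mul_assoc (lM _ _ _ _), l1, Matrix.one_mul, tM_mul_neg])
    (by rw [Matrix.mul_assoc, ← Matrix.mul_assoc (tM _ _ _), tM_neg_mul, Matrix.one_mul, l2])
    (fun i j => by
      rw [Matrix.mul_apply]
      refine KK.sum_mem fun y _ => KK.mul_mem ?_ ?_
      · fin_cases i <;> fin_cases y <;> simp [lM, KK.zero_mem, hVK, conj_mem_KK, KK.neg_mem]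
      · have ha := ratCast_mem_KK a
        have hc := ratCast_mem_KK c
        fin_cases y <;> fin_cases j <;>
          simp [tM, KK.zero_mem, KK.one_mem, hx, ha, hc, conj_mem_KK, KK.neg_mem])
  have hdg' := dg_mem_iff.1 hdg
  have := goodAt_moebius_dg hF hV1 hV3 hn hR hdg'.1 hdg'.2
  rwa [moebius_mul hL hdg, hm, moebius_tM, add_comm] at this

theorem exists_rat_ne_zero {g : ℂ → ℂ} {r : ℝ} (hg : DifferentiableOn ℂ g (Metric.ball 0 r)) {t : ℂ}
    (ht : t ∈ Metric.ball (0 : ℂ) r) (h : g t ≠ 0) :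
    ∃ q : ℚ, ((q : ℝ) : ℂ) ∈ Metric.ball (0 : ℂ) r ∧ g ((q : ℝ) : ℂ) ≠ 0 := by
  by_contra! hcon
  apply h
  have hr : 0 < r := Metric.pos_of_mem_ball ht
  have h0 : (0 : ℂ) ∈ Metric.ball (0 : ℂ) r := Metric.mem_ball_self hr
  refine (hg.analyticOnNhd Metric.isOpen_ball).eqOn_zero_of_preconnected_of_frequently_eq_zero
    (convex_ball 0 r).isPreconnected h0 ?_ ht
  rw [frequently_nhdsWithin_iff, Metric.nhds_basis_ball.frequently_iff]
  intro ε hε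
  obtain ⟨q, hq1, hq2⟩ := exists_rat_btwn (lt_min hε hr)
  have hq : (0 : ℝ) < q := hq1
  have hn : ‖((q : ℝ) : ℂ)‖ = q := by rw [Complex.norm_real, Real.norm_of_nonneg hq.le]
  refine ⟨((q : ℝ) : ℂ), ?_, hcon q ?_, ?_⟩
  · rw [mem_ball_zero_iff, hn]; exact hq2.trans_le (min_le_left _ _)
  · rw [mem_ball_zero_iff, hn]; exact hq2.trans_le (min_le_right _ _)
  · have : ((q : ℝ) : ℂ) ≠ 0 := by exact_mod_cast hq.ne'
    exact this

/-- Hermitian matrices in rational coordinates. -/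
def wmat (t₁ t₂ t₃ t₄ : ℂ) : Matrix (Fin 2) (Fin 2) ℂ :=
  !![t₁, t₃ + t₄ * om; t₃ + t₄ * (1 - om), t₂]

theorem exists_rat_hermitian {f : Matrix (Fin 2) (Fin 2) ℂ → ℂ} {Ω : Set (Matrix (Fin 2) (Fin 2) ℂ)}
    (hΩ : IsOpen Ω) (h0 : 0 ∈ Ω) (hf : DifferentiableOn ℂ f Ω) (hne : ∃ᶠ W in 𝓝 0, f W ≠ 0) :
    ∃ a b c d : ℚ, wmat (a : ℝ) (b : ℝ) (c : ℝ) (d : ℝ) ∈ Ω ∧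
      f (wmat (a : ℝ) (b : ℝ) (c : ℝ) (d : ℝ)) ≠ 0 := by
  have hcont : Continuous fun t : ℂ × ℂ × ℂ × ℂ => wmat t.1 t.2.1 t.2.2.1 t.2.2.2 := by
    refine continuous_matrix fun i j => ?_
    fin_cases i <;> fin_cases j <;> simp [wmat] <;> fun_prop
  have hw0 : wmat 0 0 0 0 = 0 := by
    ext i j; fin_cases i <;> fin_cases j <;> simp [wmat]
  have hmem : ∀ᶠ t : ℂ × ℂ × ℂ × ℂ in 𝓝 0, wmat t.1 t.2.1 t.2.2.1 t.2.2.2 ∈ Ω :=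
    hcont.continuousAt.eventually_mem (hΩ.mem_nhds (by simpa [hw0] using h0))
  obtain ⟨r, hr, hball⟩ := Metric.eventually_nhds_iff_ball.1 hmem
  have hin : ∀ a b c d : ℂ, a ∈ Metric.ball (0 : ℂ) r → b ∈ Metric.ball (0 : ℂ) r →
      c ∈ Metric.ball (0 : ℂ) r → d ∈ Metric.ball (0 : ℂ) r → wmat a b c d ∈ Ω := by
    intro a b c d ha hb hc hd
    rw [mem_ball_zero_iff] at ha hb hc hd
    refine hball (a, b, c, d) ?_
    rw [mem_ball_zero_iff, Prod.norm_mk, Prod.norm_mk, Prod.norm_mk]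
    simp [ha, hb, hc, hd]
  have hs : (2 * om - 1 : ℂ) ≠ 0 := by
    intro h
    have := om_mul_self
    have h2 : (2 * om - 1) * (2 * om - 1) = -11 := by linear_combination 4 * this
    rw [h] at h2; norm_num at h2
  have hsurj : ∀ W : Matrix (Fin 2) (Fin 2) ℂ, wmat (W 0 0) (W 1 1)
      (W 0 1 - (W 0 1 - W 1 0) / (2 * om - 1) * om) ((W 0 1 - W 1 0) / (2 * om - 1)) = W := by
    intro W
    ext i j; fin_cases i <;> fin_cases j <;> simp [wmat]
    field_simp; ring
  have hc2 : Continuous fun W : Matrix (Fin 2) (Fin 2) ℂ => ((W 0 0), (W 1 1),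
      (W 0 1 - (W 0 1 - W 1 0) / (2 * om - 1) * om), ((W 0 1 - W 1 0) / (2 * om - 1))) := by
    have := fun i j => (differentiable_entry i j).continuous
    have a := this 0 0
    have b := this 0 1
    have c := this 1 0
    have d := this 1 1
    simp only [div_eq_mul_inv]
    fun_prop
  have hsmall : ∀ᶠ W : Matrix (Fin 2) (Fin 2) ℂ in 𝓝 0, ((W 0 0), (W 1 1),
      (W 0 1 - (W 0 1 - W 1 0) / (2 * om - 1) * om), ((W 0 1 - W 1 0) / (2 * om - 1))) ∈
      Metric.ball (0 : ℂ × ℂ × ℂ × ℂ) r :=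
    hc2.continuousAt.eventually_mem (by
      refine Metric.isOpen_ball.mem_nhds ?_
      simpa using hr)
  obtain ⟨W, hW, hWr⟩ := (hne.and_eventually hsmall).exists
  rw [mem_ball_zero_iff, Prod.norm_mk, Prod.norm_mk, Prod.norm_mk] at hWr
  simp only [max_lt_iff] at hWr
  simp only [← mem_ball_zero_iff] at hWr
  rw [← hsurj W] at hW
  generalize W 0 0 = t₁ at *
  generalize W 1 1 = t₂ at *
  generalize (W 0 1 - W 1 0) / (2 * om - 1) = t₄ at *
  generalize W 0 1 - t₄ * om = t₃ at *
  obtain ⟨m1, m2, m3, m4⟩ := hWr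
  have hdiff : ∀ γ : ℂ → Matrix (Fin 2) (Fin 2) ℂ, Differentiable ℂ γ →
      (∀ t ∈ Metric.ball (0 : ℂ) r, γ t ∈ Ω) → DifferentiableOn ℂ (fun t => f (γ t)) (Metric.ball 0 r) :=
    fun γ hγ h => hf.comp hγ.differentiableOn h
  have hent : ∀ γ : ℂ → Matrix (Fin 2) (Fin 2) ℂ, (∀ i j, Differentiable ℂ fun t => γ t i j) →
      Differentiable ℂ γ := fun γ h t => differentiableAt_of_entries fun i j => h i j t
  obtain ⟨a, ha, hWa⟩ := exists_rat_ne_zero (hdiff (fun t => wmat t t₂ t₃ t₄)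
    (hent _ fun i j => by fin_cases i <;> fin_cases j <;> simp [wmat])
    fun t ht => hin _ _ _ _ ht m2 m3 m4) m1 hW
  obtain ⟨b, hb, hWb⟩ := exists_rat_ne_zero (hdiff (fun t => wmat (a : ℝ) t t₃ t₄)
    (hent _ fun i j => by fin_cases i <;> fin_cases j <;> simp [wmat])
    fun t ht => hin _ _ _ _ ha ht m3 m4) m2 hWa
  obtain ⟨c, hc, hWc⟩ := exists_rat_ne_zero (hdiff (fun t => wmat (a : ℝ) (b : ℝ) t t₄)
    (hent _ fun i j => by fin_cases i <;> fin_cases j <;> simp [wmat])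
    fun t ht => hin _ _ _ _ ha hb ht m4) m3 hWb
  obtain ⟨d, hd, hWd⟩ := exists_rat_ne_zero (hdiff (fun t => wmat (a : ℝ) (b : ℝ) (c : ℝ) t)
    (hent _ fun i j => by fin_cases i <;> fin_cases j <;> simp [wmat])
    fun t ht => hin _ _ _ _ ha hb hc ht) m4 hWc
  exact ⟨a, b, c, d, hin _ _ _ _ ha hb hc hd, hWd⟩

end RationalPoints

section EverywhereGood

open Complex

/-- A unimodular frame with first row proportional to `(r₀, r₁)` and second row orthogonal to
`(c₀, c₁)`. -/
def frm (r₀ r₁ c₀ c₁ : ℂ) : Matrix (Fin 2) (Fin 2) ℂ :=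
  !![r₀ / -(r₀ * (starRingEnd ℂ) c₀ + r₁ * (starRingEnd ℂ) c₁),
    r₁ / -(r₀ * (starRingEnd ℂ) c₀ + r₁ * (starRingEnd ℂ) c₁);
    (starRingEnd ℂ) c₁, -(starRingEnd ℂ) c₀]

theorem det_frm {r₀ r₁ c₀ c₁ : ℂ}
    (h : r₀ * (starRingEnd ℂ) c₀ + r₁ * (starRingEnd ℂ) c₁ ≠ 0) : (frm r₀ r₁ c₀ c₁).det = 1 := by
  rw [frm, Matrix.det_fin_two_of]
  field_simp
  ring

theorem frm_mem_KK {r₀ r₁ c₀ c₁ : ℂ} (h₀ : r₀ ∈ KK) (h₁ : r₁ ∈ KK) (k₀ : c₀ ∈ KK) (k₁ : c₁ ∈ KK)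
    (i j : Fin 2) : frm r₀ r₁ c₀ c₁ i j ∈ KK := by
  have hd := inv_mem_KK (KK.neg_mem (KK.add_mem (KK.mul_mem h₀ (conj_mem_KK k₀))
    (KK.mul_mem h₁ (conj_mem_KK k₁))))
  fin_cases i <;> fin_cases j
  · exact KK.mul_mem h₀ hd
  · exact KK.mul_mem h₁ hd
  · exact conj_mem_KK k₁
  · exact KK.neg_mem (conj_mem_KK k₀)

theorem frm_diag {r₀ r₁ c₀ c₁ μ : ℂ} {H : Matrix (Fin 2) (Fin 2) ℂ} (hH : H.IsHermitian)
    (h₀ : c₀ = μ * (r₀ * H 0 0 + r₁ * H 1 0)) (h₁ : c₁ = μ * (r₀ * H 0 1 + r₁ * H 1 1))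
    (hμ : μ ≠ 0) : frm r₀ r₁ c₀ c₁ * H * (frm r₀ r₁ c₀ c₁)ᴴ =
      dg ((frm r₀ r₁ c₀ c₁ * H * (frm r₀ r₁ c₀ c₁)ᴴ) 0 0)
        ((frm r₀ r₁ c₀ c₁ * H * (frm r₀ r₁ c₀ c₁)ᴴ) 1 1) := by
  set V := frm r₀ r₁ c₀ c₁ with hV
  have hh : (V * H * Vᴴ).IsHermitian := by
    rw [Matrix.IsHermitian, Matrix.conjTranspose_mul, Matrix.conjTranspose_mul,
      Matrix.conjTranspose_conjTranspose, hH.eq, Matrix.mul_assoc]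
  have h01 : (V * H * Vᴴ) 0 1 = 0 := by
    have e : (V * H * Vᴴ) 0 1 = (V 0 0 * H 0 0 + V 0 1 * H 1 0) * c₁ -
        (V 0 0 * H 0 1 + V 0 1 * H 1 1) * c₀ := by
      have v0 : V 1 0 = (starRingEnd ℂ) c₁ := rfl
      have v1 : V 1 1 = -(starRingEnd ℂ) c₀ := rfl
      simp only [Matrix.mul_apply, Fin.sum_univ_two, Matrix.conjTranspose_apply, v0, v1,
        Complex.star_def, map_neg, Complex.conj_conj]
      ring
    rw [e, h₀, h₁, hV, frm]
    simp [div_eq_mul_inv]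
    ring
  have h10 : (V * H * Vᴴ) 1 0 = 0 := by
    rw [← hh.apply 1 0, h01, star_zero]
  ext i j
  fin_cases i <;> fin_cases j <;> simp [dg, h01, h10]

theorem adjugate_conj {V H : Matrix (Fin 2) (Fin 2) ℂ} (hV : V.det = 1) :
    V.adjugate * (V * H * Vᴴ) * V.adjugateᴴ = H := by
  have e : V.adjugate * (V * H * Vᴴ) * V.adjugateᴴ =
      (V.adjugate * V) * H * (V.adjugate * V)ᴴ := by
    rw [Matrix.conjTranspose_mul]; simp only [Matrix.mul_assoc]
  rw [e, Matrix.adjugate_mul, hV, one_smul, Matrix.conjTranspose_one, Matrix.one_mul,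
    Matrix.mul_one]

/-- A simultaneous diagonalisation of a positive definite and an invertible Hermitian matrix. -/
theorem exists_frm {Y W : Matrix (Fin 2) (Fin 2) ℂ} (hY : Y.PosDef) (hW : W.det ≠ 0) :
    ∃ r₀ r₁ μ : ℂ, μ ≠ 0 ∧ r₀ * W 0 0 + r₁ * W 1 0 = μ * (r₀ * Y 0 0 + r₁ * Y 1 0) ∧
      r₀ * W 0 1 + r₁ * W 1 1 = μ * (r₀ * Y 0 1 + r₁ * Y 1 1) ∧
      r₀ * (starRingEnd ℂ) (r₀ * W 0 0 + r₁ * W 1 0) +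
        r₁ * (starRingEnd ℂ) (r₀ * W 0 1 + r₁ * W 1 1) ≠ 0 := by
  have hYd : Y.det ≠ 0 := hY.det_pos.ne'
  obtain ⟨s, hs⟩ := IsAlgClosed.exists_pow_nat_eq (discrim Y.det
    (-(W 0 0 * Y 1 1 + Y 0 0 * W 1 1 - W 0 1 * Y 1 0 - Y 0 1 * W 1 0)) W.det) two_pos
  obtain ⟨μ, hμ⟩ := exists_quadratic_eq_zero hYd ⟨s, by rw [← hs, sq]⟩
  have hdet : (W - μ • Y).det = 0 := by
    rw [← hμ]
    simp only [Matrix.det_fin_two, Matrix.sub_apply, Matrix.smul_apply, smul_eq_mul]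
    ring
  have hμ0 : μ ≠ 0 := by
    rintro rfl
    simp only [mul_zero, zero_add] at hμ
    exact hW hμ
  obtain ⟨r, hr, hr0⟩ := Matrix.exists_vecMul_eq_zero_iff.2 hdet
  have e0 := congrFun hr0 0
  have e1 := congrFun hr0 1
  simp only [Matrix.vecMul, dotProduct, Fin.sum_univ_two, Matrix.sub_apply, Matrix.smul_apply,
    smul_eq_mul, Pi.zero_apply] at e0 e1
  have f0 : r 0 * W 0 0 + r 1 * W 1 0 = μ * (r 0 * Y 0 0 + r 1 * Y 1 0) := by
    linear_combination e0
  have f1 : r 0 * W 0 1 + r 1 * W 1 1 = μ * (r 0 * Y 0 1 + r 1 * Y 1 1) := by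
    linear_combination e1
  refine ⟨r 0, r 1, μ, hμ0, f0, f1, ?_⟩
  rw [f0, f1]
  have hp := hY.dotProduct_mulVec_pos (x := star r) (by simpa using hr)
  have h00 := hY.isHermitian.apply 0 0
  have h10 := hY.isHermitian.apply 1 0
  have h01 := hY.isHermitian.apply 0 1
  have h11 := hY.isHermitian.apply 1 1
  rw [Complex.star_def] at h00 h10 h01 h11
  have e : r 0 * (starRingEnd ℂ) (μ * (r 0 * Y 0 0 + r 1 * Y 1 0)) +
        r 1 * (starRingEnd ℂ) (μ * (r 0 * Y 0 1 + r 1 * Y 1 1)) =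
      (starRingEnd ℂ) μ * (star (star r) ⬝ᵥ Y *ᵥ star r) := by
    simp only [map_mul, map_add, h00, h10, h01, h11, dotProduct, Matrix.mulVec,
      Fin.sum_univ_two, Pi.star_apply, Complex.star_def, Complex.conj_conj]
    ring
  rw [e]
  exact mul_ne_zero (by simpa using hμ0) hp.ne'

theorem exists_line {p : Matrix (Fin 2) (Fin 2) ℂ} (hp : p ∈ HH2) :
    ∃ W : Matrix (Fin 2) (Fin 2) ℂ, W.IsHermitian ∧ (∀ i j, W i j ∈ KK) ∧ W.det ≠ 0 ∧
      ∃ ρ : ℝ, 0 < ρ ∧ (∀ ζ : ℂ, ‖ζ‖ ≤ ρ → p + ζ • W ∈ HH2) ∧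
        ∀ ζ : ℂ, ‖ζ‖ = ρ → b5 (p + ζ • W) ≠ 0 := by
  have hdet : Differentiable ℂ fun Z : Matrix (Fin 2) (Fin 2) ℂ => (Z - p).det := by
    have a := differentiable_entry 0 0
    have b := differentiable_entry 0 1
    have c := differentiable_entry 1 0
    have d := differentiable_entry 1 1
    simp only [Matrix.det_fin_two, Matrix.sub_apply]
    fun_prop
  have hadd : Continuous fun W : Matrix (Fin 2) (Fin 2) ℂ => p + W := by fun_prop
  have hF : DifferentiableOn ℂ (fun Z => (Z - p).det * b5 Z) HH2 :=
    hdet.differentiableOn.mul differentiableOn_b5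
  have hpI : p + I • (1 : Matrix (Fin 2) (Fin 2) ℂ) ∈ HH2 := by
    rw [mem_HH2_iff_posDef] at *
    have : imM (p + I • (1 : Matrix (Fin 2) (Fin 2) ℂ)) = imM p + 1 := by
      rw [imM_eq, imM_eq, Matrix.conjTranspose_add, Matrix.conjTranspose_smul,
        Matrix.conjTranspose_one, Complex.star_def, conj_I]
      have : p + I • (1 : Matrix (Fin 2) (Fin 2) ℂ) - (pᴴ + -I • 1) = (p - pᴴ) + (2 * I) • 1 := by
        module
      rw [this, smul_add, smul_smul, inv_mul_cancel₀ (by simp), one_smul]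
    rw [this]
    exact hp.add Matrix.PosDef.one
  have hprod : ∃ Z ∈ HH2, (Z - p).det * b5 Z ≠ 0 := by
    by_contra! hcon
    obtain ⟨Z₁, h1, h2⟩ := exists_b5_ne_zero
    exact h2 (eq_zero_of_mul_eq_zero_convex isOpen_HH2 convex_HH2 hdet.differentiableOn
      differentiableOn_b5.continuousOn hpI (by simp) hcon Z₁ h1)
  obtain ⟨Z₁, hZ₁, hne₁⟩ := hprod
  have hfr := frequently_ne_zero_of_convex isOpen_HH2 convex_HH2 hF hZ₁ hne₁ hp
  have hfr' : ∃ᶠ W in 𝓝 (0 : Matrix (Fin 2) (Fin 2) ℂ), (p + W - p).det * b5 (p + W) ≠ 0 := by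
    have hsub : Continuous fun Z : Matrix (Fin 2) (Fin 2) ℂ => Z - p := by fun_prop
    have ht : Tendsto (fun Z : Matrix (Fin 2) (Fin 2) ℂ => Z - p) (𝓝 p) (𝓝 0) := by
      simpa using hsub.tendsto p
    refine ht.frequently (hfr.mono fun Z hZ => ?_)
    rwa [add_sub_cancel]
  obtain ⟨a, b, c, d, hΩ, hne⟩ := exists_rat_hermitian (f := fun W => (p + W - p).det * b5 (p + W))
    (isOpen_HH2.preimage hadd) (by simpa using hp)
    (hF.comp ((differentiable_const p).add differentiable_id).differentiableOn fun W hW => hW) hfr'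
  rw [add_sub_cancel_left] at hne
  set W := wmat (a : ℝ) (b : ℝ) (c : ℝ) (d : ℝ) with hW
  have hS : IsOpen {ζ : ℂ | p + ζ • W ∈ HH2} := isOpen_HH2.preimage (by fun_prop)
  have hSc : Convex ℝ {ζ : ℂ | p + ζ • W ∈ HH2} := by
    intro s hs t ht α β hα hβ hαβ
    have := convex_HH2 hs ht hα hβ hαβ
    simp only [Set.mem_ofPred_eq] at *
    have e : p + (α • s + β • t) • W = α • (p + s • W) + β • (p + t • W) := by
      have : p = (α + β) • p := by rw [hαβ, one_smul]
      nth_rewrite 1 [this]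
      simp only [Complex.real_smul]
      module
    rwa [e]
  have hlin : Differentiable ℂ fun ζ : ℂ => p + ζ • W := by fun_prop
  have hg : AnalyticOnNhd ℂ (fun ζ : ℂ => b5 (p + ζ • W)) {ζ : ℂ | p + ζ • W ∈ HH2} :=
    (differentiableOn_b5.comp hlin.differentiableOn fun ζ hζ => hζ).analyticOnNhd hS
  have h0 : (0 : ℂ) ∈ {ζ : ℂ | p + ζ • W ∈ HH2} := by simpa using hp
  have h1 : (1 : ℂ) ∈ {ζ : ℂ | p + ζ • W ∈ HH2} := by
    rw [Set.mem_ofPred_eq, one_smul]; exact hΩ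
  have hev : ∀ᶠ ζ in 𝓝[≠] (0 : ℂ), b5 (p + ζ • W) ≠ 0 := by
    refine (hg 0 h0).eventually_eq_zero_or_eventually_ne_zero.resolve_left fun h => ?_
    refine right_ne_zero_of_mul hne ?_
    have := hg.eqOn_zero_of_preconnected_of_eventuallyEq_zero hSc.isPreconnected h0 h h1
    simpa using this
  rw [eventually_nhdsWithin_iff] at hev
  obtain ⟨ε, hε, hb⟩ := Metric.eventually_nhds_iff_ball.1 (hev.and (hS.mem_nhds h0))
  refine ⟨W, ?_, ?_, left_ne_zero_of_mul hne, ε / 2, half_pos hε, fun ζ hζ => (hb ζ ?_).2,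
    fun ζ hζ => (hb ζ ?_).1 ?_⟩
  · ext i j
    fin_cases i <;> fin_cases j <;> simp [hW, wmat, conj_om]
  · intro i j
    have q := ratCast_mem_KK
    have ho := OK_le_KK om_mem
    fin_cases i <;> fin_cases j
    · simpa [hW, wmat] using q a
    · simpa [hW, wmat] using KK.add_mem (q c) (KK.mul_mem (q d) ho)
    · simpa [hW, wmat] using KK.add_mem (q c) (KK.mul_mem (q d) (KK.sub_mem KK.one_mem ho))
    · simpa [hW, wmat] using q b
  · rw [mem_ball_zero_iff]; linarith
  · rw [mem_ball_zero_iff]; linarith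
  · have : ζ ≠ 0 := by
      rw [← norm_pos_iff]; linarith
    exact this

theorem goodAt_all {k : ℕ} {F : Matrix (Fin 2) (Fin 2) ℂ → ℂ} (hF : IsHMF 11 k F)
    (hV1 : VanishesAlongH1 F 5) (hV3 : VanishesOnHeegner (omg 11) F)
    {p : Matrix (Fin 2) (Fin 2) ℂ} (hp : p ∈ HH2) : GoodAt F b5 p := by
  obtain ⟨W, hWh, hWK, hWd, ρ, hρ, hdisc, hcirc⟩ := exists_line hp
  obtain ⟨s₀, s₁, μ, hμ, e0, e1, hd⟩ := exists_frm hp hWd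
  have hγ : Differentiable ℂ fun ζ : ℂ => ζ • W := by fun_prop
  set C₀ : ℂ × ℂ → ℂ := fun r => r.1 * W 0 0 + r.2 * W 1 0 with hC₀
  set C₁ : ℂ × ℂ → ℂ := fun r => r.1 * W 0 1 + r.2 * W 1 1 with hC₁
  set V : ℂ × ℂ → Matrix (Fin 2) (Fin 2) ℂ := fun r => frm r.1 r.2 (C₀ r) (C₁ r) with hV
  set N : ℂ × ℂ → ℂ := fun r => r.1 * (starRingEnd ℂ) (C₀ r) + r.2 * (starRingEnd ℂ) (C₁ r) with hN
  have hcC₀ : Continuous C₀ := by fun_prop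
  have hcC₁ : Continuous C₁ := by fun_prop
  have hcN : Continuous N :=
    (continuous_fst.mul (Complex.continuous_conj.comp hcC₀)).add
      (continuous_snd.mul (Complex.continuous_conj.comp hcC₁))
  set t₀ : (ℂ × ℂ) × ℂ × ℝ × ℝ :=
    ((s₀, s₁), (p 0 1 + (starRingEnd ℂ) (p 1 0)) / 2, (p 0 0).re, (p 1 1).re) with ht₀
  set D : ℂ × ℂ → Matrix (Fin 2) (Fin 2) ℂ := fun r => V r * imM p * (V r)ᴴ with hD
  set E : (ℂ × ℂ) × ℂ × ℝ × ℝ → Matrix (Fin 2) (Fin 2) ℂ := fun t =>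
    !![(t.2.2.1 : ℂ), t.2.1; (starRingEnd ℂ) t.2.1, (t.2.2.2 : ℂ)] +
      (V t.1).adjugate * dg (I * D t.1 0 0) (I * D t.1 1 1) * (V t.1).adjugateᴴ with hE
  have hEt₀ : E t₀ = p := by
    have hdiag := frm_diag (imM_isHermitian p) e0 e1 hμ
    have hD' : dg (I * D t₀.1 0 0) (I * D t₀.1 1 1) = I • (V t₀.1 * imM p * (V t₀.1)ᴴ) := by
      conv_rhs => rw [show V t₀.1 * imM p * (V t₀.1)ᴴ = _ from hdiag]
      ext i j; fin_cases i <;> fin_cases j <;> simp [dg, hD, hV, ht₀, hC₀, hC₁]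
    simp only [hE]
    rw [hD', Matrix.mul_smul, Matrix.smul_mul, adjugate_conj (det_frm hd)]
    have hre : ∀ z : ℂ, z - (starRingEnd ℂ) z = 2 * I * z.im := fun z => by
      rw [Complex.sub_conj]; push_cast; ring
    have h2 : (starRingEnd ℂ) 2 = 2 := Complex.conj_ofNat 2
    ext i j; fin_cases i <;> fin_cases j <;> simp [imM, ht₀, hre, h2]
    · rw [mul_comm I, Complex.re_add_im]
    · field_simp; ring
    · field_simp; ring
    · rw [mul_comm I, Complex.re_add_im]
  have hVc : ContinuousAt V (s₀, s₁) := by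
    have hNi : ContinuousAt (fun r => (-(N r))⁻¹) (s₀, s₁) :=
      hcN.neg.continuousAt.inv₀ (neg_ne_zero.2 hd)
    have : V = fun r => !![r.1 * (-(N r))⁻¹, r.2 * (-(N r))⁻¹; (starRingEnd ℂ) (C₁ r),
        -(starRingEnd ℂ) (C₀ r)] := by
      funext r; simp only [hV, frm, hN, div_eq_mul_inv]
    rw [this]
    refine continuousAt_pi.2 fun i => continuousAt_pi.2 fun j => ?_
    fin_cases i <;> fin_cases j
    · exact continuousAt_fst.mul hNi
    · exact continuousAt_snd.mul hNi
    · exact (Complex.continuous_conj.comp hcC₁).continuousAt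
    · exact (Complex.continuous_conj.comp hcC₀).neg.continuousAt
  have hEc : ContinuousAt E t₀ := by
    have hVt : ContinuousAt (fun t : (ℂ × ℂ) × ℂ × ℝ × ℝ => V t.1) t₀ :=
      Tendsto.comp (f := fun t : (ℂ × ℂ) × ℂ × ℝ × ℝ => t.1) hVc (continuous_fst.tendsto t₀)
    have hg : Continuous fun q : Matrix (Fin 2) (Fin 2) ℂ × ℂ × ℝ × ℝ =>
        !![(q.2.2.1 : ℂ), q.2.1; (starRingEnd ℂ) q.2.1, (q.2.2.2 : ℂ)] +
          q.1.adjugate * dg (I * (q.1 * imM p * q.1ᴴ) 0 0) (I * (q.1 * imM p * q.1ᴴ) 1 1) *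
            q.1.adjugateᴴ := by
      refine Continuous.add ?_ ?_
      · refine continuous_matrix fun i j => ?_
        fin_cases i <;> fin_cases j <;> simp <;> fun_prop
      · have hc : Continuous fun q : Matrix (Fin 2) (Fin 2) ℂ × ℂ × ℝ × ℝ => q.1 := continuous_fst
        have hm : Continuous fun q : Matrix (Fin 2) (Fin 2) ℂ × ℂ × ℝ × ℝ =>
            q.1 * imM p * q.1ᴴ := (hc.mul continuous_const).mul hc.matrix_conjTranspose
        refine ((hc.matrix_adjugate).mul ?_).mul hc.matrix_adjugate.matrix_conjTranspose
        refine continuous_matrix fun i j => ?_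
        fin_cases i <;> fin_cases j <;> simp only [dg]
        · exact continuous_const.mul (hm.matrix_elem 0 0)
        · exact continuous_const
        · exact continuous_const
        · exact continuous_const.mul (hm.matrix_elem 1 1)
    exact ContinuousAt.comp (f := fun t : (ℂ × ℂ) × ℂ × ℝ × ℝ => (V t.1, t.2)) hg.continuousAt
      (hVt.prodMk continuousAt_snd)
  have hdense : Dense (((KK : Set ℂ) ×ˢ (KK : Set ℂ)) ×ˢ (KK : Set ℂ) ×ˢ
      (Set.range ((↑) : ℚ → ℝ)) ×ˢ (Set.range ((↑) : ℚ → ℝ))) :=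
    (dense_KK.prod dense_KK).prod (dense_KK.prod (Rat.denseRange_cast.prod Rat.denseRange_cast))
  have hfreq := mem_closure_iff_frequently.1 (hdense t₀)
  have hNe : ∀ᶠ t : (ℂ × ℂ) × ℂ × ℝ × ℝ in 𝓝 t₀, N t.1 ≠ 0 :=
    (hcN.comp continuous_fst).continuousAt.eventually_ne hd
  have hmem : ∀ᶠ e in 𝓝 p, ∀ ζ ∈ Metric.closedBall (0 : ℂ) ρ, e + ζ • W ∈ HH2 :=
    eventually_forall_add_mem isOpen_HH2 hγ.continuous (isCompact_closedBall _ _)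
      fun ζ hζ => hdisc ζ (by simpa using hζ)
  have hEt : Tendsto E (𝓝 t₀) (𝓝 p) := by
    have := hEc.tendsto
    rwa [hEt₀] at this
  refine goodAt_of_frequently_disc isOpen_HH2 hF.1 differentiableOn_b5 frequently_b5_ne_zero hγ
    (zero_smul _ _) hρ hp (fun ζ hζ => ⟨hdisc ζ hζ.le,
      GoodAt.of_ne_zero isOpen_HH2 hF.1 differentiableOn_b5 (hdisc ζ hζ.le) (hcirc ζ hζ)⟩) ?_
  refine hEt.frequently ((hfreq.and_eventually (hNe.and (hEt.eventually hmem))).mono ?_)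
  rintro ⟨⟨r₀, r₁⟩, x, a, c⟩ ⟨⟨⟨hr₀, hr₁⟩, hx, ⟨a, rfl⟩, ⟨c, rfl⟩⟩, hn, hm⟩ ζ hζ
  have hζm := hm ζ (by simpa using hζ)
  refine ⟨hζm, ?_⟩
  have hV1' : (V (r₀, r₁)).det = 1 := det_frm hn
  have hVK : ∀ i j, V (r₀, r₁) i j ∈ KK := frm_mem_KK hr₀ hr₁
    (KK.add_mem (KK.mul_mem hr₀ (hWK 0 0)) (KK.mul_mem hr₁ (hWK 1 0)))
    (KK.add_mem (KK.mul_mem hr₀ (hWK 0 1)) (KK.mul_mem hr₁ (hWK 1 1)))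
  have hWe : W = (V (r₀, r₁)).adjugate * dg ((V (r₀, r₁) * W * (V (r₀, r₁))ᴴ) 0 0)
      ((V (r₀, r₁) * W * (V (r₀, r₁))ᴴ) 1 1) * (V (r₀, r₁)).adjugateᴴ := by
    have h := frm_diag (r₀ := r₀) (r₁ := r₁) hWh (one_mul _).symm (one_mul _).symm one_ne_zero
    rw [show dg ((V (r₀, r₁) * W * (V (r₀, r₁))ᴴ) 0 0) ((V (r₀, r₁) * W * (V (r₀, r₁))ᴴ) 1 1) =
      V (r₀, r₁) * W * (V (r₀, r₁))ᴴ from h.symm, adjugate_conj hV1']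
  have hsm : ∀ z a b : ℂ, z • dg a b = dg (z * a) (z * b) := fun z a b => by
    ext i j; fin_cases i <;> fin_cases j <;> simp [dg]
  have hfin : E ((r₀, r₁), x, (a : ℝ), (c : ℝ)) + ζ • W =
      !![((a : ℝ) : ℂ), x; (starRingEnd ℂ) x, ((c : ℝ) : ℂ)] + (V (r₀, r₁)).adjugate *
        dg (I * D (r₀, r₁) 0 0 + ζ * (V (r₀, r₁) * W * (V (r₀, r₁))ᴴ) 0 0)
          (I * D (r₀, r₁) 1 1 + ζ * (V (r₀, r₁) * W * (V (r₀, r₁))ᴴ) 1 1) *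
        (V (r₀, r₁)).adjugateᴴ := by
    nth_rewrite 1 [hWe]
    simp only [hE]
    rw [add_assoc, ← Matrix.smul_mul, ← Matrix.mul_smul, hsm, ← Matrix.add_mul, ← Matrix.mul_add,
      dg_add]
  rw [hfin] at hζm ⊢
  exact goodAt_rational_surface hF hV1 hV3 hV1' hVK hx hζm

end EverywhereGood

section Quotient

open Complex

theorem quo_transform {k : ℕ} {F : Matrix (Fin 2) (Fin 2) ℂ → ℂ} (hF : IsHMF 11 k F)
    (hgood : ∀ Z ∈ HH2, GoodAt F b5 Z) (hdiff : DifferentiableOn ℂ (quo F b5) HH2)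
    {M : Matrix (Fin 4) (Fin 4) ℂ} (hM : inSU 11 M) {Z : Matrix (Fin 2) (Fin 2) ℂ} (hZ : Z ∈ HH2) :
    (autM M Z).det ^ 5 * quo F b5 (moebius M Z) = (autM M Z).det ^ k * quo F b5 Z := by
  obtain ⟨Z₁, h1, h2⟩ := exists_b5_ne_zero
  have hmem : ∀ W ∈ HH2, moebius M W ∈ HH2 := fun W hW => moebius_mem hM.inU hW
  have hm : ContinuousOn (moebius M) HH2 := fun W hW =>
    (differentiableAt_moebius hM.inU hW).continuousAt.continuousWithinAt
  have hj : Continuous fun W => (autM M W).det := by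
    unfold autM
    exact ((continuous_const.mul continuous_id).add continuous_const).matrix_det
  have key := eq_zero_of_mul_eq_zero_convex isOpen_HH2 convex_HH2 differentiableOn_b5
    (g := fun W => (autM M W).det ^ 5 * quo F b5 (moebius M W) - (autM M W).det ^ k * quo F b5 W)
    (((hj.pow 5).continuousOn.mul (hdiff.continuousOn.comp hm hmem)).sub
      ((hj.pow k).continuousOn.mul hdiff.continuousOn)) h1 h2 (fun W hW => ?_) Z hZ
  · exact sub_eq_zero.1 key
  · have e1 := hF.2 M hM W hW
    have e2 := isHMF_b5.2 M hM W hW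
    have e3 := (hgood W hW).eq_mul_quo isOpen_HH2 frequently_b5_ne_zero hW
    have e4 := (hgood _ (hmem W hW)).eq_mul_quo isOpen_HH2 frequently_b5_ne_zero (hmem W hW)
    rw [e4, e2, e3] at e1
    unfold autM
    linear_combination e1

end Quotient

section Koecher

open Complex

theorem imM_add_smul {D : Matrix (Fin 2) (Fin 2) ℂ} (hD : D.IsHermitian)
    (Z : Matrix (Fin 2) (Fin 2) ℂ) (ζ : ℂ) : imM (Z + ζ • D) = imM Z + (ζ.im : ℂ) • D := by
  have h : ζ - (starRingEnd ℂ) ζ = 2 * I * ζ.im := by rw [Complex.sub_conj]; push_cast; ring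
  rw [imM_eq, imM_eq, Matrix.conjTranspose_add, Matrix.conjTranspose_smul, hD.eq, Complex.star_def]
  have : Z + ζ • D - (Zᴴ + (starRingEnd ℂ) ζ • D) =
      (Z - Zᴴ) + (2 * I) • ((ζ.im : ℂ) • D) := by
    rw [smul_smul, ← h]; module
  rw [this, smul_add, smul_smul (2 * I)⁻¹, inv_mul_cancel₀ (by simp), one_smul]

theorem imM_conj (U Z : Matrix (Fin 2) (Fin 2) ℂ) : imM (U * Z * Uᴴ) = U * imM Z * Uᴴ := by
  rw [imM_eq, imM_eq, Matrix.conjTranspose_mul, Matrix.conjTranspose_mul,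
    Matrix.conjTranspose_conjTranspose, Matrix.mul_smul, Matrix.smul_mul, Matrix.mul_sub,
    Matrix.sub_mul, ← Matrix.mul_assoc]

theorem imM_I_smul {Y : Matrix (Fin 2) (Fin 2) ℂ} (hY : Y.IsHermitian) : imM (I • Y) = Y := by
  have := imM_add_smul hY 0 I
  rw [zero_add, I_im, ofReal_one, one_smul] at this
  rw [this]
  ext i j; simp [imM]

theorem posDef_segment {Y₀ Y₁ : Matrix (Fin 2) (Fin 2) ℂ} (h₀ : Y₀.PosDef) (h₁ : Y₁.PosDef) {t : ℝ}
    (ht₀ : 0 ≤ t) (ht₁ : t ≤ 1) : (Y₀ + (t : ℂ) • (Y₁ - Y₀)).PosDef := by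
  have m₀ : I • Y₀ ∈ HH2 := by rwa [mem_HH2_iff_posDef, imM_I_smul h₀.isHermitian]
  have m₁ : I • Y₁ ∈ HH2 := by rwa [mem_HH2_iff_posDef, imM_I_smul h₁.isHermitian]
  have h := convex_HH2 m₀ m₁ (sub_nonneg.2 ht₁) ht₀ (by ring)
  have e : (1 - t) • (I • Y₀) + t • (I • Y₁) = I • Y₀ + (t * I) • (Y₁ - Y₀) := by
    ext i j; simp; ring
  rw [mem_HH2_iff_posDef, e, imM_add_smul (h₁.isHermitian.sub h₀.isHermitian),
    imM_I_smul h₀.isHermitian] at h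
  simpa using h

/-- Holomorphic functions on the Hermitian half-space invariant under translations and `SL₂`. -/
structure UnipInv (g : Matrix (Fin 2) (Fin 2) ℂ → ℂ) : Prop where
  diff : DifferentiableOn ℂ g HH2
  trans : ∀ (p q : ℤ), ∀ x ∈ OK, ∀ Z ∈ HH2,
    g (Z + !![((p : ℝ) : ℂ), x; (starRingEnd ℂ) x, ((q : ℝ) : ℂ)]) = g Z
  conj : ∀ α ∈ OK, ∀ β ∈ OK, ∀ γ ∈ OK, ∀ δ ∈ OK, α * δ - β * γ = 1 → ∀ Z ∈ HH2,
    g (!![α, β; γ, δ] * Z * !![α, β; γ, δ]ᴴ) = g Z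

/-- `B` bounds `g` on all points with imaginary part `Y`. -/
def BddAt (g : Matrix (Fin 2) (Fin 2) ℂ → ℂ) (B : ℝ) (Y : Matrix (Fin 2) (Fin 2) ℂ) : Prop :=
  ∀ Z, imM Z = Y → ‖g Z‖ ≤ B

variable {g : Matrix (Fin 2) (Fin 2) ℂ → ℂ}

theorem exists_translate (Z : Matrix (Fin 2) (Fin 2) ℂ) : ∃ t ∈ Set.Icc (0 : ℝ × ℝ × ℝ × ℝ) 1,
    ∃ p q : ℤ, ∃ x ∈ OK, Z + !![((p : ℝ) : ℂ), x; (starRingEnd ℂ) x, ((q : ℝ) : ℂ)] =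
      wmat t.1 t.2.1 t.2.2.1 t.2.2.2 + I • imM Z := by
  obtain ⟨a, b, hab⟩ := exists_coord ((Z 0 1 + (starRingEnd ℂ) (Z 1 0)) / 2)
  have hab' := congrArg (starRingEnd ℂ) hab
  simp only [map_div₀, map_add, map_mul, Complex.conj_conj, conj_ofReal, conj_om,
    Complex.conj_ofNat] at hab'
  have hx : ((-⌊a⌋ : ℤ) : ℂ) + ((-⌊b⌋ : ℤ) : ℂ) * om ∈ OK :=
    OK.add_mem (intCast_mem_OK _) (OK.mul_mem (intCast_mem_OK _) om_mem)
  refine ⟨(Int.fract (Z 0 0).re, Int.fract (Z 1 1).re, Int.fract a, Int.fract b), ?_,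
    -⌊(Z 0 0).re⌋, -⌊(Z 1 1).re⌋, _, hx, ?_⟩
  · have h0 := fun x : ℝ => Int.fract_nonneg x
    have h1 := fun x : ℝ => (Int.fract_lt_one x).le
    exact ⟨⟨h0 _, h0 _, h0 _, h0 _⟩, ⟨h1 _, h1 _, h1 _, h1 _⟩⟩
  · have hf : ∀ x : ℝ, ((Int.fract x : ℝ) : ℂ) = x - (⌊x⌋ : ℂ) := fun x => by
      rw [Int.fract]; push_cast; rfl
    have hre : ∀ z : ℂ, z = z.re + I * z.im := fun z => by
      rw [mul_comm I, Complex.re_add_im]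
    have hI : ∀ z w : ℂ, I * ((z - w) / (2 * I)) = (z - w) / 2 := fun z w => by
      field_simp
    ext i j
    fin_cases i <;> fin_cases j
    · simp only [wmat, Fin.zero_eta, Fin.isValue, Matrix.add_apply, of_apply, cons_val', cons_val_zero,
        cons_val_fin_one, Matrix.smul_apply, smul_eq_mul, imM_00, hf]
      push_cast; linear_combination hre (Z 0 0)
    · simp [wmat, imM, hf, hI]
      linear_combination hab
    · simp [wmat, imM, hf, hI, conj_om]
      linear_combination hab'
    · simp only [wmat, Fin.mk_one, Fin.isValue, Matrix.add_apply, of_apply, cons_val', cons_val_one,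
        cons_val_fin_one, Matrix.smul_apply, smul_eq_mul, imM_11, hf]
      push_cast; linear_combination hre (Z 1 1)

theorem imM_wmat (t₁ t₂ t₃ t₄ : ℝ) {Y : Matrix (Fin 2) (Fin 2) ℂ} (hY : Y.IsHermitian) :
    imM (wmat t₁ t₂ t₃ t₄ + I • Y) = Y := by
  rw [imM_add_smul hY, I_im, ofReal_one, one_smul, add_eq_right]
  ext i j; fin_cases i <;> fin_cases j <;> simp [imM, wmat, conj_om]

theorem UnipInv.exists_bound (hg : UnipInv g) {K : Set (Matrix (Fin 2) (Fin 2) ℂ)} (hK : IsCompact K)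
    (hpos : ∀ Y ∈ K, Y.PosDef) : ∃ B, ∀ Y ∈ K, BddAt g B Y := by
  set Φ : (ℝ × ℝ × ℝ × ℝ) × Matrix (Fin 2) (Fin 2) ℂ → Matrix (Fin 2) (Fin 2) ℂ := fun q =>
    wmat q.1.1 q.1.2.1 q.1.2.2.1 q.1.2.2.2 + I • q.2 with hΦ
  have hc : Continuous Φ := by
    refine Continuous.add ?_ (continuous_snd.const_smul I)
    refine continuous_matrix fun i j => ?_
    fin_cases i <;> fin_cases j <;> simp [wmat] <;> fun_prop
  have hsub : ∀ Z ∈ Φ '' (Set.Icc 0 1 ×ˢ K), Z ∈ HH2 := by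
    rintro _ ⟨⟨t, Y⟩, ⟨-, hY⟩, rfl⟩
    rw [mem_HH2_iff_posDef, imM_wmat _ _ _ _ (hpos Y hY).isHermitian]
    exact hpos Y hY
  obtain ⟨B, hB⟩ := ((isCompact_Icc.prod hK).image hc).exists_bound_of_continuousOn
    (hg.diff.continuousOn.mono hsub)
  refine ⟨B, fun Y hY Z hZ => ?_⟩
  obtain ⟨t, ht, p, q, x, hx, he⟩ := exists_translate Z
  have hZm : Z ∈ HH2 := by rw [mem_HH2_iff_posDef, hZ]; exact hpos Y hY
  rw [← hg.trans p q x hx Z hZm, he, hZ]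
  exact hB _ ⟨(t, Y), ⟨ht, hY⟩, rfl⟩

theorem UnipInv.bddAt_segment (hg : UnipInv g) {Y₀ Y₁ : Matrix (Fin 2) (Fin 2) ℂ} (h₀ : Y₀.PosDef)
    (h₁ : Y₁.PosDef) {B : ℝ} (hB₀ : BddAt g B Y₀) (hB₁ : BddAt g B Y₁) {θ : ℝ} (hθ₀ : 0 ≤ θ)
    (hθ₁ : θ ≤ 1) : BddAt g B (Y₀ + (θ : ℂ) • (Y₁ - Y₀)) := by
  intro Z hZ
  have hD := h₁.isHermitian.sub h₀.isHermitian
  have him : ∀ ζ : ℂ, imM (Z + (ζ - I * θ) • (Y₁ - Y₀)) = Y₀ + (ζ.im : ℂ) • (Y₁ - Y₀) := fun ζ => by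
    rw [imM_add_smul hD, hZ, add_assoc, ← add_smul]
    congr 2
    simp
  have hmem : ∀ ζ : ℂ, 0 ≤ ζ.im → ζ.im ≤ 1 → Z + (ζ - I * θ) • (Y₁ - Y₀) ∈ HH2 := fun ζ a b => by
    rw [mem_HH2_iff_posDef, him]; exact posDef_segment h₀ h₁ a b
  obtain ⟨C, hC⟩ := hg.exists_bound (K := (fun t : ℝ => Y₀ + (t : ℂ) • (Y₁ - Y₀)) '' Set.Icc 0 1)
    (isCompact_Icc.image (by fun_prop)) (by
      rintro _ ⟨t, ht, rfl⟩; exact posDef_segment h₀ h₁ ht.1 ht.2)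
  have hlin : Differentiable ℂ fun ζ : ℂ => Z + (ζ - I * θ) • (Y₁ - Y₀) := by fun_prop
  have hcl : closure (im ⁻¹' Set.Ioo 0 1) ⊆ im ⁻¹' Set.Icc (0 : ℝ) 1 :=
    closure_minimal (Set.preimage_mono Set.Ioo_subset_Icc_self)
      (isClosed_Icc.preimage Complex.continuous_im)
  have key := PhragmenLindelof.horizontal_strip (a := 0) (b := 1) (C := B)
    (f := fun ζ => g (Z + (ζ - I * θ) • (Y₁ - Y₀))) (z := I * θ)
    (DifferentiableOn.diffContOnCl fun ζ hζ => by
      have hm := hmem ζ (hcl hζ).1 (hcl hζ).2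
      have h1 : DifferentiableAt ℂ g ((fun ζ : ℂ => Z + (ζ - I * θ) • (Y₁ - Y₀)) ζ) :=
        hg.diff.differentiableAt (isOpen_HH2.mem_nhds hm)
      exact (h1.comp ζ (hlin ζ)).differentiableWithinAt)
    ⟨0, by positivity, 0, by
      refine Asymptotics.IsBigO.of_bound C ?_
      refine Filter.mem_inf_of_right ?_
      rw [Filter.mem_principal]
      intro ζ hζ
      simpa using hC _ ⟨ζ.im, Set.Ioo_subset_Icc_self hζ, rfl⟩ _ (him ζ)⟩
    (fun ζ hζ => hB₀ _ (by rw [him, hζ]; simp)) (fun ζ hζ => hB₁ _ (by rw [him, hζ]; simp))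
    (by simpa using hθ₀) (by simpa using hθ₁)
  simpa using key

/-- The rank one Hermitian matrix attached to `(a, b)`. -/
def rk (a b : ℂ) : Matrix (Fin 2) (Fin 2) ℂ :=
  !![a * (starRingEnd ℂ) a, a * (starRingEnd ℂ) b; b * (starRingEnd ℂ) a, b * (starRingEnd ℂ) b]

theorem rk_posSemidef (a b : ℂ) : (rk a b).PosSemidef := by
  have : rk a b = vecMulVec ![a, b] (star ![a, b]) := by
    ext i j; fin_cases i <;> fin_cases j <;> simp [rk, vecMulVec_apply]
  rw [this]
  exact posSemidef_vecMulVec_self_star _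

theorem posDef_add_rk {Y : Matrix (Fin 2) (Fin 2) ℂ} (hY : Y.PosDef) {t : ℝ} (ht : 0 ≤ t) (a b : ℂ) :
    (Y + (t : ℂ) • rk a b).PosDef :=
  hY.add_posSemidef ((rk_posSemidef a b).smul (by exact_mod_cast ht))

theorem UnipInv.bddAt_conj (hg : UnipInv g) {α β γ δ : ℂ} (hα : α ∈ OK) (hβ : β ∈ OK) (hγ : γ ∈ OK)
    (hδ : δ ∈ OK) (h : α * δ - β * γ = 1) {Y : Matrix (Fin 2) (Fin 2) ℂ} (hY : Y.PosDef) {B : ℝ}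
    (hB : BddAt g B Y) : (!![α, β; γ, δ] * Y * !![α, β; γ, δ]ᴴ).PosDef ∧
      BddAt g B (!![α, β; γ, δ] * Y * !![α, β; γ, δ]ᴴ) := by
  set U := !![α, β; γ, δ] with hU
  set U' := !![δ, -β; -γ, α] with hU'
  have hUU : U' * U = 1 := by
    ext i j; fin_cases i <;> fin_cases j <;> simp [hU, hU'] <;>
      first | linear_combination h | ring
  have h' : δ * α - -β * -γ = 1 := by linear_combination h
  have m : I • Y ∈ HH2 := by rwa [mem_HH2_iff_posDef, imM_I_smul hY.isHermitian]
  have hpos : (U * Y * Uᴴ).PosDef := by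
    have := moebius_mem (inU_lM h) m
    rwa [moebius_lM h, mem_HH2_iff_posDef, imM_conj, imM_I_smul hY.isHermitian] at this
  refine ⟨hpos, fun Z hZ => ?_⟩
  have hZm : Z ∈ HH2 := by rwa [mem_HH2_iff_posDef, hZ]
  rw [← hg.conj δ hδ (-β) (OK.neg_mem hβ) (-γ) (OK.neg_mem hγ) α hα h' Z hZm]
  refine hB _ ?_
  rw [imM_conj, hZ, ← hU']
  have : U' * (U * Y * Uᴴ) * U'ᴴ = (U' * U) * Y * (U' * U)ᴴ := by
    rw [Matrix.conjTranspose_mul]; simp only [Matrix.mul_assoc]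
  rw [this, hUU, Matrix.conjTranspose_one, Matrix.one_mul, Matrix.mul_one]

theorem unip_average (Y : Matrix (Fin 2) (Fin 2) ℂ) (a b : ℂ) (n : ℤ) :
    !![1 - n * (a * b), n * (a * a); -(n * (b * b)), 1 + n * (a * b)] * Y *
        !![1 - n * (a * b), n * (a * a); -(n * (b * b)), 1 + n * (a * b)]ᴴ +
      !![1 + n * (a * b), -(n * (a * a)); n * (b * b), 1 - n * (a * b)] * Y *
        !![1 + n * (a * b), -(n * (a * a)); n * (b * b), 1 - n * (a * b)]ᴴ =
    (2 : ℂ) • Y + (2 * n ^ 2 * (star (star ![-b, a]) ⬝ᵥ Y *ᵥ star ![-b, a])) • rk a b := by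
  ext i j
  fin_cases i <;> fin_cases j <;>
    simp [rk, Matrix.mul_apply, Fin.sum_univ_two, Matrix.vecMul, Matrix.mulVec, dotProduct] <;> ring

theorem UnipInv.bddAt_add_rk_int (hg : UnipInv g) {Y : Matrix (Fin 2) (Fin 2) ℂ} (hY : Y.PosDef) {B : ℝ}
    (hB : BddAt g B Y) {a b : ℂ} (ha : a ∈ OK) (hb : b ∈ OK) {t : ℝ} (ht : 0 ≤ t) :
    BddAt g B (Y + (t : ℂ) • rk a b) := by
  rcases eq_or_ne ![-b, a] 0 with h0 | h0
  · have h1 : b = 0 := by simpa using congrFun h0 0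
    have h2 : a = 0 := by simpa using congrFun h0 1
    have : rk a b = 0 := by
      ext i j; fin_cases i <;> fin_cases j <;> simp [rk, h1, h2]
    rwa [this, smul_zero, add_zero]
  have hc := hY.dotProduct_mulVec_pos (x := star ![-b, a]) (by simpa using h0)
  set c := star (star ![-b, a]) ⬝ᵥ Y *ᵥ star ![-b, a] with hcd
  obtain ⟨hcr, hci⟩ := Complex.lt_def.1 hc
  have hce : c = (c.re : ℂ) := by
    apply Complex.ext
    · simp
    · simpa using hci.symm
  rw [zero_re] at hcr
  obtain ⟨n, hn⟩ := exists_nat_gt (t / c.re)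
  have hn1 : t < (n : ℝ) ^ 2 * c.re := by
    rw [div_lt_iff₀ hcr] at hn
    have hn0 : (1 : ℝ) ≤ n := by
      rcases Nat.eq_zero_or_pos n with rfl | h
      · simp at hn; linarith
      · exact_mod_cast h
    nlinarith [mul_le_mul_of_nonneg_right (mul_le_mul_of_nonneg_left hn0 (by linarith : (0 : ℝ) ≤ n))
      hcr.le]
  have hnO := intCast_mem_OK n
  have hab := OK.mul_mem hnO (OK.mul_mem ha hb)
  have haa := OK.mul_mem hnO (OK.mul_mem ha ha)
  have hbb := OK.mul_mem hnO (OK.mul_mem hb hb)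
  obtain ⟨p1, b1⟩ := hg.bddAt_conj (OK.sub_mem OK.one_mem hab) haa (OK.neg_mem hbb)
    (OK.add_mem OK.one_mem hab) (by ring) hY hB
  obtain ⟨p2, b2⟩ := hg.bddAt_conj (OK.add_mem OK.one_mem hab) (OK.neg_mem haa) hbb
    (OK.sub_mem OK.one_mem hab) (by ring) hY hB
  have hmid := hg.bddAt_segment p1 p2 b1 b2 (θ := 1 / 2) (by norm_num) (by norm_num)
  have hav := unip_average Y a b n
  rw [← hcd] at hav
  set P := !![1 - ((n : ℤ) : ℂ) * (a * b), ((n : ℤ) : ℂ) * (a * a); -(((n : ℤ) : ℂ) * (b * b)),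
    1 + ((n : ℤ) : ℂ) * (a * b)] * Y * !![1 - ((n : ℤ) : ℂ) * (a * b), ((n : ℤ) : ℂ) * (a * a);
    -(((n : ℤ) : ℂ) * (b * b)), 1 + ((n : ℤ) : ℂ) * (a * b)]ᴴ with hP
  set Q := !![1 + ((n : ℤ) : ℂ) * (a * b), -(((n : ℤ) : ℂ) * (a * a)); ((n : ℤ) : ℂ) * (b * b),
    1 - ((n : ℤ) : ℂ) * (a * b)] * Y * !![1 + ((n : ℤ) : ℂ) * (a * b), -(((n : ℤ) : ℂ) * (a * a));
    ((n : ℤ) : ℂ) * (b * b), 1 - ((n : ℤ) : ℂ) * (a * b)]ᴴ with hQ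
  have hmid' : P + ((1 / 2 : ℝ) : ℂ) • (Q - P) = Y + (((n : ℝ) ^ 2 * c.re : ℝ) : ℂ) • rk a b := by
    have : P + ((1 / 2 : ℝ) : ℂ) • (Q - P) = (1 / 2 : ℂ) • (P + Q) := by
      push_cast; module
    rw [this, hav, smul_add, smul_smul, smul_smul]
    congr 1
    · norm_num
    · congr 1
      rw [hce]; push_cast; simp; ring
  rw [hmid'] at hmid
  have hT : 0 < (n : ℝ) ^ 2 * c.re := lt_of_le_of_lt ht hn1
  have := hg.bddAt_segment hY (posDef_add_rk hY hT.le a b) hB hmid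
    (θ := t / ((n : ℝ) ^ 2 * c.re)) (by positivity) ((div_le_one hT).2 hn1.le)
  rwa [add_sub_cancel_left, smul_smul, ← ofReal_mul, div_mul_cancel₀ _ hT.ne'] at this

theorem UnipInv.bddAt_add_rk (hg : UnipInv g) {Y : Matrix (Fin 2) (Fin 2) ℂ} (hY : Y.PosDef) {B : ℝ}
    (hB : BddAt g B Y) (a b : ℂ) : BddAt g B (Y + rk a b) := by
  have hK : ∀ q ∈ (KK : Set ℂ) ×ˢ (KK : Set ℂ), BddAt g B (Y + rk q.1 q.2) := by
    rintro ⟨x, y⟩ ⟨⟨n, hn, hx⟩, ⟨m, hm, hy⟩⟩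
    have hn' : (n : ℂ) ≠ 0 := by exact_mod_cast hn.ne'
    have hm' : (m : ℂ) ≠ 0 := by exact_mod_cast hm.ne'
    have := hg.bddAt_add_rk_int hY hB (OK.mul_mem (intCast_mem_OK m) hx)
      (OK.mul_mem (intCast_mem_OK n) hy) (t := (((n : ℝ) * m) ^ 2)⁻¹) (by positivity)
    convert this using 2
    ext i j; fin_cases i <;> fin_cases j <;> simp [rk] <;> field_simp
  intro Z hZ
  have hrk : ∀ q : ℂ × ℂ, (rk q.1 q.2).IsHermitian := fun q => (rk_posSemidef _ _).isHermitian
  have him : ∀ q : ℂ × ℂ, imM (Z - I • rk a b + I • rk q.1 q.2) = Y + rk q.1 q.2 := fun q => by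
    rw [sub_eq_add_neg, ← neg_smul, imM_add_smul (hrk q), imM_add_smul (hrk (a, b)), hZ]
    simp
  have hmem : ∀ q : ℂ × ℂ, Z - I • rk a b + I • rk q.1 q.2 ∈ HH2 := fun q => by
    rw [mem_HH2_iff_posDef, him]
    simpa using posDef_add_rk hY zero_le_one q.1 q.2
  have hrc : Continuous fun q : ℂ × ℂ => rk q.1 q.2 := by
    have h1 : Continuous fun q : ℂ × ℂ => (starRingEnd ℂ) q.1 :=
      Complex.continuous_conj.comp continuous_fst
    have h2 : Continuous fun q : ℂ × ℂ => (starRingEnd ℂ) q.2 :=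
      Complex.continuous_conj.comp continuous_snd
    refine continuous_matrix fun i j => ?_
    fin_cases i <;> fin_cases j <;> simp only [rk]
    · exact continuous_fst.mul h1
    · exact continuous_fst.mul h2
    · exact continuous_snd.mul h1
    · exact continuous_snd.mul h2
  have hcont : Continuous fun q : ℂ × ℂ => ‖g (Z - I • rk a b + I • rk q.1 q.2)‖ :=
    (hg.diff.continuousOn.comp_continuous (by fun_prop) hmem).norm
  have hcl : IsClosed {q : ℂ × ℂ | ‖g (Z - I • rk a b + I • rk q.1 q.2)‖ ≤ B} :=
    isClosed_le hcont continuous_const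
  have := hcl.closure_subset_iff.2 (fun q hq => hK q hq _ (him q))
    ((dense_KK.prod dense_KK) (a, b))
  simpa using this

theorem exists_rk_decomp {R : Matrix (Fin 2) (Fin 2) ℂ} (hR : R.IsHermitian) {y d : ℝ} (hy : 0 < y)
    (h00 : R 0 0 = y) (hd : 0 ≤ d) (hdet : R.det = d) :
    ∃ a b c e : ℂ, R = rk a b + rk c e := by
  have hs : ((Real.sqrt y : ℝ) : ℂ) * (Real.sqrt y : ℝ) = y := by
    rw [← ofReal_mul, Real.mul_self_sqrt hy.le]
  have hs' : ((Real.sqrt (d / y) : ℝ) : ℂ) * (Real.sqrt (d / y) : ℝ) = d / y := by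
    rw [← ofReal_mul, Real.mul_self_sqrt (by positivity)]; push_cast; rfl
  have hs0 : ((Real.sqrt y : ℝ) : ℂ) ≠ 0 := by
    exact_mod_cast (Real.sqrt_pos.2 hy).ne'
  have hy0 : (y : ℂ) ≠ 0 := by exact_mod_cast hy.ne'
  have h01 : (starRingEnd ℂ) (R 1 0) = R 0 1 := hR.apply 0 1
  rw [Matrix.det_fin_two, h00] at hdet
  refine ⟨(Real.sqrt y : ℝ), R 1 0 / (Real.sqrt y : ℝ), 0, (Real.sqrt (d / y) : ℝ), ?_⟩
  ext i j
  fin_cases i <;> fin_cases j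
  · simp [rk, h00, hs]
  · simp [rk, h01]; field_simp
  · simp [rk]; field_simp
  · simp only [rk, Fin.mk_one, Fin.isValue, Matrix.add_apply, of_apply, cons_val', cons_val_one,
      cons_val_fin_one, map_div₀, conj_ofReal, h01, hs']
    rw [div_mul_div_comm, hs, ← add_div, eq_div_iff hy0]
    linear_combination hdet

theorem UnipInv.norm_le_of_bddAt (hg : UnipInv g) {ε B : ℝ} (hε : 0 < ε)
    (hB : BddAt g B ((ε : ℂ) • 1)) {Z : Matrix (Fin 2) (Fin 2) ℂ} (h1 : ε < (Z 0 0).im)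
    (h2 : ε * ((Z 0 0).im + (Z 1 1).im) ≤ detY Z) : ‖g Z‖ ≤ B := by
  have hpos : ((ε : ℂ) • (1 : Matrix (Fin 2) (Fin 2) ℂ)).PosDef :=
    Matrix.PosDef.one.smul (by exact_mod_cast hε)
  obtain ⟨a, b, c, e, h⟩ := exists_rk_decomp ((imM_isHermitian Z).sub hpos.isHermitian)
    (y := (Z 0 0).im - ε) (d := detY Z - ε * ((Z 0 0).im + (Z 1 1).im) + ε ^ 2) (sub_pos.2 h1)
    (by simp [imM_00]) (by nlinarith) (by
      have := imM_det Z
      rw [Matrix.det_fin_two, imM_00, imM_11] at this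
      simp [Matrix.det_fin_two, imM_00, imM_11]
      linear_combination this)
  have hab := posDef_add_rk hpos zero_le_one a b
  rw [ofReal_one, one_smul] at hab
  refine hg.bddAt_add_rk hab (hg.bddAt_add_rk hpos hB a b) c e Z ?_
  rw [add_assoc, ← h]; abel

end Koecher

section LowWeight

open Complex

theorem unipInv_of_transform {g : Matrix (Fin 2) (Fin 2) ℂ → ℂ} {s : ℕ}
    (hd : DifferentiableOn ℂ g HH2)
    (ht : ∀ M, inSU 11 M → ∀ Z ∈ HH2, (autM M Z).det ^ s * g (moebius M Z) = g Z) : UnipInv g where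
  diff := hd
  trans p q x hx Z hZ := by
    have := ht _ (inSU_tM p hx q) Z hZ
    rwa [autM_tM, Matrix.det_one, one_pow, one_mul, moebius_tM] at this
  conj α hα β hβ γ hγ δ hδ h Z hZ := by
    have := ht _ (inSU_lM h hα hβ hγ hδ) Z hZ
    rwa [det_autM_lM h, one_pow, one_mul, moebius_lM h] at this

theorem smul_one_posDef {ε : ℝ} (hε : 0 < ε) :
    ((ε : ℂ) • (1 : Matrix (Fin 2) (Fin 2) ℂ)).PosDef :=
  Matrix.PosDef.one.smul (by exact_mod_cast hε)

theorem Reduced.detY_bounds {W : Matrix (Fin 2) (Fin 2) ℂ} (h : Reduced W) :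
    4 / 125 ≤ detY W ∧ 1 / 500 * ((W 0 0).im + (W 1 1).im) ≤ detY W := by
  have hy := h.hy
  have hv := h.hv
  have hA := sq_lt_sq' (abs_lt.1 h.hA).1 (abs_lt.1 h.hA).2
  have hB := sq_lt_sq' (abs_lt.1 h.hB).1 (abs_lt.1 h.hB).2
  have hC := sq_lt_sq' (abs_lt.1 h.hC').1 (abs_lt.1 h.hC').2
  have hu := im_u_sq (W 0 1) (W 1 0)
  have hy0 : 0 < (W 0 0).im := by linarith
  have hyv : detY W = (W 0 0).im * vht W := by unfold vht; field_simp
  have hdef := detY.eq_1 W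
  set y := (W 0 0).im
  set v := vht W
  set n := normSq (W 0 1 - (starRingEnd ℂ) (W 1 0))
  have hn : n < 63 / 2 * y ^ 2 := by nlinarith
  have hY : (W 1 1).im ≤ 8 * y + v := by
    by_contra hc
    push Not at hc
    nlinarith
  constructor
  · rw [hyv]; nlinarith
  · rw [hyv]; nlinarith

theorem eq_zero_of_negative_weight {g : Matrix (Fin 2) (Fin 2) ℂ → ℂ} {s : ℕ} (hs : 0 < s)
    (hd : DifferentiableOn ℂ g HH2)
    (ht : ∀ M, inSU 11 M → ∀ Z ∈ HH2, (autM M Z).det ^ s * g (moebius M Z) = g Z)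
    {Z : Matrix (Fin 2) (Fin 2) ℂ} (hZ : Z ∈ HH2) : g Z = 0 := by
  have hg := unipInv_of_transform hd ht
  obtain ⟨B, hB⟩ := hg.exists_bound (isCompact_singleton (x := (((1 / 500 : ℝ) : ℂ) • 1)))
    (by rintro _ rfl; exact smul_one_posDef (by norm_num))
  have hB' := hB _ rfl
  have hall : ∀ W ∈ HH2, ‖g W‖ ^ 2 ≤ B ^ 2 * (125 / 4 * detY W) ^ s := by
    intro W hW
    obtain ⟨M, hM, hR, -⟩ := exists_reduced_moebius hW
    have hSU := Gam_inSU hM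
    obtain ⟨h1, h2⟩ := hR.detY_bounds
    have hb := hg.norm_le_of_bddAt (by norm_num) hB' (by linarith [hR.hy]) h2
    have hj : normSq (autM M W).det ≤ 125 / 4 * detY W := by
      have := detY_moebius hSU.inU hW
      nlinarith [normSq_nonneg (autM M W).det]
    rw [← ht M hSU W hW, norm_mul, norm_pow, mul_pow, ← pow_mul, mul_comm s, pow_mul,
      ← Complex.normSq_eq_norm_sq, mul_comm]
    exact mul_le_mul (pow_le_pow_left₀ (norm_nonneg _) hb 2)
      (pow_le_pow_left₀ (normSq_nonneg _) hj s) (pow_nonneg (normSq_nonneg _) _) (sq_nonneg _)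
  have hy := HH2_im_pos hZ
  have hy' := HH2_im_pos' hZ
  have hD := HH2_detY_pos hZ
  have hδ : ∀ᶠ δ : ℝ in 𝓝[>] 0, ‖g Z‖ ^ 2 ≤ B ^ 2 * (125 / 4 * δ ^ 2) ^ s := by
    have e1 : ∀ᶠ δ : ℝ in 𝓝[>] 0, δ < (Z 0 0).im :=
      nhdsWithin_le_nhds (eventually_lt_nhds hy)
    have e2 : ∀ᶠ δ : ℝ in 𝓝[>] 0, δ < detY Z / ((Z 0 0).im + (Z 1 1).im) :=
      nhdsWithin_le_nhds (eventually_lt_nhds (by positivity))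
    filter_upwards [e1, e2, self_mem_nhdsWithin] with δ h1 h2 (h0 : 0 < δ)
    rw [lt_div_iff₀ (by positivity)] at h2
    have hb : BddAt g (Real.sqrt (B ^ 2 * (125 / 4 * δ ^ 2) ^ s)) ((δ : ℂ) • 1) := by
      intro W hW
      have hWH : W ∈ HH2 := by
        rw [mem_HH2_iff_posDef, hW]; exact smul_one_posDef h0
      have hdW : detY W = δ ^ 2 := by
        have := imM_det W
        rw [hW, Matrix.det_smul, Matrix.det_one, Fintype.card_fin, mul_one] at this
        exact_mod_cast this.symm
      rw [← hdW]
      exact Real.le_sqrt_of_sq_le (hall W hWH)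
    have := hg.norm_le_of_bddAt h0 hb h1 h2.le
    calc ‖g Z‖ ^ 2 ≤ _ := pow_le_pow_left₀ (norm_nonneg _) this 2
      _ = _ := Real.sq_sqrt (by positivity)
  have hlim : Tendsto (fun δ : ℝ => B ^ 2 * (125 / 4 * δ ^ 2) ^ s) (𝓝[>] 0) (𝓝 0) := by
    have : Continuous fun δ : ℝ => B ^ 2 * (125 / 4 * δ ^ 2) ^ s := by fun_prop
    simpa [hs.ne'] using (this.tendsto 0).mono_left nhdsWithin_le_nhds
  have h0 := ge_of_tendsto hlim hδ
  simpa using le_antisymm h0 (sq_nonneg _)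

end LowWeight

section Divisibility

variable {k : ℕ} {F : Matrix (Fin 2) (Fin 2) ℂ → ℂ}

theorem differentiableOn_quo_b5 (hgood : ∀ Z ∈ HH2, GoodAt F b5 Z) :
    DifferentiableOn ℂ (quo F b5) HH2 := fun Z hZ =>
  ((hgood Z hZ).differentiableAt_quo isOpen_HH2 frequently_b5_ne_zero hZ).differentiableWithinAt

theorem exists_isHMF_quotient (hF : IsHMF 11 k F) (hgood : ∀ Z ∈ HH2, GoodAt F b5 Z) :
    ∃ G, IsHMF 11 (k - 5) G ∧ ∀ Z ∈ HH2, F Z = b5 Z * G Z := by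
  have hd := differentiableOn_quo_b5 hgood
  have he : ∀ Z ∈ HH2, F Z = b5 Z * quo F b5 Z := fun Z hZ =>
    (hgood Z hZ).eq_mul_quo isOpen_HH2 frequently_b5_ne_zero hZ
  rcases le_or_gt 5 k with hk | hk
  · refine ⟨quo F b5, ⟨hd, fun M hM Z hZ => ?_⟩, he⟩
    have hj := autM_det_ne_zero hM.inU hZ
    have := quo_transform hF hgood hd hM hZ
    rw [← Nat.add_sub_of_le hk, pow_add, mul_assoc] at this
    exact mul_left_cancel₀ (pow_ne_zero 5 hj) this
  · refine ⟨0, ⟨differentiableOn_const 0, fun M _ Z _ => by simp⟩, fun Z hZ => ?_⟩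
    have h0 := eq_zero_of_negative_weight (s := 5 - k) (by omega) hd (fun M hM W hW => ?_) hZ
    · rw [he Z hZ, h0, Pi.zero_apply]
    · have hj := autM_det_ne_zero hM.inU hW
      have := quo_transform hF hgood hd hM hW
      rw [← Nat.add_sub_of_le hk.le, pow_add, mul_assoc] at this
      exact mul_left_cancel₀ (pow_ne_zero k hj) this

end Divisibility

/-- For K = ℚ(√-11) and λ = (1+√-11)/2 of norm 3, there is a nonzero symmetric
Hermitian modular form b₅ of weight 5 vanishing to order ≥ 5 along ℋ₁ and vanishing on ℋ₃,
such that every Hermitian modular form of weight k with these vanishing properties is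
divisible by b₅, with quotient a Hermitian modular form of weight k - 5. -/
theorem borcherds_product_b5 :
    ∃ b5 : Matrix (Fin 2) (Fin 2) ℂ → ℂ,
      IsSymHMF 11 5 b5 ∧ (∃ τ ∈ HH2, b5 τ ≠ 0) ∧
      VanishesAlongH1 b5 5 ∧
      VanishesOnHeegner (omg 11) b5 ∧
      ∀ k : ℕ, ∀ F : Matrix (Fin 2) (Fin 2) ℂ → ℂ, IsHMF 11 k F →
        VanishesAlongH1 F 5 → VanishesOnHeegner (omg 11) F →
        ∃ G : Matrix (Fin 2) (Fin 2) ℂ → ℂ,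
          IsHMF 11 (k - 5) G ∧ ∀ τ ∈ HH2, F τ = b5 τ * G τ := by
  exact ⟨b5, isSymHMF_b5, exists_b5_ne_zero, vanishesAlongH1_b5, vanishesOnHeegner_b5,
    fun k F hF h1 h3 => exists_isHMF_quotient hF fun Z hZ => goodAt_all hF h1 h3 hZ⟩

end
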